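/- Let R_k → ∞ and let u_k be classical solutions of the one-phase free boundary problem in the disks B_{R_k} ⊆ ℝ² with 0 ∈ F(u_k) for every k. Then there is a subsequence of (u_k) that converges uniformly on compact subsets of ℝ² to a function U : ℝ² → ℝ. If moreover no connected component of F(u_k) is compact (i.e., each component curve of F(u_k) has both ends on ∂B_{R_k}), then there is a rigid motion T of ℝ² such that U ∘ T is either the one-plane solution P, a two-plane solution TP_a for some a > 0, a double hairpin solution H_a for some a > 0, or the wedge W₁(x) = |x₁|. -/

import Mathlib

open Complex Metric Set Filter MeasureTheory
open scoped Topology Classical NNReal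

noncomputable section

/-- The positive phase of `u` in `Ω`. -/
def posSet (Ω : Set ℂ) (u : ℂ → ℝ) : Set ℂ := {z ∈ Ω | 0 < u z}

/-- The free boundary of `u` in `Ω`. -/
def FB (Ω : Set ℂ) (u : ℂ → ℝ) : Set ℂ := Ω ∩ frontier (posSet Ω u)

/-- The gradient of `u : ℂ → ℝ`, viewed as a complex number `∂ₓu + i ∂ᵧu`. -/
def grad2 (u : ℂ → ℝ) (z : ℂ) : ℂ :=
  ((fderiv ℝ u z 1 : ℝ) : ℂ) + ((fderiv ℝ u z Complex.I : ℝ) : ℂ) * Complex.I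

/-- Second derivative (Hessian) of `u : ℂ → ℝ` at `z` in directions `v, w`. -/
def hess (u : ℂ → ℝ) (z v w : ℂ) : ℝ := fderiv ℝ (fun x => fderiv ℝ u x v) z w

/-- `u` is harmonic on `s`: twice continuously differentiable with vanishing Laplacian. -/
def HarmonicOn2 (u : ℂ → ℝ) (s : Set ℂ) : Prop :=
  ContDiffOn ℝ 2 u s ∧ ∀ z ∈ s, hess u z 1 1 + hess u z Complex.I Complex.I = 0

/-- A classical solution of the one-phase free boundary problem `Δu = 0` in `{u>0}`,
`|∇u| = 1` on the free boundary, in the open set `Ω ⊆ ℝ² ≅ ℂ`. -/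
structure IsClassicalSolution (Ω : Set ℂ) (u : ℂ → ℝ) : Prop where
  contOn : ContinuousOn u Ω
  nonneg : ∀ z ∈ Ω, 0 ≤ u z
  harm : HarmonicOn2 u (posSet Ω u)
  smooth_ext : ∃ v : ℂ → ℝ, ContDiffOn ℝ (⊤ : ℕ∞) v (Ω ∩ closure (posSet Ω u)) ∧
    Set.EqOn u v (Ω ∩ closure (posSet Ω u))
  fb_manifold : ∀ z ∈ FB Ω u, ∃ V : Set ℂ, IsOpen V ∧ z ∈ V ∧ V ⊆ Ω ∧
    ∃ φ : ℂ → ℝ, ContDiffOn ℝ (⊤ : ℕ∞) φ V ∧ (∀ w ∈ V, fderiv ℝ φ w ≠ 0) ∧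
      V ∩ posSet Ω u = {w ∈ V | 0 < φ w} ∧
      V ∩ {w | u w = 0} = {w ∈ V | φ w ≤ 0} ∧
      V ∩ FB Ω u = {w ∈ V | φ w = 0}
  grad_one : ∀ z ∈ FB Ω u,
    Filter.Tendsto (fun w => ‖grad2 u w‖) (nhdsWithin z (posSet Ω u)) (nhds 1)

/-- One-plane solution `P(z) = max (Re z) 0`. -/
def Pfun (z : ℂ) : ℝ := max z.re 0

/-- Wedge solution `W_s(z) = s |Re z|`. -/
def Wfun (s : ℝ) (z : ℂ) : ℝ := s * |z.re|

/-- Two-plane solution `TP_a`. -/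
def TPfun (a : ℝ) (z : ℂ) : ℝ := max z.re 0 + max (-z.re - a) 0

/-- Rotation of the plane by angle `θ`. -/
def rot (θ : ℝ) (z : ℂ) : ℂ := Complex.exp (θ * Complex.I) * z

/-- The strip `S = {|Im ζ| < π/2}`. -/
def Sstrip : Set ℂ := {ζ : ℂ | |ζ.im| < Real.pi / 2}

/-- The hairpin domain `Ω₁ = {|x₂| < π/2 + cosh x₁}`. -/
def Omega1 : Set ℂ := {z : ℂ | |z.im| < Real.pi / 2 + Real.cosh z.re}

/-- Dilated hairpin domain `Ω_a = aΩ₁`. -/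
def OmegaA (a : ℝ) : Set ℂ := {z : ℂ | z / (a : ℂ) ∈ Omega1}

/-- The Hauswirth–Hélein–Pacard double hairpin solution `H = H₁`:
`H(z) = Re (cosh w)` where `w` is the unique point of the strip `S` with `w + sinh w = z`,
and `H(z) = 0` if there is no such point. -/
def hairpinH (z : ℂ) : ℝ :=
  if h : ∃ w : ℂ, w ∈ Sstrip ∧ w + Complex.sinh w = z then (Complex.cosh h.choose).re else 0

/-- The double hairpin solution `H_a(z) = a H(z/a)`. -/
def hairpin (a : ℝ) (z : ℂ) : ℝ := a * hairpinH (z / (a : ℂ))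

/-- Euclidean dot product of two complex numbers viewed as vectors in ℝ². -/
def dot2 (a b : ℂ) : ℝ := a.re * b.re + a.im * b.im

/-- Divergence of a vector field `ψ : ℂ → ℂ` on ℝ². -/
def div2 (ψ : ℂ → ℂ) (z : ℂ) : ℝ := (fderiv ℝ ψ z 1).re + (fderiv ℝ ψ z Complex.I).im

/-- A variational (weak) solution of the one-phase free boundary problem in `Ω`:
`u ∈ H¹_loc(Ω) ∩ C(Ω)`, `u ≥ 0`, `u ∈ C²({u>0})`, and the domain-variation
Euler–Lagrange identity holds for all compactly supported smooth vector fields. -/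
def VariationalSolution (Ω : Set ℂ) (u : ℂ → ℝ) : Prop :=
  ContinuousOn u Ω ∧ (∀ z ∈ Ω, 0 ≤ u z) ∧
  (∀ K : Set ℂ, K ⊆ Ω → IsCompact K →
    MeasureTheory.IntegrableOn (fun z => (u z) ^ 2 + ‖grad2 u z‖ ^ 2) K) ∧
  ContDiffOn ℝ 2 u (posSet Ω u) ∧
  ∀ ψ : ℂ → ℂ, ContDiff ℝ (⊤ : ℕ∞) ψ → HasCompactSupport ψ → tsupport ψ ⊆ Ω →
    ∫ z in Ω, ((‖grad2 u z‖ ^ 2 + Set.indicator {w | 0 < u w} (fun _ => (1 : ℝ)) z) * div2 ψ z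
      - 2 * dot2 (grad2 u z) (fderiv ℝ ψ z (grad2 u z))) = 0

/-- Average of `w` over the circle of radius `r` around `z`. -/
def circleAvg (w : ℂ → ℝ) (z : ℂ) (r : ℝ) : ℝ :=
  (1 / (2 * Real.pi)) * ∫ θ in (0 : ℝ)..(2 * Real.pi), w (z + r * Complex.exp (θ * Complex.I))

/-- Superharmonicity on `s` via the super-mean-value property. -/
def SuperharmonicOn2 (w : ℂ → ℝ) (s : Set ℂ) : Prop :=
  ∀ z ∈ s, ∀ r : ℝ, 0 < r → Metric.closedBall z r ⊆ s → circleAvg w z r ≤ w z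

/-- Subharmonicity on `s` via the sub-mean-value property. -/
def SubharmonicOn2 (w : ℂ → ℝ) (s : Set ℂ) : Prop :=
  ∀ z ∈ s, ∀ r : ℝ, 0 < r → Metric.closedBall z r ⊆ s → w z ≤ circleAvg w z r

/-- Non-tangential approach region in `B` at `x₀` with aperture `C`. -/
def NontangentialIn (B : Set ℂ) (x₀ : ℂ) (C : ℝ) : Set ℂ :=
  {x ∈ B | ‖x - x₀‖ ≤ C * Metric.infDist x Bᶜ}

/-- `w(x) = α ⟨x − x₀, ν⟩⁺ + o(|x − x₀|)` as `x → x₀` within the region `R`. -/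
def HasSlopeAt (w : ℂ → ℝ) (x₀ ν : ℂ) (α : ℝ) (R : Set ℂ) : Prop :=
  Filter.Tendsto (fun x => (w x - α * max (dot2 (x - x₀) ν) 0) / ‖x - x₀‖)
    (nhdsWithin x₀ R) (nhds 0)

/-- Viscosity supersolution of the one-phase free boundary problem in `Ω`. -/
structure ViscositySupersolution (Ω : Set ℂ) (w : ℂ → ℝ) : Prop where
  contOn : ContinuousOn w Ω
  nonneg : ∀ z ∈ Ω, 0 ≤ w z
  superharm : SuperharmonicOn2 w (posSet Ω w)
  slope : ∀ x₀ ∈ FB Ω w, ∀ (y : ℂ) (ρ : ℝ), 0 < ρ → Metric.ball y ρ ⊆ posSet Ω w →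
    dist x₀ y = ρ → ∃ α : ℝ, α ≤ 1 ∧ ∀ C : ℝ, 1 < C →
      HasSlopeAt w x₀ ((y - x₀) / (ρ : ℂ)) α (NontangentialIn (Metric.ball y ρ) x₀ C)

/-- Viscosity subsolution of the one-phase free boundary problem in `Ω`. -/
structure ViscositySubsolution (Ω : Set ℂ) (w : ℂ → ℝ) : Prop where
  contOn : ContinuousOn w Ω
  nonneg : ∀ z ∈ Ω, 0 ≤ w z
  subharm : SubharmonicOn2 w (posSet Ω w)
  slope : ∀ x₀ ∈ FB Ω w, ∀ (y : ℂ) (ρ : ℝ), 0 < ρ →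
    Metric.ball y ρ ⊆ {z ∈ Ω | w z = 0} → dist x₀ y = ρ →
    ∃ α : ℝ, 1 ≤ α ∧ ∀ C : ℝ, 1 < C →
      HasSlopeAt w x₀ ((x₀ - y) / (ρ : ℂ)) α
        (NontangentialIn (closure (Metric.ball y ρ))ᶜ x₀ C)

/-- Viscosity solution: both a supersolution and a subsolution. -/
def ViscositySolution (Ω : Set ℂ) (w : ℂ → ℝ) : Prop :=
  ViscositySupersolution Ω w ∧ ViscositySubsolution Ω w

/-- Non-degeneracy with constant `c`: linear growth away from the free boundary. -/
def Nondegenerate (Ω : Set ℂ) (w : ℂ → ℝ) (c : ℝ) : Prop :=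
  ∀ x ∈ FB Ω w, ∀ r : ℝ, 0 < r → Metric.ball x r ⊆ Ω → c * r ≤ sSup (w '' Metric.ball x r)

/-- The open annulus `{δ < |z| < R}`. -/
def ann (δ R : ℝ) : Set ℂ := {z : ℂ | δ < ‖z‖ ∧ ‖z‖ < R}

/-- Condition (A): the free boundary of `u` in the annulus `{δ < |z| < R}` consists of
exactly two connected components, each non-compact with closure meeting both boundary
circles. -/
def ConditionA (δ R : ℝ) (u : ℂ → ℝ) : Prop :=
  ∃ F₁ F₂ : Set ℂ,
    F₁.Nonempty ∧ F₂.Nonempty ∧ Disjoint F₁ F₂ ∧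
    F₁ ∪ F₂ = FB (ann δ R) u ∧
    (∀ z ∈ F₁, connectedComponentIn (FB (ann δ R) u) z = F₁) ∧
    (∀ z ∈ F₂, connectedComponentIn (FB (ann δ R) u) z = F₂) ∧
    ¬ IsCompact F₁ ∧ ¬ IsCompact F₂ ∧
    (closure F₁ ∩ Metric.sphere 0 δ).Nonempty ∧
    (closure F₁ ∩ Metric.sphere 0 R).Nonempty ∧
    (closure F₂ ∩ Metric.sphere 0 δ).Nonempty ∧
    (closure F₂ ∩ Metric.sphere 0 R).Nonempty

/-- `k` is the curvature of the set `S` at the point `p`, computed via an arc-length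
parametrization. -/
def IsCurvatureAt (S : Set ℂ) (p : ℂ) (k : ℝ) : Prop :=
  ∃ γ : ℝ → ℂ, ContDiff ℝ 2 γ ∧ γ 0 = p ∧ (∀ s : ℝ, ‖deriv γ s‖ = 1) ∧
    (∃ ε > 0, ∀ s ∈ Set.Ioo (-ε) ε, γ s ∈ S) ∧ ‖deriv (deriv γ) 0‖ = k

/-- A set has exactly two connected components. -/
def HasExactlyTwoComponents (S : Set ℂ) : Prop :=
  ∃ z₁ ∈ S, ∃ z₂ ∈ S, connectedComponentIn S z₁ ≠ connectedComponentIn S z₂ ∧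
    ∀ z ∈ S, connectedComponentIn S z = connectedComponentIn S z₁ ∨
      connectedComponentIn S z = connectedComponentIn S z₂

end


open scoped ComplexConjugate

namespace OP

lemma norm_real_pos {t : ℝ} (ht : 0 < t) : ‖(t : ℂ)‖ = t := by
  rw [norm_real, Real.norm_eq_abs, abs_of_pos ht]

/-- a point of the segment from `z` to `w` that lies in a prescribed ball around `z` -/
lemma seg_pt {z w : ℂ} {r : ℝ} (hr : 0 < r) (hne : w ≠ z) : ∃ (t : ℝ) (y : ℂ), 0 < ‖w - z‖ ∧ 0 < t ∧
    t ≤ 1/2 ∧ y - z = t * (w - z) ∧ w - y = ((1 - t : ℝ) : ℂ) * (w - z) ∧ ‖y - z‖ = t * ‖w - z‖ ∧ y ∈ ball z r := by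
  have hn : 0 < ‖w - z‖ := norm_pos_iff.2 (sub_ne_zero.2 hne)
  have ht0 : 0 < min (1/2) (r / (2 * ‖w - z‖)) := by positivity
  have : min (1/2) (r / (2 * ‖w - z‖)) ≤ r / (2 * ‖w - z‖) := min_le_right _ _
  have ht1 : min (1/2) (r / (2 * ‖w - z‖)) ≤ 1/2 := min_le_left _ _
  generalize min (1/2) (r / (2 * ‖w - z‖)) = t at *
  have e : ‖z + t * (w - z) - z‖ = t * ‖w - z‖ := by rw [add_sub_cancel_left, norm_mul, norm_real_pos ht0]
  refine ⟨t, z + t * (w - z), hn, ht0, ht1, by ring, by push_cast; ring, e, ?_⟩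
  rw [mem_ball, dist_eq_norm, e]
  rw [le_div_iff₀ (by positivity)] at this
  nlinarith

/-- The real-linear functional `v ↦ Re (c v)`. -/
noncomputable def reL (c : ℂ) : ℂ →L[ℝ] ℝ := reCLM.comp (ContinuousLinearMap.mul ℝ ℂ c)

@[simp] lemma reL_apply (c v : ℂ) : reL c v = (c * v).re := by simp [reL]

lemma reL_sub (a b : ℂ) : reL (a - b) = reL a - reL b := by
  ext v; simp [sub_mul]

lemma norm_reL_le (c : ℂ) : ‖reL c‖ ≤ ‖c‖ := by
  refine ContinuousLinearMap.opNorm_le_bound _ (norm_nonneg _) fun v => ?_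
  rw [reL_apply, Real.norm_eq_abs, ← norm_mul]
  exact abs_re_le_norm _

/-- Conjugate gradient. -/
noncomputable def cg (U : ℂ → ℝ) (z : ℂ) : ℂ :=
  ((fderiv ℝ U z 1 : ℝ) : ℂ) - I * ((fderiv ℝ U z I : ℝ) : ℂ)

lemma reL_inj {a b : ℂ} (h : reL a = reL b) : a = b := by
  have h1 := congrArg (fun L => L 1) h
  have h2 := congrArg (fun L => L I) h
  simp at h1 h2
  exact Complex.ext h1 h2

lemma reL_cg_of_diff {U : ℂ → ℝ} {z : ℂ} (h : DifferentiableAt ℝ U z) :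
    HasFDerivAt U (reL (cg U z)) z := by
  convert h.hasFDerivAt using 1
  ext v
  have : v = v.re • (1 : ℂ) + v.im • I := by
    simp [Complex.re_add_im]
  conv_rhs => rw [this, map_add, map_smul, map_smul]
  simp [cg]; ring

lemma cg_eq {U : ℂ → ℝ} {z c : ℂ} (h : HasFDerivAt U (reL c) z) : cg U z = c :=
  reL_inj ((reL_cg_of_diff h.differentiableAt).unique h)

lemma norm_grad2 (U : ℂ → ℝ) (z : ℂ) : ‖grad2 U z‖ = ‖cg U z‖ := by
  rw [← Complex.norm_conj]; congr 1
  simp [grad2, cg]; ring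

/-- `U` is harmonic on the open set `O`, with holomorphic conjugate gradient. -/
structure Har (U : ℂ → ℝ) (O : Set ℂ) : Prop where
  op : IsOpen O
  hd : ∀ z ∈ O, HasFDerivAt U (reL (cg U z)) z
  hol : DifferentiableOn ℂ (cg U) O

lemma Har.mono {U : ℂ → ℝ} {O O' : Set ℂ} (h : Har U O) (h' : O' ⊆ O) (ho : IsOpen O') :
    Har U O' := ⟨ho, fun z hz => h.hd z (h' hz), h.hol.mono h'⟩

lemma Har.cont {U : ℂ → ℝ} {O : Set ℂ} (h : Har U O) : ContinuousOn U O :=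
  fun z hz => (h.hd z hz).continuousAt.continuousWithinAt

lemma har_of_re {U : ℂ → ℝ} {F f : ℂ → ℂ} {O : Set ℂ} (ho : IsOpen O)
    (hF : ∀ z ∈ O, HasDerivAt F (f z) z) (hU : ∀ z ∈ O, U z = (F z).re) :
    Har U O ∧ ∀ z ∈ O, cg U z = f z := by
  have key : ∀ z ∈ O, HasFDerivAt U (reL (f z)) z := by
    intro z hz
    have h1 : HasFDerivAt (fun w => (F w).re) (reL (f z)) z := by
      have := reCLM.hasFDerivAt.comp z ((hF z hz).hasFDerivAt.restrictScalars ℝ)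
      refine this.congr_fderiv ?_
      ext v; simp [mul_comm]
    refine h1.congr_of_eventuallyEq ?_
    filter_upwards [ho.mem_nhds hz] with w hw using hU w hw
  have hcg : ∀ z ∈ O, cg U z = f z := fun z hz => cg_eq (key z hz)
  refine ⟨⟨ho, fun z hz => by rw [hcg z hz]; exact key z hz, ?_⟩, hcg⟩
  have hFd : DifferentiableOn ℂ F O := fun z hz => (hF z hz).differentiableAt.differentiableWithinAt
  refine (hFd.deriv ho).congr fun z hz => ?_
  rw [hcg z hz, (hF z hz).deriv]

lemma Har.primitive {U : ℂ → ℝ} {O : Set ℂ} (h : Har U O) {c : ℂ} {r : ℝ} (hb : ball c r ⊆ O) :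
    ∃ F : ℂ → ℂ, (∀ z ∈ ball c r, HasDerivAt F (cg U z) z) ∧ ∀ z ∈ ball c r, U z = (F z).re := by
  by_cases hr : r ≤ 0
  · simp [ball_eq_empty.2 hr]
  push Not at hr
  obtain ⟨F, hF⟩ := (h.hol.mono hb).isExactOn_ball
  obtain ⟨hF1, hF2⟩ := har_of_re (U := fun z => (F z).re) isOpen_ball hF (fun _ _ => rfl)
  refine ⟨fun z => F z + ((U c - (F c).re : ℝ) : ℂ), fun z hz => (hF z hz).add_const _, ?_⟩
  intro z hz
  have hcc : c ∈ ball c r := mem_ball_self hr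
  have := (convex_ball c r).is_const_of_fderivWithin_eq_zero (𝕜 := ℝ)
    (f := fun z => U z - (F z).re) (x := z) (y := c) ?_ ?_ hz hcc
  · simp at this ⊢; linarith
  · intro w hw
    exact ((h.hd w (hb hw)).sub (hF1.hd w hw)).differentiableAt.differentiableWithinAt
  · intro w hw
    have h0 : HasFDerivAt (fun z => U z - (F z).re) (0 : ℂ →L[ℝ] ℝ) w := by
      refine ((h.hd w (hb hw)).sub (hF1.hd w hw)).congr_fderiv ?_
      rw [hF2 w hw, sub_self]
    rw [fderivWithin_of_isOpen isOpen_ball hw, h0.fderiv]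

lemma Har.sub {U V : ℂ → ℝ} {O : Set ℂ} (h : Har U O) (h' : Har V O) :
    Har (fun z => U z - V z) O ∧ ∀ z ∈ O, cg (fun z => U z - V z) z = cg U z - cg V z := by
  have hk : ∀ z ∈ O, HasFDerivAt (fun z => U z - V z) (reL (cg U z - cg V z)) z := by
    intro z hz; rw [reL_sub]; exact (h.hd z hz).sub (h'.hd z hz)
  have e : ∀ z ∈ O, cg (fun z => U z - V z) z = cg U z - cg V z := fun z hz => cg_eq (hk z hz)
  exact ⟨⟨h.op, fun z hz => by rw [e z hz]; exact hk z hz, (h.hol.sub h'.hol).congr e⟩, e⟩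

lemma Har.add_const {U : ℂ → ℝ} {O : Set ℂ} (h : Har U O) (c : ℝ) :
    Har (fun z => U z + c) O ∧ ∀ z ∈ O, cg (fun z => U z + c) z = cg U z := by
  have hk : ∀ z ∈ O, HasFDerivAt (fun z => U z + c) (reL (cg U z)) z := by
    intro z hz; exact (h.hd z hz).add_const c
  have e : ∀ z ∈ O, cg (fun z => U z + c) z = cg U z := fun z hz => cg_eq (hk z hz)
  exact ⟨⟨h.op, fun z hz => by rw [e z hz]; exact hk z hz, h.hol.congr e⟩, e⟩

lemma Har.smul {U : ℂ → ℝ} {O : Set ℂ} (h : Har U O) (c : ℝ) :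
    Har (fun z => c * U z) O ∧ ∀ z ∈ O, cg (fun z => c * U z) z = c * cg U z := by
  have hk : ∀ z ∈ O, HasFDerivAt (fun z => c * U z) (reL (c * cg U z)) z := by
    intro z hz
    refine ((h.hd z hz).const_mul c).congr_fderiv ?_
    ext v; simp [mul_assoc]
  have e : ∀ z ∈ O, cg (fun z => c * U z) z = c * cg U z := fun z hz => cg_eq (hk z hz)
  exact ⟨⟨h.op, fun z hz => by rw [e z hz]; exact hk z hz, (h.hol.const_mul (c:ℂ)).congr e⟩, e⟩

/-- Harnack and gradient bound for positive harmonic functions. -/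
lemma Har.harnack {U : ℂ → ℝ} {O : Set ℂ} (h : Har U O) {c : ℂ} {r : ℝ} (hr : 0 < r)
    (hb : ball c r ⊆ O) (hpos : ∀ z ∈ ball c r, 0 < U z) :
    (∀ z ∈ ball c r, U c * (1 - dist z c / r) ≤ U z * (1 + dist z c / r)) ∧
      ‖cg U c‖ ≤ 2 * U c / r := by
  obtain ⟨F0, hF0, hU0⟩ := h.primitive hb
  have hcc : c ∈ ball c r := mem_ball_self hr
  have hc0 := hpos c hcc
  set F : ℂ → ℂ := fun z => F0 z - ((F0 c).im : ℂ) * I with hFdef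
  have hF : ∀ z ∈ ball c r, HasDerivAt F (cg U z) z := fun z hz => (hF0 z hz).sub_const _
  have hU : ∀ z ∈ ball c r, U z = (F z).re := fun z hz => by simp [hFdef, hU0 z hz]
  have hFc : F c = (U c : ℂ) := by
    apply Complex.ext <;> simp [hFdef, hU0 c hcc]
  have hne : ∀ z ∈ ball c r, F z + (U c : ℂ) ≠ 0 := by
    intro z hz h0
    have := congrArg re h0
    simp [← hU z hz] at this
    linarith [hpos z hz]
  set κ : ℂ → ℂ := fun z => (F z - U c) / (F z + U c) with hκ
  have hκd : ∀ z ∈ ball c r, HasDerivAt κ ((cg U z * (F z + U c) - (F z - U c) * cg U z) / (F z + U c)^2) z :=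
    fun z hz => ((hF z hz).sub_const _).div ((hF z hz).add_const _) (hne z hz)
  have hκdiff : DifferentiableOn ℂ κ (ball c r) :=
    fun z hz => (hκd z hz).differentiableAt.differentiableWithinAt
  have hκc : κ c = 0 := by simp [hκ, hFc]
  have hmaps : MapsTo κ (ball c r) (closedBall (κ c) 1) := by
    intro z hz
    rw [hκc, mem_closedBall, dist_zero_right, hκ]
    simp only [norm_div]
    rw [div_le_one (norm_pos_iff.2 (hne z hz))]
    have h1 := hpos z hz
    rw [hU z hz] at h1
    rw [Complex.norm_def, Complex.norm_def]
    apply Real.sqrt_le_sqrt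
    simp only [normSq_apply, sub_re, add_re, ofReal_re, sub_im, add_im, ofReal_im]
    nlinarith
  constructor
  · intro z hz
    have h1 := Complex.dist_le_div_mul_dist_of_mapsTo_ball hκdiff hmaps hz
    rw [hκc, dist_zero_right, hκ] at h1
    simp only [norm_div] at h1
    rw [div_le_iff₀ (norm_pos_iff.2 (hne z hz))] at h1
    set ρ := dist z c / r with hρ
    have hρ1 : ρ < 1 := by rw [hρ, div_lt_one hr]; exact hz
    have hρ0 : 0 ≤ ρ := by positivity
    have h2 : (1 / r * dist z c) = ρ := by rw [hρ]; ring
    rw [h2] at h1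
    have hz' := hpos z hz
    have h3 : ‖F z - U c‖^2 ≤ (ρ * ‖F z + U c‖)^2 := by gcongr
    rw [mul_pow, Complex.sq_norm, Complex.sq_norm] at h3
    simp only [normSq_apply, sub_re, add_re, ofReal_re, sub_im, add_im, ofReal_im,
      ← hU z hz] at h3
    have h4 : (U z - U c)^2 ≤ (ρ * (U z + U c))^2 := by
      have : ρ^2 ≤ 1 := by nlinarith
      nlinarith [sq_nonneg (F z).im, mul_nonneg (sub_nonneg.2 this) (sq_nonneg (F z).im)]
    have h5 := abs_le_of_sq_le_sq' h4 (by positivity)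
    linarith [h5.1]
  · have h1 := Complex.norm_deriv_le_div_of_mapsTo_ball hκdiff hmaps hr
    rw [(hκd c hcc).deriv, hFc] at h1
    have e : (cg U c * ((U c:ℂ) + U c) - ((U c:ℂ) - U c) * cg U c) / ((U c:ℂ) + U c)^2
        = cg U c / ((2 * U c : ℝ) : ℂ) := by
      have : (U c : ℂ) ≠ 0 := by exact_mod_cast hc0.ne'
      push_cast; field_simp; ring
    rw [e, norm_div, norm_real_pos (by positivity),
      div_le_div_iff₀ (by positivity) hr] at h1
    rw [le_div_iff₀ hr]; linarith

lemma Har.grad_le {U : ℂ → ℝ} {O : Set ℂ} (h : Har U O) {c : ℂ} {r M : ℝ} (hr : 0 < r)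
    (hb : ball c r ⊆ O) (hM : ∀ z ∈ ball c r, |U z| ≤ M) : ‖cg U c‖ ≤ 4 * M / r := by
  refine le_of_forall_pos_le_add fun ε hε => ?_
  have hcc : c ∈ ball c r := mem_ball_self hr
  set δ := ε * r / 2 with hδ
  have hδ0 : 0 < δ := by positivity
  obtain ⟨h1, h2⟩ := h.add_const (M + δ)
  have := (h1.harnack hr hb fun z hz => by linarith [(abs_le.1 (hM z hz)).1]).2
  rw [h2 c (hb hcc)] at this
  refine this.trans ?_
  rw [div_le_iff₀ hr]
  have h3 := (abs_le.1 (hM c hcc)).2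
  have : (4 * M / r + ε) * r = 4 * M + 2 * δ := by rw [hδ]; field_simp
  linarith

/-- Maximum principle. -/
lemma Har.max_principle {U : ℂ → ℝ} {V : Set ℂ} (h : Har U V) (hbd : Bornology.IsBounded V)
    (hc : ContinuousOn U (closure V)) {M : ℝ} (hM : ∀ z ∈ frontier V, U z ≤ M) :
    ∀ z ∈ V, U z ≤ M := by
  intro z hz
  have hcomp : IsCompact (closure V) := hbd.isCompact_closure
  obtain ⟨m, hm, hmax⟩ := hcomp.exists_isMaxOn ⟨z, subset_closure hz⟩ hc
  have hmax' : ∀ w ∈ closure V, U w ≤ U m := fun w hw => hmax hw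
  set K := closure V ∩ U ⁻¹' {U m}
  have hK : IsCompact K := by
    refine hcomp.of_isClosed_subset ?_ inter_subset_left
    exact hc.preimage_isClosed_of_isClosed isClosed_closure isClosed_singleton
  obtain ⟨p, hp, hpmax⟩ := hK.exists_isMaxOn ⟨m, hm, rfl⟩ continuous_re.continuousOn
  have hUp : U p = U m := hp.2
  by_contra! hlt
  have hpV : p ∈ V := by
    by_contra hpn
    have : p ∈ frontier V := by rw [h.op.frontier_eq]; exact ⟨hp.1, hpn⟩
    have h1 := hM p this
    have h2 := hmax' z (subset_closure hz)
    linarith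
  obtain ⟨r, hr, hball⟩ := Metric.isOpen_iff.1 h.op p hpV
  obtain ⟨F, hF, hUF⟩ := h.primitive hball
  have hev : ∀ᶠ w in 𝓝 p, ‖cexp (F w)‖ = ‖cexp (F p)‖ := by
    apply Complex.norm_eventually_eq_of_isLocalMax
    · filter_upwards [ball_mem_nhds p hr] with w hw
      exact ((hF w hw).differentiableAt).cexp
    · filter_upwards [ball_mem_nhds p hr] with w hw
      simp only [Function.comp, norm_exp]
      rw [← hUF w hw, ← hUF p (mem_ball_self hr)]
      apply Real.exp_le_exp.2
      rw [hUp]; exact hmax' w (subset_closure (hball hw))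
  obtain ⟨s, hs, hsub⟩ := Metric.eventually_nhds_iff.1 (hev.and (ball_mem_nhds p hr))
  have hd : dist (p + ((s/2 : ℝ) : ℂ)) p < s := by
    rw [dist_eq_norm]; simp only [add_sub_cancel_left, norm_real, Real.norm_eq_abs]
    rw [abs_of_pos (by positivity)]; linarith
  obtain ⟨h1, h2⟩ := hsub hd
  rw [norm_exp, norm_exp, Real.exp_eq_exp, ← hUF _ h2,
    ← hUF p (mem_ball_self hr)] at h1
  have h3 := hpmax (show (p + ((s/2 : ℝ) : ℂ)) ∈ K from
    ⟨subset_closure (hball h2), by simp only [mem_preimage, mem_singleton_iff]; rw [h1, hUp]⟩)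
  simp at h3
  linarith

lemma har_of_harmonicOn2 {u : ℂ → ℝ} {O : Set ℂ} (ho : IsOpen O) (h : HarmonicOn2 u O) :
    Har u O := by
  have hC : ∀ z ∈ O, ContDiffAt ℝ 2 u z := fun z hz => h.1.contDiffAt (ho.mem_nhds hz)
  refine ⟨ho, fun z hz => reL_cg_of_diff ((hC z hz).differentiableAt (by norm_num)), ?_⟩
  intro z hz
  have hh : InnerProductSpace.HarmonicAt u z := by
    refine ⟨hC z hz, ?_⟩
    filter_upwards [ho.mem_nhds hz] with w hw
    have := h.2 w hw
    rw [InnerProductSpace.laplacian_eq_iteratedFDeriv_complexPlane]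
    simp only [Pi.zero_apply]
    have hd : DifferentiableAt ℝ (fderiv ℝ u) w :=
      ((hC w hw).fderiv_right (m := 1) (by norm_num)).differentiableAt (by norm_num)
    rw [iteratedFDeriv_two_apply, iteratedFDeriv_two_apply]
    simp only [hess] at this
    rw [fderiv_clm_apply hd (by fun_prop), fderiv_clm_apply hd (by fun_prop)] at this
    simpa using this
  exact (HarmonicAt.differentiableAt_complex_partial hh).differentiableWithinAt

lemma har_limit {V : ℕ → ℂ → ℝ} {U : ℂ → ℝ} {c : ℂ} {r : ℝ} (hr : 0 < r)
    (hV : ∀ᶠ n in atTop, Har (V n) (ball c r))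
    (hu : TendstoUniformlyOn V U atTop (ball c r)) :
    Har U (ball c (r/2)) ∧
      TendstoUniformlyOn (fun n => cg (V n)) (cg U) atTop (ball c (r/2)) := by
  have hcau := hu.uniformCauchySeqOn
  rw [Metric.uniformCauchySeqOn_iff] at hcau
  have hsub : ∀ w ∈ ball c (r/2), ball w (r/2) ⊆ ball c r := fun w hw => by
    apply ball_subset_ball'
    rw [mem_ball] at hw; linarith
  have hC : UniformCauchySeqOn (fun n => cg (V n)) atTop (ball c (r/2)) := by
    rw [Metric.uniformCauchySeqOn_iff]
    intro ε hε
    obtain ⟨N, hN⟩ := hcau (ε * r / 16) (by positivity)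
    obtain ⟨N', hN'⟩ := eventually_atTop.1 hV
    refine ⟨max N N', fun m hm n hn w hw => ?_⟩
    obtain ⟨h1, h2⟩ := (hN' m (le_of_max_le_right hm)).sub (hN' n (le_of_max_le_right hn))
    have hwr : w ∈ ball c r := hsub w hw (mem_ball_self (by positivity))
    have h3 := h1.grad_le (c := w) (r := r/2) (M := ε * r / 16) (by positivity) (hsub w hw)
      (fun z hz => by
        have := hN m (le_of_max_le_left hm) n (le_of_max_le_left hn) z (hsub w hw hz)
        rw [Real.dist_eq] at this; exact this.le)
    rw [h2 w hwr] at h3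
    rw [dist_eq_norm]
    refine h3.trans_lt ?_
    rw [div_lt_iff₀ (by positivity)]
    nlinarith [mul_pos hε hr]
  have hex : ∀ w ∈ ball c (r/2), ∃ g, Tendsto (fun n => cg (V n) w) atTop (𝓝 g) := fun w hw =>
    cauchySeq_tendsto_of_complete (hC.cauchySeq hw)
  choose! g hg using hex
  have hlim : TendstoUniformlyOn (fun n => cg (V n)) g atTop (ball c (r/2)) :=
    hC.tendstoUniformlyOn_of_tendsto hg
  have hss : ball c (r/2) ⊆ ball c r := ball_subset_ball (by linarith)
  have hder : ∀ w ∈ ball c (r/2), HasFDerivAt U (reL (g w)) w := by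
    intro w hw
    refine hasFDerivAt_of_tendstoUniformlyOnFilter (l := atTop) (f := V)
      (f' := fun n z => reL (cg (V n) z)) (g' := fun z => reL (g z)) ?_ ?_ ?_
    · have h1 : TendstoUniformlyOn (fun n z => reL (cg (V n) z)) (fun z => reL (g z)) atTop
          (ball c (r/2)) := by
        rw [tendstoUniformlyOn_iff] at hlim ⊢
        intro ε hε
        filter_upwards [hlim ε hε] with n hn z hz
        rw [dist_eq_norm, ← reL_sub]
        refine (norm_reL_le _).trans_lt ?_
        rw [← dist_eq_norm]; exact hn z hz
      rw [tendstoUniformlyOn_iff_tendstoUniformlyOnFilter] at h1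
      exact h1.mono_right (le_principal_iff.2 (isOpen_ball.mem_nhds hw))
    · have : ∀ᶠ p : ℕ × ℂ in atTop ×ˢ 𝓝 w, Har (V p.1) (ball c r) ∧ p.2 ∈ ball c (r/2) :=
        hV.prod_mk (isOpen_ball.mem_nhds hw)
      filter_upwards [this] with p hp
      exact hp.1.hd p.2 (hss hp.2)
    · filter_upwards [isOpen_ball.mem_nhds hw] with z hz
      exact hu.tendsto_at (hss hz)
  have hcg : ∀ w ∈ ball c (r/2), cg U w = g w := fun w hw => cg_eq (hder w hw)
  refine ⟨⟨isOpen_ball, fun w hw => by rw [hcg w hw]; exact hder w hw, ?_⟩, ?_⟩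
  · have : DifferentiableOn ℂ g (ball c (r/2)) := by
      refine hlim.tendstoLocallyUniformlyOn.differentiableOn ?_ isOpen_ball
      filter_upwards [hV] with n hn using hn.hol.mono hss
    exact this.congr hcg
  · exact hlim.congr_right fun w hw => (hcg w hw).symm

/-- Arzela-Ascoli for Lipschitz functions on the plane. -/
lemma arzela {E : Type*} [NormedAddCommGroup E] [ProperSpace E] (g : ℕ → ℂ → E)
    {L : ℝ≥0} (hL : ∀ n, LipschitzWith L (g n)) {C : ℝ} (hC : ∀ n, ‖g n 0‖ ≤ C) :
    ∃ (φ : ℕ → ℕ) (G : ℂ → E), StrictMono φ ∧ LipschitzWith L G ∧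
      TendstoLocallyUniformly (fun n => g (φ n)) G atTop := by
  set d := TopologicalSpace.denseSeq ℂ with hd
  have hdense : DenseRange d := TopologicalSpace.denseRange_denseSeq ℂ
  have hbd : ∀ n z, ‖g n z‖ ≤ C + L * ‖z‖ := by
    intro n z
    have h1 := (hL n).dist_le_mul z 0
    rw [dist_zero_right, dist_eq_norm] at h1
    have := norm_le_norm_sub_add (g n z) (g n 0)
    linarith [hC n]
  have hK : IsCompact (Set.pi univ fun i : ℕ => closedBall (0 : E) (C + L * ‖d i‖)) :=
    isCompact_univ_pi fun i => isCompact_closedBall _ _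
  obtain ⟨a, -, φ, hφ, ha⟩ := hK.tendsto_subseq (x := fun n i => g n (d i))
    (fun n => by simp only [mem_univ_pi]; intro i; simpa using hbd n (d i))
  rw [tendsto_pi_nhds] at ha
  have hcau : ∀ z, CauchySeq (fun n => g (φ n) z) := by
    intro z
    rw [Metric.cauchySeq_iff]
    intro ε hε
    obtain ⟨i, hi⟩ := hdense.exists_dist_lt z (ε := ε / (3 * (L + 1))) (by positivity)
    have := (ha i).cauchySeq
    rw [Metric.cauchySeq_iff] at this
    obtain ⟨N, hN⟩ := this (ε/3) (by positivity)
    refine ⟨N, fun m hm n hn => ?_⟩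
    have h1 := (hL (φ m)).dist_le_mul z (d i)
    have h2 := (hL (φ n)).dist_le_mul (d i) z
    have h3 : L * dist z (d i) ≤ ε / 3 := by
      have : (L:ℝ) * dist z (d i) ≤ (L + 1) * (ε / (3 * (L + 1))) := by gcongr; linarith
      refine this.trans (le_of_eq ?_); field_simp
    rw [dist_comm (d i) z] at h2
    have h4 := hN m hm n hn
    simp only [Function.comp] at h4
    have := dist_triangle4 (g (φ m) z) (g (φ m) (d i)) (g (φ n) (d i)) (g (φ n) z)
    linarith
  choose G hG using fun z => cauchySeq_tendsto_of_complete (hcau z)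
  have hGL : LipschitzWith L G := by
    refine LipschitzWith.of_dist_le_mul fun x y => ?_
    exact le_of_tendsto ((hG x).dist (hG y)) (Eventually.of_forall fun n => (hL _).dist_le_mul x y)
  refine ⟨φ, G, hφ, hGL, ?_⟩
  rw [Metric.tendstoLocallyUniformly_iff]
  intro ε hε z
  refine ⟨ball z (ε / (3 * (L + 1))), ball_mem_nhds _ (by positivity), ?_⟩
  filter_upwards [(Metric.tendsto_nhds.1 (hG z)) (ε/3) (by positivity)] with n hn y hy
  have h1 := (hL (φ n)).dist_le_mul z y
  have h2 := hGL.dist_le_mul y z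
  rw [mem_ball] at hy
  have h3 : L * dist y z ≤ ε / 3 := by
    have : (L:ℝ) * dist y z ≤ (L + 1) * (ε / (3 * (L + 1))) := by gcongr; linarith
    refine this.trans (le_of_eq ?_); field_simp
  rw [dist_comm z y] at h1
  have := dist_triangle4 (G y) (G z) (g (φ n) z) (g (φ n) y)
  rw [dist_comm (G z)] at this
  linarith

/-- Nonnegative harmonic functions with an interior zero vanish nearby. -/
lemma Har.zero_of_nonneg {U : ℂ → ℝ} {c : ℂ} {r : ℝ} (h : Har U (ball c r))
    (h0 : ∀ z ∈ ball c r, 0 ≤ U z) (hc : U c = 0) : ∀ z ∈ ball c r, U z = 0 := by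
  intro z hz
  have hr : 0 < r := dist_nonneg.trans_lt hz
  have hcc : c ∈ ball c r := mem_ball_self hr
  refine le_antisymm ?_ (h0 z hz)
  obtain ⟨F, hF, hUF⟩ := h.primitive subset_rfl
  have hd : DifferentiableOn ℂ (fun z => cexp (- F z)) (ball c r) := fun w hw =>
    ((hF w hw).differentiableAt.neg.cexp).differentiableWithinAt
  have := Complex.norm_eqOn_of_isPreconnected_of_isMaxOn (convex_ball c r).isPreconnected
    isOpen_ball hd hcc (fun w hw => by
      simp only [mem_setOf_eq, Function.comp, norm_exp, neg_re]
      rw [← hUF w hw, ← hUF c hcc, hc]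
      apply Real.exp_le_exp.2
      linarith [h0 w hw])
  have h1 := this hz
  simp only [Function.comp, Function.const, norm_exp, neg_re] at h1
  rw [← hUF z hz, ← hUF c hcc, hc, Real.exp_eq_exp] at h1
  linarith

section level
variable {Ω : Set ℂ} {u : ℂ → ℝ} {R : ℝ}

lemma posSet_open (hΩ : IsOpen Ω) (hs : IsClassicalSolution Ω u) : IsOpen (posSet Ω u) :=
  hs.contOn.isOpen_inter_preimage hΩ isOpen_Ioi

lemma har_pos (hΩ : IsOpen Ω) (hs : IsClassicalSolution Ω u) : Har u (posSet Ω u) :=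
  har_of_harmonicOn2 (posSet_open hΩ hs) hs.harm

lemma mem_FB_iff (hΩ : IsOpen Ω) (hs : IsClassicalSolution Ω u) {z : ℂ} :
    z ∈ FB Ω u ↔ z ∈ Ω ∧ u z = 0 ∧ z ∈ closure (posSet Ω u) := by
  rw [FB, (posSet_open hΩ hs).frontier_eq]
  constructor
  · rintro ⟨h1, h2, h3⟩
    refine ⟨h1, le_antisymm ?_ (hs.nonneg z h1), h2⟩
    by_contra h
    exact h3 ⟨h1, not_le.1 h⟩
  · rintro ⟨h1, h2, h3⟩
    exact ⟨h1, h3, fun h => by have := h.2; linarith⟩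

lemma near_zero (hs : IsClassicalSolution (ball 0 R) u) (h0 : (0:ℂ) ∈ FB (ball 0 R) u)
    {z : ℂ} (hz : ‖z‖ < R / 4) (hp : 0 < u z) :
    ∃ (y : ℂ), 0 < dist z y ∧ y ∈ FB (ball 0 R) u ∧ ball z (dist z y) ⊆ posSet (ball 0 R) u ∧
      u z ≤ 2 * dist z y ∧ (∀ w, ‖w‖ < R/2 → u w = 0 → dist z y ≤ dist z w) := by
  have hR : 0 < R := by linarith [norm_nonneg z]
  set Z := closedBall (0:ℂ) (R/2) ∩ u ⁻¹' {0}
  have hsubb : closedBall (0:ℂ) (R/2) ⊆ ball 0 R := closedBall_subset_ball (by linarith)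
  have hZc : IsCompact Z := by
    refine (isCompact_closedBall (0:ℂ) (R/2)).of_isClosed_subset ?_ inter_subset_left
    exact (hs.contOn.mono hsubb).preimage_isClosed_of_isClosed isClosed_closedBall isClosed_singleton
  have h0' := (mem_FB_iff isOpen_ball hs).1 h0
  have h0Z : (0:ℂ) ∈ Z := ⟨by simp; linarith, h0'.2.1⟩
  obtain ⟨y, hyZ, hy⟩ := hZc.exists_isMinOn ⟨0, h0Z⟩ (f := fun w => dist z w) (by fun_prop)
  have hy' : ∀ w ∈ Z, dist z y ≤ dist z w := fun w hw => hy hw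
  have hd0 : dist z y < R/4 := by
    have := hy' 0 h0Z; rw [dist_zero_right] at this; linarith
  have hd : 0 < dist z y := by
    rw [dist_pos]; rintro rfl
    have : u z = 0 := hyZ.2
    linarith
  have hy0 : u y = 0 := hyZ.2
  have hbp : ball z (dist z y) ⊆ posSet (ball 0 R) u := by
    intro w hw
    have hwn : ‖w‖ < R/2 := by
      have : ‖w‖ ≤ dist w z + ‖z‖ := by rw [dist_eq_norm]; exact norm_le_norm_sub_add w z
      rw [mem_ball] at hw; linarith
    have hwR : w ∈ ball (0:ℂ) R := by simp; linarith
    refine ⟨hwR, lt_of_le_of_ne (hs.nonneg w hwR) fun h => ?_⟩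
    have := hy' w ⟨by simp; linarith, h.symm⟩
    rw [mem_ball, dist_comm] at hw; linarith
  have hyR : y ∈ ball (0:ℂ) R := hsubb hyZ.1
  have hycl : y ∈ closure (posSet (ball 0 R) u) := by
    refine closure_mono hbp ?_
    rw [closure_ball _ hd.ne', mem_closedBall, dist_comm]
  have hyF : y ∈ FB (ball 0 R) u := (mem_FB_iff isOpen_ball hs).2 ⟨hyR, hy0, hycl⟩
  refine ⟨y, hd, hyF, hbp, ?_, fun w hw hw0 => hy' w ⟨by simp; linarith, hw0⟩⟩
  have har := har_pos isOpen_ball hs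
  refine le_of_forall_pos_le_add fun ε hε => ?_
  set d := dist z y with hdd
  -- gradient close to one near y
  have hg := hs.grad_one y hyF
  have hev : ∀ᶠ w in 𝓝[posSet (ball 0 R) u] y, ‖grad2 u w‖ < 1 + ε / (2 * d) :=
    hg.eventually (gt_mem_nhds (by have : 0 < ε / (2*d) := by positivity
                                   linarith))
  rw [eventually_nhdsWithin_iff, Metric.eventually_nhds_iff] at hev
  obtain ⟨δ, hδ, hδ'⟩ := hev
  set t := min (δ/2) (d/2) with ht
  have ht0 : 0 < t := by positivity
  have htd : t < d := lt_of_le_of_lt (min_le_right _ _) (by linarith)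
  have htδ : t < δ := lt_of_le_of_lt (min_le_left _ _) (by linarith)
  have hnzy : ‖z - y‖ = d := by rw [← dist_eq_norm]
  set γ : ℝ → ℂ := fun s => y + (s : ℂ) * ((z - y) / d) with hγ
  have hdC : (d:ℂ) ≠ 0 := by exact_mod_cast hd.ne'
  have hdir : ‖(z - y) / (d:ℂ)‖ = 1 := by
    rw [norm_div, hnzy, norm_real_pos hd, div_self hd.ne']
  have hγball : ∀ s, 0 < s → s ≤ d → dist (γ s) z = d - s := by
    intro s hs0 hsd
    have : γ s - z = ((s - d : ℝ) : ℂ) * ((z - y) / d) := by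
      simp only [hγ]; push_cast; field_simp; ring
    rw [dist_eq_norm, this, norm_mul, hdir, norm_real, Real.norm_eq_abs,
      abs_of_nonpos (by linarith)]; ring
  have hγpos : ∀ s, 0 < s → s ≤ d → γ s ∈ posSet (ball 0 R) u := by
    intro s h1 h2
    apply hbp; rw [mem_ball, hγball s h1 h2]; linarith
  have hγy : ∀ s, 0 < s → dist (γ s) y = s := by
    intro s hs0
    rw [dist_eq_norm]; simp only [hγ, add_sub_cancel_left]
    rw [norm_mul, hdir, norm_real_pos hs0, mul_one]
  have hγd : ∀ s, HasDerivAt γ ((z - y) / d) s := by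
    intro s
    have h1 : HasDerivAt (fun s : ℝ => (s:ℂ)) 1 s := ofRealCLM.hasDerivAt
    have h2 := (h1.mul_const ((z - y) / (d:ℂ))).const_add y
    rw [one_mul] at h2
    exact h2
  have hup : u (γ t) ≤ (1 + ε / (2*d)) * t := by
    have hcont : ContinuousOn (u ∘ γ) (Icc 0 t) := by
      intro s hs'
      have hγs : γ s ∈ ball (0:ℂ) R := by
        rcases hs'.1.eq_or_lt with h | h
        · rw [← h]; simpa [hγ] using hyR
        · exact (hγpos s h (by linarith [hs'.2])).1
      exact ((hs.contOn.continuousAt (isOpen_ball.mem_nhds hγs)).comp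
        (hγd s).continuousAt).continuousWithinAt
    have hmv := exists_hasDerivAt_eq_slope (u ∘ γ)
      (fun s => (cg u (γ s) * ((z - y) / d)).re) ht0 hcont (fun s hs' => by
        have h1 := har.hd (γ s) (hγpos s hs'.1 (by linarith [hs'.2]))
        have := h1.comp_hasDerivAt s (hγd s)
        simpa using this)
    obtain ⟨s, hs', hse⟩ := hmv
    have h0 : (u ∘ γ) 0 = 0 := by simp [hγ, hy0]
    rw [h0, sub_zero, sub_zero] at hse
    have hb : ‖cg u (γ s)‖ < 1 + ε / (2*d) := by
      rw [← norm_grad2]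
      exact hδ' (by rw [hγy s hs'.1]; linarith [hs'.2]) (hγpos s hs'.1 (by linarith [hs'.2]))
    have h2 : (cg u (γ s) * ((z - y) / d)).re ≤ ‖cg u (γ s)‖ := by
      refine (Complex.re_le_norm _).trans ?_
      rw [norm_mul, hdir, mul_one]
    rw [hse, Function.comp, div_le_iff₀ ht0] at h2
    nlinarith
  have hlow := (har.harnack hd hbp (fun w hw => (hbp hw).2)).1 (γ t)
    (by rw [mem_ball, hγball t ht0 htd.le]; linarith)
  rw [hγball t ht0 htd.le] at hlow
  have e1 : 1 - (d - t) / d = t / d := by field_simp; ring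
  have e2 : 1 + (d - t) / d ≤ 2 := by
    have : (d - t)/d ≤ 1 := by rw [div_le_one hd]; linarith
    linarith
  rw [e1] at hlow
  have h3 : u z * (t / d) ≤ (1 + ε/(2*d)) * t * 2 := by
    refine hlow.trans ?_
    have := (hγpos t ht0 htd.le).2
    have h4 : u (γ t) * (1 + (d - t)/d) ≤ u (γ t) * 2 := by gcongr
    linarith
  have h5 : u z * (t / d) * (d / t) ≤ (1 + ε/(2*d)) * t * 2 * (d / t) := by gcongr
  have e3 : u z * (t / d) * (d / t) = u z := by field_simp
  have e4 : (1 + ε/(2*d)) * t * 2 * (d / t) = 2 * d + ε := by field_simp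
  linarith

lemma cg_le_four (hs : IsClassicalSolution (ball 0 R) u) (h0 : (0:ℂ) ∈ FB (ball 0 R) u)
    {z : ℂ} (hz : ‖z‖ < R / 4) (hp : 0 < u z) : ‖cg u z‖ ≤ 4 := by
  obtain ⟨y, hd, -, hb, hu, -⟩ := near_zero hs h0 hz hp
  refine ((har_pos isOpen_ball hs).harnack hd hb fun w hw => (hb hw).2).2.trans ?_
  rw [div_le_iff₀ hd]; linarith

lemma u_lip (hs : IsClassicalSolution (ball 0 R) u) (h0 : (0:ℂ) ∈ FB (ball 0 R) u) :
    LipschitzOnWith 4 u (ball 0 (R/4)) := by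
  have main : ∀ z ∈ ball (0:ℂ) (R/4), ∀ w ∈ ball (0:ℂ) (R/4), u z - u w ≤ 4 * dist z w := by
    intro z hz w hw
    have hz' : ‖z‖ < R/4 := by simpa using hz
    have hw' : ‖w‖ < R/4 := by simpa using hw
    have hwR : w ∈ ball (0:ℂ) R := by simp; linarith [norm_nonneg w]
    have hu0 := hs.nonneg w hwR
    by_cases hp : 0 < u z
    · obtain ⟨y, hd, -, hb, hu, hy⟩ := near_zero hs h0 hz' hp
      by_cases hcase : dist z y ≤ dist z w
      · linarith [dist_nonneg (x := z) (y := w)]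
      · push Not at hcase
        have hconv : Convex ℝ (ball z (dist z y) ∩ ball (0:ℂ) (R/4)) :=
          (convex_ball _ _).inter (convex_ball _ _)
        have := hconv.norm_image_sub_le_of_norm_hasFDerivWithin_le (f := u)
          (f' := fun x => reL (cg u x)) (C := 4) (x := w) (y := z)
          (fun x hx => ((har_pos isOpen_ball hs).hd x (hb hx.1)).hasFDerivWithinAt)
          (fun x hx => (norm_reL_le _).trans
            (cg_le_four hs h0 (by simpa using hx.2) (hb hx.1).2))
          ⟨by rw [mem_ball, dist_comm]; exact hcase, hw⟩ ⟨mem_ball_self hd, hz⟩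
        rw [Real.norm_eq_abs, ← dist_eq_norm] at this
        exact (le_abs_self _).trans this
    · push Not at hp; linarith [dist_nonneg (x := z) (y := w)]
  refine LipschitzOnWith.of_dist_le_mul fun z hz w hw => ?_
  rw [Real.dist_eq, abs_le]
  have h1 := main z hz w hw
  have h2 := main w hw z hz
  rw [dist_comm] at h2
  simp only [NNReal.coe_ofNat]
  constructor <;> linarith

end level

end OP

namespace OP

lemma arzela_loc {E : Type*} [NormedAddCommGroup E] [NormedSpace ℝ E] [FiniteDimensional ℝ E]
    (g : ℕ → ℂ → E) {r : ℕ → ℝ} (hr : Tendsto r atTop atTop) (hr0 : ∀ n, 0 < r n)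
    {L : ℝ≥0} (hL : ∀ n, LipschitzOnWith L (g n) (ball 0 (r n))) {C : ℝ}
    (hC : ∀ n, ‖g n 0‖ ≤ C) :
    ∃ (φ : ℕ → ℕ) (G : ℂ → E), StrictMono φ ∧ LipschitzWith L G ∧
      TendstoLocallyUniformly (fun n => g (φ n)) G atTop := by
  have : ProperSpace E := FiniteDimensional.proper_real E
  choose h hh1 hh2 using fun n => (hL n).extend_finite_dimension
  obtain ⟨φ, G, hφ, -, hlim⟩ := arzela h hh1 (C := C) (fun n => by
    rw [← hh2 n (mem_ball_self (hr0 n))]; exact hC n)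
  have hrφ : Tendsto (fun n => r (φ n)) atTop atTop := hr.comp hφ.tendsto_atTop
  have hlim' : TendstoLocallyUniformly (fun n => g (φ n)) G atTop := by
    rw [Metric.tendstoLocallyUniformly_iff] at hlim ⊢
    intro ε hε x
    obtain ⟨t, ht, hev⟩ := hlim ε hε x
    refine ⟨t ∩ ball 0 (‖x‖ + 1), inter_mem ht (isOpen_ball.mem_nhds (by simp)), ?_⟩
    filter_upwards [hev, hrφ.eventually_ge_atTop (‖x‖ + 1)] with n hn hn' y hy
    have := hn y hy.1
    rwa [← hh2 (φ n) (ball_subset_ball hn' hy.2)] at this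
  refine ⟨φ, G, hφ, ?_, hlim'⟩
  refine LipschitzWith.of_dist_le_mul fun x y => ?_
  have hp : ∀ z, Tendsto (fun n => g (φ n) z) atTop (𝓝 (G z)) := fun z =>
    (tendstoLocallyUniformlyOn_univ.2 hlim').tendsto_at (mem_univ z)
  refine le_of_tendsto ((hp x).dist (hp y)) ?_
  filter_upwards [hrφ.eventually_gt_atTop ‖x‖, hrφ.eventually_gt_atTop ‖y‖] with n hx hy
  exact (hL (φ n)).dist_le_mul x (by simpa using hx) y (by simpa using hy)

lemma first_conv (R : ℕ → ℝ) (hRpos : ∀ k, 0 < R k)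
    (hR : Filter.Tendsto R atTop atTop) (u : ℕ → ℂ → ℝ)
    (hsol : ∀ k, IsClassicalSolution (ball 0 (R k)) (u k))
    (h0 : ∀ k, (0 : ℂ) ∈ FB (ball 0 (R k)) (u k)) :
    ∃ (φ : ℕ → ℕ) (U : ℂ → ℝ), StrictMono φ ∧ LipschitzWith 4 U ∧
      TendstoLocallyUniformly (fun k => u (φ k)) U atTop := by
  refine arzela_loc u (r := fun n => R n / 4) (hR.atTop_div_const (by norm_num))
    (fun n => by have := hRpos n; positivity) (fun n => u_lip (hsol n) (h0 n)) (C := 0) fun n => ?_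
  have := ((mem_FB_iff isOpen_ball (hsol n)).1 (h0 n)).2.1
  simp [this]

lemma integral_fderiv_zero {X : ℂ → ℂ} (h1 : ContDiff ℝ 1 X) (hc : HasCompactSupport X) (v : ℂ) :
    ∫ z, fderiv ℝ X z v = 0 := by
  have hd : Continuous fun z => fderiv ℝ X z v :=
    (h1.continuous_fderiv (by norm_num)).clm_apply continuous_const
  have := integral_mul_fderiv_eq_neg_fderiv_mul_of_integrable (μ := volume)
    (f := fun _ : ℂ => (1:ℂ)) (g := X) (v := v) (by simp)
    (by simpa using hd.integrable_of_hasCompactSupport (hc.fderiv_apply (𝕜 := ℝ) v))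
    (by simpa using h1.continuous.integrable_of_hasCompactSupport hc)
    (by fun_prop) (fun x _ => (h1.differentiable (by norm_num)) x)
  simpa using this

/-- smooth step -/
noncomputable def bt (ε t : ℝ) : ℝ := Real.smoothTransition ((t - ε) / ε)

/-- primitive of the smooth step -/
noncomputable def Bt (ε t : ℝ) : ℝ := ∫ s in (0:ℝ)..t, bt ε s

lemma bt_contDiff (ε : ℝ) : ContDiff ℝ 1 (bt ε) := by
  unfold bt
  exact (Real.smoothTransition.contDiff (n := 1)).comp (by fun_prop)

lemma bt_zero {ε t : ℝ} (hε : 0 < ε) (h : t ≤ ε) : bt ε t = 0 :=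
  Real.smoothTransition.zero_of_nonpos (div_nonpos_of_nonpos_of_nonneg (by linarith) hε.le)

lemma bt_one {ε t : ℝ} (hε : 0 < ε) (h : 2 * ε ≤ t) : bt ε t = 1 :=
  Real.smoothTransition.one_of_one_le (by rw [le_div_iff₀ hε]; linarith)

lemma bt_nonneg (ε t : ℝ) : 0 ≤ bt ε t := Real.smoothTransition.nonneg _
lemma bt_le_one (ε t : ℝ) : bt ε t ≤ 1 := Real.smoothTransition.le_one _

lemma bt_mono {ε : ℝ} (hε : 0 < ε) : Monotone (bt ε) := fun s t hst =>
  Real.smoothTransition.monotone (by gcongr)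

lemma bt_deriv_nonneg {ε : ℝ} (hε : 0 < ε) (t : ℝ) : 0 ≤ deriv (bt ε) t := (bt_mono hε).deriv_nonneg

lemma bt_deriv_zero {ε t : ℝ} (hε : 0 < ε) (h : t ≤ ε) : deriv (bt ε) t = 0 := by
  have hcl : closure (Iio ε) = Iic ε := closure_Iio ε
  have : t ∈ closure (Iio ε) := by rw [hcl]; exact h
  have hz : ∀ s ∈ Iio ε, deriv (bt ε) s = 0 := by
    intro s hs
    have : bt ε =ᶠ[𝓝 s] fun _ => 0 := by
      filter_upwards [isOpen_Iio.mem_nhds hs] with x hx using bt_zero hε (le_of_lt hx)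
    rw [this.deriv_eq]; simp
  exact (isClosed_eq ((bt_contDiff ε).continuous_deriv (by norm_num)) continuous_const).closure_subset_iff.2
    (fun s hs => hz s hs) this

lemma bt_deriv_zero' {ε t : ℝ} (hε : 0 < ε) (h : 2 * ε < t) : deriv (bt ε) t = 0 := by
  have : bt ε =ᶠ[𝓝 t] fun _ => 1 := by
    filter_upwards [isOpen_Ioi.mem_nhds h] with x hx using bt_one hε (le_of_lt hx)
  rw [this.deriv_eq]; simp

lemma Bt_deriv (ε t : ℝ) : HasDerivAt (Bt ε) (bt ε t) t := by
  have hc := (bt_contDiff ε).continuous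
  exact intervalIntegral.integral_hasDerivAt_right (hc.intervalIntegrable _ _)
    hc.stronglyMeasurable.stronglyMeasurableAtFilter hc.continuousAt

lemma Bt_contDiff (ε : ℝ) : ContDiff ℝ 1 (Bt ε) := by
  rw [contDiff_one_iff_deriv]
  refine ⟨fun t => (Bt_deriv ε t).differentiableAt, ?_⟩
  have : deriv (Bt ε) = bt ε := funext fun t => (Bt_deriv ε t).deriv
  rw [this]; exact (bt_contDiff ε).continuous

lemma Bt_zero {ε t : ℝ} (hε : 0 < ε) (h : t ≤ ε) : Bt ε t = 0 := by
  unfold Bt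
  rw [intervalIntegral.integral_congr (g := fun _ => 0)]
  · simp
  · intro s hs
    refine bt_zero hε ?_
    rcases le_total 0 t with h0 | h0
    · rw [uIcc_of_le h0] at hs; linarith [hs.2]
    · rw [uIcc_of_ge h0] at hs; linarith [hs.2]

lemma Bt_bounds {ε t : ℝ} (ht : 0 ≤ t) : 0 ≤ Bt ε t ∧ Bt ε t ≤ t := by
  have hc := (bt_contDiff ε).continuous
  constructor
  · exact intervalIntegral.integral_nonneg ht fun s _ => bt_nonneg ε s
  · have := intervalIntegral.integral_mono_on ht (hc.intervalIntegrable _ _)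
      (intervalIntegrable_const (c := (1:ℝ)) (μ := volume)) (fun s _ => bt_le_one ε s)
    simpa [Bt] using this

noncomputable def dbar2 (η : ℂ → ℂ) (z : ℂ) : ℂ := fderiv ℝ η z 1 + I * fderiv ℝ η z I
noncomputable def d2 (η : ℂ → ℂ) (z : ℂ) : ℂ := fderiv ℝ η z 1 - I * fderiv ℝ η z I

section level
variable {Ω : Set ℂ} {u : ℂ → ℝ}

/-- gluing: continuity of `η * b(u) * g`. -/
lemma glue_cont (hΩ : IsOpen Ω) (hs : IsClassicalSolution Ω u) {η g : ℂ → ℂ} {b : ℝ → ℝ} {ε : ℝ}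
    (hε : 0 < ε) (hη : Continuous η) (hηs : tsupport η ⊆ Ω)
    (hb : Continuous b) (hb0 : ∀ t ≤ ε, b t = 0) (hg : ContinuousOn g (posSet Ω u)) :
    Continuous fun z => η z * b (u z) * g z := by
  rw [continuous_iff_continuousAt]
  intro z
  by_cases hz : z ∈ tsupport η
  · have hzΩ := hηs hz
    have hu : ContinuousAt u z := hs.contOn.continuousAt (hΩ.mem_nhds hzΩ)
    rcases (hs.nonneg z hzΩ).eq_or_lt with h0 | h0
    · have : (fun z => η z * b (u z) * g z) =ᶠ[𝓝 z] fun _ => 0 := by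
        filter_upwards [hu.eventually (gt_mem_nhds (show u z < ε by rw [← h0]; exact hε))] with w hw
        simp [hb0 _ hw.le]
      exact continuousAt_const.congr this.symm
    · have hzp : z ∈ posSet Ω u := ⟨hzΩ, h0⟩
      have hgz := hg.continuousAt ((posSet_open hΩ hs).mem_nhds hzp)
      exact (hη.continuousAt.mul (continuous_ofReal.continuousAt.comp
        (hb.continuousAt.comp hu))).mul hgz
  · have : (fun z => η z * b (u z) * g z) =ᶠ[𝓝 z] fun _ => 0 := by
      filter_upwards [(isClosed_tsupport η).isOpen_compl.mem_nhds hz] with w hw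
      simp [image_eq_zero_of_notMem_tsupport hw]
    exact continuousAt_const.congr this.symm

lemma glue_integrable (hΩ : IsOpen Ω) (hs : IsClassicalSolution Ω u) {η g : ℂ → ℂ} {b : ℝ → ℝ}
    {ε : ℝ} (hε : 0 < ε) (hη : Continuous η) (hηc : HasCompactSupport η) (hηs : tsupport η ⊆ Ω)
    (hb : Continuous b) (hb0 : ∀ t ≤ ε, b t = 0) (hg : ContinuousOn g (posSet Ω u)) :
    Integrable fun z => η z * b (u z) * g z := by
  refine (glue_cont hΩ hs hε hη hηs hb hb0 hg).integrable_of_hasCompactSupport ?_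
  refine hηc.mono fun z hz => ?_
  simp only [Function.mem_support, ne_eq] at hz ⊢
  intro h; apply hz; simp [h]

lemma ibp_aux (hΩ : IsOpen Ω) (hs : IsClassicalSolution Ω u) {η g : ℂ → ℂ} {b : ℝ → ℝ} {ε : ℝ}
    (hε : 0 < ε) (hη : ContDiff ℝ 1 η) (hηc : HasCompactSupport η) (hηs : tsupport η ⊆ Ω)
    (hb : ContDiff ℝ 1 b) (hb0 : ∀ t ≤ ε, b t = 0) (hb1 : ∀ t ≤ ε, deriv b t = 0)
    (hg : DifferentiableOn ℂ g (posSet Ω u)) (v : ℂ) :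
    ∫ z, (fderiv ℝ η z v * b (u z) * g z + η z * (deriv b (u z)) * ((cg u z * v).re * g z)
      + η z * b (u z) * (deriv g z * v)) = 0 := by
  have har := har_pos hΩ hs
  have hO := posSet_open hΩ hs
  set X : ℂ → ℂ := fun z => η z * b (u z) * g z with hX
  have hz0 : ∀ z, z ∉ tsupport η → X =ᶠ[𝓝 z] fun _ => 0 := by
    intro z hz
    filter_upwards [(isClosed_tsupport η).isOpen_compl.mem_nhds hz] with w hw
    simp [hX, image_eq_zero_of_notMem_tsupport hw]
  have hz1 : ∀ z, z ∈ tsupport η → u z = 0 → X =ᶠ[𝓝 z] fun _ => 0 := by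
    intro z hz h0
    have hu : ContinuousAt u z := hs.contOn.continuousAt (hΩ.mem_nhds (hηs hz))
    filter_upwards [hu.eventually (gt_mem_nhds (show u z < ε by rw [h0]; exact hε))] with w hw
    simp [hX, hb0 _ hw.le]
  have hC : ContDiff ℝ 1 X := by
    rw [contDiff_iff_contDiffAt]
    intro z
    by_cases hz : z ∈ tsupport η
    · have hzΩ := hηs hz
      rcases (hs.nonneg z hzΩ).eq_or_lt with h0 | h0
      · exact contDiffAt_const.congr_of_eventuallyEq (hz1 z hz h0.symm)
      · have hzp : z ∈ posSet Ω u := ⟨hzΩ, h0⟩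
        have hgz : ContDiffAt ℝ 1 g z :=
          ((hg.analyticAt (hO.mem_nhds hzp)).contDiffAt (n := 1)).restrict_scalars ℝ
        have huz : ContDiffAt ℝ 1 u z :=
          (hs.harm.1.contDiffAt (hO.mem_nhds hzp)).of_le (by norm_num)
        have hbz : ContDiffAt ℝ 1 (fun z => ((b (u z) : ℝ) : ℂ)) z :=
          ofRealCLM.contDiff.contDiffAt.comp z (hb.contDiffAt.comp z huz)
        exact (hη.contDiffAt.mul hbz).mul hgz
    · exact contDiffAt_const.congr_of_eventuallyEq (hz0 z hz)
  have hcs : HasCompactSupport X := by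
    refine hηc.mono fun z hz => ?_
    simp only [Function.mem_support, ne_eq] at hz ⊢
    intro h; apply hz; simp [hX, h]
  rw [← integral_fderiv_zero hC hcs v]
  congr 1
  ext z
  by_cases hz : z ∈ tsupport η
  · have hzΩ := hηs hz
    rcases (hs.nonneg z hzΩ).eq_or_lt with h0 | h0
    · rw [(hz1 z hz h0.symm).fderiv_eq]
      simp [hb0 (u z) (by linarith), hb1 (u z) (by linarith)]
    · have hzp : z ∈ posSet Ω u := ⟨hzΩ, h0⟩
      have hgz : HasFDerivAt g ((ContinuousLinearMap.toSpanSingleton ℂ (deriv g z)).restrictScalars ℝ) z :=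
        ((hg.differentiableAt (hO.mem_nhds hzp)).hasDerivAt).hasFDerivAt.restrictScalars ℝ
      have hηz := ((hη.differentiable (by norm_num)) z).hasFDerivAt
      have hbz : HasFDerivAt (fun z => ((b (u z) : ℝ) : ℂ))
          (ofRealCLM.comp ((deriv b (u z)) • reL (cg u z))) z :=
        ofRealCLM.hasFDerivAt.comp z
          (((hb.differentiable (by norm_num)) (u z)).hasDerivAt.comp_hasFDerivAt z (har.hd z hzp))
      have hXd : HasFDerivAt X _ z := (hηz.mul hbz).mul hgz
      rw [hXd.fderiv]
      simp only [Pi.mul_apply, ContinuousLinearMap.add_apply, ContinuousLinearMap.smul_apply, smul_eq_mul,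
        ContinuousLinearMap.comp_apply, Complex.ofRealCLM_apply, reL_apply,
        ContinuousLinearMap.coe_restrictScalars', ContinuousLinearMap.toSpanSingleton_apply]
      push_cast
      ring
  · rw [(hz0 z hz).fderiv_eq]
    have : fderiv ℝ η z = 0 := by
      have : η =ᶠ[𝓝 z] fun _ => 0 := by
        filter_upwards [(isClosed_tsupport η).isOpen_compl.mem_nhds hz] with w hw
        simp [image_eq_zero_of_notMem_tsupport hw]
      rw [this.fderiv_eq]; simp
    simp [this, image_eq_zero_of_notMem_tsupport hz]

lemma tsupport_fderiv_apply (η : ℂ → ℂ) (v : ℂ) : tsupport (fun z => fderiv ℝ η z v) ⊆ tsupport η :=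
  tsupport_fderiv_apply_subset ℝ v

lemma cg_cont (hΩ : IsOpen Ω) (hs : IsClassicalSolution Ω u) : ContinuousOn (cg u) (posSet Ω u) :=
  (har_pos hΩ hs).hol.continuousOn

lemma ibp_three (hΩ : IsOpen Ω) (hs : IsClassicalSolution Ω u) {η g : ℂ → ℂ} {b : ℝ → ℝ} {ε : ℝ}
    (hε : 0 < ε) (hη : ContDiff ℝ 1 η) (hηc : HasCompactSupport η) (hηs : tsupport η ⊆ Ω)
    (hb : ContDiff ℝ 1 b) (hb0 : ∀ t ≤ ε, b t = 0) (hb1 : ∀ t ≤ ε, deriv b t = 0)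
    (hg : DifferentiableOn ℂ g (posSet Ω u)) (v : ℂ) :
    (∫ z, fderiv ℝ η z v * b (u z) * g z)
      + (∫ z, η z * (deriv b (u z)) * ((cg u z * v).re * g z))
      + (∫ z, η z * b (u z) * deriv g z) * v = 0 := by
  have h := ibp_aux hΩ hs hε hη hηc hηs hb hb0 hb1 hg v
  have hgc := hg.continuousOn
  have hgd : ContinuousOn (deriv g) (posSet Ω u) :=
    (hg.deriv (posSet_open hΩ hs)).continuousOn
  have i1 := glue_integrable hΩ hs (η := fun z => fderiv ℝ η z v) hε
    ((hη.continuous_fderiv (by norm_num)).clm_apply continuous_const)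
    (hηc.fderiv_apply (𝕜 := ℝ) v) ((tsupport_fderiv_apply η v).trans hηs) hb.continuous hb0 hgc
  have i2 := glue_integrable hΩ hs hε hη.continuous hηc hηs
    (hb.continuous_deriv (by norm_num)) hb1 (g := fun z => ((cg u z * v).re * g z))
    ((continuous_ofReal.comp_continuousOn (continuous_re.comp_continuousOn
      ((cg_cont hΩ hs).mul continuousOn_const))).mul hgc)
  have i3 := glue_integrable hΩ hs hε hη.continuous hηc hηs hb.continuous hb0
    (g := fun z => deriv g z * v) (hgd.mul continuousOn_const)
  have i12 := i1.add i2
  rw [integral_add (by exact i12) i3, integral_add i1 i2] at h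
  rw [← h]; congr 1
  rw [← integral_mul_const]; congr 1; ext z; ring

/-- main identity with `∂̄`. -/
lemma ibp_dbar (hΩ : IsOpen Ω) (hs : IsClassicalSolution Ω u) {η g : ℂ → ℂ} {b : ℝ → ℝ} {ε : ℝ}
    (hε : 0 < ε) (hη : ContDiff ℝ 1 η) (hηc : HasCompactSupport η) (hηs : tsupport η ⊆ Ω)
    (hb : ContDiff ℝ 1 b) (hb0 : ∀ t ≤ ε, b t = 0) (hb1 : ∀ t ≤ ε, deriv b t = 0)
    (hg : DifferentiableOn ℂ g (posSet Ω u)) :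
    (∫ z, dbar2 η z * b (u z) * g z) =
      - ∫ z, η z * (deriv b (u z)) * (conj (cg u z) * g z) := by
  have h1 := ibp_three hΩ hs hε hη hηc hηs hb hb0 hb1 hg 1
  have h2 := ibp_three hΩ hs hε hη hηc hηs hb hb0 hb1 hg I
  have hgc := hg.continuousOn
  have i1 := fun v => glue_integrable hΩ hs (η := fun z => fderiv ℝ η z v) hε
    ((hη.continuous_fderiv (by norm_num)).clm_apply continuous_const)
    (hηc.fderiv_apply (𝕜 := ℝ) v) ((tsupport_fderiv_apply η v).trans hηs) hb.continuous hb0 hgc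
  have i2 := fun v => glue_integrable hΩ hs hε hη.continuous hηc hηs
    (hb.continuous_deriv (by norm_num)) hb1 (g := fun z => ((cg u z * v).re * g z))
    ((continuous_ofReal.comp_continuousOn (continuous_re.comp_continuousOn
      ((cg_cont hΩ hs).mul continuousOn_const))).mul hgc)
  have e1 : (∫ z, dbar2 η z * b (u z) * g z) = (∫ z, fderiv ℝ η z 1 * b (u z) * g z)
      + I * ∫ z, fderiv ℝ η z I * b (u z) * g z := by
    rw [← integral_const_mul, ← integral_add (i1 1) ((i1 I).const_mul I)]
    congr 1; ext z; simp only [dbar2]; ring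
  have e2 : (∫ z, η z * (deriv b (u z)) * (conj (cg u z) * g z))
      = (∫ z, η z * (deriv b (u z)) * ((cg u z * 1).re * g z))
        + I * ∫ z, η z * (deriv b (u z)) * ((cg u z * I).re * g z) := by
    rw [← integral_const_mul, ← integral_add (i2 1) ((i2 I).const_mul I)]
    congr 1; ext z
    have : conj (cg u z) = ((cg u z * 1).re : ℂ) + I * ((cg u z * I).re : ℂ) := by
      apply Complex.ext <;> simp
    rw [this]; ring
  rw [e1, e2]
  linear_combination h1 + I * h2 - (∫ z, η z * b (u z) * deriv g z) * I_sq

lemma ibp_d (hΩ : IsOpen Ω) (hs : IsClassicalSolution Ω u) {η : ℂ → ℂ} {b : ℝ → ℝ} {ε : ℝ}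
    (hε : 0 < ε) (hη : ContDiff ℝ 1 η) (hηc : HasCompactSupport η) (hηs : tsupport η ⊆ Ω)
    (hb : ContDiff ℝ 1 b) (hb0 : ∀ t ≤ ε, b t = 0) (hb1 : ∀ t ≤ ε, deriv b t = 0) :
    (∫ z, d2 η z * b (u z) * 1) =
      - ∫ z, η z * (deriv b (u z)) * cg u z := by
  have hg : DifferentiableOn ℂ (fun _ : ℂ => (1:ℂ)) (posSet Ω u) := by fun_prop
  have h1 := ibp_three hΩ hs hε hη hηc hηs hb hb0 hb1 hg 1
  have h2 := ibp_three hΩ hs hε hη hηc hηs hb hb0 hb1 hg I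
  have hgc := hg.continuousOn
  have i1 := fun v => glue_integrable hΩ hs (η := fun z => fderiv ℝ η z v) hε
    ((hη.continuous_fderiv (by norm_num)).clm_apply continuous_const)
    (hηc.fderiv_apply (𝕜 := ℝ) v) ((tsupport_fderiv_apply η v).trans hηs) hb.continuous hb0 hgc
  have i2 := fun v => glue_integrable hΩ hs hε hη.continuous hηc hηs
    (hb.continuous_deriv (by norm_num)) hb1 (g := fun z => ((cg u z * v).re * 1))
    ((continuous_ofReal.comp_continuousOn (continuous_re.comp_continuousOn
      ((cg_cont hΩ hs).mul continuousOn_const))).mul hgc)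
  have e1 : (∫ z, d2 η z * b (u z) * 1) = (∫ z, fderiv ℝ η z 1 * b (u z) * 1)
      - I * ∫ z, fderiv ℝ η z I * b (u z) * 1 := by
    rw [← integral_const_mul, ← integral_sub (i1 1) ((i1 I).const_mul I)]
    congr 1; ext z; simp only [d2]; ring
  have e2 : (∫ z, η z * (deriv b (u z)) * cg u z)
      = (∫ z, η z * (deriv b (u z)) * ((cg u z * 1).re * 1))
        - I * ∫ z, η z * (deriv b (u z)) * ((cg u z * I).re * 1) := by
    rw [← integral_const_mul, ← integral_sub (i2 1) ((i2 I).const_mul I)]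
    congr 1; ext z
    have : cg u z = ((cg u z * 1).re : ℂ) - I * ((cg u z * I).re : ℂ) := by
      apply Complex.ext <;> simp
    conv_lhs => rw [this]
    ring
  rw [e1, e2]
  simp only [deriv_const', mul_zero, integral_zero, zero_mul, add_zero] at h1 h2
  linear_combination h1 - I * h2

end level

end OP

namespace OP

section level
variable {Ω : Set ℂ} {u : ℂ → ℝ}

lemma gradclose (hΩ : IsOpen Ω) (hs : IsClassicalSolution Ω u) {K : Set ℂ} (hK : IsCompact K)
    (hKΩ : K ⊆ Ω) {τ : ℝ} (hτ : 0 < τ) :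
    ∃ ε0 > 0, ∀ z ∈ K, 0 < u z → u z < ε0 → |‖cg u z‖ - 1| < τ := by
  by_contra! hcon
  choose z hzK hz0 hz1 hz2 using fun n : ℕ => hcon (1 / ((n:ℝ) + 1)) (by positivity)
  obtain ⟨w, hwK, ψ, hψ, hlim⟩ := hK.tendsto_subseq hzK
  have hwΩ := hKΩ hwK
  have hu : ContinuousAt u w := hs.contOn.continuousAt (hΩ.mem_nhds hwΩ)
  have h1 : Tendsto (fun n => u (z (ψ n))) atTop (𝓝 (u w)) := hu.tendsto.comp hlim
  have h2 : Tendsto (fun n => u (z (ψ n))) atTop (𝓝 0) := by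
    refine squeeze_zero (fun n => (hz0 _).le) (fun n => (hz1 (ψ n)).le) ?_
    exact tendsto_one_div_add_atTop_nhds_zero_nat.comp hψ.tendsto_atTop
  have hw0 : u w = 0 := tendsto_nhds_unique h1 h2
  have hmem : ∀ n, z (ψ n) ∈ posSet Ω u := fun n => ⟨hKΩ (hzK _), hz0 _⟩
  have hlim' : Tendsto (fun n => z (ψ n)) atTop (𝓝[posSet Ω u] w) :=
    tendsto_nhdsWithin_iff.2 ⟨hlim, Eventually.of_forall hmem⟩
  have hF : w ∈ FB Ω u := (mem_FB_iff hΩ hs).2 ⟨hwΩ, hw0,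
    mem_closure_of_tendsto hlim (Eventually.of_forall hmem)⟩
  have h3 := (hs.grad_one w hF).comp hlim'
  have h4 := (Metric.tendsto_nhds.1 h3 τ hτ).exists
  obtain ⟨n, hn⟩ := h4
  simp only [Function.comp, norm_grad2, Real.dist_eq] at hn
  exact absurd (hz2 (ψ n)) (not_le.2 hn)

lemma dbar2_contDiff {η : ℂ → ℂ} {n : ℕ} (hη : ContDiff ℝ (n+1) η) : ContDiff ℝ n (dbar2 η) := by
  have h := hη.fderiv_right (m := n) le_rfl
  exact (h.clm_apply contDiff_const).add (contDiff_const.mul (h.clm_apply contDiff_const))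

lemma d2_contDiff {η : ℂ → ℂ} {n : ℕ} (hη : ContDiff ℝ (n+1) η) : ContDiff ℝ n (d2 η) := by
  have h := hη.fderiv_right (m := n) le_rfl
  exact (h.clm_apply contDiff_const).sub (contDiff_const.mul (h.clm_apply contDiff_const))

lemma fderiv_zero_off {η : ℂ → ℂ} {z : ℂ} (hz : z ∉ tsupport η) : fderiv ℝ η z = 0 := by
  have : η =ᶠ[𝓝 z] fun _ => 0 := by
    filter_upwards [(isClosed_tsupport η).isOpen_compl.mem_nhds hz] with w hw
    simp [image_eq_zero_of_notMem_tsupport hw]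
  rw [this.fderiv_eq]; simp

lemma dbar2_off {η : ℂ → ℂ} {z : ℂ} (hz : z ∉ tsupport η) : dbar2 η z = 0 := by
  simp [dbar2, fderiv_zero_off hz]
lemma d2_off {η : ℂ → ℂ} {z : ℂ} (hz : z ∉ tsupport η) : d2 η z = 0 := by
  simp [d2, fderiv_zero_off hz]

lemma dbar2_tsupport (η : ℂ → ℂ) : tsupport (dbar2 η) ⊆ tsupport η :=
  closure_minimal (fun z hz => by by_contra h; exact hz (dbar2_off h)) (isClosed_tsupport η)
lemma d2_tsupport (η : ℂ → ℂ) : tsupport (d2 η) ⊆ tsupport η :=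
  closure_minimal (fun z hz => by by_contra h; exact hz (d2_off h)) (isClosed_tsupport η)

lemma energy_id (hΩ : IsOpen Ω) (hs : IsClassicalSolution Ω u) {η : ℂ → ℂ} {ε : ℝ}
    (hε : 0 < ε) (hη : ContDiff ℝ 2 η) (hηc : HasCompactSupport η) (hηs : tsupport η ⊆ Ω) :
    (∫ z, η z * (deriv (bt ε) (u z)) * (conj (cg u z) * cg u z)) =
      ∫ z, d2 (dbar2 η) z * Bt ε (u z) * 1 := by
  have hη1 : ContDiff ℝ 1 η := hη.of_le (by norm_num)
  have hη' : ContDiff ℝ ((1:ℕ)+1) η := hη.of_le (by norm_num)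
  have h1 := ibp_dbar hΩ hs hε hη1 hηc hηs (bt_contDiff ε) (fun t => bt_zero hε)
    (fun t => bt_deriv_zero hε) (har_pos hΩ hs).hol
  have hd : deriv (Bt ε) = bt ε := funext fun t => (Bt_deriv ε t).deriv
  have h2 := ibp_d hΩ hs hε (η := dbar2 η) (by simpa using dbar2_contDiff hη')
    (hηc.of_isClosed_subset (isClosed_tsupport _) (dbar2_tsupport η))
    ((dbar2_tsupport η).trans hηs) (Bt_contDiff ε) (fun t => Bt_zero hε)
    (fun t ht => by rw [hd]; exact bt_zero hε ht)
  rw [hd] at h2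
  rw [h2, h1]; simp

lemma energy_le (hΩ : IsOpen Ω) (hs : IsClassicalSolution Ω u) {ρ : ℂ → ℝ} {ε M : ℝ}
    (hε : 0 < ε) (hρ : ContDiff ℝ 2 (fun z => (ρ z : ℂ)))
    (hηc : HasCompactSupport (fun z => (ρ z : ℂ))) (hηs : tsupport (fun z => (ρ z : ℂ)) ⊆ Ω)
    (hM : ∀ z ∈ tsupport (fun z => (ρ z : ℂ)), u z ≤ M) :
    Integrable (fun z => ρ z * deriv (bt ε) (u z) * ‖cg u z‖ ^ 2) ∧
    ∫ z, ρ z * deriv (bt ε) (u z) * ‖cg u z‖ ^ 2 ≤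
      M * ∫ z, ‖d2 (dbar2 (fun z => (ρ z : ℂ))) z‖ := by
  set η : ℂ → ℂ := fun z => (ρ z : ℂ) with hη
  have hid := energy_id hΩ hs hε hρ hηc hηs
  have hpt : ∀ z, η z * (deriv (bt ε) (u z)) * (conj (cg u z) * cg u z) =
      ((ρ z * deriv (bt ε) (u z) * ‖cg u z‖ ^ 2 : ℝ) : ℂ) := by
    intro z
    rw [hη, ← normSq_eq_conj_mul_self, normSq_eq_norm_sq]; push_cast; ring
  have hint : Integrable (fun z => η z * (deriv (bt ε) (u z)) * (conj (cg u z) * cg u z)) :=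
    glue_integrable hΩ hs hε hρ.continuous hηc hηs ((bt_contDiff ε).continuous_deriv (by norm_num))
      (fun t => bt_deriv_zero hε)
      ((continuous_conj.comp_continuousOn (cg_cont hΩ hs)).mul (cg_cont hΩ hs))
  simp_rw [hpt] at hid hint
  have hint' : Integrable (fun z => ρ z * deriv (bt ε) (u z) * ‖cg u z‖ ^ 2) := by
    exact hint.re
  refine ⟨hint', ?_⟩
  rw [integral_complex_ofReal] at hid
  have h1 : ∫ z, ρ z * deriv (bt ε) (u z) * ‖cg u z‖ ^ 2 ≤
      ‖∫ z, d2 (dbar2 η) z * Bt ε (u z) * 1‖ := by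
    rw [← hid]; simp only [norm_real, Real.norm_eq_abs]; exact le_abs_self _
  refine h1.trans ?_
  rw [← integral_const_mul]
  have hD : Continuous (d2 (dbar2 η)) := by
    have : ContDiff ℝ ((0:ℕ)+1) (dbar2 η) :=
      (dbar2_contDiff (n := 1) (by simpa [one_add_one_eq_two] using hρ)).of_le (by norm_num)
    exact (d2_contDiff this).continuous
  have hDc : HasCompactSupport (d2 (dbar2 η)) :=
    hηc.of_isClosed_subset (isClosed_tsupport _) ((d2_tsupport _).trans (dbar2_tsupport η))
  refine norm_integral_le_of_norm_le ((hD.integrable_of_hasCompactSupport hDc).norm.const_mul M) ?_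
  refine Eventually.of_forall fun z => ?_
  by_cases hz : z ∈ tsupport η
  · have h0 := hs.nonneg z (hηs hz)
    have := Bt_bounds (ε := ε) h0
    simp only [mul_one, norm_mul, norm_real, Real.norm_eq_abs, abs_of_nonneg this.1]
    rw [mul_comm]
    gcongr
    exact this.2.trans (hM z hz)
  · have : d2 (dbar2 η) z = 0 := d2_off fun h => hz (dbar2_tsupport η h)
    simp [this]

/-- the coefficients of the closed form, cut off to a ball -/
noncomputable def Af (u : ℂ → ℝ) (R : ℝ) (z : ℂ) : ℂ :=
  (posSet (ball 0 (R/4)) u).indicator (fun z => cg u z ^ 2) z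
noncomputable def Bf (u : ℂ → ℝ) (R : ℝ) (z : ℂ) : ℂ :=
  (posSet (ball 0 (R/4)) u).indicator (fun _ => 1) z

variable {R : ℝ}

lemma pos4 (hR : 0 < R) : posSet (ball 0 (R/4)) u ⊆ posSet (ball 0 R) u := fun z hz =>
  ⟨ball_subset_ball (by linarith) hz.1, hz.2⟩

lemma pos4_open (hs : IsClassicalSolution (ball 0 R) u) (hR : 0 < R) :
    IsOpen (posSet (ball 0 (R/4)) u) := by
  have : posSet (ball 0 (R/4)) u = posSet (ball 0 R) u ∩ ball 0 (R/4) := by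
    ext z; constructor
    · exact fun h => ⟨pos4 hR h, h.1⟩
    · exact fun h => ⟨h.2, h.1.2⟩
  rw [this]; exact (posSet_open isOpen_ball hs).inter isOpen_ball

lemma Af_meas (hs : IsClassicalSolution (ball 0 R) u) (hR : 0 < R) :
    AEStronglyMeasurable (Af u R) := by
  have ho := pos4_open hs hR
  unfold Af
  refine (aestronglyMeasurable_indicator_iff ho.measurableSet).2 ?_
  exact (((cg_cont isOpen_ball hs).mono (pos4 hR)).pow 2).aestronglyMeasurable ho.measurableSet

lemma Bf_meas (hs : IsClassicalSolution (ball 0 R) u) (hR : 0 < R) :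
    AEStronglyMeasurable (Bf u R) := by
  have ho := pos4_open hs hR
  exact (aestronglyMeasurable_indicator_iff ho.measurableSet).2 aestronglyMeasurable_const

lemma Af_le (hs : IsClassicalSolution (ball 0 R) u) (h0 : (0:ℂ) ∈ FB (ball 0 R) u) (z : ℂ) :
    ‖Af u R z‖ ≤ 16 := by
  unfold Af
  by_cases h : z ∈ posSet (ball 0 (R/4)) u
  · rw [indicator_of_mem h, norm_pow]
    have := cg_le_four hs h0 (z := z) (by simpa using h.1) h.2
    nlinarith [norm_nonneg (cg u z)]
  · rw [indicator_of_notMem h]; simp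

lemma Bf_le (z : ℂ) : ‖Bf u R z‖ ≤ 1 := by
  unfold Bf
  by_cases h : z ∈ posSet (ball 0 (R/4)) u
  · rw [indicator_of_mem h]; simp
  · rw [indicator_of_notMem h]; simp

lemma R_pos (h0 : (0:ℂ) ∈ FB (ball 0 R) u) : 0 < R := by simpa using h0.1

/-- weak closedness of the form -/
lemma weak_closed (hs : IsClassicalSolution (ball 0 R) u) (h0 : (0:ℂ) ∈ FB (ball 0 R) u)
    {ρ : ℂ → ℝ} (hρ0 : ∀ z, 0 ≤ ρ z) (hρ : ContDiff ℝ 2 (fun z => (ρ z : ℂ)))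
    (hηc : HasCompactSupport (fun z => (ρ z : ℂ)))
    (hηs : tsupport (fun z => (ρ z : ℂ)) ⊆ ball 0 (R/4)) :
    ∫ z, (dbar2 (fun z => (ρ z : ℂ)) z * Af u R z - d2 (fun z => (ρ z : ℂ)) z * Bf u R z) = 0 := by
  set η : ℂ → ℂ := fun z => (ρ z : ℂ) with hη
  have hR := R_pos h0
  have hηΩ : tsupport η ⊆ ball 0 R := hηs.trans (ball_subset_ball (by linarith))
  have hη1 : ContDiff ℝ 1 η := hρ.of_le (by norm_num)
  have hΩ : IsOpen (ball (0:ℂ) R) := isOpen_ball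
  obtain ⟨M, hM⟩ : ∃ M, ∀ z ∈ tsupport η, u z ≤ M := by
    obtain ⟨M, hM⟩ := (hηc.image_of_continuousOn (hs.contOn.mono hηΩ)).bddAbove
    exact ⟨M, fun z hz => hM (mem_image_of_mem u hz)⟩
  set C := M * ∫ z, ‖d2 (dbar2 η) z‖ with hC
  -- integrals with cutoff
  have hcut : ∀ ε > 0, (∫ z, (bt ε (u z) : ℂ) * (dbar2 η z * Af u R z - d2 η z * Bf u R z)) =
      - ∫ z, η z * deriv (bt ε) (u z) * (cg u z * (((‖cg u z‖ ^ 2 - 1 : ℝ)) : ℂ)) := by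
    intro ε hε
    have hf2 : DifferentiableOn ℂ (fun z => cg u z ^ 2) (posSet (ball 0 R) u) :=
      (har_pos hΩ hs).hol.pow 2
    have h1 := ibp_dbar hΩ hs hε hη1 hηc hηΩ (bt_contDiff ε) (fun t => bt_zero hε)
      (fun t => bt_deriv_zero hε) hf2
    have h2 := ibp_d hΩ hs hε hη1 hηc hηΩ (bt_contDiff ε) (fun t => bt_zero hε)
      (fun t => bt_deriv_zero hε)
    have hη1' : ContDiff ℝ ((0:ℕ)+1) η := by simpa using hη1
    have i1 := glue_integrable hΩ hs hε (dbar2_contDiff hη1').continuous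
      (hηc.of_isClosed_subset (isClosed_tsupport _) (dbar2_tsupport η))
      ((dbar2_tsupport η).trans hηΩ) (bt_contDiff ε).continuous (fun t => bt_zero hε)
      hf2.continuousOn
    have i2 := glue_integrable hΩ hs hε (d2_contDiff hη1').continuous
      (hηc.of_isClosed_subset (isClosed_tsupport _) (d2_tsupport η))
      ((d2_tsupport η).trans hηΩ) (bt_contDiff ε).continuous (fun t => bt_zero hε)
      (continuousOn_const (c := (1:ℂ)))
    have i3 := glue_integrable hΩ hs hε hη1.continuous hηc hηΩ
      ((bt_contDiff ε).continuous_deriv (by norm_num)) (fun t => bt_deriv_zero hε)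
      ((continuous_conj.comp_continuousOn (cg_cont hΩ hs)).mul hf2.continuousOn)
    have i4 := glue_integrable hΩ hs hε hη1.continuous hηc hηΩ
      ((bt_contDiff ε).continuous_deriv (by norm_num)) (fun t => bt_deriv_zero hε)
      (cg_cont hΩ hs)
    have e1 : (∫ z, (bt ε (u z) : ℂ) * (dbar2 η z * Af u R z - d2 η z * Bf u R z)) =
        (∫ z, dbar2 η z * bt ε (u z) * cg u z ^ 2) - ∫ z, d2 η z * bt ε (u z) * 1 := by
      rw [← integral_sub i1 i2]
      congr 1; ext z
      by_cases hz : z ∈ tsupport η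
      · by_cases hp : 0 < u z
        · have : z ∈ posSet (ball 0 (R/4)) u := ⟨hηs hz, hp⟩
          simp only [Af, Bf, indicator_of_mem this]; ring
        · rw [bt_zero hε (by linarith)]; simp
      · rw [dbar2_off hz, d2_off hz]; simp
    rw [e1, h1, h2, neg_sub_neg, ← integral_sub i4 (by exact i3), ← integral_neg]
    congr 1; ext z
    have : conj (cg u z) * (cg u z)^2 = cg u z * ((‖cg u z‖^2 : ℝ) : ℂ) := by
      rw [← normSq_eq_norm_sq, normSq_eq_conj_mul_self]; ring
    rw [this]; push_cast; ring
  set e : ℕ → ℝ := fun n => 1 / ((n:ℝ)+1) with he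
  have hepos : ∀ n, 0 < e n := fun n => by positivity
  have he0 : Tendsto e atTop (𝓝 0) := tendsto_one_div_add_atTop_nhds_zero_nat
  have hη1' : ContDiff ℝ ((0:ℕ)+1) η := by simpa using hη1
  have L1 : Tendsto (fun n => ∫ z, (bt (e n) (u z) : ℂ) * (dbar2 η z * Af u R z - d2 η z * Bf u R z))
      atTop (𝓝 (∫ z, (dbar2 η z * Af u R z - d2 η z * Bf u R z))) := by
    have hb1 := ((dbar2_contDiff hη1').continuous.integrable_of_hasCompactSupport (μ := volume)
      (hηc.of_isClosed_subset (isClosed_tsupport _) (dbar2_tsupport η))).norm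
    have hb2 := ((d2_contDiff hη1').continuous.integrable_of_hasCompactSupport (μ := volume)
      (hηc.of_isClosed_subset (isClosed_tsupport _) (d2_tsupport η))).norm
    have hmm : AEStronglyMeasurable (fun z => dbar2 η z * Af u R z - d2 η z * Bf u R z) :=
      ((dbar2_contDiff hη1').continuous.aestronglyMeasurable.mul (Af_meas hs hR)).sub
        ((d2_contDiff hη1').continuous.aestronglyMeasurable.mul (Bf_meas hs hR))
    refine tendsto_integral_of_dominated_convergence (fun z => ‖dbar2 η z‖ * 16 + ‖d2 η z‖ * 1) ?_
      ((hb1.mul_const _).add (hb2.mul_const _)) ?_ ?_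
    · intro n
      have ho := pos4_open hs hR
      have hsupp : (fun z => (bt (e n) (u z) : ℂ) * (dbar2 η z * Af u R z - d2 η z * Bf u R z)) =
          (posSet (ball 0 (R/4)) u).indicator (fun z => (bt (e n) (u z) : ℂ) * (dbar2 η z * Af u R z - d2 η z * Bf u R z)) := by
        ext z
        by_cases h : z ∈ posSet (ball 0 (R/4)) u
        · rw [indicator_of_mem h]
        · rw [indicator_of_notMem h]; simp [Af, Bf, indicator_of_notMem h]
      rw [hsupp, aestronglyMeasurable_indicator_iff ho.measurableSet]
      refine AEStronglyMeasurable.mul ?_ hmm.restrict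
      refine ContinuousOn.aestronglyMeasurable ?_ ho.measurableSet
      exact continuous_ofReal.comp_continuousOn ((bt_contDiff _).continuous.comp_continuousOn
        (hs.contOn.mono fun z hz => (pos4 hR hz).1))
    · intro n
      refine Eventually.of_forall fun z => ?_
      rw [norm_mul]
      have h1 : ‖(bt (e n) (u z) : ℂ)‖ ≤ 1 := by
        rw [norm_real, Real.norm_eq_abs, abs_of_nonneg (bt_nonneg _ _)]; exact bt_le_one _ _
      calc _ ≤ 1 * ‖dbar2 η z * Af u R z - d2 η z * Bf u R z‖ := by gcongr
        _ ≤ ‖dbar2 η z * Af u R z‖ + ‖d2 η z * Bf u R z‖ := by rw [one_mul]; exact norm_sub_le _ _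
        _ ≤ _ := by
          rw [norm_mul, norm_mul]
          gcongr
          · exact Af_le hs h0 z
          · exact Bf_le z
    · refine Eventually.of_forall fun z => ?_
      by_cases h : z ∈ posSet (ball 0 (R/4)) u
      · refine tendsto_const_nhds.congr' ?_
        filter_upwards [he0.eventually (gt_mem_nhds (show 0 < u z / 2 by have := h.2; linarith))] with n hn
        rw [bt_one (hepos n) (by linarith)]; simp
      · simp [Af, Bf, indicator_of_notMem h]
  have L2 : Tendsto (fun n => ∫ z, (bt (e n) (u z) : ℂ) * (dbar2 η z * Af u R z - d2 η z * Bf u R z))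
      atTop (𝓝 0) := by
    rw [Metric.tendsto_nhds]
    intro κ hκ
    set τ : ℝ := min (1/2) (κ / (10 * (|C| + 1))) with hτ
    have hτ0 : 0 < τ := by positivity
    obtain ⟨ε0, hε0, hg⟩ := gradclose hΩ hs hηc hηΩ hτ0
    filter_upwards [he0.eventually (gt_mem_nhds (show 0 < ε0 / 2 by linarith))] with n hn
    rw [hcut (e n) (hepos n), dist_zero_right, norm_neg]
    obtain ⟨hi, hle⟩ := energy_le hΩ hs (hepos n) hρ hηc hηΩ hM
    have : ‖∫ z, η z * deriv (bt (e n)) (u z) * (cg u z * (((‖cg u z‖ ^ 2 - 1 : ℝ)) : ℂ))‖ ≤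
        ∫ z, (5 * τ) * (ρ z * deriv (bt (e n)) (u z) * ‖cg u z‖ ^ 2) := by
      refine norm_integral_le_of_norm_le (hi.const_mul _) (Eventually.of_forall fun z => ?_)
      have hb := bt_deriv_nonneg (hepos n) (u z)
      simp only [norm_mul, norm_real, Real.norm_eq_abs, hη, abs_of_nonneg (hρ0 z), abs_of_nonneg hb]
      by_cases hz : z ∈ tsupport η
      · by_cases h1 : u z ≤ e n
        · rw [bt_deriv_zero (hepos n) h1]; simp
        by_cases h2 : 2 * e n < u z
        · rw [bt_deriv_zero' (hepos n) h2]; simp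
        push Not at h1 h2
        have hgz := hg z hz (by linarith [hepos n]) (by linarith)
        have hτ2 : τ ≤ 1/2 := min_le_left _ _
        set x := ‖cg u z‖
        obtain ⟨ha, hb'⟩ := abs_lt.1 hgz
        have hx : |x^2-1| ≤ τ * (5/2) := by
          have : x^2-1 = (x-1)*(x+1) := by ring
          rw [this, abs_mul]
          have : |x+1| ≤ 5/2 := by rw [abs_le]; constructor <;> linarith
          gcongr
        have hx2 : x ≤ 2 * x^2 := by nlinarith
        calc ρ z * deriv (bt (e n)) (u z) * (x * |x^2-1|)
            ≤ ρ z * deriv (bt (e n)) (u z) * ((2*x^2) * (τ * (5/2))) := by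
              have := mul_nonneg (hρ0 z) hb
              gcongr
          _ = _ := by ring
      · have : ρ z = 0 := by
          have := image_eq_zero_of_notMem_tsupport hz
          simpa [hη] using this
        simp [this]
    refine this.trans_lt ?_
    rw [integral_const_mul]
    have hCC : (∫ z, ρ z * deriv (bt (e n)) (u z) * ‖cg u z‖ ^ 2) ≤ |C| + 1 :=
      hle.trans ((le_abs_self C).trans (by linarith))
    calc _ ≤ 5 * τ * (|C| + 1) := by gcongr
      _ ≤ 5 * (κ / (10 * (|C| + 1))) * (|C|+1) := by gcongr; exact min_le_right _ _
      _ = κ / 2 := by field_simp; ring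
      _ < κ := by linarith
  exact tendsto_nhds_unique L1 L2

end level

end OP

namespace OP
open scoped Convolution

/-- the real-linear map `v ↦ a v + b conj v`. -/
noncomputable def om (a b : ℂ) : ℂ →L[ℝ] ℂ :=
  ContinuousLinearMap.mul ℝ ℂ a + (ContinuousLinearMap.mul ℝ ℂ b).comp (conjCLE : ℂ →L[ℝ] ℂ)

@[simp] lemma om_apply (a b v : ℂ) : om a b v = a * v + b * conj v := by
  simp [om]

lemma om_sub (a b a' b' : ℂ) : om a b - om a' b' = om (a - a') (b - b') := by
  ext v <;> simp <;> ring

lemma norm_om_le (a b : ℂ) : ‖om a b‖ ≤ ‖a‖ + ‖b‖ := by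
  refine ContinuousLinearMap.opNorm_le_bound _ (by positivity) fun v => ?_
  rw [om_apply, add_mul]
  refine (norm_add_le _ _).trans ?_
  simp [norm_mul]

lemma om_zero : om 0 0 = 0 := by ext v <;> simp

/-- closed form gives a primitive -/
lemma om_primitive {s : Set ℂ} (hs : Convex ℝ s) (hso : IsOpen s) {A B : ℂ → ℂ}
    (hA : ∀ z ∈ s, DifferentiableAt ℝ A z) (hB : ∀ z ∈ s, DifferentiableAt ℝ B z)
    (hcl : ∀ z ∈ s, dbar2 A z = d2 B z) :
    ∃ Y : ℂ → ℂ, ∀ z ∈ s, HasFDerivAt Y (om (A z) (B z)) z := by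
  have hd : ∀ z ∈ s, DifferentiableAt ℝ (fun z => om (A z) (B z)) z := by
    intro z hz
    have h1 := hA z hz
    have h2 := hB z hz
    have h3 : DifferentiableAt ℝ (fun z => ContinuousLinearMap.mul ℝ ℂ (A z)) z :=
      (ContinuousLinearMap.mul ℝ ℂ).differentiableAt.comp z h1
    have h4 : DifferentiableAt ℝ (fun z => ContinuousLinearMap.mul ℝ ℂ (B z)) z :=
      (ContinuousLinearMap.mul ℝ ℂ).differentiableAt.comp z h2
    exact h3.add (h4.clm_comp (differentiableAt_const _))
  refine hs.exists_forall_hasFDerivAt_of_fderiv_symmetric hso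
    (fun z hz => (hd z hz).differentiableWithinAt) ?_
  intro z hz x y
  have key : ∀ x y, fderiv ℝ (fun z => om (A z) (B z)) z x y =
      fderiv ℝ A z x * y + fderiv ℝ B z x * conj y := by
    intro x y
    have h1 : HasFDerivAt (fun z => om (A z) (B z) y)
        ((ContinuousLinearMap.apply ℝ ℂ y).comp (fderiv ℝ (fun z => om (A z) (B z)) z)) z :=
      (ContinuousLinearMap.apply ℝ ℂ y).hasFDerivAt.comp z (hd z hz).hasFDerivAt
    have h2 : HasFDerivAt (fun z => om (A z) (B z) y)
        ((fderiv ℝ A z).smulRight y + (fderiv ℝ B z).smulRight (conj y)) z := by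
      simp only [om_apply]
      refine HasFDerivAt.add ?_ ?_
      · exact ((hA z hz).hasFDerivAt.mul_const y).congr_fderiv (by
          apply ContinuousLinearMap.ext; intro v; simp [mul_comm])
      · exact ((hB z hz).hasFDerivAt.mul_const _).congr_fderiv (by
          apply ContinuousLinearMap.ext; intro v; simp [mul_comm])
    have := DFunLike.congr_fun (h1.unique h2) x
    simpa using this
  rw [key, key]
  have lin : ∀ (T : ℂ →L[ℝ] ℂ) (x : ℂ), T x = x.re * T 1 + x.im * T I := by
    intro T x
    have : x = x.re • (1:ℂ) + x.im • I := by simp [Complex.re_add_im]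
    conv_lhs => rw [this]
    rw [map_add, map_smul, map_smul]; simp
  rw [lin _ x, lin (fderiv ℝ B z) x, lin _ y, lin (fderiv ℝ B z) y]
  have h := hcl z hz
  simp only [dbar2, d2] at h
  have e1 : ∀ x : ℂ, conj x = x.re - x.im * I := by
    intro x; apply Complex.ext <;> simp
  have e2 : ∀ x : ℂ, x = x.re + x.im * I := fun x => (re_add_im x).symm
  rw [e1 x, e1 y]
  generalize hx1 : (x.re : ℂ) = xr at *
  generalize hx2 : (x.im : ℂ) = xi at *
  generalize hy1 : (y.re : ℂ) = yr at *
  generalize hy2 : (y.im : ℂ) = yi at *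
  have ex : x = xr + xi * I := by rw [← hx1, ← hx2]; exact e2 x
  have ey : y = yr + yi * I := by rw [← hy1, ← hy2]; exact e2 y
  rw [ex, ey]
  linear_combination (xr * yi - yr * xi) * I * h - (xr * yi - yr * xi) * (fderiv ℝ A z I + fderiv ℝ B z I) * I_sq

noncomputable def bump (δ : ℝ) (hδ : 0 < δ) : ContDiffBump (0:ℂ) := ⟨δ/2, δ, by linarith, by linarith⟩

noncomputable def moll (δ : ℝ) (hδ : 0 < δ) (A : ℂ → ℂ) : ℂ → ℂ :=
  ((bump δ hδ).normed volume) ⋆[ContinuousLinearMap.lsmul ℝ ℝ, volume] A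

lemma moll_dist {δ : ℝ} (hδ : 0 < δ) {A : ℂ → ℂ} (hA : AEStronglyMeasurable A) {z w : ℂ} {ε : ℝ}
    (hε : 0 ≤ ε) (h : ∀ x ∈ ball z δ, dist (A x) w ≤ ε) : dist (moll δ hδ A z) w ≤ ε := by
  refine dist_convolution_le (R := δ) hε ?_ (bump δ hδ).nonneg_normed (bump δ hδ).integral_normed hA h
  rw [(bump δ hδ).support_normed_eq]; rfl

lemma moll_fderiv {δ : ℝ} (hδ : 0 < δ) {A : ℂ → ℂ} (hA : Integrable A) (z : ℂ) :
    DifferentiableAt ℝ (moll δ hδ A) z ∧ ∀ v, fderiv ℝ (moll δ hδ A) z v =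
      ∫ t, fderiv ℝ ((bump δ hδ).normed volume) (z - t) v • A t := by
  set φ := (bump δ hδ).normed volume with hφ
  have hcd : ContDiff ℝ 1 φ := (bump δ hδ).contDiff_normed
  have hcs : HasCompactSupport φ := (bump δ hδ).hasCompactSupport_normed
  have h := hcs.hasFDerivAt_convolution_left (ContinuousLinearMap.lsmul ℝ ℝ) (μ := volume)
    hcd hA.locallyIntegrable z
  refine ⟨h.differentiableAt, fun v => ?_⟩
  have h' : fderiv ℝ (moll δ hδ A) z = _ := h.fderiv
  rw [h', convolution_eq_swap, ContinuousLinearMap.integral_apply]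
  · rfl
  · have := (hcs.fderiv (𝕜 := ℝ)).convolutionExists_left
      (L := (ContinuousLinearMap.lsmul ℝ ℝ (E := ℂ)).precompL ℂ) (μ := volume)
      (hcd.continuous_fderiv (by norm_num)) hA.locallyIntegrable z
    have h2 := this.integrable_swap
    exact h2

lemma moll_closed {δ r : ℝ} (hδ : 0 < δ) {A B : ℂ → ℂ} (hA : Integrable A) (hB : Integrable B)
    (hw : ∀ ρ : ℂ → ℝ, (∀ z, 0 ≤ ρ z) → ContDiff ℝ 2 (fun z => (ρ z : ℂ)) →
      HasCompactSupport (fun z => (ρ z : ℂ)) → tsupport (fun z => (ρ z : ℂ)) ⊆ ball 0 r →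
      ∫ z, (dbar2 (fun z => (ρ z : ℂ)) z * A z - d2 (fun z => (ρ z : ℂ)) z * B z) = 0)
    {z : ℂ} (hz : ‖z‖ + δ < r) : dbar2 (moll δ hδ A) z = d2 (moll δ hδ B) z := by
  set φ := (bump δ hδ).normed volume with hφ
  have hcd : ContDiff ℝ 2 φ := (bump δ hδ).contDiff_normed
  have hsup : tsupport φ = closedBall 0 δ := (bump δ hδ).tsupport_normed_eq
  set η : ℂ → ℂ := fun t => ((φ (z - t) : ℝ) : ℂ) with hη
  have hηd : ContDiff ℝ 2 η := ofRealCLM.contDiff.comp (hcd.comp (contDiff_const.sub contDiff_id))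
  have hts : tsupport η ⊆ closedBall z δ := by
    refine closure_minimal (fun t ht => ?_) isClosed_closedBall
    have : z - t ∈ tsupport φ := by
      apply subset_tsupport
      simp only [hη, Function.mem_support, ne_eq, ofReal_eq_zero] at ht ⊢
      exact ht
    rw [hsup] at this
    simpa [dist_eq_norm, norm_sub_rev] using this
  have hηcs : HasCompactSupport η :=
    (isCompact_closedBall z δ).of_isClosed_subset (isClosed_tsupport _) hts
  have hw' := hw (fun t => φ (z - t)) (fun t => (bump δ hδ).nonneg_normed _) hηd
    ((isCompact_closedBall z δ).of_isClosed_subset (isClosed_tsupport _) hts)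
    (hts.trans (fun t ht => by
      simp only [mem_closedBall, dist_eq_norm, mem_ball_zero_iff] at ht ⊢
      calc ‖t‖ = ‖(t - z) + z‖ := by ring_nf
        _ ≤ ‖t - z‖ + ‖z‖ := norm_add_le _ _
        _ < r := by linarith))
  change ∫ t, (dbar2 η t * A t - d2 η t * B t) = 0 at hw'
  have hfd : ∀ t v, fderiv ℝ η t v = -((fderiv ℝ φ (z - t) v : ℝ) : ℂ) := by
    intro t v
    have h1 : HasFDerivAt φ (fderiv ℝ φ (z - t)) (z - t) :=
      ((hcd.differentiable (by norm_num)) _).hasFDerivAt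
    have h2 := ofRealCLM.hasFDerivAt.comp t
      (h1.comp t ((hasFDerivAt_const z t).sub (hasFDerivAt_id t)))
    have h3 : HasFDerivAt η _ t := h2
    rw [h3.fderiv]; simp
  have iA : ∀ v, Integrable fun t => fderiv ℝ η t v * A t := by
    intro v
    have hc : Continuous fun t => fderiv ℝ η t v :=
      (hηd.continuous_fderiv (by norm_num)).clm_apply continuous_const
    have hcs : HasCompactSupport fun t => fderiv ℝ η t v :=
      hηcs.fderiv_apply (𝕜 := ℝ) v
    obtain ⟨C, hC⟩ := hc.bounded_above_of_compact_support hcs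
    exact hA.bdd_mul hc.aestronglyMeasurable (Eventually.of_forall hC)
  have iB : ∀ v, Integrable fun t => fderiv ℝ η t v * B t := by
    intro v
    have hc : Continuous fun t => fderiv ℝ η t v :=
      (hηd.continuous_fderiv (by norm_num)).clm_apply continuous_const
    have hcs : HasCompactSupport fun t => fderiv ℝ η t v :=
      hηcs.fderiv_apply (𝕜 := ℝ) v
    obtain ⟨C, hC⟩ := hc.bounded_above_of_compact_support hcs
    exact hB.bdd_mul hc.aestronglyMeasurable (Eventually.of_forall hC)
  have eA : ∀ v, fderiv ℝ (moll δ hδ A) z v = - ∫ t, fderiv ℝ η t v * A t := by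
    intro v
    rw [(moll_fderiv hδ hA z).2 v, ← integral_neg]
    congr 1; ext t; rw [hfd]; simp [hφ]
  have eB : ∀ v, fderiv ℝ (moll δ hδ B) z v = - ∫ t, fderiv ℝ η t v * B t := by
    intro v
    rw [(moll_fderiv hδ hB z).2 v, ← integral_neg]
    congr 1; ext t; rw [hfd]; simp [hφ]
  have e3 : (∫ t, (dbar2 η t * A t - d2 η t * B t)) =
      ((∫ t, fderiv ℝ η t 1 * A t) + I * ∫ t, fderiv ℝ η t I * A t)
      - ((∫ t, fderiv ℝ η t 1 * B t) - I * ∫ t, fderiv ℝ η t I * B t) := by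
    rw [← integral_const_mul, ← integral_const_mul, ← integral_add (iA 1) ((iA I).const_mul I),
      ← integral_sub (iB 1) ((iB I).const_mul I), ← integral_sub]
    · congr 1; ext t; simp only [dbar2, d2]; ring
    · exact (iA 1).add ((iA I).const_mul I)
    · exact (iB 1).sub ((iB I).const_mul I)
  rw [e3] at hw'
  simp only [dbar2, d2, eA, eB]
  linear_combination -hw'

end OP

namespace OP
open scoped Convolution

variable {u : ℂ → ℝ} {R : ℝ}

lemma Af_int (hs : IsClassicalSolution (ball 0 R) u) (h0 : (0:ℂ) ∈ FB (ball 0 R) u) :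
    Integrable (Af u R) := by
  have hR := R_pos h0
  have ho := pos4_open hs hR
  have h2 : IntegrableOn (fun _ : ℂ => (16:ℝ)) (posSet (ball 0 (R/4)) u) := by
    refine integrableOn_const ?_
    exact ((measure_mono (fun z hz => hz.1)).trans_lt measure_ball_lt_top).ne
  have h3 : Integrable ((posSet (ball 0 (R/4)) u).indicator (fun _ : ℂ => (16:ℝ))) :=
    (integrable_indicator_iff ho.measurableSet).2 h2
  refine h3.mono' (Af_meas hs hR) (Eventually.of_forall fun z => ?_)
  by_cases h : z ∈ posSet (ball 0 (R/4)) u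
  · rw [indicator_of_mem h]; exact Af_le hs h0 z
  · rw [indicator_of_notMem h, Af, indicator_of_notMem h]; simp

lemma Bf_int (hs : IsClassicalSolution (ball 0 R) u) (h0 : (0:ℂ) ∈ FB (ball 0 R) u) :
    Integrable (Bf u R) := by
  have hR := R_pos h0
  have ho := pos4_open hs hR
  refine (integrable_indicator_iff ho.measurableSet).2 (integrableOn_const ?_)
  exact ((measure_mono (fun z hz => hz.1)).trans_lt measure_ball_lt_top).ne

/-- Existence of the primitive of the closed form. -/
lemma exists_Y0 (hs : IsClassicalSolution (ball 0 R) u) (h0 : (0:ℂ) ∈ FB (ball 0 R) u) :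
    ∃ Y : ℂ → ℂ, LipschitzOnWith 17 Y (ball 0 (R/8)) ∧ Y 0 = 0 ∧
      (∀ z ∈ ball (0:ℂ) (R/8), 0 < u z → HasFDerivAt Y (om (cg u z ^ 2) 1) z) ∧
      (∀ z ∈ ball (0:ℂ) (R/8), (∀ᶠ w in 𝓝 z, u w = 0) → HasFDerivAt Y (0 : ℂ →L[ℝ] ℂ) z) := by
  have hR := R_pos h0
  set A := Af u R with hA
  set B := Bf u R with hB
  have hAm : AEStronglyMeasurable A := Af_meas hs hR
  have hBm : AEStronglyMeasurable B := Bf_meas hs hR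
  set δ : ℕ → ℝ := fun n => (R / 16) * (1 / ((n:ℝ)+1)) with hδ
  have hδ0 : ∀ n, 0 < δ n := fun n => by positivity
  have hδ1 : ∀ n, δ n ≤ R / 16 := fun n => by
    have : (1 / ((n:ℝ)+1)) ≤ 1 := by
      rw [div_le_one (by positivity)]; linarith [n.cast_nonneg (α := ℝ)]
    calc δ n ≤ (R/16) * 1 := by simp only [hδ]; gcongr
      _ = _ := by ring
  have hδlim : Tendsto δ atTop (𝓝 0) := by
    have := tendsto_one_div_add_atTop_nhds_zero_nat (𝕜 := ℝ) |>.const_mul (R/16)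
    rwa [mul_zero] at this
  have hex : ∀ n, ∃ Y : ℂ → ℂ, (∀ z ∈ ball (0:ℂ) (R/8),
      HasFDerivAt Y (om (moll (δ n) (hδ0 n) A z) (moll (δ n) (hδ0 n) B z)) z) ∧ Y 0 = 0 := by
    intro n
    obtain ⟨Y, hY⟩ := om_primitive (convex_ball (0:ℂ) (R/8)) isOpen_ball
      (fun z _ => (moll_fderiv (hδ0 n) (Af_int hs h0) z).1)
      (fun z _ => (moll_fderiv (hδ0 n) (Bf_int hs h0) z).1)
      (fun z hz => moll_closed (r := R/4) (hδ0 n) (Af_int hs h0) (Bf_int hs h0)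
        (fun ρ h1 h2 h3 h4 => weak_closed hs h0 h1 h2 h3 h4) (by
          have := hδ1 n; rw [mem_ball_zero_iff] at hz; linarith))
    exact ⟨fun z => Y z - Y 0, fun z hz => (hY z hz).sub_const _, by simp⟩
  choose Y hYd hY0 using hex
  have hlip : ∀ n, LipschitzOnWith 17 (Y n) (ball 0 (R/8)) := by
    intro n
    refine (convex_ball (0:ℂ) (R/8)).lipschitzOnWith_of_nnnorm_hasFDerivWithin_le
      (fun z hz => (hYd n z hz).hasFDerivWithinAt) (fun z hz => ?_)
    have h1 : ‖moll (δ n) (hδ0 n) A z‖ ≤ 16 := by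
      rw [← dist_zero_right]
      exact moll_dist (hδ0 n) hAm (by norm_num) fun x _ => by rw [dist_zero_right]; exact Af_le hs h0 x
    have h2 : ‖moll (δ n) (hδ0 n) B z‖ ≤ 1 := by
      rw [← dist_zero_right]
      exact moll_dist (hδ0 n) hBm (by norm_num) fun x _ => by rw [dist_zero_right]; exact Bf_le x
    rw [← NNReal.coe_le_coe]
    have := norm_om_le (moll (δ n) (hδ0 n) A z) (moll (δ n) (hδ0 n) B z)
    simp only [coe_nnnorm]
    push_cast
    linarith
  choose h hh1 hh2 using fun n => (hlip n).extend_finite_dimension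
  have h0b : (0:ℂ) ∈ ball (0:ℂ) (R/8) := by simp [hR]
  obtain ⟨φ, G, hφ, -, hlim⟩ := arzela h hh1 (C := 0) (fun n => by
    rw [← hh2 n h0b, hY0]; simp)
  have hp : ∀ z ∈ ball (0:ℂ) (R/8), Tendsto (fun n => Y (φ n) z) atTop (𝓝 (G z)) := fun z hz => by
    have := (tendstoLocallyUniformlyOn_univ.2 hlim).tendsto_at (mem_univ z)
    exact this.congr fun n => (hh2 (φ n) hz).symm
  have hδφ : Tendsto (fun n => δ (φ n)) atTop (𝓝 0) := hδlim.comp hφ.tendsto_atTop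
  -- general differentiation lemma
  have hder : ∀ z ∈ ball (0:ℂ) (R/8), ∀ s > 0, ∀ a b : ℂ → ℂ,
      ContinuousOn a (closedBall z s) → ContinuousOn b (closedBall z s) →
      (∀ w ∈ closedBall z s, A w = a w) → (∀ w ∈ closedBall z s, B w = b w) →
      HasFDerivAt G (om (a z) (b z)) z := by
    intro z hz s hs0 a b ha hb hAa hBb
    have hzz : ∃ s' > 0, s' ≤ s / 2 ∧ ball z s' ⊆ ball 0 (R/8) := by
      obtain ⟨t, ht, htb⟩ := Metric.isOpen_iff.1 isOpen_ball z hz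
      exact ⟨min t (s/2), by positivity, min_le_right _ _, (ball_subset_ball (min_le_left _ _)).trans htb⟩
    obtain ⟨s', hs', hs's, hsb⟩ := hzz
    refine hasFDerivAt_of_tendstoUniformlyOn (l := atTop) (f := fun n => Y (φ n))
      (f' := fun n w => om (moll (δ (φ n)) (hδ0 (φ n)) A w) (moll (δ (φ n)) (hδ0 (φ n)) B w))
      (g' := fun w => om (a w) (b w)) (isOpen_ball : IsOpen (ball z s')) ?_ ?_ ?_ (mem_ball_self hs')
    · rw [tendstoUniformlyOn_iff]
      intro ε hε
      have hcK : IsCompact (closedBall z s) := isCompact_closedBall z s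
      obtain ⟨d1, hd1, hu1⟩ := Metric.uniformContinuousOn_iff.1 (hcK.uniformContinuousOn_of_continuous ha) (ε/4) (by linarith)
      obtain ⟨d2, hd2, hu2⟩ := Metric.uniformContinuousOn_iff.1 (hcK.uniformContinuousOn_of_continuous hb) (ε/4) (by linarith)
      filter_upwards [hδφ.eventually (gt_mem_nhds hd1), hδφ.eventually (gt_mem_nhds hd2),
        hδφ.eventually (gt_mem_nhds (show 0 < s/2 by linarith))] with n hn1 hn2 hn3 w hw
      have hwK : w ∈ closedBall z s := by
        rw [mem_ball] at hw; rw [mem_closedBall]; linarith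
      have hxK : ∀ x ∈ ball w (δ (φ n)), x ∈ closedBall z s := by
        intro x hx
        rw [mem_ball] at hw hx; rw [mem_closedBall]
        linarith [dist_triangle x w z]
      have e1 : dist (moll (δ (φ n)) (hδ0 (φ n)) A w) (a w) ≤ ε/4 := by
        refine moll_dist _ hAm (by linarith) fun x hx => ?_
        rw [hAa x (hxK x hx)]
        exact (hu1 x (hxK x hx) w hwK ((mem_ball.1 hx).trans hn1)).le
      have e2 : dist (moll (δ (φ n)) (hδ0 (φ n)) B w) (b w) ≤ ε/4 := by
        refine moll_dist _ hBm (by linarith) fun x hx => ?_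
        rw [hBb x (hxK x hx)]
        exact (hu2 x (hxK x hx) w hwK ((mem_ball.1 hx).trans hn2)).le
      rw [dist_eq_norm, om_sub]
      refine (norm_om_le _ _).trans_lt ?_
      rw [dist_comm, dist_eq_norm] at e1 e2
      linarith
    · exact fun n w hw => hYd (φ n) w (hsb hw)
    · exact fun w hw => hp w (hsb hw)
  refine ⟨G, ?_, ?_, ?_, ?_⟩
  · refine LipschitzOnWith.of_dist_le_mul fun x hx y hy => ?_
    exact le_of_tendsto' ((hp x hx).dist (hp y hy)) fun n => (hlip (φ n)).dist_le_mul x hx y hy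
  · refine tendsto_nhds_unique (hp 0 h0b) ?_
    simp [hY0]
  · intro z hz hpos
    have hz4 : z ∈ posSet (ball 0 (R/4)) u := ⟨ball_subset_ball (by linarith) hz, hpos⟩
    obtain ⟨s, hs0, hsub⟩ := Metric.nhds_basis_closedBall.mem_iff.1 ((pos4_open hs hR).mem_nhds hz4)
    refine hder z hz s hs0 (fun w => cg u w ^ 2) (fun _ => 1) ?_ continuousOn_const ?_ ?_
    · exact ((cg_cont isOpen_ball hs).mono (hsub.trans (pos4 hR))).pow 2
    · intro w hw; simp [hA, Af, indicator_of_mem (hsub hw)]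
    · intro w hw; simp [hB, Bf, indicator_of_mem (hsub hw)]
  · intro z hz hev
    obtain ⟨s, hs0, hsub⟩ := Metric.nhds_basis_closedBall.mem_iff.1 hev
    have := hder z hz s hs0 (fun _ => 0) (fun _ => 0) continuousOn_const continuousOn_const ?_ ?_
    · rwa [om_zero] at this
    · intro w hw
      have : u w = 0 := hsub hw
      exact indicator_of_notMem (fun h => by have := h.2; linarith) _
    · intro w hw
      have : u w = 0 := hsub hw
      exact indicator_of_notMem (fun h => by have := h.2; linarith) _

end OP

namespace OP

variable {u : ℂ → ℝ} {R : ℝ}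

lemma const_of_zero_deriv {Y : ℂ → ℂ} {C : Set ℂ} (hC : Convex ℝ C)
    (h : ∀ z ∈ C, HasFDerivAt Y (0 : ℂ →L[ℝ] ℂ) z) {x y : ℂ} (hx : x ∈ C) (hy : y ∈ C) :
    Y x = Y y := by
  have := hC.norm_image_sub_le_of_norm_hasFDerivWithin_le (f := Y) (C := 0)
    (fun z hz => (h z hz).hasFDerivWithinAt) (fun z _ => by simp) hx hy
  simp only [zero_mul] at this
  exact (sub_eq_zero.1 (norm_le_zero_iff.1 this)).symm

/-- `Y` is locally constant on the zero set. -/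
lemma Y_loc_const (hs : IsClassicalSolution (ball 0 R) u) {Y : ℂ → ℂ}
    (hYc : ContinuousOn Y (ball 0 (R/8)))
    (hY0 : ∀ z ∈ ball (0:ℂ) (R/8), (∀ᶠ w in 𝓝 z, u w = 0) → HasFDerivAt Y (0 : ℂ →L[ℝ] ℂ) z)
    (hR : 0 < R) {z : ℂ} (hz : z ∈ ball (0:ℂ) (R/8)) (huz : u z = 0) :
    ∃ s > 0, ∀ w ∈ ball z s, u w = 0 → Y w = Y z := by
  have hzR : z ∈ ball (0:ℂ) R := ball_subset_ball (by linarith) hz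
  have hΩ : IsOpen (ball (0:ℂ) R) := isOpen_ball
  by_cases hF : z ∈ FB (ball 0 R) u
  swap
  · -- interior point
    have hcl : z ∉ closure (posSet (ball 0 R) u) := fun h => hF ((mem_FB_iff hΩ hs).2 ⟨hzR, huz, h⟩)
    have hev : ∀ᶠ w in 𝓝 z, u w = 0 ∧ w ∈ ball (0:ℂ) (R/8) := by
      filter_upwards [isClosed_closure.isOpen_compl.mem_nhds hcl, isOpen_ball.mem_nhds hzR,
        isOpen_ball.mem_nhds hz] with w hw hwR hw8
      refine ⟨?_, hw8⟩
      by_contra hne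
      exact hw (subset_closure ⟨hwR, lt_of_le_of_ne (hs.nonneg w hwR) (Ne.symm hne)⟩)
    obtain ⟨s, hs0, hsub⟩ := eventually_nhds_iff_ball.1 hev
    refine ⟨s, hs0, fun w hw _ => ?_⟩
    refine const_of_zero_deriv (convex_ball z s) (fun x hx => hY0 x (hsub x hx).2 ?_) hw (mem_ball_self hs0)
    filter_upwards [isOpen_ball.mem_nhds hx] with y hy using (hsub y hy).1
  · obtain ⟨V, hVo, hzV, hVΩ, φ, hφ, hφ', hV1, hV2, hV3⟩ := hs.fb_manifold z hF
    have hφz : φ z = 0 := (hV3.subset ⟨hzV, hF⟩).2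
    have hne := hφ' z hzV
    obtain ⟨e0, he0⟩ : ∃ e, fderiv ℝ φ z e ≠ 0 := by
      by_contra h; push Not at h; exact hne (ContinuousLinearMap.ext h)
    set L := fderiv ℝ φ z with hL
    set e : ℂ := (-(L e0)⁻¹) • e0 with he
    have hLe : L e = -1 := by rw [he, map_smul]; simp; field_simp
    have hene : e ≠ 0 := by intro h; rw [h] at hLe; simp at hLe
    have hen : 0 < ‖e‖ := norm_pos_iff.2 hene
    have hstrict : HasStrictFDerivAt φ L z :=
      ((hφ.contDiffAt (hVo.mem_nhds hzV)).hasStrictFDerivAt (by simp))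
    set c : ℝ := 1 / (2 * ‖e‖) with hc
    have hc0 : 0 < c := by positivity
    obtain ⟨ρ, hρ, hball⟩ : ∃ ρ > 0, ball z ρ ⊆ V ∩ ball 0 (R/8) ∧
        ∀ x ∈ ball z ρ, ∀ y ∈ ball z ρ, φ x ≤ φ y + L (x - y) + c * ‖x - y‖ := by
      have h1 := hstrict.isLittleO.def hc0
      obtain ⟨r1, hr1, hb1⟩ := eventually_nhds_iff_ball.1 h1
      obtain ⟨r2, hr2, hb2⟩ := Metric.isOpen_iff.1 (hVo.inter (isOpen_ball (x := (0:ℂ)) (ε := R/8))) z ⟨hzV, hz⟩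
      refine ⟨min r1 r2, by positivity, (ball_subset_ball (min_le_right _ _)).trans hb2, ?_⟩
      intro x hx y hy
      have := hb1 (x, y) (by
        rw [← ball_prod_same]
        exact ⟨ball_subset_ball (min_le_left _ _) hx, ball_subset_ball (min_le_left _ _) hy⟩)
      simp only [Real.norm_eq_abs] at this
      linarith [(abs_le.1 this).2]
    obtain ⟨hbV, hφb⟩ := hball
    have hneg : ∀ x ∈ ball z ρ, φ x < 0 → HasFDerivAt Y (0 : ℂ →L[ℝ] ℂ) x := by
      intro x hx hx0
      have hxV := (hbV hx).1
      refine hY0 x (hbV hx).2 ?_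
      have hcx : ContinuousAt φ x := (hφ.continuousOn).continuousAt (hVo.mem_nhds hxV)
      filter_upwards [hVo.mem_nhds hxV, hcx.eventually (gt_mem_nhds hx0)] with y hy hy0
      exact (hV2.superset ⟨hy, hy0.le⟩).2
    set t : ℝ := ρ / (4 * ‖e‖) with ht
    have ht0 : 0 < t := by positivity
    have hte : t * ‖e‖ = ρ / 4 := by rw [ht]; field_simp
    have hce : c * ‖e‖ = 1/2 := by rw [hc]; field_simp
    set s : ℝ := min (ρ/4) (t / (4 * (‖L‖ + c))) with hsdef
    have hs0 : 0 < s := by positivity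
    have hs1 : s ≤ ρ/4 := min_le_left _ _
    have hs2 : (‖L‖ + c) * s ≤ t / 4 := by
      calc (‖L‖ + c) * s ≤ (‖L‖ + c) * (t / (4 * (‖L‖ + c))) := by gcongr; exact min_le_right _ _
        _ = t / 4 := by field_simp
    have hYt : ∀ w ∈ ball z s, u w = 0 → Y w = Y (w + t • e) := by
      intro w hw hw0
      have hwz : ‖w - z‖ < s := by rw [← dist_eq_norm]; exact hw
      have hwb : w ∈ ball z ρ := ball_subset_ball (by linarith) hw
      have hφw : φ w ≤ 0 := (hV2.subset ⟨(hbV hwb).1, hw0⟩).2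
      have hin : ∀ τ : ℝ, 0 < τ → τ ≤ t → w + τ • e ∈ ball z ρ ∧ φ (w + τ • e) < 0 := by
        intro τ h1 h2
        have hτe : ‖τ • e‖ = τ * ‖e‖ := by rw [norm_smul, Real.norm_eq_abs, abs_of_pos h1]
        have hmem : w + τ • e ∈ ball z ρ := by
          rw [mem_ball, dist_eq_norm]
          calc ‖w + τ • e - z‖ = ‖(w - z) + τ • e‖ := by congr 1; ring
            _ ≤ ‖w - z‖ + τ * ‖e‖ := by rw [← hτe]; exact norm_add_le _ _
            _ < s + t * ‖e‖ := by have := mul_le_mul_of_nonneg_right h2 hen.le; linarith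
            _ ≤ ρ := by rw [hte]; linarith
        refine ⟨hmem, ?_⟩
        have := hφb _ hmem w hwb
        rw [add_sub_cancel_left, map_smul, hLe, hτe, smul_eq_mul] at this
        have h3 : c * (τ * ‖e‖) = τ / 2 := by rw [mul_left_comm, hce]; ring
        linarith
      have hseg : ∀ τ : ℝ, 0 < τ → τ ≤ t → Y (w + τ • e) = Y (w + t • e) := by
        intro τ h1 h2
        refine const_of_zero_deriv (convex_segment (𝕜 := ℝ) (w + τ • e) (w + t • e)) ?_
          (left_mem_segment _ _ _) (right_mem_segment _ _ _)
        rintro x ⟨a, b, ha, hb, hab, rfl⟩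
        have hx : a • (w + τ • e) + b • (w + t • e) = w + (a * τ + b * t) • e := by
          have : w = (a + b) • w := by rw [hab, one_smul]
          conv_rhs => rw [this]
          simp only [smul_add, add_smul, smul_smul]; ring
        have h3 : 0 < a * τ + b * t := by
          rcases ha.eq_or_lt with h | h
          · have : b = 1 := by linarith
            rw [← h, this]; linarith
          · have := mul_pos h h1
            have := mul_nonneg hb ht0.le
            linarith
        have h4 : a * τ + b * t ≤ t := by
          calc a * τ + b * t ≤ a * t + b * t := by gcongr
            _ = t := by rw [← add_mul, hab, one_mul]
        rw [hx]
        exact hneg _ (hin _ h3 h4).1 (hin _ h3 h4).2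
      have hcont : Tendsto (fun τ : ℝ => Y (w + τ • e)) (𝓝[>] 0) (𝓝 (Y w)) := by
        have hcw : ContinuousAt Y w := hYc.continuousAt (isOpen_ball.mem_nhds (hbV hwb).2)
        have h1 : Tendsto (fun τ : ℝ => w + τ • e) (𝓝[>] 0) (𝓝 w) := by
          have : Continuous (fun τ : ℝ => w + τ • e) := by fun_prop
          have := this.tendsto 0
          simp only [zero_smul, add_zero] at this
          exact this.mono_left nhdsWithin_le_nhds
        exact hcw.tendsto.comp h1
      refine tendsto_nhds_unique hcont (tendsto_const_nhds.congr' ?_)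
      filter_upwards [Ioc_mem_nhdsGT ht0] with τ hτ
      exact (hseg τ hτ.1 hτ.2).symm
    refine ⟨s, hs0, fun w hw hw0 => ?_⟩
    rw [hYt w hw hw0, hYt z (mem_ball_self hs0) huz]
    have hnte : ‖t • e‖ = ρ/4 := by rw [norm_smul, Real.norm_eq_abs, abs_of_pos ht0, hte]
    refine const_of_zero_deriv (convex_ball (z + t • e) s) ?_ ?_ (mem_ball_self hs0)
    · intro x hx
      rw [mem_ball, dist_eq_norm] at hx
      have hxz : ‖x - z‖ ≤ s + ρ/4 := by
        calc ‖x - z‖ = ‖(x - (z + t • e)) + t • e‖ := by congr 1; ring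
          _ ≤ ‖x - (z + t • e)‖ + ‖t • e‖ := norm_add_le _ _
          _ ≤ _ := by rw [hnte]; linarith
      have hxb : x ∈ ball z ρ := by rw [mem_ball, dist_eq_norm]; linarith
      refine hneg x hxb ?_
      have h1 := hφb x hxb z (mem_ball_self hρ)
      have h2 : L (x - z) ≤ ‖L‖ * s - t := by
        have : x - z = (x - (z + t • e)) + t • e := by ring
        rw [this, map_add, map_smul, hLe]
        have h3 := (le_abs_self _).trans (L.le_opNorm (x - (z + t • e)))
        have h4 : ‖L‖ * ‖x - (z + t • e)‖ ≤ ‖L‖ * s := by gcongr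
        simp only [smul_eq_mul]; linarith
      have h5 : c * ‖x - z‖ ≤ c * s + t/2 := by
        calc c * ‖x - z‖ ≤ c * (s + t * ‖e‖) := by rw [hte]; gcongr
          _ = c * s + t * (c * ‖e‖) := by ring
          _ = _ := by rw [hce]; ring
      rw [hφz] at h1
      have : ‖L‖ * s + c * s ≤ t/4 := by rw [← add_mul]; exact hs2
      linarith
    · rw [mem_ball, dist_eq_norm, add_sub_add_right_eq_sub, ← dist_eq_norm]; exact hw

lemma Y_const_conn (hs : IsClassicalSolution (ball 0 R) u) {Y : ℂ → ℂ}
    (hYc : ContinuousOn Y (ball 0 (R/8)))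
    (hY0 : ∀ z ∈ ball (0:ℂ) (R/8), (∀ᶠ w in 𝓝 z, u w = 0) → HasFDerivAt Y (0 : ℂ →L[ℝ] ℂ) z)
    (hR : 0 < R) {E : Set ℂ} (hE : IsPreconnected E) (hEb : E ⊆ ball (0:ℂ) (R/8))
    (hEu : ∀ z ∈ E, u z = 0) : ∀ x ∈ E, ∀ y ∈ E, Y x = Y y := by
  intro x hx y hy
  refine hE.induction₂ (fun x y => Y x = Y y) ?_ (fun _ _ _ _ _ _ => Eq.trans)
    (fun _ _ _ _ => Eq.symm) hx hy
  intro z hz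
  obtain ⟨s, hs0, h⟩ := Y_loc_const hs hYc hY0 hR (hEb hz) (hEu z hz)
  filter_upwards [mem_nhdsWithin_of_mem_nhds (isOpen_ball.mem_nhds (mem_ball_self (x := z) hs0)),
    self_mem_nhdsWithin] with w hw hwE
  exact (h w hw (hEu w hwE)).symm

end OP

namespace OP

variable {u : ℂ → ℝ} {R : ℝ}

lemma isCompact_compIn {K : Set ℂ} (hK : IsCompact K) {x : ℂ} (hx : x ∈ K) :
    IsCompact (connectedComponentIn K x) := by
  rw [connectedComponentIn_eq_image hx]
  haveI : CompactSpace K := isCompact_iff_compactSpace.1 hK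
  exact (isClosed_connectedComponent.isCompact).image continuous_subtype_val

lemma bumping {F : Set ℂ} {x c : ℂ} {r : ℝ} (hx : x ∈ F) (hxc : dist x c ≤ r)
    (hK : IsCompact (F ∩ closedBall c r)) (hnc : ¬ IsCompact (connectedComponentIn F x)) :
    ∃ E, IsPreconnected E ∧ x ∈ E ∧ E ⊆ F ∩ closedBall c r ∧ ∃ y ∈ E, dist y c = r := by
  set K := F ∩ closedBall c r with hKdef
  have hxK : x ∈ K := ⟨hx, hxc⟩
  refine ⟨connectedComponentIn K x, isPreconnected_connectedComponentIn,
    mem_connectedComponentIn hxK, connectedComponentIn_subset _ _, ?_⟩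
  by_contra! hno
  apply hnc
  haveI : CompactSpace K := isCompact_iff_compactSpace.1 hK
  -- clopen piece
  obtain ⟨Z, hZ, hxZ, hZb⟩ : ∃ Z : Set K, IsClopen Z ∧ ⟨x, hxK⟩ ∈ Z ∧ ∀ y ∈ Z, (y:ℂ) ∈ ball c r := by
    have hS : IsCompact {y : K | dist (y:ℂ) c = r} := by
      apply IsClosed.isCompact
      exact isClosed_eq (by fun_prop) continuous_const
    have hint := connectedComponent_eq_iInter_isClopen (⟨x, hxK⟩ : K)
    obtain ⟨t, ht⟩ := hS.elim_finite_subfamily_closed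
      (fun s : {s : Set K // IsClopen s ∧ (⟨x, hxK⟩ : K) ∈ s} => (s : Set K)) (fun s => s.2.1.1) (by
        rw [← hint]
        ext y
        simp only [mem_inter_iff, mem_setOf_eq, mem_empty_iff_false, iff_false, not_and]
        intro hy hyc
        refine hno y ?_ hy
        rw [connectedComponentIn_eq_image hxK]
        exact ⟨y, hyc, rfl⟩)
    refine ⟨⋂ s ∈ t, (s : Set K), isClopen_biInter_finset (fun s _ => s.2.1), ?_, ?_⟩
    · simp only [mem_iInter]; exact fun s _ => s.2.2
    · intro y hy
      have hyr : dist (y:ℂ) c ≤ r := y.2.2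
      rcases hyr.eq_or_lt with h | h
      · have hmem := mem_inter (show y ∈ {y : K | dist (y:ℂ) c = r} from h) hy
        rw [ht] at hmem
        exact hmem.elim
      · exact h
  obtain ⟨V, hVo, hV⟩ := isOpen_induced_iff.1 hZ.2
  have hsub : connectedComponentIn F x ⊆ K := by
    have hZc : IsClosed ((↑) '' Z : Set ℂ) := ((hZ.1.isCompact).image continuous_subtype_val).isClosed
    have h1 : connectedComponentIn F x ⊆ V ∩ ball c r := by
      have hpre : IsPreconnected (connectedComponentIn F x) := isPreconnected_connectedComponentIn
      have hZV : ∀ y ∈ F, y ∈ V ∩ ball c r ↔ y ∈ ((↑) '' Z : Set ℂ) := by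
        intro y hy
        constructor
        · rintro ⟨h1, h2⟩
          refine ⟨⟨y, hy, ball_subset_closedBall h2⟩, ?_, rfl⟩
          rw [← hV]; exact h1
        · rintro ⟨y', hy', rfl⟩
          refine ⟨?_, hZb y' hy'⟩
          rw [← hV] at hy'; exact hy'
      have hA : connectedComponentIn F x ⊆ (V ∩ ball c r) ∪ ((↑) '' Z : Set ℂ)ᶜ := by
        intro y hy
        by_cases h : y ∈ ((↑) '' Z : Set ℂ)
        · exact Or.inl ((hZV y (connectedComponentIn_subset _ _ hy)).2 h)
        · exact Or.inr h
      have hB : connectedComponentIn F x ∩ ((V ∩ ball c r) ∩ ((↑) '' Z : Set ℂ)ᶜ) = ∅ := by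
        rw [Set.eq_empty_iff_forall_notMem]
        rintro y ⟨hy, h, h'⟩
        exact h' ((hZV y (connectedComponentIn_subset _ _ hy)).1 h)
      rcases isPreconnected_iff_subset_of_disjoint.1 hpre (V ∩ ball c r) ((↑) '' Z : Set ℂ)ᶜ
        (hVo.inter isOpen_ball) hZc.isOpen_compl hA hB with h | h
      · exact h
      · exact absurd ⟨_, hxZ, rfl⟩ (h (mem_connectedComponentIn hx))
    intro y hy
    exact ⟨connectedComponentIn_subset _ _ hy, ball_subset_closedBall (h1 hy).2⟩
  have : connectedComponentIn F x ⊆ connectedComponentIn K x :=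
    (isPreconnected_connectedComponentIn).subset_connectedComponentIn (mem_connectedComponentIn hx) hsub
  have h2 : connectedComponentIn K x ⊆ connectedComponentIn F x :=
    connectedComponentIn_mono x inter_subset_left
  rw [subset_antisymm this h2]
  exact isCompact_compIn hK hxK

lemma FB_zero (hs : IsClassicalSolution (ball 0 R) u) {x : ℂ} (hx : x ∈ FB (ball 0 R) u) : u x = 0 :=
  ((mem_FB_iff isOpen_ball hs).1 hx).2.1

/-- through every free boundary point there is a connected piece of the zero set reaching the
sphere. -/
lemma exists_E (hs : IsClassicalSolution (ball 0 R) u)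
    (hnc : ∀ z ∈ FB (ball 0 R) u, ¬ IsCompact (connectedComponentIn (FB (ball 0 R) u) z))
    {x c : ℂ} {r : ℝ} (hx : x ∈ FB (ball 0 R) u) (hxc : dist x c ≤ r)
    (hc : closedBall c r ⊆ ball 0 R) :
    ∃ E, IsPreconnected E ∧ x ∈ E ∧ E ⊆ closedBall c r ∧ E ⊆ FB (ball 0 R) u ∧
      ∃ y ∈ E, dist y c = r := by
  have hK : IsCompact (FB (ball 0 R) u ∩ closedBall c r) := by
    have : FB (ball 0 R) u ∩ closedBall c r = closedBall c r ∩ frontier (posSet (ball 0 R) u) := by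
      ext y
      simp only [FB, mem_inter_iff]
      exact ⟨fun h => ⟨h.2, h.1.2⟩, fun h => ⟨⟨hc h.1, h.2⟩, h.1⟩⟩
    rw [this]
    exact (isCompact_closedBall c r).inter_right isClosed_frontier
  obtain ⟨E, h1, h2, h3, h4⟩ := bumping hx hxc hK (hnc x hx)
  exact ⟨E, h1, h2, fun y hy => (h3 hy).2, fun y hy => (h3 hy).1, h4⟩

end OP

namespace OP

variable {u : ℂ → ℝ} {R : ℝ}

lemma dbar2_scale {η : ℂ → ℂ} (hη : Differentiable ℝ η) (a : ℝ) (k c : ℂ) (z : ℂ) :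
    dbar2 (fun z => k * η (a • (z - c))) z = (k * a) * dbar2 η (a • (z - c)) ∧
    d2 (fun z => k * η (a • (z - c))) z = (k * a) * d2 η (a • (z - c)) := by
  have h1 : HasFDerivAt (fun z : ℂ => a • (z - c)) (a • ContinuousLinearMap.id ℝ ℂ) z :=
    ((hasFDerivAt_id z).sub_const c).const_smul a
  have h2 := (((hη (a • (z - c))).hasFDerivAt).comp z h1).const_mul k
  have h3 : fderiv ℝ (fun z => k * η (a • (z - c))) z = _ := h2.fderiv
  unfold dbar2 d2
  rw [h3]
  constructor <;> simp <;> ring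

/-- fixed bump function -/
noncomputable def eta0 : ContDiffBump (0:ℂ) := ⟨2, 3, by norm_num, by norm_num⟩

/-- absolute constant -/
noncomputable def K0 : ℝ := ∫ z, ‖d2 (dbar2 (fun z => (eta0 z : ℂ))) z‖

noncomputable def rhoB (c : ℂ) (M : ℝ) (z : ℂ) : ℝ := eta0 (M⁻¹ • (z - c))

lemma K0_nonneg : 0 ≤ K0 := integral_nonneg fun _ => norm_nonneg _

lemma eta0_contDiff : ContDiff ℝ 3 (fun z => (eta0 z : ℂ)) := by
  exact ofRealCLM.contDiff.comp eta0.contDiff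

lemma rhoB_contDiff (c : ℂ) (M : ℝ) : ContDiff ℝ 2 (fun z => (rhoB c M z : ℂ)) := by
  unfold rhoB
  exact ofRealCLM.contDiff.comp (eta0.contDiff.comp (by fun_prop))

lemma rhoB_int (c : ℂ) {M : ℝ} (hM : 0 < M) :
    ∫ z, ‖d2 (dbar2 (fun z => (rhoB c M z : ℂ))) z‖ = K0 := by
  have hd : Differentiable ℝ (fun z => (eta0 z : ℂ)) := eta0_contDiff.differentiable (by norm_num)
  have hd' : Differentiable ℝ (dbar2 (fun z => (eta0 z : ℂ))) :=
    (dbar2_contDiff (n := 1) (eta0_contDiff.of_le (by norm_num))).differentiable (by norm_num)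
  have e1 : dbar2 (fun z => (rhoB c M z : ℂ)) =
      fun z => (M⁻¹ : ℂ) * dbar2 (fun z => (eta0 z : ℂ)) (M⁻¹ • (z - c)) := by
    funext z
    have := (dbar2_scale hd M⁻¹ 1 c z).1
    simp only [one_mul] at this
    rw [← Complex.ofReal_inv, ← this]; rfl
  have e2 : ∀ z, d2 (dbar2 (fun z => (rhoB c M z : ℂ))) z =
      (M⁻¹ : ℂ)^2 * d2 (dbar2 (fun z => (eta0 z : ℂ))) (M⁻¹ • (z - c)) := by
    intro z
    rw [e1, (dbar2_scale hd' M⁻¹ (M⁻¹ : ℂ) c z).2]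
    push_cast; ring
  simp_rw [e2, norm_mul]
  rw [integral_const_mul]
  have h1 := integral_sub_right_eq_self (μ := (volume : Measure ℂ))
    (fun z => ‖d2 (dbar2 (fun z => (eta0 z : ℂ))) (M⁻¹ • z)‖) c
  rw [h1]
  have h2 := Measure.integral_comp_smul (μ := (volume : Measure ℂ))
    (fun z => ‖d2 (dbar2 (fun z => (eta0 z : ℂ))) z‖) M⁻¹
  rw [h2]
  have : ‖(M⁻¹ : ℂ)^2‖ = (M⁻¹)^2 := by
    rw [norm_pow, norm_inv, norm_real_pos hM]
  rw [this]
  simp only [Complex.finrank_real_complex, smul_eq_mul]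
  rw [abs_of_pos (by positivity), K0]
  field_simp

lemma rhoB_tsupport (c : ℂ) {M : ℝ} (hM : 0 < M) :
    tsupport (fun z => (rhoB c M z : ℂ)) ⊆ closedBall c (3*M) := by
  refine closure_minimal (fun z hz => ?_) isClosed_closedBall
  by_contra hc
  apply hz
  simp only [rhoB]
  rw [eta0.zero_of_le_dist]
  · simp
  · rw [mem_closedBall, not_le, dist_eq_norm] at hc
    rw [dist_zero_right, norm_smul, Real.norm_eq_abs, abs_of_pos (by positivity)]
    rw [inv_mul_eq_div, le_div_iff₀ hM]
    exact hc.le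

lemma rhoB_compact (c : ℂ) {M : ℝ} (hM : 0 < M) :
    HasCompactSupport (fun z => (rhoB c M z : ℂ)) :=
  (isCompact_closedBall c (3*M)).of_isClosed_subset (isClosed_tsupport _) (rhoB_tsupport c hM)

lemma rhoB_one (c : ℂ) {M : ℝ} (hM : 0 < M) {z : ℂ} (hz : dist z c ≤ 2 * M) : rhoB c M z = 1 := by
  refine eta0.one_of_mem_closedBall ?_
  rw [mem_closedBall, dist_zero_right, norm_smul, Real.norm_eq_abs, abs_of_pos (by positivity),
    inv_mul_eq_div, div_le_iff₀ hM, ← dist_eq_norm]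
  exact hz

lemma rhoB_nonneg (c : ℂ) (M : ℝ) (z : ℂ) : 0 ≤ rhoB c M z := eta0.nonneg

/-- energy density -/
noncomputable def kd (u : ℂ → ℝ) (c : ℂ) (M ε : ℝ) (z : ℂ) : ℝ :=
  rhoB c M z * deriv (bt ε) (u z) * ‖cg u z‖

lemma kd_nonneg {c : ℂ} {M ε : ℝ} (hε : 0 < ε) (z : ℂ) : 0 ≤ kd u c M ε z := by
  unfold kd
  have := rhoB_nonneg c M z
  have := bt_deriv_nonneg hε (u z)
  positivity

lemma kd_cont (hs : IsClassicalSolution (ball 0 R) u) {c : ℂ} {M ε : ℝ} (hM : 0 < M) (hε : 0 < ε)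
    (hc : closedBall c (3*M) ⊆ ball 0 R) : Continuous (kd u c M ε) := by
  have h := glue_cont (η := fun z => (rhoB c M z : ℂ)) (g := fun z => (‖cg u z‖ : ℂ))
    (b := deriv (bt ε)) isOpen_ball hs hε (rhoB_contDiff c M).continuous
    ((rhoB_tsupport c hM).trans hc) ((bt_contDiff ε).continuous_deriv (by norm_num))
    (fun t ht => bt_deriv_zero hε ht)
    (continuous_ofReal.comp_continuousOn (cg_cont isOpen_ball hs).norm)
  have h2 := continuous_re.comp h
  convert h2 using 1
  funext z
  simp only [kd, Function.comp, ← Complex.ofReal_mul, Complex.ofReal_re]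

lemma kd_bound (hs : IsClassicalSolution (ball 0 R) u) {c : ℂ} {M B : ℝ} (hM : 0 < M)
    (hc : closedBall c (3*M) ⊆ ball 0 R) (hB : ∀ z ∈ closedBall c (3*M), u z ≤ B) :
    ∀ᶠ ε in 𝓝[>] (0:ℝ), Integrable (kd u c M ε) ∧ ∫ z, kd u c M ε z ≤ 2 * (B * K0) := by
  obtain ⟨ε0, hε0, hcl⟩ := gradclose isOpen_ball hs (isCompact_closedBall c (3*M)) hc
    (τ := 1/2) (by norm_num)
  filter_upwards [Ioo_mem_nhdsGT (show (0:ℝ) < ε0/2 by positivity)] with ε hε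
  obtain ⟨hi, hle⟩ := energy_le isOpen_ball hs hε.1 (rhoB_contDiff c M) (rhoB_compact c hM)
    ((rhoB_tsupport c hM).trans hc) (fun z hz => hB z (rhoB_tsupport c hM hz))
  rw [rhoB_int c hM] at hle
  have hkc := kd_cont hs hM hε.1 hc
  have hki : Integrable (kd u c M ε) := by
    refine hkc.integrable_of_hasCompactSupport ((rhoB_compact c hM).mono fun z hz => ?_)
    simp only [Function.mem_support, ne_eq, kd] at hz ⊢
    intro h; apply hz
    rw [Complex.ofReal_eq_zero.1 h]; simp
  refine ⟨hki, ?_⟩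
  have : ∫ z, kd u c M ε z ≤ ∫ z, 2 * (rhoB c M z * deriv (bt ε) (u z) * ‖cg u z‖ ^ 2) := by
    refine integral_mono hki (hi.const_mul 2) fun z => ?_
    by_cases h0 : rhoB c M z * deriv (bt ε) (u z) = 0
    · simp [kd, h0]
    · have hr : rhoB c M z ≠ 0 := left_ne_zero_of_mul h0
      have hb : deriv (bt ε) (u z) ≠ 0 := right_ne_zero_of_mul h0
      have hz : z ∈ closedBall c (3*M) := by
        refine rhoB_tsupport c hM (subset_closure ?_)
        simpa using hr
      have h1 : ε < u z := by by_contra h; push Not at h; exact hb (bt_deriv_zero hε.1 h)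
      have h2 : u z ≤ 2 * ε := by by_contra h; push Not at h; exact hb (bt_deriv_zero' hε.1 h)
      have h3 := hcl z hz (hε.1.trans h1) (by linarith [hε.2])
      have h4 : 1/2 ≤ ‖cg u z‖ := by linarith [(abs_lt.1 h3).1]
      have h5 : 0 ≤ rhoB c M z * deriv (bt ε) (u z) :=
        mul_nonneg (rhoB_nonneg c M z) (bt_deriv_nonneg hε.1 _)
      simp only [kd]
      nlinarith [mul_nonneg h5 (norm_nonneg (cg u z)), mul_nonneg (mul_nonneg h5 (norm_nonneg (cg u z))) (sub_nonneg.2 h4)]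
  rw [integral_const_mul] at this
  linarith

/-- derivative of `bt ε ∘ u` along circles -/
lemma circ_deriv (hs : IsClassicalSolution (ball 0 R) u) {c : ℂ} {M ε s : ℝ} (hM : 0 < M) (hε : 0 < ε)
    (hc : closedBall c (3*M) ⊆ ball 0 R) (hs0 : 0 < s) (hs2 : s < 2 * M) (θ : ℝ) :
    ∃ d, HasDerivAt (fun θ : ℝ => bt ε (u (c + s * cexp (θ * I)))) d θ ∧
      |d| ≤ s * kd u c M ε (c + s * cexp (θ * I)) := by
  set z := c + s * cexp (θ * I) with hz
  have hzc : dist z c = s := by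
    rw [dist_eq_norm, hz, add_sub_cancel_left, norm_mul, norm_exp_ofReal_mul_I,
      norm_real_pos hs0, mul_one]
  have hzR : z ∈ ball (0:ℂ) R := hc (by rw [mem_closedBall, hzc]; linarith)
  have hγ : HasDerivAt (fun θ : ℝ => c + s * cexp (θ * I)) (s * (cexp (θ * I) * I)) θ := by
    have h1 : HasDerivAt (fun θ : ℝ => (θ:ℂ) * I) I θ := by
      simpa using (ofRealCLM.hasDerivAt (x := θ)).mul_const I
    exact (h1.cexp.const_mul (s:ℂ)).const_add c
  by_cases hp : 0 < u z
  · have hU := (har_pos isOpen_ball hs).hd z ⟨hzR, hp⟩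
    have h1 := hU.comp_hasDerivAt θ hγ
    have h2 := (((bt_contDiff ε).differentiable (by norm_num)) (u z)).hasDerivAt
    have h3 := h2.comp θ h1
    refine ⟨_, h3, ?_⟩
    rw [reL_apply, abs_mul, abs_of_nonneg (bt_deriv_nonneg hε _)]
    rw [kd, rhoB_one c hM (by rw [hzc]; exact hs2.le), one_mul]
    have h4 := abs_re_le_norm (cg u z * (s * (cexp (θ * I) * I)))
    rw [norm_mul, norm_mul, norm_mul, norm_exp_ofReal_mul_I, Complex.norm_I,
      norm_real_pos hs0] at h4
    have := mul_le_mul_of_nonneg_left h4 (bt_deriv_nonneg hε (u z))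
    linarith
  · refine ⟨0, ?_, ?_⟩
    · have hcz : ContinuousAt u z := hs.contOn.continuousAt (isOpen_ball.mem_nhds hzR)
      have hev : ∀ᶠ w in 𝓝 z, u w < ε := hcz.eventually (gt_mem_nhds (by linarith))
      have : (fun θ : ℝ => bt ε (u (c + s * cexp (θ * I)))) =ᶠ[𝓝 θ] fun _ => 0 := by
        filter_upwards [hγ.continuousAt.eventually hev] with t ht using bt_zero hε ht.le
      exact (hasDerivAt_const θ (0:ℝ)).congr_of_eventuallyEq this
    · rw [abs_zero]; exact mul_nonneg hs0.le (kd_nonneg hε _)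

/-- `N` transitions zero/positive on the circle -/
def Trans (u : ℂ → ℝ) (c : ℂ) (s : ℝ) (N : ℕ) : Prop :=
  ∃ t : ℕ → ℝ, -Real.pi ≤ t 0 ∧ t N ≤ Real.pi ∧ ∀ i < N, t i ≤ t (i+1) ∧
    ∃ a ∈ Icc (t i) (t (i+1)), ∃ b ∈ Icc (t i) (t (i+1)),
      u (c + s * cexp (a * I)) ≤ 0 ∧ 0 < u (c + s * cexp (b * I))

lemma osc_le {h q : ℝ → ℝ} (hq : Continuous q) (hq0 : ∀ x, 0 ≤ q x)
    (hd : ∀ x, ∃ d, HasDerivAt h d x ∧ |d| ≤ q x) {p p' a b : ℝ} (ha : a ∈ Icc p p')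
    (hb : b ∈ Icc p p') : h b - h a ≤ ∫ x in p..p', q x := by
  choose d hd1 hd2 using hd
  have hmono : ∀ x y, p ≤ x → x ≤ y → y ≤ p' → ∫ t in x..y, q t ≤ ∫ t in p..p', q t := by
    intro x y h1 h2 h3
    exact intervalIntegral.integral_mono_interval h1 h2 h3 (Eventually.of_forall hq0)
      (hq.intervalIntegrable _ _)
  have hint : ∀ x y, IntegrableOn q (Icc x y) := fun x y => hq.continuousOn.integrableOn_Icc
  rcases le_total a b with hab | hab
  · refine le_trans ?_ (hmono a b ha.1 hab hb.2)
    exact intervalIntegral.sub_le_integral_of_hasDeriv_right_of_le hab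
      (fun x _ => (hd1 x).continuousAt.continuousWithinAt)
      (fun x _ => (hd1 x).hasDerivWithinAt) (hint a b) (fun x _ => (le_abs_self _).trans (hd2 x))
  · refine le_trans ?_ (hmono b a hb.1 hab ha.2)
    have := intervalIntegral.sub_le_integral_of_hasDeriv_right_of_le hab (g := fun x => - h x)
      (g' := fun x => - d x) (φ := q)
      (fun x _ => (hd1 x).neg.continuousAt.continuousWithinAt)
      (fun x _ => (hd1 x).neg.hasDerivWithinAt) (hint b a) (fun x _ => (neg_le_abs _).trans (hd2 x))
    linarith

lemma circ_lower (hs : IsClassicalSolution (ball 0 R) u) {c : ℂ} {M s : ℝ} {N : ℕ} (hM : 0 < M)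
    (hc : closedBall c (3*M) ⊆ ball 0 R) (hs0 : 0 < s) (hs2 : s < 2 * M) (hT : Trans u c s N) :
    ∀ᶠ ε in 𝓝[>] (0:ℝ), (N:ℝ) ≤ ∫ θ in (-Real.pi)..Real.pi, s * kd u c M ε (c + s * cexp (θ * I)) := by
  obtain ⟨t, ht0, htN, ht⟩ := hT
  choose! htm a ha b hb hua hub using ht
  have hev : ∀ᶠ ε in 𝓝[>] (0:ℝ), ∀ i ∈ Finset.range N, 2 * ε ≤ u (c + s * cexp (b i * I)) := by
    rw [Filter.eventually_all_finset]
    intro i hi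
    have := hub i (Finset.mem_range.1 hi)
    filter_upwards [Ioo_mem_nhdsGT (half_pos this)] with ε hε
    linarith [hε.2]
  filter_upwards [hev, self_mem_nhdsWithin] with ε hε hε0
  have hε0 : 0 < ε := hε0
  set q : ℝ → ℝ := fun θ => s * kd u c M ε (c + s * cexp (θ * I)) with hq
  have hqc : Continuous q := by
    have := kd_cont hs hM hε0 hc
    exact continuous_const.mul (this.comp (by fun_prop))
  have hq0 : ∀ x, 0 ≤ q x := fun x => mul_nonneg hs0.le (kd_nonneg hε0 _)
  have hint : ∀ x y, IntervalIntegrable q volume x y := fun x y => hqc.intervalIntegrable _ _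
  have hone : ∀ i ∈ Finset.range N, (1:ℝ) ≤ ∫ x in (t i)..(t (i+1)), q x := by
    intro i hi
    have hi' := Finset.mem_range.1 hi
    have := osc_le hqc hq0 (circ_deriv hs hM hε0 hc hs0 hs2) (ha i hi') (hb i hi')
    rw [bt_one hε0 (hε i hi), bt_zero hε0 ((hua i hi').trans hε0.le)] at this
    linarith
  have hsum := intervalIntegral.sum_integral_adjacent_intervals (f := q) (μ := volume) (a := t) (n := N)
    (fun k _ => hint _ _)
  have h1 : (N:ℝ) ≤ ∫ x in (t 0)..(t N), q x := by
    rw [← hsum]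
    have := Finset.sum_le_sum hone
    simpa using this
  have ht0N : t 0 ≤ t N := by
    have : ∀ n ≤ N, t 0 ≤ t n := by
      intro n
      induction n with
      | zero => intro _; exact le_rfl
      | succ k ih => intro hk; exact (ih (by omega)).trans (htm k (by omega))
    exact this N le_rfl
  exact h1.trans (intervalIntegral.integral_mono_interval ht0 ht0N htN (Eventually.of_forall hq0) (hint _ _))

end OP

namespace OP

variable {u : ℂ → ℝ} {R : ℝ}

lemma polar_bound {k : ℂ → ℝ} (hk : Continuous k) (hk0 : ∀ z, 0 ≤ k z) (hki : Integrable k) (c : ℂ) :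
    ∫⁻ s in Ioi (0:ℝ), ∫⁻ θ in Ioo (-Real.pi) Real.pi, ENNReal.ofReal (s * k (c + s * cexp (θ * I)))
      = ENNReal.ofReal (∫ z, k z) := by
  have h1 := Complex.lintegral_comp_polarCoord_symm (fun z => ENNReal.ofReal (k (c + z)))
  have h2 : ∫⁻ z, ENNReal.ofReal (k (c + z)) = ENNReal.ofReal (∫ z, k z) := by
    rw [lintegral_add_left_eq_self (fun z => ENNReal.ofReal (k z)) c,
      ofReal_integral_eq_lintegral_ofReal hki (Eventually.of_forall hk0)]
  rw [← h2, ← h1]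
  have h3 : (polarCoord.target : Set (ℝ × ℝ)) = Ioi (0:ℝ) ×ˢ Ioo (-Real.pi) Real.pi := rfl
  rw [h3, Measure.volume_eq_prod, ← Measure.prod_restrict, lintegral_prod]
  · refine setLIntegral_congr_fun measurableSet_Ioi fun s hs => ?_
    refine lintegral_congr fun θ => ?_
    rw [smul_eq_mul, ← ENNReal.ofReal_mul (le_of_lt hs), Complex.polarCoord_symm_apply, Complex.exp_mul_I]
    push_cast; rfl
  · refine Measurable.aemeasurable ?_
    have : Continuous fun p : ℝ × ℝ => k (c + Complex.polarCoord.symm p) := by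
      refine hk.comp (continuous_const.add ?_)
      have h4 : Continuous fun p : ℝ × ℝ => (p.1:ℂ) * (Real.cos p.2 + Real.sin p.2 * I) := by fun_prop
      exact h4.congr fun p => (Complex.polarCoord_symm_apply p).symm
    exact (ENNReal.measurable_ofReal.comp measurable_fst).mul (ENNReal.measurable_ofReal.comp this.measurable)

lemma trans_bound (hs : IsClassicalSolution (ball 0 R) u) {c : ℂ} {M B : ℝ} {N : ℕ} (hM : 0 < M)
    (hc : closedBall c (3*M) ⊆ ball 0 R) (hB : ∀ z ∈ closedBall c (3*M), u z ≤ B)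
    (hT : ∀ s ∈ Ioo M (2*M), Trans u c s N) : N * M ≤ 2 * (B * K0) := by
  set e : ℕ → ℝ := fun n => 1 / ((n:ℝ) + 1) with he
  have hepos : ∀ n, 0 < e n := fun n => by rw [he]; positivity
  have he0 : Tendsto e atTop (𝓝[>] 0) := by
    refine tendsto_nhdsWithin_iff.2 ⟨tendsto_one_div_add_atTop_nhds_zero_nat, ?_⟩
    exact Eventually.of_forall hepos
  set J : ℕ → ℝ → ENNReal := fun n s => ∫⁻ θ in Ioo (-Real.pi) Real.pi,
    ENNReal.ofReal (s * kd u c M (e n) (c + s * cexp (θ * I))) with hJ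
  have hcont : ∀ n, Continuous fun p : ℝ × ℝ => p.1 * kd u c M (e n) (c + p.1 * cexp (p.2 * I)) := by
    intro n
    exact continuous_fst.mul ((kd_cont hs hM (hepos n) hc).comp (by fun_prop))
  have hJm : ∀ n, Measurable (J n) := by
    intro n
    exact Measurable.lintegral_prod_right' (f := fun p : ℝ × ℝ => ENNReal.ofReal (p.1 * kd u c M (e n) (c + p.1 * cexp (p.2 * I))))
      (ENNReal.measurable_ofReal.comp (hcont n).measurable)
  have hF := lintegral_liminf_le (μ := volume.restrict (Ioi (0:ℝ))) (u := atTop) hJm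
  have hup : liminf (fun n => ∫⁻ s in Ioi (0:ℝ), J n s) atTop ≤ ENNReal.ofReal (2 * (B * K0)) := by
    refine liminf_le_of_frequently_le' ?_
    refine Eventually.frequently ?_
    filter_upwards [he0.eventually (kd_bound hs hM hc hB)] with n hn
    rw [hJ, polar_bound (kd_cont hs hM (hepos n) hc) (kd_nonneg (hepos n)) hn.1 c]
    exact ENNReal.ofReal_le_ofReal hn.2
  have hlow : ENNReal.ofReal (N * M) ≤ ∫⁻ s in Ioi (0:ℝ), liminf (fun n => J n s) atTop := by
    have h1 : ∫⁻ s in Ioo M (2*M), (ENNReal.ofReal N) ≤ ∫⁻ s in Ioo M (2*M), liminf (fun n => J n s) atTop := by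
      refine setLIntegral_mono' measurableSet_Ioo fun s hs' => ?_
      have hs0 : 0 < s := hM.trans hs'.1
      refine le_liminf_of_le (by isBoundedDefault) ?_
      filter_upwards [he0.eventually (circ_lower hs hM hc hs0 hs'.2 (hT s hs'))] with n hn
      refine (ENNReal.ofReal_le_ofReal hn).trans ?_
      have hpi : -Real.pi ≤ Real.pi := by linarith [Real.pi_pos]
      rw [intervalIntegral.integral_of_le hpi, integral_Ioc_eq_integral_Ioo,
        ofReal_integral_eq_lintegral_ofReal]
      · have hcs : Continuous fun θ : ℝ => s * kd u c M (e n) (c + s * cexp (θ * I)) :=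
          (hcont n).comp (by fun_prop : Continuous fun θ : ℝ => (s, θ))
        exact (hcs.continuousOn.integrableOn_Icc (a := -Real.pi) (b := Real.pi)).mono_set Ioo_subset_Icc_self
      · exact Eventually.of_forall fun θ => mul_nonneg hs0.le (kd_nonneg (hepos n) _)
    have h2 : ∫⁻ s in Ioo M (2*M), liminf (fun n => J n s) atTop ≤ ∫⁻ s in Ioi (0:ℝ), liminf (fun n => J n s) atTop :=
      lintegral_mono_set fun s hs' => hM.trans hs'.1
    refine le_trans ?_ (h1.trans h2)
    rw [setLIntegral_const, Real.volume_Ioo, ← ENNReal.ofReal_mul (by positivity)]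
    apply ENNReal.ofReal_le_ofReal
    linarith
  have := hlow.trans (hF.trans hup)
  by_contra! hcon
  have hBn : 0 ≤ 2 * (B * K0) := by
    have := (hs.nonneg c (hc (mem_closedBall_self (by positivity)))).trans (hB c (mem_closedBall_self (by positivity)))
    have := K0_nonneg
    positivity
  rw [ENNReal.ofReal_le_ofReal_iff hBn] at this
  linarith

/-- points on circle -/
lemma circ_pt {z c : ℂ} {s : ℝ} (h : dist z c = s) : ∃ θ ∈ Ioc (-Real.pi) Real.pi, z = c + s * cexp (θ * I) := by
  refine ⟨Complex.arg (z - c), ⟨Complex.neg_pi_lt_arg _, Complex.arg_le_pi _⟩, ?_⟩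
  rw [← h, dist_eq_norm, Complex.norm_mul_exp_arg_mul_I]; ring

/-- a solution vanishing on a circle vanishes inside -/
lemma zero_inside (hs : IsClassicalSolution (ball 0 R) u) {c : ℂ} {s : ℝ} (hsp : 0 < s)
    (hc : closedBall c s ⊆ ball 0 R) (h : ∀ z, dist z c = s → u z ≤ 0) : ∀ z ∈ ball c s, u z ≤ 0 := by
  intro z hz
  by_contra! hp
  have hop : IsOpen (posSet (ball 0 R) u ∩ ball c s) := (posSet_open isOpen_ball hs).inter isOpen_ball
  have hH := (har_pos isOpen_ball hs).mono (inter_subset_left (t := ball c s)) hop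
  have hcl : closure (posSet (ball 0 R) u ∩ ball c s) ⊆ closedBall c s :=
    (closure_mono inter_subset_right).trans closure_ball_subset_closedBall
  have := hH.max_principle (isBounded_ball.subset inter_subset_right) (M := 0)
    (hs.contOn.mono (hcl.trans hc)) ?_ z ⟨⟨hc (ball_subset_closedBall hz), hp⟩, hz⟩
  · linarith
  · intro w hw
    have hwc := hcl hw.1
    rcases (mem_closedBall.1 hwc).eq_or_lt with h1 | h1
    · exact h w h1
    · by_contra! hpw
      exact hw.2 (by rw [hop.interior_eq]; exact ⟨⟨hc hwc, hpw⟩, h1⟩)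

/-- nondegeneracy -/
lemma nondeg (hs : IsClassicalSolution (ball 0 R) u)
    (hnc : ∀ z ∈ FB (ball 0 R) u, ¬ IsCompact (connectedComponentIn (FB (ball 0 R) u) z))
    {x : ℂ} {M : ℝ} (hM : 0 < M) (hx : x ∈ FB (ball 0 R) u)
    (hc : closedBall x (3*M) ⊆ ball 0 R) : ∃ y ∈ closedBall x (3*M), M / (2 * K0 + 1) ≤ u y := by
  by_contra! hcon
  have hK := K0_nonneg
  have hT : ∀ s ∈ Ioo M (2*M), Trans u x s 1 := by
    intro s hsM
    have hs0 : 0 < s := hM.trans hsM.1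
    have hcs : closedBall x s ⊆ ball 0 R := (closedBall_subset_closedBall (by linarith [hsM.2])).trans hc
    obtain ⟨E, -, -, -, hEF, y, hy, hys⟩ := exists_E hs hnc hx (by simpa using hs0.le) hcs
    obtain ⟨a, ha, hya⟩ := circ_pt hys
    obtain ⟨w, hws, hw⟩ : ∃ w, dist w x = s ∧ 0 < u w := by
      by_contra! hno
      have hz := zero_inside hs hs0 hcs hno
      have := ((mem_FB_iff isOpen_ball hs).1 hx).2.2
      obtain ⟨p, hp, hpb⟩ := Metric.mem_closure_iff.1 this s hs0
      have := hz p (by rw [mem_ball, dist_comm]; exact hpb)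
      linarith [hp.2]
    obtain ⟨b, hb, hwb⟩ := circ_pt hws
    refine ⟨fun i => if i = 0 then -Real.pi else Real.pi, by simp, by simp, ?_⟩
    intro i hi
    obtain rfl : i = 0 := by omega
    refine ⟨by simp; linarith [Real.pi_pos], a, ?_, b, ?_, ?_, ?_⟩
    · simpa using Ioc_subset_Icc_self ha
    · simpa using Ioc_subset_Icc_self hb
    · rw [← hya, FB_zero hs (hEF hy)]
    · rw [← hwb]; exact hw
  have := trans_bound hs hM hc (fun z hz => (hcon z hz).le) hT
  have h2 : M / (2*K0+1) * K0 * 2 < M := by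
    rw [div_mul_eq_mul_div, div_mul_eq_mul_div, div_lt_iff₀ (by positivity)]
    nlinarith
  push_cast at this
  linarith

/-- counting lemma: free boundary points with distinct values of `Y` -/
lemma count (hs : IsClassicalSolution (ball 0 R) u) (h0 : (0:ℂ) ∈ FB (ball 0 R) u)
    (hnc : ∀ z ∈ FB (ball 0 R) u, ¬ IsCompact (connectedComponentIn (FB (ball 0 R) u) z))
    {Y : ℂ → ℂ} (hYc : ContinuousOn Y (ball 0 (R/8)))
    (hY0 : ∀ z ∈ ball (0:ℂ) (R/8), (∀ᶠ w in 𝓝 z, u w = 0) → HasFDerivAt Y (0 : ℂ →L[ℝ] ℂ) z)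
    {M : ℝ} (hM : 0 < M) (hMR : 3 * M < R / 8) {N : ℕ} (x : Fin (N+1) → ℂ)
    (hxF : ∀ i, x i ∈ FB (ball 0 R) u) (hxM : ∀ i, ‖x i‖ ≤ M) (hinj : Function.Injective fun i => Y (x i)) :
    (N : ℝ) ≤ 24 * K0 := by
  have hRp := R_pos h0
  have hc : closedBall (0:ℂ) (3*M) ⊆ ball 0 R := closedBall_subset_ball (by linarith)
  have hB : ∀ z ∈ closedBall (0:ℂ) (3*M), u z ≤ 12 * M := by
    intro z hz
    have hz' : ‖z‖ ≤ 3*M := by simpa using hz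
    have h0z := FB_zero hs h0
    have := (u_lip hs h0).dist_le_mul z (by simp; linarith) 0 (by simp; linarith)
    rw [h0z, Real.dist_eq, sub_zero, dist_zero_right] at this
    have h3 := (le_abs_self _).trans this
    norm_num at h3
    linarith
  have hT : ∀ s ∈ Ioo M (2*M), Trans u 0 s N := by
    intro s hsM
    have hs0 : 0 < s := hM.trans hsM.1
    have hcs : closedBall (0:ℂ) s ⊆ ball 0 R := (closedBall_subset_closedBall (by linarith [hsM.2])).trans hc
    have hcs8 : closedBall (0:ℂ) s ⊆ ball 0 (R/8) := closedBall_subset_ball (by linarith [hsM.2])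
    have hz : ∀ i, ∃ θ ∈ Ioc (-Real.pi) Real.pi, u (0 + s * cexp (θ * I)) = 0 ∧
        Y (0 + s * cexp (θ * I)) = Y (x i) := by
      intro i
      obtain ⟨E, hEc, hxE, hEs, hEF, y, hy, hys⟩ := exists_E hs hnc (hxF i)
        (by rw [dist_zero_right]; exact (hxM i).trans hsM.1.le) hcs
      obtain ⟨θ, hθ, hyθ⟩ := circ_pt hys
      refine ⟨θ, hθ, ?_, ?_⟩
      · rw [← hyθ]; exact FB_zero hs (hEF hy)
      · rw [← hyθ]
        exact Y_const_conn hs hYc hY0 hRp hEc (hEs.trans hcs8) (fun z hz => FB_zero hs (hEF hz)) y hy _ hxE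
    choose θ hθ huθ hYθ using hz
    have hθi : Function.Injective θ := by
      intro i j hij
      apply hinj
      simp only
      rw [← hYθ i, ← hYθ j, hij]
    set S : Finset ℝ := Finset.univ.image θ with hS
    have hcard : S.card = N + 1 := by
      rw [hS, Finset.card_image_of_injective _ hθi]; simp
    set o := S.orderEmbOfFin hcard with ho
    have hoS : ∀ i, ∃ j, θ j = o i := by
      intro i
      have := S.orderEmbOfFin_mem hcard i
      obtain ⟨j, -, hj⟩ := Finset.mem_image.1 this
      exact ⟨j, hj⟩
    set t : ℕ → ℝ := fun n => if h : n < N + 1 then o ⟨n, h⟩ else 0 with ht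
    have htn : ∀ n (h : n < N + 1), t n = o ⟨n, h⟩ := fun n h => by rw [ht]; simp [h]
    have htj : ∀ n, n < N + 1 → ∃ j, θ j = t n := fun n h => by rw [htn n h]; exact hoS _
    have htlt : ∀ n, n < N → t n < t (n+1) := by
      intro n h
      rw [htn n (by omega), htn (n+1) (by omega)]
      exact o.strictMono (by simp)
    refine ⟨t, ?_, ?_, ?_⟩
    · obtain ⟨j, hj⟩ := htj 0 (by omega)
      rw [← hj]; exact (hθ j).1.le
    · obtain ⟨j, hj⟩ := htj N (by omega)
      rw [← hj]; exact (hθ j).2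
    · intro i hi
      have hlt := htlt i hi
      refine ⟨hlt.le, t i, ⟨le_rfl, hlt.le⟩, ?_⟩
      obtain ⟨j, hj⟩ := htj i (by omega)
      obtain ⟨j', hj'⟩ := htj (i+1) (by omega)
      by_contra! hno
      have hno' := fun b hb => hno b hb (by rw [← hj, huθ j])
      -- the arc lies in the zero set
      set γ : ℝ → ℂ := fun b => 0 + s * cexp (b * I) with hγ
      have hγc : Continuous γ := by rw [hγ]; fun_prop
      have hγs : ∀ b, γ b ∈ closedBall (0:ℂ) s := by
        intro b
        simp [hγ, norm_exp_ofReal_mul_I, abs_of_pos hs0]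
      have harc : IsPreconnected (γ '' Icc (t i) (t (i+1))) := isPreconnected_Icc.image _ hγc.continuousOn
      have hYY := Y_const_conn hs hYc hY0 hRp harc (by rintro _ ⟨b, -, rfl⟩; exact hcs8 (hγs b))
        (by
          rintro _ ⟨b, hb, rfl⟩
          exact le_antisymm (hno' b hb) (hs.nonneg _ (hcs (hγs b))))
        (γ (t i)) ⟨t i, ⟨le_rfl, hlt.le⟩, rfl⟩ (γ (t (i+1))) ⟨t (i+1), ⟨hlt.le, le_rfl⟩, rfl⟩
      rw [← hj, ← hj'] at hYY
      have : Y (x j) = Y (x j') := by rw [← hYθ j, ← hYθ j']; exact hYY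
      have hjj := hinj this
      rw [← hj, ← hj', hjj] at hlt
      exact lt_irrefl _ hlt
  have := trans_bound hs hM hc hB hT
  by_contra! hcon
  have := mul_pos (sub_pos.2 hcon) hM
  linarith

end OP

namespace OP

lemma tlu_ball {E : Type*} [PseudoMetricSpace E] {F : ℕ → ℂ → E} {G : ℂ → E}
    (h : TendstoLocallyUniformly F G atTop) (c : ℂ) (r : ℝ) :
    TendstoUniformlyOn F G atTop (ball c r) := by
  have h1 : TendstoLocallyUniformlyOn F G atTop (closedBall c r) := h.tendstoLocallyUniformlyOn
  exact ((tendstoLocallyUniformlyOn_iff_tendstoUniformlyOn_of_compact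
    (isCompact_closedBall c r)).1 h1).mono ball_subset_closedBall

lemma tlu_tendsto {E : Type*} [PseudoMetricSpace E] {F : ℕ → ℂ → E} {G : ℂ → E}
    (h : TendstoLocallyUniformly F G atTop) (c : ℂ) : Tendsto (fun n => F n c) atTop (𝓝 (G c)) :=
  (tlu_ball h c 1).tendsto_at (mem_ball_self one_pos)

lemma om_limit {V : ℕ → ℂ → ℝ} {U : ℂ → ℝ} {Y : ℕ → ℂ → ℂ} {Yl : ℂ → ℂ} {c : ℂ} {r : ℝ} (hr : 0 < r)
    (hV : ∀ᶠ n in atTop, Har (V n) (ball c r))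
    (hu : TendstoUniformlyOn V U atTop (ball c r))
    (hY : ∀ᶠ n in atTop, ∀ w ∈ ball c r, HasFDerivAt (Y n) (om (cg (V n) w ^ 2) 1) w)
    (hYl : ∀ w ∈ ball c r, Tendsto (fun n => Y n w) atTop (𝓝 (Yl w))) :
    HasFDerivAt Yl (om (cg U c ^ 2) 1) c := by
  obtain ⟨h1, h2⟩ := har_limit hr hV hu
  have hcb : ContinuousOn (cg U) (closedBall c (r/4)) :=
    h1.hol.continuousOn.mono (closedBall_subset_ball (by linarith))
  obtain ⟨C, hC⟩ := (isCompact_closedBall c (r/4)).exists_bound_of_continuousOn hcb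
  have hC0 : 0 ≤ C := (norm_nonneg _).trans (hC c (by simp; linarith))
  obtain ⟨N, hN⟩ := eventually_atTop.1 hY
  have hsub : ball c (r/4) ⊆ ball c r := ball_subset_ball (by linarith)
  refine hasFDerivAt_of_tendstoUniformlyOn (l := atTop) (s := ball c (r/4)) isOpen_ball
    (f := fun n => Y (n + N)) (f' := fun n w => om (cg (V (n+N)) w ^ 2) 1)
    (g' := fun w => om (cg U w ^ 2) 1) ?_ (fun n w hw => hN _ (by omega) w (hsub hw))
    (fun w hw => (hYl w (hsub hw)).comp (tendsto_add_atTop_nat N)) (mem_ball_self (by linarith))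
  rw [tendstoUniformlyOn_iff] at h2 ⊢
  intro ε hε
  have he : 0 < min 1 (ε / (1 + 2 * C)) := by positivity
  filter_upwards [(tendsto_add_atTop_nat N).eventually (h2 _ he)] with n hn w hw
  have hw1 := hn w (ball_subset_ball (by linarith) hw)
  rw [dist_eq_norm] at hw1 ⊢
  rw [om_sub]
  refine (norm_om_le _ _).trans_lt ?_
  have hb := hC w (ball_subset_closedBall hw)
  set a := cg U w
  set b := cg (V (n+N)) w
  have e1 : a ^ 2 - b ^ 2 = (a - b) * (2 * a - (a - b)) := by ring
  rw [e1, norm_mul, sub_self, norm_zero, add_zero]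
  have e2 : ‖2 * a - (a - b)‖ ≤ 2 * C + 1 := by
    refine (norm_sub_le _ _).trans ?_
    rw [norm_mul]
    have := (lt_min_iff.1 hw1).1
    simp; linarith
  have e3 := (lt_min_iff.1 hw1).2
  calc ‖a - b‖ * ‖2 * a - (a - b)‖ ≤ ‖a - b‖ * (2 * C + 1) := by gcongr
    _ < ε / (1 + 2 * C) * (2 * C + 1) := by gcongr
    _ = ε := by field_simp; ring

lemma conj_hasFDerivAt {W : ℂ → ℂ} {c z : ℂ} (h : HasFDerivAt W (om 1 (conj c)) z) :
    HasFDerivAt (fun w => conj (W w)) (om c 1) z := by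
  have := (conjCLE : ℂ ≃L[ℝ] ℂ).toContinuousLinearMap.hasFDerivAt.comp z h
  refine HasFDerivAt.congr_fderiv (f := fun w => conj (W w)) this ?_
  ext v <;> simp <;> ring

lemma conj_hasFDerivAt' {Y : ℂ → ℂ} {c z : ℂ} (h : HasFDerivAt Y (om c 1) z) :
    HasFDerivAt (fun w => conj (Y w)) (om 1 (conj c)) z := by
  have := (conjCLE : ℂ ≃L[ℝ] ℂ).toContinuousLinearMap.hasFDerivAt.comp z h
  refine HasFDerivAt.congr_fderiv (f := fun w => conj (Y w)) this ?_
  ext v <;> simp <;> ring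

structure Lim (U : ℂ → ℝ) (W : ℂ → ℂ) : Prop where
  lip : LipschitzWith 4 U
  nn : ∀ z, 0 ≤ U z
  u0 : U 0 = 0
  har : Har U {z | 0 < U z}
  wlip : LipschitzWith 17 W
  wd : ∀ z, 0 < U z → HasFDerivAt W (om 1 (conj (cg U z ^ 2))) z
  far : ∀ x ∈ frontier {z | 0 < U z}, ∀ ρ > 0, ∃ x', dist x' x = ρ ∧ W x' = W x
  ext : ∀ x ∉ closure {z | 0 < U z}, (∀ᶠ w in 𝓝 x, W w = W x) ∨ (∀ᶠ w in 𝓝 x, W w - w = W x - x)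
  nd : ∃ c > 0, ∀ x ∈ frontier {z | 0 < U z}, ∀ r > 0, ∃ y ∈ ball x r, c * r ≤ U y
  fin : ∀ (N : ℕ) (x : Fin (N+1) → ℂ), (∀ i, x i ∈ frontier {z | 0 < U z}) →
    Function.Injective (fun i => W (x i)) → (N:ℝ) ≤ 24 * K0
  o0 : (0:ℂ) ∈ frontier {z | 0 < U z}

structure Sq (R : ℕ → ℝ) (v : ℕ → ℂ → ℝ) (Y : ℕ → ℂ → ℂ) (U : ℂ → ℝ) (V : ℂ → ℂ) : Prop where
  hR : Tendsto R atTop atTop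
  hs : ∀ n, IsClassicalSolution (ball 0 (R n)) (v n)
  h0 : ∀ n, (0:ℂ) ∈ FB (ball 0 (R n)) (v n)
  hnc : ∀ n, ∀ z ∈ FB (ball 0 (R n)) (v n), ¬ IsCompact (connectedComponentIn (FB (ball 0 (R n)) (v n)) z)
  yl : ∀ n, LipschitzOnWith 17 (Y n) (ball 0 (R n / 8))
  yd : ∀ n, ∀ z ∈ ball (0:ℂ) (R n/8), 0 < v n z → HasFDerivAt (Y n) (om (cg (v n) z ^ 2) 1) z
  yz : ∀ n, ∀ z ∈ ball (0:ℂ) (R n/8), (∀ᶠ w in 𝓝 z, v n w = 0) → HasFDerivAt (Y n) (0 : ℂ →L[ℝ] ℂ) z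
  cu : TendstoLocallyUniformly v U atTop
  cy : TendstoLocallyUniformly Y V atTop
  ul : LipschitzWith 4 U
  vl : LipschitzWith 17 V

variable {R : ℕ → ℝ} {v : ℕ → ℂ → ℝ} {Y : ℕ → ℂ → ℂ} {U : ℂ → ℝ} {V : ℂ → ℂ}

lemma no_FB {R : ℝ} {u : ℂ → ℝ} (hs : IsClassicalSolution (ball 0 R) u) {x : ℂ} {δ : ℝ}
    (hb : ball x δ ⊆ ball 0 R) (hno : ∀ y ∈ ball x δ, y ∉ FB (ball 0 R) u) :
    (∀ y ∈ ball x δ, 0 < u y) ∨ (∀ y ∈ ball x δ, u y = 0) := by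
  by_cases hp : ∃ p ∈ ball x δ, 0 < u p
  · left
    obtain ⟨p, hp1, hp2⟩ := hp
    have ho := posSet_open isOpen_ball hs
    have := (convex_ball x δ).isPreconnected.subset_left_of_subset_union ho
      (isClosed_closure (s := posSet (ball 0 R) u)).isOpen_compl
      (Set.disjoint_left.2 fun y hy hy' => hy' (subset_closure hy))
      (fun y hy => by
        by_cases hyc : y ∈ closure (posSet (ball 0 R) u)
        · left
          refine ⟨hb hy, lt_of_le_of_ne (hs.nonneg y (hb hy)) fun h => ?_⟩
          exact hno y hy ((mem_FB_iff isOpen_ball hs).2 ⟨hb hy, h.symm, hyc⟩)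
        · exact Or.inr hyc) ⟨p, hp1, hb hp1, hp2⟩
    exact fun y hy => (this hy).2
  · right
    push Not at hp
    exact fun y hy => le_antisymm (hp y hy) (hs.nonneg y (hb hy))

namespace Sq

variable (S : Sq R v Y U V)
include S

lemma ev_ball (c : ℂ) (r : ℝ) : ∀ᶠ n in atTop, closedBall c r ⊆ ball 0 (R n / 8) := by
  filter_upwards [S.hR.eventually_gt_atTop (8 * (‖c‖ + r))] with n hn
  intro y hy
  have h1 : dist y c ≤ r := hy
  have h2 := dist_triangle y c 0
  simp only [dist_zero_right] at h2
  simp only [mem_ball, dist_zero_right]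
  linarith

lemma sub8 (n : ℕ) : ball (0:ℂ) (R n/8) ⊆ ball 0 (R n) := by
  have := R_pos (S.h0 n)
  exact ball_subset_ball (by linarith)

lemma nn (z : ℂ) : 0 ≤ U z := by
  refine ge_of_tendsto (tlu_tendsto S.cu z) ?_
  filter_upwards [S.ev_ball z 1] with n hn
  exact (S.hs n).nonneg z (S.sub8 n (hn (by simp)))

lemma op : IsOpen {z | 0 < U z} := isOpen_lt continuous_const S.ul.continuous

lemma fr0 {x : ℂ} (hx : x ∈ frontier {z | 0 < U z}) : U x = 0 := by
  rw [S.op.frontier_eq] at hx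
  exact le_antisymm (not_lt.1 hx.2) (S.nn x)

/-- `v n` positive near a positive point -/
lemma pos_near {z : ℂ} (hz : 0 < U z) : ∃ r > 0, ∀ᶠ n in atTop, ball z r ⊆ ball 0 (R n / 8) ∧ ∀ w ∈ ball z r, 0 < v n w := by
  refine ⟨U z / 16, by positivity, ?_⟩
  have := tendstoUniformlyOn_iff.1 (tlu_ball S.cu z (U z / 16)) (U z / 4) (by positivity)
  filter_upwards [this, S.ev_ball z (U z / 16)] with n hn hb
  refine ⟨ball_subset_closedBall.trans hb, fun w hw => ?_⟩
  have h1 := hn w hw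
  have h2 := S.ul.dist_le_mul z w
  have h3 : dist w z < U z / 16 := hw
  rw [dist_comm z w] at h2
  rw [Real.dist_eq, abs_lt] at h1
  rw [Real.dist_eq, abs_le] at h2
  push_cast at h2
  linarith [h1.2, h2.2]

lemma ev_har {z : ℂ} {r : ℝ} (h : ∀ᶠ n in atTop, ball z r ⊆ ball 0 (R n / 8) ∧ ∀ w ∈ ball z r, 0 < v n w) :
    ∀ᶠ n in atTop, Har (v n) (ball z r) := by
  filter_upwards [h] with n hn
  exact (har_pos isOpen_ball (S.hs n)).mono (fun w hw => ⟨S.sub8 n (hn.1 hw), hn.2 w hw⟩) isOpen_ball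

lemma harU : Har U {z | 0 < U z} := by
  have key : ∀ z, 0 < U z → ∃ r > 0, Har U (ball z r) := fun z hz => by
    obtain ⟨r, hr, h⟩ := S.pos_near hz
    exact ⟨r/2, by positivity, (har_limit hr (S.ev_har h) (tlu_ball S.cu z r)).1⟩
  refine ⟨S.op, fun z hz => ?_, fun z hz => ?_⟩
  · obtain ⟨r, hr, h⟩ := key z hz
    exact h.hd z (mem_ball_self hr)
  · obtain ⟨r, hr, h⟩ := key z hz
    exact (h.hol.differentiableAt (isOpen_ball.mem_nhds (mem_ball_self hr))).differentiableWithinAt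

lemma vd {z : ℂ} (hz : 0 < U z) : HasFDerivAt V (om (cg U z ^ 2) 1) z := by
  obtain ⟨r, hr, h⟩ := S.pos_near hz
  refine om_limit hr (S.ev_har h) (tlu_ball S.cu z r) ?_ (fun w _ => tlu_tendsto S.cy w)
  filter_upwards [h] with n hn w hw
  exact S.yd n w (hn.1 hw) (hn.2 w hw)

lemma lemA {x : ℂ} (hx : x ∈ frontier {z | 0 < U z}) {δ : ℝ} (hδ : 0 < δ) :
    ∀ᶠ n in atTop, ∃ y ∈ ball x δ, y ∈ FB (ball 0 (R n)) (v n) := by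
  have hxc : x ∈ closure {z | 0 < U z} := frontier_subset_closure hx
  obtain ⟨p, hp, hpx⟩ := Metric.mem_closure_iff.1 hxc (δ/4) (by positivity)
  have hp' : 0 < U p := hp
  have t1 := (tlu_tendsto S.cu p).eventually (lt_mem_nhds (show U p / 2 < U p by linarith))
  have t2 := (tlu_tendsto S.cu x).eventually (gt_mem_nhds (show U x < U p / 6 by rw [S.fr0 hx]; linarith))
  filter_upwards [t1, t2, S.ev_ball x δ] with n h1 h2 h3
  by_contra! hcon
  have hb : ball x δ ⊆ ball 0 (R n) := (ball_subset_closedBall.trans h3).trans (S.sub8 n)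
  have hpb : p ∈ ball x δ := by rw [mem_ball, dist_comm]; linarith
  rcases no_FB (S.hs n) hb hcon with h | h
  · have hsub : ball p (δ/2) ⊆ ball x δ := by
      apply ball_subset_ball'; rw [dist_comm]; linarith
    have hh := (har_pos isOpen_ball (S.hs n)).mono (O' := ball p (δ/2))
      (fun w hw => ⟨hb (hsub hw), h w (hsub hw)⟩) isOpen_ball
    have := (hh.harnack (by positivity) subset_rfl (fun w hw => h w (hsub hw))).1 x
      (by rw [mem_ball]; linarith)
    have e : dist x p / (δ/2) ≤ 1/2 := by
      rw [div_le_iff₀ (by positivity)]; linarith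
    have hvx := h x (mem_ball_self hδ)
    nlinarith
  · rw [h p hpb] at h1; linarith

lemma nd : ∃ c > 0, ∀ x ∈ frontier {z | 0 < U z}, ∀ r > 0, ∃ y ∈ ball x r, c * r ≤ U y := by
  have hK := K0_nonneg
  refine ⟨1 / (16 * (2 * K0 + 1)), by positivity, fun x hx r hr => ?_⟩
  have hM : 0 < r / 8 := by positivity
  have h1 := S.lemA hx (δ := r/8) hM
  have h2 := tendstoUniformlyOn_iff.1 (tlu_ball S.cu x r) (r / 16 / (2 * K0 + 1)) (by positivity)
  obtain ⟨n, ⟨y, hy, hyF⟩, h2, h3⟩ := (h1.and (h2.and (S.ev_ball x r))).exists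
  have hsub : closedBall y (3 * (r/8)) ⊆ ball x r := by
    apply closedBall_subset_ball'
    have : dist y x < r/8 := hy
    linarith
  obtain ⟨z, hz, hvz⟩ := nondeg (S.hs n) (S.hnc n) hM hyF
    ((hsub.trans (ball_subset_closedBall.trans h3)).trans (S.sub8 n))
  refine ⟨z, hsub hz, ?_⟩
  have h4 := h2 z (hsub hz)
  rw [Real.dist_eq, abs_lt] at h4
  have e1 : r / 8 / (2 * K0 + 1) = 2 * (r / 16 / (2 * K0 + 1)) := by ring
  have e2 : 1 / (16 * (2 * K0 + 1)) * r = r / 16 / (2 * K0 + 1) := by field_simp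
  rw [e2]; linarith [h4.1]

lemma o0 : (0:ℂ) ∈ frontier {z | 0 < U z} := by
  have hU0 : U 0 = 0 := by
    have h1 := tlu_tendsto S.cu 0
    have h2 : (fun n => v n 0) = fun _ => 0 := funext fun n => FB_zero (S.hs n) (S.h0 n)
    rw [h2] at h1
    exact (tendsto_nhds_unique h1 tendsto_const_nhds)
  rw [S.op.frontier_eq]
  refine ⟨?_, by simp [hU0]⟩
  have hK := K0_nonneg
  rw [Metric.mem_closure_iff]
  intro ε hε
  have hM : 0 < ε / 8 := by positivity
  have h2 := tendstoUniformlyOn_iff.1 (tlu_ball S.cu 0 ε) (ε / 8 / (2 * K0 + 1)) (by positivity)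
  obtain ⟨n, h2, h3⟩ := (h2.and (S.ev_ball 0 ε)).exists
  have hsub : closedBall (0:ℂ) (3 * (ε/8)) ⊆ ball 0 ε := closedBall_subset_ball (by linarith)
  obtain ⟨z, hz, hvz⟩ := nondeg (S.hs n) (S.hnc n) hM (S.h0 n)
    ((hsub.trans (ball_subset_closedBall.trans h3)).trans (S.sub8 n))
  refine ⟨z, ?_, by rw [dist_comm]; exact hsub hz⟩
  have h4 := h2 z (hsub hz)
  rw [Real.dist_eq, abs_lt] at h4
  show 0 < U z
  linarith [h4.1]

lemma fin (N : ℕ) (x : Fin (N+1) → ℂ) (hx : ∀ i, x i ∈ frontier {z | 0 < U z})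
    (hinj : Function.Injective (fun i => V (x i))) : (N:ℝ) ≤ 24 * K0 := by
  -- separation
  have hsep : ∃ d > 0, ∀ i j, i ≠ j → d ≤ dist (V (x i)) (V (x j)) := by
    have : ∀ᶠ d in 𝓝[>] (0:ℝ), ∀ i j, i ≠ j → d ≤ dist (V (x i)) (V (x j)) := by
      rw [eventually_all]; intro i
      rw [eventually_all]; intro j
      by_cases hij : i = j
      · exact Eventually.of_forall fun d h => absurd hij h
      · have hpos : 0 < dist (V (x i)) (V (x j)) := dist_pos.2 fun h => hij (hinj h)
        filter_upwards [nhdsWithin_le_nhds (gt_mem_nhds hpos)] with d hd _ using hd.le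
    obtain ⟨d, h1, h2⟩ := (this.and self_mem_nhdsWithin).exists
    exact ⟨d, h2, h1⟩
  obtain ⟨d, hd, hsep⟩ := hsep
  obtain ⟨B, hB⟩ := (Set.finite_range fun i => ‖x i‖).bddAbove
  have hB' : ∀ i, ‖x i‖ ≤ B := fun i => hB ⟨i, rfl⟩
  have hB0 : 0 ≤ B := (norm_nonneg _).trans (hB' 0)
  have hδ : 0 < min 1 (d / 100) := by positivity
  have h1 : ∀ᶠ n in atTop, ∀ i, ∃ y ∈ ball (x i) (min 1 (d/100)), y ∈ FB (ball 0 (R n)) (v n) :=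
    eventually_all.2 fun i => S.lemA (hx i) hδ
  have h2 : ∀ᶠ n in atTop, ∀ z ∈ ball (0:ℂ) (B + 1), dist (V z) (Y n z) < d / 8 :=
    tendstoUniformlyOn_iff.1 (tlu_ball S.cy 0 (B+1)) (d/8) (by positivity)
  obtain ⟨n, h1, h2, h3⟩ := (h1.and (h2.and (S.hR.eventually_gt_atTop (8 * (3 * (B + 1)))))).exists
  choose y hy hyF using h1
  have hyn : ∀ i, ‖y i‖ < B + 1 := fun i => by
    have e1 : dist (y i) (x i) < 1 := (lt_min_iff.1 (hy i)).1
    have e2 := norm_le_norm_add_norm_sub' (y i) (x i)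
    rw [dist_eq_norm] at e1
    linarith [hB' i]
  refine count (S.hs n) (S.h0 n) (S.hnc n) (S.yl n).continuousOn (S.yz n) (M := B + 1) (by linarith)
    (by linarith) y hyF (fun i => (hyn i).le) ?_
  intro i j hij
  by_contra hne
  have hij' : Y n (y i) = Y n (y j) := hij
  have e0 := hsep i j hne
  have a1 := h2 (y i) (by simpa using hyn i)
  have a2 := h2 (y j) (by simpa using hyn j)
  have b1 := S.vl.dist_le_mul (x i) (y i)
  have b2 := S.vl.dist_le_mul (x j) (y j)
  have c1 : dist (y i) (x i) < d/100 := (lt_min_iff.1 (hy i)).2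
  have c2 : dist (y j) (x j) < d/100 := (lt_min_iff.1 (hy j)).2
  rw [dist_comm (x i)] at b1
  rw [dist_comm (x j)] at b2
  push_cast at b1 b2
  have t1 := dist_triangle (V (x i)) (V (y i)) (V (x j))
  have t2 := dist_triangle (V (y i)) (V (y j)) (V (x j))
  have t3 := dist_triangle (V (y i)) (Y n (y i)) (V (y j))
  rw [hij', dist_comm (Y n (y j))] at t3
  rw [hij'] at a1
  rw [dist_comm (V (y j)) (V (x j))] at t2
  linarith

lemma far {x : ℂ} (hx : x ∈ frontier {z | 0 < U z}) {ρ : ℝ} (hρ : 0 < ρ) :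
    ∃ x', dist x' x = ρ ∧ V x' = V x := by
  have key : ∀ ε > 0, ∃ w ∈ sphere x ρ, dist (V w) (V x) ≤ ε := by
    intro ε hε
    have h1 := S.lemA hx (δ := min ρ (ε/100)) (by positivity)
    have h2 : ∀ᶠ n in atTop, ∀ z ∈ ball x (2*ρ), dist (V z) (Y n z) < ε / 8 :=
      tendstoUniformlyOn_iff.1 (tlu_ball S.cy x (2*ρ)) (ε/8) (by positivity)
    obtain ⟨n, ⟨y, hy, hyF⟩, h2, h3⟩ := (h1.and (h2.and (S.ev_ball x ρ))).exists
    have hy1 := lt_min_iff.1 (mem_ball.1 hy)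
    obtain ⟨E, hE1, hE2, hE3, hE4, w, hw, hwd⟩ := exists_E (S.hs n) (S.hnc n) hyF (c := x) (r := ρ) hy1.1.le
      (h3.trans (S.sub8 n))
    refine ⟨w, hwd, ?_⟩
    have := Y_const_conn (S.hs n) (S.yl n).continuousOn (S.yz n) (R_pos (S.h0 n)) hE1 (hE3.trans h3)
      (fun z hz => FB_zero (S.hs n) (hE4 hz)) y hE2 w hw
    have a1 := h2 y (by rw [mem_ball]; linarith [hy1.1])
    have a2 := h2 w (by rw [mem_ball]; linarith)
    have b := S.vl.dist_le_mul y x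
    push_cast at b
    have t1 := dist_triangle (V w) (Y n w) (V x)
    have t2 := dist_triangle (Y n w) (V y) (V x)
    rw [this] at a1
    rw [dist_comm (Y n w) (V y)] at t2
    linarith [hy1.2]
  have hne : (sphere x ρ).Nonempty := NormedSpace.sphere_nonempty.2 hρ.le
  obtain ⟨w, hw, hmin⟩ := (isCompact_sphere x ρ).exists_isMinOn hne
    (f := fun w => dist (V w) (V x)) (by have := S.vl.continuous; fun_prop)
  refine ⟨w, hw, ?_⟩
  rw [← dist_le_zero]
  refine le_of_forall_pos_le_add fun ε hε => ?_
  obtain ⟨w', hw', h'⟩ := key ε hε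
  have : dist (V w) (V x) ≤ dist (V w') (V x) := hmin hw'
  linarith

lemma ext {x : ℂ} (hx : x ∉ closure {z | 0 < U z}) :
    (∀ᶠ w in 𝓝 x, V w = V x) ∨ (∀ᶠ w in 𝓝 x, V w - conj w = V x - conj x) := by
  have hK := K0_nonneg
  obtain ⟨δ, hδ, hb⟩ := Metric.isOpen_iff.1 (isClosed_closure (s := {z | 0 < U z})).isOpen_compl x hx
  have hU0 : ∀ w ∈ ball x δ, U w = 0 := fun w hw =>
    le_antisymm (not_lt.1 fun h => hb hw (subset_closure h)) (S.nn w)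
  have hsm : ∀ ε > 0, ∀ᶠ n in atTop, ∀ w ∈ ball x δ, v n w < ε := fun ε hε => by
    filter_upwards [tendstoUniformlyOn_iff.1 (tlu_ball S.cu x δ) ε hε] with n hn w hw
    have := hn w hw
    rw [hU0 w hw, Real.dist_eq, abs_lt] at this
    linarith [this.1]
  -- no free boundary points
  have hno : ∀ᶠ n in atTop, ∀ y ∈ ball x (δ/2), y ∉ FB (ball 0 (R n)) (v n) := by
    filter_upwards [hsm (δ/12 / (2 * K0 + 1)) (by positivity), S.ev_ball x δ] with n hn h3 y hy hyF
    have hsub : closedBall y (3 * (δ/12)) ⊆ ball x δ := by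
      apply closedBall_subset_ball'
      have : dist y x < δ/2 := hy
      linarith
    obtain ⟨z, hz, hvz⟩ := nondeg (S.hs n) (S.hnc n) (by positivity : 0 < δ/12) hyF
      ((hsub.trans (ball_subset_closedBall.trans h3)).trans (S.sub8 n))
    linarith [hn z (hsub hz)]
  have hsub2 : ball x (δ/2) ⊆ ball x δ := ball_subset_ball (by linarith)
  have hdich : ∀ᶠ n in atTop, (∀ y ∈ ball x (δ/2), 0 < v n y) ∨ (∀ y ∈ ball x (δ/2), v n y = 0) := by
    filter_upwards [hno, S.ev_ball x δ] with n hn h3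
    exact no_FB (S.hs n) (((hsub2.trans ball_subset_closedBall).trans h3).trans (S.sub8 n)) hn
  have hmem : ball x (δ/4) ∈ 𝓝 x := ball_mem_nhds x (by positivity)
  by_cases hfr : ∃ᶠ n in atTop, ∀ y ∈ ball x (δ/2), v n y = 0
  · left
    filter_upwards [hmem] with w hw
    have hwx : w ∈ ball x (δ/2) := ball_subset_ball (by linarith) hw
    have hf : ∃ᶠ n in atTop, Y n w - Y n x = 0 := by
      refine (hfr.and_eventually (S.ev_ball x δ)).mono fun n hn => ?_
      rw [sub_eq_zero]
      refine const_of_zero_deriv (convex_ball x (δ/2)) (fun z hz => ?_) hwx (mem_ball_self (by positivity))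
      refine S.yz n z (hn.2 (ball_subset_closedBall (hsub2 hz))) ?_
      filter_upwards [isOpen_ball.mem_nhds hz] with w hw using hn.1 w hw
    have ht := (tlu_tendsto S.cy w).sub (tlu_tendsto S.cy x)
    rw [← sub_eq_zero]
    by_contra hne
    exact hf (ht.eventually (isOpen_ne.mem_nhds hne))
  · right
    have hpos : ∀ᶠ n in atTop, ball x (δ/2) ⊆ ball 0 (R n / 8) ∧ ∀ w ∈ ball x (δ/2), 0 < v n w := by
      rw [not_frequently] at hfr
      filter_upwards [hfr, hdich, S.ev_ball x δ] with n h1 h2 h3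
      exact ⟨(hsub2.trans ball_subset_closedBall).trans h3, h2.resolve_right h1⟩
    have hd : ∀ z ∈ ball x (δ/4), HasFDerivAt V (om 0 1) z := by
      intro z hz
      have hzs : ball z (δ/4) ⊆ ball x (δ/2) := by
        apply ball_subset_ball'
        have : dist z x < δ/4 := hz
        linarith
      have hpos' : ∀ᶠ n in atTop, ball z (δ/4) ⊆ ball 0 (R n / 8) ∧ ∀ w ∈ ball z (δ/4), 0 < v n w := by
        filter_upwards [hpos] with n hn
        exact ⟨hzs.trans hn.1, fun w hw => hn.2 w (hzs hw)⟩
      have hV := om_limit (r := δ/4) (by positivity) (S.ev_har hpos') (tlu_ball S.cu z _)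
        (Y := Y) (Yl := V) (by
          filter_upwards [hpos'] with n hn w hw
          exact S.yd n w (hn.1 hw) (hn.2 w hw)) (fun w _ => tlu_tendsto S.cy w)
      have hc0 : cg U z = 0 := by
        apply cg_eq
        have h0 : reL 0 = 0 := by ext v; simp
        rw [h0]
        refine (hasFDerivAt_const (0:ℝ) z).congr_of_eventuallyEq ?_
        filter_upwards [isOpen_ball.mem_nhds (mem_ball_self (x := z) (ε := δ/4) (by positivity))] with w hw
        exact hU0 w (hsub2 (hzs hw))
      rw [hc0] at hV
      simpa using hV
    filter_upwards [hmem] with w hw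
    refine const_of_zero_deriv (convex_ball x (δ/4)) (Y := fun w => V w - conj w)
      (fun z hz => ?_) hw (mem_ball_self (by positivity))
    refine ((hd z hz).sub (conjCLE : ℂ ≃L[ℝ] ℂ).toContinuousLinearMap.hasFDerivAt).congr_fderiv ?_
    ext v <;> simp

lemma toLim : Lim U (fun z => conj (V z)) where
  lip := S.ul
  nn := S.nn
  u0 := S.fr0 S.o0
  har := S.harU
  wlip := by
    refine LipschitzWith.of_dist_le_mul fun x y => ?_
    have := S.vl.dist_le_mul x y
    rwa [← Complex.dist_conj_conj] at this
  wd := fun z hz => conj_hasFDerivAt' (S.vd hz)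
  far := fun x hx ρ hρ => by
    obtain ⟨x', h1, h2⟩ := S.far hx hρ
    exact ⟨x', h1, by simp [h2]⟩
  ext := fun x hx => by
    rcases S.ext hx with h | h
    · left; filter_upwards [h] with w hw; rw [hw]
    · right; filter_upwards [h] with w hw
      have := congrArg conj hw
      simpa using this
  nd := S.nd
  fin := fun N x hx hi => S.fin N x hx fun i j hij => hi (by
    have : V (x i) = V (x j) := hij
    simp [this])
  o0 := S.o0

end Sq

lemma main_lim (R : ℕ → ℝ) (hRpos : ∀ k, 0 < R k)
    (hR : Filter.Tendsto R atTop atTop) (u : ℕ → ℂ → ℝ)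
    (hsol : ∀ k, IsClassicalSolution (ball 0 (R k)) (u k))
    (h0 : ∀ k, (0 : ℂ) ∈ FB (ball 0 (R k)) (u k))
    (hnc : ∀ k, ∀ z ∈ FB (ball 0 (R k)) (u k),
          ¬ IsCompact (connectedComponentIn (FB (ball 0 (R k)) (u k)) z))
    {φ : ℕ → ℕ} {U : ℂ → ℝ} (hφ : StrictMono φ) (hUl : LipschitzWith 4 U)
    (hc : TendstoLocallyUniformly (fun k => u (φ k)) U atTop) : ∃ W, Lim U W := by
  choose Y hY1 hY2 hY3 hY4 using fun n => exists_Y0 (hsol n) (h0 n)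
  have hRφ := hR.comp hφ.tendsto_atTop
  obtain ⟨ψ, V, hψ, hVl, hVc⟩ := arzela_loc (fun n => Y (φ n)) (r := fun n => R (φ n) / 8)
    (hRφ.atTop_div_const (by norm_num)) (fun n => by have := hRpos (φ n); positivity)
    (fun n => hY1 (φ n)) (C := 0) fun n => by simp [hY2]
  refine ⟨_, Sq.toLim (R := fun n => R (φ (ψ n))) (v := fun n => u (φ (ψ n))) (Y := fun n => Y (φ (ψ n)))
    (U := U) (V := V) ⟨hRφ.comp hψ.tendsto_atTop, fun n => hsol _, fun n => h0 _, fun n => hnc _,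
      fun n => hY1 _, fun n => hY3 _, fun n => hY4 _, ?_, hVc, hUl, hVl⟩⟩
  intro s hs x
  obtain ⟨t, ht, h⟩ := hc s hs x
  exact ⟨t, ht, hψ.tendsto_atTop.eventually h⟩

end OP

namespace OP

lemma const_of_zero_derivR {Y : ℂ → ℝ} {C : Set ℂ} (hC : Convex ℝ C)
    (h : ∀ z ∈ C, HasFDerivAt Y (0 : ℂ →L[ℝ] ℝ) z) {x y : ℂ} (hx : x ∈ C) (hy : y ∈ C) :
    Y x = Y y := by
  have := hC.norm_image_sub_le_of_norm_hasFDerivWithin_le (f := Y) (C := 0)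
    (fun z hz => (h z hz).hasFDerivWithinAt) (fun z _ => by simp) hx hy
  simp only [zero_mul] at this
  exact (sub_eq_zero.1 (norm_le_zero_iff.1 this)).symm

lemma hasFDerivAt_lin (b : ℝ) (c p z : ℂ) :
    HasFDerivAt (fun z => b + (c * (z - p)).re) (reL c) z := by
  have h := ((reL c).hasFDerivAt (x := z)).add_const (b - (c * p).re)
  refine h.congr_of_eventuallyEq (Eventually.of_forall fun w => ?_)
  simp [mul_sub]; ring

lemma convex_half (b : ℝ) (c p : ℂ) : Convex ℝ {z : ℂ | 0 < b + (c * (z - p)).re} := by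
  have h1 : {z : ℂ | 0 < b + (c * (z - p)).re} = {z | (c * p).re - b < reL c z} := by
    ext z; simp [mul_sub]; constructor <;> intro h <;> linarith
  rw [h1]
  exact convex_halfSpace_gt (reL c).toLinearMap.isLinear _

lemma isOpen_half (b : ℝ) (c p : ℂ) : IsOpen {z : ℂ | 0 < b + (c * (z - p)).re} :=
  isOpen_lt continuous_const (by fun_prop)

/-- If the gradient is constant near a positive point then `U` is affine on a half plane. -/
lemma halfplane {U : ℂ → ℝ} (hc : Continuous U) (hh : Har U {z | 0 < U z}) {p c : ℂ}
    (hp : 0 < U p) (hev : ∀ᶠ w in 𝓝 p, cg U w = c) :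
    ∀ z, 0 < U p + (c * (z - p)).re → U z = U p + (c * (z - p)).re := by
  set L : ℂ → ℝ := fun z => U p + (c * (z - p)).re with hL
  have ball_eq : ∀ z r, 0 < r → ball z r ⊆ {z | 0 < U z} → (∀ w ∈ ball z r, cg U w = c) →
      ∀ w ∈ ball z r, ∀ w' ∈ ball z r, U w - L w = U w' - L w' := by
    intro z r hr hb hcg w hw w' hw'
    refine const_of_zero_derivR (Y := fun w => U w - L w) (convex_ball z r) (fun y hy => ?_) hw hw'
    have h1 := hh.hd y (hb hy)
    rw [hcg y hy] at h1
    exact (h1.sub (hasFDerivAt_lin _ c p y)).congr_fderiv (sub_self _)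
  set A : Set ℂ := interior {w | U w = L w} with hA
  have hconn : IsPreconnected {z : ℂ | 0 < L z} := (convex_half (U p) c p).isPreconnected
  have hsub := hconn.subset_of_closure_inter_subset (u := A) isOpen_interior ?_ ?_
  · intro z hz
    have h9 : z ∈ {w | U w = L w} := interior_subset (hsub hz)
    exact h9
  · refine ⟨p, by simpa [hL] using hp, ?_⟩
    obtain ⟨r1, h1, hb1⟩ := Metric.isOpen_iff.1 hh.op p hp
    obtain ⟨r2, h2, hb2⟩ := eventually_nhds_iff_ball.1 hev
    refine mem_interior_iff_mem_nhds.2 ?_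
    filter_upwards [ball_mem_nhds p (lt_min h1 h2)] with w hw
    have := ball_eq p (min r1 r2) (lt_min h1 h2) ((ball_subset_ball (min_le_left _ _)).trans hb1)
      (fun w hw => hb2 w (ball_subset_ball (min_le_right _ _) hw)) w hw p (mem_ball_self (lt_min h1 h2))
    simp only [hL, sub_self, mul_zero, zero_re, add_zero] at this
    show U w = L w
    simp only [hL]; linarith
  · rintro z ⟨hz, hzL⟩
    have hLc : Continuous L := by simp only [hL]; fun_prop
    have hcl : IsClosed {w | U w = L w} := isClosed_eq hc hLc
    have hUz : U z = L z := hcl.closure_subset_iff.2 interior_subset hz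
    have hzp : 0 < U z := by rw [hUz]; exact hzL
    obtain ⟨r, hr, hb⟩ := Metric.isOpen_iff.1 hh.op z hzp
    obtain ⟨a, ha, haz⟩ := Metric.mem_closure_iff.1 hz r hr
    have hab : a ∈ ball z r := by rw [mem_ball, dist_comm]; exact haz
    have hcga : cg U =ᶠ[𝓝 a] fun _ => c := by
      filter_upwards [isOpen_interior.mem_nhds ha] with w hw
      apply cg_eq
      refine (hasFDerivAt_lin (U p) c p w).congr_of_eventuallyEq ?_
      filter_upwards [isOpen_interior.mem_nhds hw] with y hy
      have h9 : y ∈ {w | U w = L w} := interior_subset hy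
      exact h9
    have hcg := AnalyticOnNhd.eqOn_of_preconnected_of_eventuallyEq (f := cg U) (g := fun _ => c)
      ((hh.hol.mono hb).analyticOnNhd isOpen_ball) analyticOnNhd_const (convex_ball z r).isPreconnected
      hab hcga
    refine mem_interior_iff_mem_nhds.2 ?_
    filter_upwards [ball_mem_nhds z hr] with w hw
    have := ball_eq z r hr hb hcg w hw z (mem_ball_self hr)
    show U w = L w
    linarith

lemma cg_le_of_lip {U : ℂ → ℝ} (hl : LipschitzWith 4 U) {z : ℂ} (h : HasFDerivAt U (reL (cg U z)) z) :
    ‖cg U z‖ ≤ 4 := by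
  have h1 := h.le_of_lipschitz hl
  have h2 := (reL (cg U z)).le_opNorm (conj (cg U z))
  rw [reL_apply, mul_conj, RCLike.norm_conj] at h2
  simp only [ofReal_re, normSq_eq_norm_sq, Real.norm_eq_abs] at h2
  rw [abs_of_nonneg (by positivity)] at h2
  by_contra! hcon
  push_cast at h1
  nlinarith

/-- rescaled function -/
noncomputable def sc (U : ℂ → ℝ) (a : ℂ) (d : ℝ) : ℂ → ℝ := fun z => d⁻¹ * U (a + d * z)
noncomputable def scW (W : ℂ → ℂ) (a : ℂ) (d : ℝ) : ℂ → ℂ := fun z => (d:ℂ)⁻¹ * (W (a + d * z) - W a)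

lemma aff_hasFDerivAt (a : ℂ) (d : ℝ) (z : ℂ) :
    HasFDerivAt (fun z : ℂ => a + d * z) (d • ContinuousLinearMap.id ℝ ℂ) z := by
  have h := (((hasFDerivAt_id (𝕜 := ℝ) z).const_smul d)).const_add a
  refine h.congr_of_eventuallyEq (Eventually.of_forall fun w => ?_)
  simp

lemma sc_fd {U : ℂ → ℝ} {a : ℂ} {d : ℝ} (hd : 0 < d) {z c : ℂ} (h : HasFDerivAt U (reL c) (a + d * z)) :
    HasFDerivAt (sc U a d) (reL c) z := by
  have := (HasFDerivAt.comp (f := fun z : ℂ => a + d * z) z h (aff_hasFDerivAt a d z)).const_smul d⁻¹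
  refine HasFDerivAt.congr_fderiv (f := sc U a d) this ?_
  ext v
  simp
  field_simp

lemma scW_fd {W : ℂ → ℂ} {a : ℂ} {d : ℝ} (hd : 0 < d) {z α β : ℂ} (h : HasFDerivAt W (om α β) (a + d * z)) :
    HasFDerivAt (scW W a d) (om α β) z := by
  have := ((HasFDerivAt.comp (f := fun z : ℂ => a + d * z) z h (aff_hasFDerivAt a d z)).sub_const
    (W a)).const_smul d⁻¹
  have h2 := HasFDerivAt.congr_fderiv this (g' := om α β) (by
    have hd' : (d:ℂ) ≠ 0 := by exact_mod_cast hd.ne'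
    ext v
    simp
    field_simp)
  refine h2.congr_of_eventuallyEq (Eventually.of_forall fun w => ?_)
  simp [scW]

lemma sc_lip {U : ℂ → ℝ} {K : ℝ≥0} (hl : LipschitzWith K U) (a : ℂ) {d : ℝ} (hd : 0 < d) : LipschitzWith K (sc U a d) := by
  refine LipschitzWith.of_dist_le_mul fun x y => ?_
  have := hl.dist_le_mul (a + d * x) (a + d * y)
  rw [dist_add_left, dist_eq_norm (_ * x), ← mul_sub, norm_mul] at this
  simp only [sc, Real.dist_eq, ← mul_sub, abs_mul, abs_inv, abs_of_pos hd] at this ⊢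
  rw [inv_mul_le_iff₀ hd, dist_eq_norm]
  simp [abs_of_pos hd] at this
  linarith

lemma scW_lip {W : ℂ → ℂ} {K : ℝ≥0} (hl : LipschitzWith K W) (a : ℂ) {d : ℝ} (hd : 0 < d) : LipschitzWith K (scW W a d) := by
  refine LipschitzWith.of_dist_le_mul fun x y => ?_
  have := hl.dist_le_mul (a + d * x) (a + d * y)
  rw [dist_add_left, dist_eq_norm (_ * x), ← mul_sub, norm_mul] at this
  simp only [scW, dist_eq_norm, ← mul_sub, norm_mul, sub_sub_sub_cancel_right, norm_inv] at this ⊢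
  simp [abs_of_pos hd] at this ⊢
  rw [inv_mul_le_iff₀ hd]
  linarith

lemma sc_pos {U : ℂ → ℝ} {a : ℂ} {d : ℝ} (hd : 0 < d) {z : ℂ} : 0 < sc U a d z ↔ 0 < U (a + d * z) := by
  simp only [sc]
  exact mul_pos_iff_of_pos_left (by positivity)

lemma sc_har {U : ℂ → ℝ} (hl : LipschitzWith 4 U) (hh : Har U {z | 0 < U z}) (a : ℂ) {d : ℝ} (hd : 0 < d) :
    Har (sc U a d) {z | 0 < sc U a d z} ∧
    ∀ z, 0 < sc U a d z → cg (sc U a d) z = cg U (a + d * z) := by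
  have h1 : ∀ z, 0 < sc U a d z → HasFDerivAt (sc U a d) (reL (cg U (a + d * z))) z := fun z hz =>
    sc_fd hd (hh.hd _ ((sc_pos hd).1 hz))
  have h2 : ∀ z, 0 < sc U a d z → cg (sc U a d) z = cg U (a + d * z) := fun z hz => cg_eq (h1 z hz)
  refine ⟨⟨isOpen_lt continuous_const (sc_lip hl a hd).continuous, fun z hz => ?_, ?_⟩, h2⟩
  · rw [h2 z hz]; exact h1 z hz
  · have : DifferentiableOn ℂ (fun z => cg U (a + d * z)) {z | 0 < sc U a d z} := by
      refine DifferentiableOn.comp (f := fun z : ℂ => a + d * z) hh.hol (by fun_prop) fun z hz => (sc_pos hd).1 hz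
    exact this.congr h2

namespace Lim
variable {U : ℂ → ℝ} {W : ℂ → ℂ} (S : Lim U W)
include S

lemma op : IsOpen {z | 0 < U z} := S.har.op

lemma fr_iff {x : ℂ} : x ∈ frontier {z | 0 < U z} ↔ U x = 0 ∧ x ∈ closure {z | 0 < U z} := by
  rw [S.op.frontier_eq]
  constructor
  · rintro ⟨h1, h2⟩; exact ⟨le_antisymm (not_lt.1 h2) (S.nn x), h1⟩
  · rintro ⟨h1, h2⟩; exact ⟨h2, by simp [h1]⟩

/-- |f| ≤ 1 -/
theorem grad_le_one {z : ℂ} (hz : 0 < U z) : ‖cg U z‖ ≤ 1 := by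
  by_contra! hcon
  set A : Set ℝ := (fun z => ‖cg U z‖) '' {z | 0 < U z} with hA
  have hbd : BddAbove A := ⟨4, by rintro _ ⟨w, hw, rfl⟩; exact cg_le_of_lip S.lip (S.har.hd w hw)⟩
  set M := sSup A with hM
  have hM1 : 1 < M := hcon.trans_le (le_csSup hbd ⟨z, hz, rfl⟩)
  have hMle : ∀ w, 0 < U w → ‖cg U w‖ ≤ M := fun w hw => le_csSup hbd ⟨w, hw, rfl⟩
  obtain ⟨s, -, hs, hsA⟩ := exists_seq_tendsto_sSup (S := A) ⟨_, z, hz, rfl⟩ hbd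
  choose p hp hps using hsA
  have hp' : ∀ n, 0 < U (p n) := hp
  -- distances
  have hcl : IsClosed {z | 0 < U z}ᶜ := S.op.isClosed_compl
  have hne : ({z | 0 < U z}ᶜ : Set ℂ).Nonempty := ⟨0, by simp [S.u0]⟩
  set d : ℕ → ℝ := fun n => infDist (p n) {z | 0 < U z}ᶜ with hd
  have hd0 : ∀ n, 0 < d n := fun n => by
    rw [hd]; exact (hcl.notMem_iff_infDist_pos hne).1 (by simpa using hp' n)
  have hdb : ∀ n, ∀ w, dist w (p n) < d n → 0 < U w := fun n w hw => by
    by_contra h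
    have := infDist_le_dist_of_mem (x := p n) (show w ∈ {z | 0 < U z}ᶜ from h)
    rw [dist_comm] at this
    exact absurd hw (not_lt.2 this)
  have hUd : ∀ n, U (p n) ≤ 4 * d n := fun n => by
    obtain ⟨y, hy, hyd⟩ := hcl.exists_infDist_eq_dist hne (p n)
    have h1 := S.lip.dist_le_mul (p n) y
    have hy' : U y = 0 := le_antisymm (not_lt.1 hy) (S.nn y)
    rw [← hyd, hy', Real.dist_eq, sub_zero] at h1
    have := le_abs_self (U (p n))
    push_cast at h1
    simp only [hd]; linarith
  set un : ℕ → ℂ → ℝ := fun n => sc U (p n) (d n) with hun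
  set wn : ℕ → ℂ → ℂ := fun n => scW W (p n) (d n) with hwn
  have hnat : Tendsto (fun n : ℕ => (n:ℝ) + 1) atTop atTop :=
    tendsto_atTop_add_const_right _ _ tendsto_natCast_atTop_atTop
  obtain ⟨φ, Us, hφ, hUsl, hUs⟩ := arzela_loc un hnat (fun n => by positivity)
    (fun n => (sc_lip S.lip (p n) (hd0 n)).lipschitzOnWith) (C := 4) (fun n => by
      simp only [hun, sc, mul_zero, add_zero, Real.norm_eq_abs, abs_mul, abs_inv,
        abs_of_pos (hd0 n), abs_of_pos (hp' n)]
      rw [inv_mul_le_iff₀ (hd0 n)]; linarith [hUd n])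
  obtain ⟨ψ, Ws, hψ, hWsl, hWs⟩ := arzela_loc (fun n => wn (φ n)) hnat (fun n => by positivity)
    (fun n => (scW_lip S.wlip (p (φ n)) (hd0 (φ n))).lipschitzOnWith) (C := 0) (fun n => by
      simp [hwn, scW])
  have hUs2 : TendstoLocallyUniformly (fun n => un (φ (ψ n))) Us atTop := by
    intro s hs x
    obtain ⟨t, ht, h⟩ := hUs s hs x
    exact ⟨t, ht, hψ.tendsto_atTop.eventually h⟩
  set k : ℕ → ℕ := fun n => φ (ψ n) with hk
  have hktop : Tendsto k atTop atTop := hφ.tendsto_atTop.comp hψ.tendsto_atTop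
  have hhar : ∀ n, Har (un n) {z | 0 < un n z} ∧ ∀ z, 0 < un n z → cg (un n) z = cg U (p n + d n * z) :=
    fun n => sc_har S.lip S.har (p n) (hd0 n)
  have hnn : ∀ n z, 0 ≤ un n z := fun n z => mul_nonneg (inv_nonneg.2 (hd0 n).le) (S.nn _)
  have hUs0 : ∀ z, 0 ≤ Us z := fun z => ge_of_tendsto' (tlu_tendsto hUs2 z) fun n => hnn _ z
  -- near 0
  have hb1 : ∀ n, ∀ z ∈ ball (0:ℂ) 1, 0 < un n z := fun n z hz => by
    refine (sc_pos (hd0 n)).2 (hdb n _ ?_)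
    have : ‖z‖ < 1 := by simpa using hz
    rw [dist_eq_norm, add_sub_cancel_left, norm_mul, norm_real_pos (hd0 n)]
    nlinarith [hd0 n]
  obtain ⟨hH, hcgl⟩ := har_limit one_pos
    (Eventually.of_forall fun n => (hhar (k n)).1.mono (hb1 (k n)) isOpen_ball) (tlu_ball hUs2 0 1)
  have hcgpt : ∀ w ∈ ball (0:ℂ) (1/2), Tendsto (fun n => cg (un (k n)) w) atTop (𝓝 (cg Us w)) :=
    fun w hw => hcgl.tendsto_at hw
  have hcg0 : ‖cg Us 0‖ = M := by
    have h1 := (hcgpt 0 (mem_ball_self (by norm_num))).norm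
    refine tendsto_nhds_unique h1 ((hs.comp hktop).congr fun n => ?_)
    rw [(hhar (k n)).2 0 (hb1 _ 0 (mem_ball_self one_pos))]
    simp [← hps (k n)]
  have hcgle : ∀ w ∈ ball (0:ℂ) (1/2), ‖cg Us w‖ ≤ M := fun w hw => by
    refine le_of_tendsto' (hcgpt w hw).norm fun n => ?_
    have hw1 : w ∈ ball (0:ℂ) 1 := ball_subset_ball (by norm_num) hw
    rw [(hhar (k n)).2 w (hb1 _ w hw1)]
    exact hMle _ ((sc_pos (hd0 _)).1 (hb1 _ w hw1))
  set c := cg Us 0 with hc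
  have hcc : EqOn (cg Us) (fun _ => c) (ball 0 (1/2)) :=
    eqOn_of_isPreconnected_of_isMaxOn_norm (convex_ball 0 (1/2)).isPreconnected isOpen_ball
      hH.hol (mem_ball_self (by norm_num)) (fun w hw => by
        show ‖cg Us w‖ ≤ ‖cg Us 0‖
        rw [hcg0]; exact hcgle w hw)
  have hc0 : c ≠ 0 := by
    intro h; rw [h, norm_zero] at hcg0; linarith
  have hUs00 : 0 < Us 0 := by
    refine lt_of_le_of_ne (hUs0 0) fun h => hc0 ?_
    have hz := hH.zero_of_nonneg (fun w _ => hUs0 w) h.symm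
    apply cg_eq
    have h0 : reL 0 = 0 := by ext v; simp
    rw [h0]
    refine (hasFDerivAt_const (0:ℝ) _).congr_of_eventuallyEq ?_
    filter_upwards [ball_mem_nhds (0:ℂ) (show (0:ℝ) < 1/2 by norm_num)] with w hw using hz w hw
  -- positivity near positive points of the limit
  have hpos : ∀ z, 0 < Us z → ∃ r > 0, ∀ᶠ n in atTop, ∀ w ∈ ball z r, 0 < un (k n) w := by
    intro z hz
    refine ⟨Us z / 16, by positivity, ?_⟩
    filter_upwards [tendstoUniformlyOn_iff.1 (tlu_ball hUs2 z (Us z / 16)) (Us z / 4) (by positivity)]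
      with n hn w hw
    have h1 := hn w hw
    have h2 := hUsl.dist_le_mul z w
    have h3 : dist w z < Us z / 16 := hw
    rw [dist_comm z w] at h2
    rw [Real.dist_eq, abs_lt] at h1
    rw [Real.dist_eq, abs_le] at h2
    push_cast at h2
    linarith [h1.2, h2.2]
  have hUshar : Har Us {z | 0 < Us z} := by
    have key : ∀ z, 0 < Us z → ∃ r > 0, Har Us (ball z r) := fun z hz => by
      obtain ⟨r, hr, h⟩ := hpos z hz
      refine ⟨r/2, by positivity, (har_limit hr ?_ (tlu_ball hUs2 z r)).1⟩
      filter_upwards [h] with n hn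
      exact (hhar (k n)).1.mono hn isOpen_ball
    refine ⟨isOpen_lt continuous_const hUsl.continuous, fun z hz => ?_, fun z hz => ?_⟩
    · obtain ⟨r, hr, h⟩ := key z hz
      exact h.hd z (mem_ball_self hr)
    · obtain ⟨r, hr, h⟩ := key z hz
      exact (h.hol.differentiableAt (isOpen_ball.mem_nhds (mem_ball_self hr))).differentiableWithinAt
  have hhp := halfplane hUsl.continuous hUshar (p := 0) (c := c) hUs00 (by
    filter_upwards [ball_mem_nhds (0:ℂ) (show (0:ℝ) < 1/2 by norm_num)] with w hw using hcc hw)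
  set b := Us 0 with hb
  have hcgH : ∀ z, 0 < b + (c * (z - 0)).re → cg Us z = c := fun z hz => by
    apply cg_eq
    refine (hasFDerivAt_lin b c 0 z).congr_of_eventuallyEq ?_
    filter_upwards [(isOpen_half b c 0).mem_nhds hz] with w hw using hhp w hw
  -- Ws on H
  have hWd : ∀ z, 0 < b + (c * (z - 0)).re → HasFDerivAt (fun w => conj (Ws w)) (om (c ^ 2) 1) z := by
    intro z hz
    have hz' : 0 < Us z := by rw [hhp z hz]; exact hz
    obtain ⟨r, hr, h⟩ := hpos z hz'
    rw [← hcgH z hz]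
    refine om_limit hr (V := fun n => un (k n)) (Y := fun n w => conj (wn (k n) w)) ?_ (tlu_ball hUs2 z r) ?_ ?_
    · filter_upwards [h] with n hn
      exact (hhar (k n)).1.mono hn isOpen_ball
    · filter_upwards [h] with n hn w hw
      apply conj_hasFDerivAt
      rw [(hhar (k n)).2 w (hn w hw)]
      exact scW_fd (hd0 _) (S.wd _ ((sc_pos (hd0 _)).1 (hn w hw)))
    · intro w _
      exact (continuous_conj.tendsto _).comp (tlu_tendsto hWs w)
  have hWH : ∀ z, 0 < b + (c * (z - 0)).re →
      conj (Ws z) - (c ^ 2 * z + conj z) = conj (Ws 0) := by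
    intro z hz
    have := const_of_zero_deriv (convex_half b c 0) (Y := fun z => conj (Ws z) - om (c ^ 2) 1 z)
      (fun z hz => ((hWd z hz).sub (om (c^2) 1).hasFDerivAt).congr_fderiv (sub_self _)) hz
      (y := 0) (by simpa using hUs00)
    simpa using this
  -- boundary points
  set x : ℝ → ℂ := fun t => -b / c + t * (I / c) with hx
  have hLx : ∀ t (s : ℝ), (b + (c * (x t + s / c - 0)).re) = s := fun t s => by
    have : c * (x t + s / c - 0) = -b + t * I + s := by
      simp only [hx]; field_simp; ring
    rw [this]; simp
  have hWx : ∀ t, conj (Ws (x t)) = (c ^ 2 * (x t) + conj (x t)) + conj (Ws 0) := by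
    intro t
    have hcont : Continuous fun s : ℝ => conj (Ws (x t + s / c)) -
      (c ^ 2 * (x t + s / c) + conj (x t + s / c)) := by
      have := hWsl.continuous
      have h2 := continuous_conj
      fun_prop
    have h1 := (hcont.tendsto 0).mono_left (nhdsWithin_le_nhds (s := Ioi 0))
    have h2 : Tendsto (fun s : ℝ => conj (Ws (x t + s / c)) -
      (c ^ 2 * (x t + s / c) + conj (x t + s / c))) (𝓝[>] 0) (𝓝 (conj (Ws 0))) := by
      refine tendsto_const_nhds.congr' ?_
      filter_upwards [self_mem_nhdsWithin] with s hs
      exact (hWH _ (by rw [hLx]; exact hs)).symm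
    have h3 := tendsto_nhds_unique h1 h2
    simp only [ofReal_zero, zero_div, add_zero] at h3
    rw [← h3]; ring
  have hUx : ∀ t, Us (x t) = 0 := fun t => by
    have h1 := (((hUsl.continuous.comp (by fun_prop : Continuous fun s : ℝ => x t + s / c))).tendsto 0).mono_left
      (nhdsWithin_le_nhds (s := Ioi 0))
    have h2 : Tendsto (Us ∘ fun s : ℝ => x t + s / c) (𝓝[>] 0) (𝓝 0) := by
      have : Tendsto (fun s : ℝ => s) (𝓝[>] 0) (𝓝 0) := nhdsWithin_le_nhds
      refine this.congr' ?_
      filter_upwards [self_mem_nhdsWithin] with s hs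
      simp only [Function.comp]
      rw [hhp _ (by rw [hLx]; exact hs), hLx]
    simpa using tendsto_nhds_unique h1 h2
  have hWxinj : ∀ t t', Ws (x t) = Ws (x t') → t = t' := by
    intro t t' h
    have h1 := hWx t
    rw [h, hWx t'] at h1
    have h2 : c ^ 2 * (x t - x t') + conj (x t - x t') = 0 := by
      rw [map_sub]; linear_combination -h1
    have h3 : x t - x t' = (t - t' : ℝ) * (I / c) := by simp only [hx]; push_cast; ring
    rw [h3] at h2
    have hcn : c * conj c = (M ^ 2 : ℝ) := by
      rw [mul_conj, normSq_eq_norm_sq, hcg0]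
    have hcc0 : conj c ≠ 0 := by simpa using hc0
    simp only [map_mul, map_div₀, conj_I, conj_ofReal] at h2
    field_simp at h2
    have h4 : ((t - t' : ℝ) : ℂ) * ((M ^ 2 : ℝ) - 1) = 0 := by
      rw [← hcn]
      have hI := I_ne_zero
      apply mul_left_cancel₀ hI
      rw [mul_zero]
      linear_combination h2
    rcases mul_eq_zero.1 h4 with h5 | h5
    · have : t - t' = 0 := by exact_mod_cast h5
      linarith
    · have : M ^ 2 - 1 = 0 := by exact_mod_cast h5
      nlinarith
  -- approximating frontier points
  have happ : ∀ t, ∀ δ > 0, ∀ᶠ n in atTop, ∃ y ∈ ball (x t) δ, (p (k n) + d (k n) * y) ∈ frontier {z | 0 < U z} := by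
    intro t δ hδ
    set q := x t + ((δ / 4 * ‖c‖ : ℝ) : ℂ) / c with hq
    have hcn : 0 < ‖c‖ := norm_pos_iff.2 hc0
    have hqd : dist q (x t) = δ/4 := by
      rw [hq, dist_eq_norm, add_sub_cancel_left, norm_div, norm_real_pos (by positivity)]
      field_simp
    have hqp : 0 < Us q := by
      rw [hhp q (by rw [hLx]; positivity), hLx]; positivity
    have t1 := (tlu_tendsto hUs2 q).eventually (lt_mem_nhds (show Us q / 2 < Us q by linarith))
    have t2 := (tlu_tendsto hUs2 (x t)).eventually (gt_mem_nhds (show Us (x t) < Us q / 6 by rw [hUx]; linarith))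
    filter_upwards [t1, t2] with n h1 h2
    have hop := (hhar (k n)).1.op
    have hfr : ∀ y, un (k n) y = 0 → y ∈ closure {z | 0 < un (k n) z} →
        (p (k n) + d (k n) * y) ∈ frontier {z | 0 < U z} := by
      intro y hy0 hy
      rw [S.fr_iff]
      refine ⟨?_, ?_⟩
      · have := hd0 (k n)
        simp only [hun, sc] at hy0
        rcases mul_eq_zero.1 hy0 with h | h
        · exact absurd h (inv_ne_zero this.ne')
        · exact h
      · have hmt : MapsTo (fun y : ℂ => p (k n) + d (k n) * y) {z | 0 < un (k n) z} {z | 0 < U z} :=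
          fun y hy => (sc_pos (hd0 _)).1 hy
        exact hmt.closure (by fun_prop) hy
    by_contra! hcon
    have hpb : q ∈ ball (x t) δ := by rw [mem_ball, hqd]; linarith
    have hball : ball (x t) δ ⊆ {z | 0 < un (k n) z} := by
      refine (convex_ball (x t) δ).isPreconnected.subset_of_closure_inter_subset hop
        ⟨q, hpb, ?_⟩ ?_
      · show 0 < un (k n) q
        linarith
      · rintro y ⟨hy1, hy2⟩
        refine lt_of_le_of_ne (hnn _ y) fun h => ?_
        exact hcon y hy2 (hfr y h.symm hy1)
    have hsub : ball q (δ/2) ⊆ ball (x t) δ := by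
      apply ball_subset_ball'; linarith
    have hh := (hhar (k n)).1.mono (hsub.trans hball) isOpen_ball
    have := (hh.harnack (by positivity) subset_rfl (fun w hw => hball (hsub hw))).1 (x t)
      (by rw [mem_ball, dist_comm]; linarith)
    have e : dist (x t) q / (δ/2) ≤ 1/2 := by
      rw [div_le_iff₀ (by positivity), dist_comm]; linarith
    have hvx : 0 < un (k n) (x t) := hball (mem_ball_self hδ)
    nlinarith
  -- contradiction
  obtain ⟨N, hN⟩ := exists_nat_gt (24 * K0)
  have hsep : ∃ e > 0, ∀ i j : Fin (N+1), i ≠ j → e ≤ dist (Ws (x i)) (Ws (x j)) := by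
    have : ∀ᶠ e in 𝓝[>] (0:ℝ), ∀ i j : Fin (N+1), i ≠ j → e ≤ dist (Ws (x i)) (Ws (x j)) := by
      rw [eventually_all]; intro i
      rw [eventually_all]; intro j
      by_cases hij : i = j
      · exact Eventually.of_forall fun d h => absurd hij h
      · have hpos : 0 < dist (Ws (x i)) (Ws (x j)) := dist_pos.2 fun h => hij (by
          have := hWxinj _ _ h
          exact Fin.ext (by exact_mod_cast this))
        filter_upwards [nhdsWithin_le_nhds (gt_mem_nhds hpos)] with d hd _ using hd.le
    obtain ⟨d, h1, h2⟩ := (this.and self_mem_nhdsWithin).exists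
    exact ⟨d, h2, h1⟩
  obtain ⟨e, he, hsep⟩ := hsep
  have h1 : ∀ᶠ n in atTop, ∀ i : Fin (N+1), ∃ y ∈ ball (x i) (e/100), (p (k n) + d (k n) * y) ∈ frontier {z | 0 < U z} :=
    eventually_all.2 fun i => happ i _ (by positivity)
  have h2 : ∀ᶠ n in atTop, ∀ i : Fin (N+1), ∀ z ∈ ball (x i) (e/100), dist (Ws z) (wn (k n) z) < e / 8 :=
    eventually_all.2 fun i => tendstoUniformlyOn_iff.1 (tlu_ball hWs (x i) (e/100)) (e/8) (by positivity)
  obtain ⟨n, h1, h2⟩ := (h1.and h2).exists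
  choose y hy hyF using h1
  have := S.fin N (fun i => p (k n) + d (k n) * y i) hyF ?_
  · linarith
  intro i j hij
  by_contra hne
  have hij' : wn (k n) (y i) = wn (k n) (y j) := by
    have : W (p (k n) + d (k n) * y i) = W (p (k n) + d (k n) * y j) := hij
    simp only [hwn, scW, this]
  have e0 := hsep i j hne
  have a1 := h2 i (y i) (hy i)
  have a2 := h2 j (y j) (hy j)
  have b1 := hWsl.dist_le_mul (x i) (y i)
  have b2 := hWsl.dist_le_mul (x j) (y j)
  have c1 : dist (y i) (x i) < e/100 := hy i
  have c2 : dist (y j) (x j) < e/100 := hy j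
  rw [dist_comm (x i)] at b1
  rw [dist_comm (x j)] at b2
  push_cast at b1 b2
  have t1 := dist_triangle (Ws (x i)) (Ws (y i)) (Ws (x j))
  have t2 := dist_triangle (Ws (y i)) (Ws (y j)) (Ws (x j))
  have t3 := dist_triangle (Ws (y i)) (wn (k n) (y i)) (Ws (y j))
  rw [hij', dist_comm (wn (k n) (y j))] at t3
  rw [hij'] at a1
  rw [dist_comm (Ws (y j)) (Ws (x j))] at t2
  linarith

end Lim
end OP

namespace OP

lemma dot2_add_left (a b c : ℂ) : dot2 (a + b) c = dot2 a c + dot2 b c := by simp [dot2]; ring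
lemma dot2_sub_left (a b c : ℂ) : dot2 (a - b) c = dot2 a c - dot2 b c := by simp [dot2]; ring
lemma dot2_add_right (a b c : ℂ) : dot2 a (b + c) = dot2 a b + dot2 a c := by simp [dot2]; ring
lemma dot2_sub_right (a b c : ℂ) : dot2 a (b - c) = dot2 a b - dot2 a c := by simp [dot2]; ring
lemma dot2_neg_right (a b : ℂ) : dot2 a (-b) = -dot2 a b := by simp [dot2]; ring
lemma dot2_smul_left (t : ℝ) (a b : ℂ) : dot2 (t * a) b = t * dot2 a b := by simp [dot2]; ring
lemma dot2_smul_right (t : ℝ) (a b : ℂ) : dot2 a (t * b) = t * dot2 a b := by simp [dot2]; ring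
lemma dot2_self (a : ℂ) : dot2 a a = ‖a‖ ^ 2 := by
  rw [← normSq_eq_norm_sq, normSq_apply, dot2]
lemma dot2_comm (a b : ℂ) : dot2 a b = dot2 b a := by simp [dot2]; ring
lemma dot2_conj (a b : ℂ) : dot2 (conj a) b = (a * b).re := by simp [dot2]; ring
lemma abs_dot2_le (a b : ℂ) : |dot2 a b| ≤ ‖a‖ * ‖b‖ := by
  have h : dot2 a b = (conj a * b).re := by simp [dot2]
  rw [h]
  refine (abs_re_le_norm _).trans ?_
  simp
lemma continuous_dot2 : Continuous fun p : ℂ × ℂ => dot2 p.1 p.2 := by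
  unfold dot2; fun_prop
lemma _root_.Continuous.dot2' {X : Type*} [TopologicalSpace X] {f g : X → ℂ} (hf : Continuous f) (hg : Continuous g) :
    Continuous fun x => dot2 (f x) (g x) := continuous_dot2.comp (hf.prodMk hg)

lemma mono1 {h : ℝ → ℝ} (hc : Continuous h) (B : Set ℝ) (hB : (h '' B).Finite)
    (hloc : ∀ t ∈ Ico (0:ℝ) 1, t ∉ B → ∀ᶠ s in 𝓝[>] t, h t ≤ h s) : h 0 ≤ h 1 := by
  by_contra! hcon
  obtain ⟨c, ⟨hc1, hc2⟩, hcB⟩ := ((Ioo_infinite hcon).diff hB).nonempty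
  have hK : IsCompact (Icc (0:ℝ) 1 ∩ {t | c ≤ h t}) :=
    isCompact_Icc.inter_right (isClosed_le continuous_const hc)
  obtain ⟨t, ⟨ht1, ht2⟩, htm⟩ := hK.exists_isMaxOn ⟨0, ⟨by simp, hc2.le⟩⟩ continuous_id.continuousOn
  have htm' : ∀ s ∈ Icc (0:ℝ) 1, c ≤ h s → s ≤ t := fun s hs1 hs2 => htm ⟨hs1, hs2⟩
  have ht2' : c ≤ h t := ht2
  have htlt : t < 1 := lt_of_le_of_ne ht1.2 fun h => by rw [h] at ht2'; linarith
  have hev : ∀ᶠ s in 𝓝[>] t, c ≤ h s := by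
    rcases ht2'.lt_or_eq with h | h
    · filter_upwards [nhdsWithin_le_nhds (hc.continuousAt.eventually (lt_mem_nhds h))] with s hs using hs.le
    · have : t ∉ B := fun hb => hcB ⟨t, hb, h.symm⟩
      filter_upwards [hloc t ⟨ht1.1, htlt⟩ this] with s hs
      rw [h]; exact hs
  have hev2 : ∀ᶠ s in 𝓝[>] t, s ∈ Ioo t 1 := Ioo_mem_nhdsGT htlt
  obtain ⟨s, h1, h2⟩ := (hev.and hev2).exists
  have := htm' s ⟨by linarith [ht1.1, h2.1], h2.2.le⟩ h1
  linarith [h2.1]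

namespace Lim
variable {U : ℂ → ℝ} {W : ℂ → ℂ} (S : Lim U W)
include S

lemma fin_vals : (W '' frontier {z | 0 < U z}).Finite := by
  by_contra hinf
  have hinf' : (W '' frontier {z | 0 < U z}).Infinite := hinf
  obtain ⟨N, hN⟩ := exists_nat_gt (24 * K0)
  let e := hinf'.natEmbedding
  have : ∀ n, ∃ x ∈ frontier {z | 0 < U z}, W x = e n := fun n => (e n).2
  choose x hx1 hx2 using this
  have := S.fin N (fun i => x i) (fun i => hx1 i) (fun i j hij => by
    have h1 : W (x i) = W (x j) := hij
    rw [hx2, hx2] at h1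
    exact Fin.ext (e.injective (Subtype.ext h1)))
  linarith

lemma seg_mv {x : ℂ} {r : ℝ} (hb : ball x r ⊆ {z | 0 < U z}) {z w : ℂ} (hz : z ∈ ball x r) (hw : w ∈ ball x r) :
    ∃ y ∈ ball x r, dot2 (W w - W z) (w - z) = ‖w - z‖ ^ 2 + (cg U y ^ 2 * (w - z) ^ 2).re := by
  have hmem : ∀ t ∈ Icc (0:ℝ) 1, z + t * (w - z) ∈ ball x r := fun t ht => by
    have := (convex_ball x r).add_smul_sub_mem hz hw ht
    simpa using this
  have hd : ∀ t ∈ Icc (0:ℝ) 1, HasDerivAt (fun t : ℝ => dot2 (W (z + t * (w - z))) (w - z))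
      (‖w - z‖ ^ 2 + (cg U (z + t * (w - z)) ^ 2 * (w - z) ^ 2).re) t := by
    intro t ht
    have h1 := S.wd _ (hb (hmem t ht))
    have h2 : HasDerivAt (fun t : ℝ => z + t * (w - z)) (w - z) t := by
      have := ((hasDerivAt_id t).ofReal_comp.mul_const (w - z)).const_add z
      simpa using this
    have h3 := h1.comp_hasDerivAt t h2
    have h4 : HasFDerivAt (fun q : ℂ => dot2 q (w - z)) (reL (conj (w - z))) (W (z + t * (w - z))) := by
      refine (reL (conj (w - z))).hasFDerivAt.congr_of_eventuallyEq (Eventually.of_forall fun q => ?_)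
      simp only [reL_apply]
      rw [← dot2_conj, dot2_comm]; simp
    have h5 := h4.comp_hasDerivAt t h3
    refine h5.congr_deriv ?_
    rw [reL_apply, ← dot2_conj, om_apply, dot2_add_right]
    simp only [Complex.conj_conj, one_mul]
    rw [dot2_self, ← map_mul, dot2_comm, dot2_conj]
    congr 2; ring
  obtain ⟨c, hc, hcs⟩ := exists_hasDerivAt_eq_slope _ _ zero_lt_one
    (fun t ht => (hd t ht).continuousAt.continuousWithinAt) (fun t ht => hd t (Ioo_subset_Icc_self ht))
  refine ⟨_, hmem c (Ioo_subset_Icc_self hc), ?_⟩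
  rw [hcs, dot2_sub_left]; simp

lemma seg_mv_le {x : ℂ} {r : ℝ} (hb : ball x r ⊆ {z | 0 < U z}) {z w : ℂ} (hz : z ∈ ball x r) (hw : w ∈ ball x r) :
    ∃ y ∈ ball x r, (1 - ‖cg U y‖ ^ 2) * ‖w - z‖ ^ 2 ≤ dot2 (W w - W z) (w - z) := by
  obtain ⟨y, hy, h⟩ := S.seg_mv hb hz hw
  refine ⟨y, hy, ?_⟩
  have h1 := abs_re_le_norm (cg U y ^ 2 * (w - z) ^ 2)
  rw [norm_mul, norm_pow, norm_pow] at h1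
  have := neg_le_of_abs_le h1
  rw [h]; linarith

lemma loc_mono {x : ℂ} (hx : x ∉ frontier {z | 0 < U z}) :
    ∃ r > 0, ∀ z ∈ ball x r, ∀ w ∈ ball x r, 0 ≤ dot2 (W w - W z) (w - z) := by
  by_cases hO : 0 < U x
  · obtain ⟨r, hr, hb⟩ := Metric.isOpen_iff.1 S.op x hO
    refine ⟨r, hr, fun z hz w hw => ?_⟩
    obtain ⟨y, hy, h⟩ := S.seg_mv_le hb hz hw
    have := S.grad_le_one (hb hy)
    refine le_trans (mul_nonneg ?_ (by positivity)) h
    nlinarith [norm_nonneg (cg U y)]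
  · have hxc : x ∉ closure {z | 0 < U z} := fun h => hx (S.fr_iff.2 ⟨le_antisymm (not_lt.1 hO) (S.nn x), h⟩)
    rcases S.ext x hxc with h | h
    · obtain ⟨r, hr, hb⟩ := eventually_nhds_iff_ball.1 h
      refine ⟨r, hr, fun z hz w hw => ?_⟩
      rw [hb z hz, hb w hw]; simp [dot2]
    · obtain ⟨r, hr, hb⟩ := eventually_nhds_iff_ball.1 h
      refine ⟨r, hr, fun z hz w hw => ?_⟩
      have : W w - W z = w - z := by linear_combination hb w hw - hb z hz
      rw [this, dot2_self]; positivity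

theorem mono (z w : ℂ) : 0 ≤ dot2 (W w - W z) (w - z) := by
  have hWc := S.wlip.continuous
  have := mono1 (h := fun t : ℝ => dot2 (W (z + t * (w - z))) (w - z))
    (Continuous.dot2' (by fun_prop) (by fun_prop)) {t | z + t * (w - z) ∈ frontier {z | 0 < U z}}
    ((S.fin_vals.image fun q => dot2 q (w - z)).subset (by
      rintro _ ⟨t, ht, rfl⟩
      exact ⟨_, ⟨_, ht, rfl⟩, rfl⟩)) (fun t _ htB => by
      obtain ⟨r, hr, hb⟩ := S.loc_mono htB
      have hcont : Continuous fun s : ℝ => z + s * (w - z) := by fun_prop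
      have hev := nhdsWithin_le_nhds (s := Ioi t) (hcont.continuousAt.eventually (ball_mem_nhds (z + t * (w - z)) hr))
      filter_upwards [hev, self_mem_nhdsWithin] with s hs hst
      have h1 := hb _ (mem_ball_self hr) _ hs
      have e : z + s * (w - z) - (z + t * (w - z)) = ((s - t : ℝ) : ℂ) * (w - z) := by push_cast; ring
      rw [e, dot2_smul_right, dot2_sub_left] at h1
      have hst' : 0 < s - t := sub_pos.2 hst
      have := nonneg_of_mul_nonneg_right h1 hst'
      linarith)
  rw [dot2_sub_left]
  simp at this
  linarith

theorem smono {z w : ℂ} (hz : 0 < U z) (hf : ‖cg U z‖ < 1) (hne : w ≠ z) : 0 < dot2 (W w - W z) (w - z) := by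
  have hcont : ContinuousAt (cg U) z := (S.har.hol.differentiableAt (S.op.mem_nhds hz)).continuousAt
  have hev := (hcont.norm.eventually (gt_mem_nhds hf)).and (S.op.mem_nhds hz)
  obtain ⟨r, hr, hb⟩ := eventually_nhds_iff_ball.1 hev
  obtain ⟨t, y, hn, ht0, ht1, hyz, hwy, hyz', hyb⟩ := seg_pt hr hne
  obtain ⟨q, hq, h1⟩ := S.seg_mv_le (fun a ha => (hb a ha).2) (mem_ball_self hr) hyb
  have h2 := S.mono y w
  have hq1 := (hb q hq).1
  have h3 : 0 < dot2 (W y - W z) (y - z) := by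
    refine lt_of_lt_of_le (mul_pos ?_ ?_) h1
    · nlinarith [norm_nonneg (cg U q)]
    · rw [hyz, norm_mul, norm_real_pos ht0]; positivity
  rw [hyz, dot2_smul_right] at h3
  rw [hwy, dot2_smul_right] at h2
  have h3' := (mul_pos_iff_of_pos_left ht0).1 h3
  have h2' := nonneg_of_mul_nonneg_right h2 (by linarith)
  rw [dot2_sub_left] at *
  linarith

/-- unimodular points -/
lemma uni {p : ℂ} (hp : 0 < U p) (h1 : ‖cg U p‖ = 1) :
    ∀ z, 0 < U p + (cg U p * (z - p)).re → U z = U p + (cg U p * (z - p)).re := by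
  obtain ⟨r, hr, hb⟩ := Metric.isOpen_iff.1 S.op p hp
  have := eqOn_of_isPreconnected_of_isMaxOn_norm (f := cg U) (convex_ball p r).isPreconnected isOpen_ball
    (S.har.hol.mono hb) (mem_ball_self hr) (fun w hw => by
      show ‖cg U w‖ ≤ ‖cg U p‖
      rw [h1]; exact S.grad_le_one (hb hw))
  refine halfplane S.lip.continuous S.har hp ?_
  filter_upwards [ball_mem_nhds p hr] with w hw using this hw

end Lim

/-- classification when everything is a half plane -/
lemma type1 {V : ℂ → ℝ} (hc : Continuous V) (hn : ∀ z, 0 ≤ V z)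
    (hpos : ∀ z, 0 < z.re → V z = z.re)
    (hV : ∀ q, 0 < V q → ∃ c : ℂ, ‖c‖ = 1 ∧ ∀ z, 0 < V q + (c * (z - q)).re → V z = V q + (c * (z - q)).re) :
    V = Pfun ∨ (∃ a : ℝ, 0 < a ∧ V = TPfun a) ∨ V = Wfun 1 := by
  have hge : ∀ z : ℂ, 0 ≤ z.re → V z = z.re := by
    intro z hz
    have h1 : Tendsto (fun s : ℝ => V (z + s)) (𝓝[>] 0) (𝓝 (V (z + (0:ℝ)))) :=
      ((hc.comp (by fun_prop : Continuous fun s : ℝ => z + s)).tendsto 0).mono_left nhdsWithin_le_nhds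
    have h2 : Tendsto (fun s : ℝ => V (z + s)) (𝓝[>] 0) (𝓝 (z.re + 0)) := by
      have : Tendsto (fun s : ℝ => z.re + s) (𝓝[>] 0) (𝓝 (z.re + 0)) :=
        (Continuous.tendsto (by fun_prop) 0).mono_left nhdsWithin_le_nhds
      refine this.congr' ?_
      filter_upwards [self_mem_nhdsWithin] with s hs
      have hs' : 0 < s := hs
      rw [hpos _ (by simp; linarith)]; simp
    simpa using tendsto_nhds_unique h1 h2
  -- structure of a negative point
  have hneg : ∀ q : ℂ, q.re < 0 → 0 < V q → ∃ a : ℝ, 0 ≤ a ∧ q.re < -a ∧ ∀ z : ℂ, z.re < -a → V z = -z.re - a := by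
    intro q hq hVq
    obtain ⟨c, hc1, hcz⟩ := hV q hVq
    have hcc : c.re ^ 2 + c.im ^ 2 = 1 := by
      have := Complex.sq_norm c
      rw [hc1, normSq_apply] at this
      nlinarith
    -- no intersection with right half plane
    have hdis : ∀ z : ℂ, 0 < V q + (c * (z - q)).re → z.re ≤ 0 := by
      intro z hz
      by_contra! hzr
      -- near z both formulas hold
      have hopn : IsOpen {w : ℂ | 0 < V q + (c * (w - q)).re ∧ 0 < w.re} :=
        (isOpen_half _ _ _).inter (isOpen_lt continuous_const continuous_re)
      obtain ⟨r, hr, hb⟩ := Metric.isOpen_iff.1 hopn z ⟨hz, hzr⟩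
      have hform : ∀ w ∈ ball z r, w.re = V q + (c * (w - q)).re := fun w hw => by
        rw [← hcz w (hb hw).1, hpos w (hb hw).2]
      have a0 := hform z (mem_ball_self hr)
      have a1 := hform (z + (r/2 : ℝ)) (by
        rw [mem_ball, dist_eq_norm, add_sub_cancel_left, norm_real_pos (by positivity)]; linarith)
      have a2 := hform (z + (r/2 : ℝ) * I) (by
        rw [mem_ball, dist_eq_norm, add_sub_cancel_left, norm_mul, norm_I, norm_real_pos (by positivity)]; linarith)
      simp at a0 a1 a2
      have hc1' : c.re = 1 := by nlinarith
      have hc2' : c.im = 0 := by nlinarith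
      have : V q = q.re := by rw [hc1', hc2'] at a0; linarith
      linarith
    have hcm : c.re = -1 ∧ c.im = 0 := by
      by_contra hne
      have hcr : -1 < c.re := by
        rcases lt_or_eq_of_le (show -1 ≤ c.re by nlinarith [sq_nonneg c.im]) with h | h
        · exact h
        · exfalso; apply hne
          refine ⟨h.symm, ?_⟩
          rw [← h] at hcc; nlinarith
      obtain ⟨t, ht⟩ := exists_gt (max 1 ((|(c * q).re|) / (1 + c.re)))
      have ht1 : 1 < t := (le_max_left _ _).trans_lt ht
      have ht2 : |(c * q).re| < t * (1 + c.re) := by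
        rw [← div_lt_iff₀ (by linarith)]; exact (le_max_right _ _).trans_lt ht
      have h3 := hdis (t * (1 + conj c)) (by
        have e : (c * (t * (1 + conj c) - q)).re = t * (c.re + (c.re^2+c.im^2)) - (c*q).re := by
          simp; ring
        rw [e, hcc]
        have := le_abs_self ((c*q).re)
        linarith)
      have e2 : (t * (1 + conj c) : ℂ).re = t * (1 + c.re) := by simp
      rw [e2] at h3
      nlinarith
    have hL : ∀ z : ℂ, V q + (c * (z - q)).re = -z.re - (-V q - q.re) := fun z => by
      simp [hcm.1, hcm.2]; ring
    refine ⟨-V q - q.re, ?_, by linarith, fun z hz => ?_⟩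
    · by_contra! h
      have := hdis (((V q + q.re)/2 : ℝ)) (by rw [hL]; simp; linarith)
      simp at this
      linarith
    · rw [hcz z (by rw [hL]; linarith), hL]
  by_cases hex : ∃ q : ℂ, q.re < 0 ∧ 0 < V q
  · right
    obtain ⟨q, hq, hVq⟩ := hex
    obtain ⟨a, ha, hqa, haz⟩ := hneg q hq hVq
    have hmid : ∀ z : ℂ, z.re < 0 → -a ≤ z.re → V z = 0 := by
      intro z hz hza
      by_contra hne
      obtain ⟨a', ha', hza', haz'⟩ := hneg z hz (lt_of_le_of_ne (hn z) (Ne.symm hne))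
      have h1 := haz ((-max a a' - 1 : ℝ)) (by simp; linarith [le_max_left a a'])
      have h2 := haz' ((-max a a' - 1 : ℝ)) (by simp; linarith [le_max_right a a'])
      rw [h1] at h2
      linarith
    have hform : ∀ z, V z = max z.re 0 + max (-z.re - a) 0 := by
      intro z
      rcases le_or_gt 0 z.re with h | h
      · rw [hge z h, max_eq_left h, max_eq_right (by linarith), add_zero]
      · rcases lt_or_ge z.re (-a) with h' | h'
        · rw [haz z h', max_eq_right h.le, max_eq_left (by linarith), zero_add]
        · rw [hmid z h h', max_eq_right h.le, max_eq_right (by linarith), zero_add]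
    rcases ha.lt_or_eq with h | h
    · left; exact ⟨a, h, funext hform⟩
    · right
      funext z
      rw [hform, ← h, Wfun]
      rcases le_total 0 z.re with h | h
      · rw [max_eq_left h, abs_of_nonneg h, max_eq_right (by linarith)]; ring
      · rw [max_eq_right h, abs_of_nonpos h, max_eq_left (by linarith)]; ring
  · left
    push Not at hex
    funext z
    rw [Pfun]
    rcases le_or_gt 0 z.re with h | h
    · rw [hge z h, max_eq_left h]
    · rw [max_eq_right h.le]; exact le_antisymm (hex z h) (hn z)

lemma Lim.type1 {U : ℂ → ℝ} {W : ℂ → ℂ} (S : Lim U W) (h1 : ∀ z, 0 < U z → ‖cg U z‖ = 1) :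
    ∃ T : ℂ → ℂ, Isometry T ∧ (U ∘ T = Pfun ∨ (∃ a : ℝ, 0 < a ∧ U ∘ T = TPfun a) ∨ U ∘ T = Wfun 1) := by
  obtain ⟨p, hp, -⟩ := Metric.mem_closure_iff.1 (frontier_subset_closure S.o0) 1 one_pos
  have hp' : 0 < U p := hp
  set c := cg U p with hc
  have hc1 : ‖c‖ = 1 := h1 p hp
  have hc0 : c ≠ 0 := by intro h; rw [h] at hc1; simp at hc1
  set T : ℂ → ℂ := fun z => p + (z - U p) / c with hT
  have hTi : Isometry T := by
    refine Isometry.of_dist_eq fun x y => ?_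
    simp only [hT, dist_eq_norm]
    rw [add_sub_add_left_eq_sub, ← sub_div, norm_div, hc1, div_one]; congr 1; ring
  refine ⟨T, hTi, OP.type1 (S.lip.continuous.comp hTi.continuous) (fun z => S.nn _) (fun z hz => ?_) (fun q hq => ?_)⟩
  · have e : U p + (c * (T z - p)).re = z.re := by
      have : c * (T z - p) = z - U p := by simp only [hT]; field_simp; ring
      rw [this]; simp
    simp only [Function.comp]
    rw [S.uni hp' hc1 (T z) (by rw [← hc, e]; exact hz), ← hc, e]
  · refine ⟨cg U (T q) / c, by rw [norm_div, hc1, h1 _ hq, div_one], fun z hz => ?_⟩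
    have e : cg U (T q) / c * (z - q) = cg U (T q) * (T z - T q) := by
      simp only [hT]; field_simp; ring
    rw [e] at hz ⊢
    exact S.uni hq (h1 _ hq) (T z) hz

end OP

namespace OP

/-- limit with all gradients < 1 -/
structure Lim2 (U : ℂ → ℝ) (W : ℂ → ℂ) : Prop where
  S : Lim U W
  lt : ∀ z, 0 < U z → ‖cg U z‖ < 1
  ne : ∃ z, 0 < U z

lemma nonneg_of_lin {A B : ℝ} (h : ∀ t : ℝ, 0 ≤ t → 0 ≤ A + t * B) : 0 ≤ B := by
  by_contra! hB
  have := h ((|A| + 1) / (-B)) (by apply div_nonneg; positivity; linarith)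
  have h2 : (|A| + 1) / (-B) * B = -(|A| + 1) := by
    rw [div_neg, neg_mul, div_mul_cancel₀ _ hB.ne]
  rw [h2] at this
  linarith [le_abs_self A]

lemma Lim.toLim2 {U : ℂ → ℝ} {W : ℂ → ℂ} (S : Lim U W) {z : ℂ} (hz : 0 < U z) (hf : ‖cg U z‖ < 1) : Lim2 U W := by
  refine ⟨S, fun p hp => ?_, z, hz⟩
  by_contra hlt
  have h1 : ‖cg U p‖ = 1 := le_antisymm (S.grad_le_one hp) (not_lt.1 hlt)
  have hu := S.uni hp h1
  set c := cg U p with hc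
  set ν : ℂ := I * conj c with hν
  have hcc : c * conj c = 1 := by
    rw [mul_conj, normSq_eq_norm_sq, h1]; simp
  have hre : ∀ t : ℝ, (c * (p + t * ν - p)).re = 0 := by
    intro t
    have : c * (p + t * ν - p) = t * I := by rw [hν]; linear_combination (t * I) * hcc
    rw [this]; simp
  have hpos : ∀ t : ℝ, 0 < U (p + t * ν) := by
    intro t
    have := hu (p + t * ν) (by rw [hre]; simpa using hp)
    rw [this, hre]; simpa using hp
  have hcg : ∀ t : ℝ, cg U (p + t * ν) = c := by
    intro t
    have hev : ∀ᶠ w in 𝓝 (p + t * ν), U w = U p + (c * (w - p)).re := by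
      filter_upwards [(isOpen_half (U p) c p).mem_nhds (by simp only [mem_ofPred_eq]; rw [hre]; simpa using hp)] with w hw
      exact hu w hw
    exact cg_eq ((hasFDerivAt_lin (U p) c p _).congr_of_eventuallyEq hev)
  have hd : ∀ t : ℝ, HasDerivAt (fun t : ℝ => W (p + t * ν)) 0 t := by
    intro t
    have h1 := S.wd _ (hpos t)
    have h2 : HasDerivAt (fun t : ℝ => p + t * ν) ν t := by
      have := ((hasDerivAt_id t).ofReal_comp.mul_const ν).const_add p
      simpa using this
    refine (h1.comp_hasDerivAt t h2).congr_deriv ?_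
    rw [hcg, om_apply, hν]
    simp only [map_mul, map_pow, conj_I, Complex.conj_conj]
    linear_combination (-I * conj c) * hcc
  have hconst : ∀ t : ℝ, W (p + t * ν) = W p := by
    intro t
    have := is_const_of_deriv_eq_zero (f := fun t : ℝ => W (p + t * ν)) (fun t => (hd t).differentiableAt)
      (fun t => (hd t).deriv) t 0
    simpa using this
  have key : ∀ y, dot2 (W y - W p) ν = 0 := by
    intro y
    have h : ∀ t : ℝ, 0 ≤ dot2 (W y - W p) (y - p) - t * dot2 (W y - W p) ν := by
      intro t
      have := S.mono (p + t * ν) y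
      rw [hconst] at this
      have e : y - (p + t * ν) = (y - p) - t * ν := by ring
      rw [e, dot2_sub_right, dot2_smul_right] at this
      exact this
    have h1 : 0 ≤ dot2 (W y - W p) ν := nonneg_of_lin (A := dot2 (W y - W p) (y - p)) fun t _ => by have := h (-t); linarith
    have h2 : 0 ≤ -dot2 (W y - W p) ν := nonneg_of_lin (A := dot2 (W y - W p) (y - p)) fun t _ => by have := h t; linarith
    linarith
  have hν0 : ν ≠ 0 := by
    rw [hν]
    refine mul_ne_zero I_ne_zero ?_
    intro h
    rw [h] at hcc; simp at hcc
  have := S.smono hz hf (w := z + ν) (by simpa using hν0)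
  have h1 := key z
  have h2 := key (z + ν)
  rw [dot2_sub_left] at *
  simp only [add_sub_cancel_left] at this
  linarith

lemma Lim.minty {U : ℂ → ℝ} {W : ℂ → ℂ} (S : Lim U W) {x p : ℂ} (h : ∀ y, 0 ≤ dot2 (W y - p) (y - x)) : W x = p := by
  have hWc := S.wlip.continuous
  set v := -(W x - p) with hv
  have h1 : ∀ s : ℝ, 0 < s → 0 ≤ dot2 (W (x + s * v) - p) v := by
    intro s hs
    have := h (x + s * v)
    rw [add_sub_cancel_left, dot2_smul_right] at this
    exact nonneg_of_mul_nonneg_right this hs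
  have hc : Continuous fun s : ℝ => dot2 (W (x + s * v) - p) v :=
    Continuous.dot2' (by fun_prop) (by fun_prop)
  have h2 : 0 ≤ dot2 (W (x + (0:ℝ) * v) - p) v := by
    refine ge_of_tendsto (x := 𝓝[>] (0:ℝ)) ((hc.tendsto 0).mono_left nhdsWithin_le_nhds) ?_
    filter_upwards [self_mem_nhdsWithin] with s hs using h1 s hs
  simp only [ofReal_zero, zero_mul, add_zero] at h2
  rw [hv, dot2_neg_right, dot2_self] at h2
  have : ‖W x - p‖ = 0 := by nlinarith [norm_nonneg (W x - p)]
  exact sub_eq_zero.1 (norm_eq_zero.1 this)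

lemma Lim.Zconvex {U : ℂ → ℝ} {W : ℂ → ℂ} (S : Lim U W) (p : ℂ) : Convex ℝ {z | W z = p} := by
  intro a ha b hb s t hs ht hst
  have ha' : W a = p := ha
  have hb' : W b = p := hb
  refine S.minty fun y => ?_
  have h1 := S.mono a y
  have h2 := S.mono b y
  rw [ha'] at h1; rw [hb'] at h2
  have e : y - (s • a + t • b) = s * (y - a) + t * (y - b) := by
    have : (s:ℂ) + t = 1 := by exact_mod_cast hst
    simp only [real_smul]
    linear_combination (-y) * this
  rw [e, dot2_add_right, dot2_smul_right, dot2_smul_right]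
  positivity

/-- the ray lemma -/
lemma Lim.ray {U : ℂ → ℝ} {W : ℂ → ℂ} (S : Lim U W) {a : ℂ} (ha : a ∈ frontier {z | 0 < U z}) :
    ∃ e : ℂ, ‖e‖ = 1 ∧ (∀ y, dot2 (W y - W a) e ≤ 0) ∧ ∀ b, W b = W a → ∀ t : ℝ, 0 ≤ t → W (b + t * e) = W a := by
  have hWc := S.wlip.continuous
  have h1 : ∀ n : ℕ, ∃ e : ℂ, e ∈ sphere (0:ℂ) 1 ∧ W (a + (n + 1 : ℝ) * e) = W a := by
    intro n
    have hn : (0:ℝ) < n + 1 := by positivity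
    obtain ⟨x, hx1, hx2⟩ := S.far a ha (n + 1) hn
    refine ⟨(x - a) / (n + 1 : ℝ), ?_, ?_⟩
    · rw [mem_sphere_zero_iff_norm, norm_div, ← dist_eq_norm, hx1, norm_real_pos hn, div_self hn.ne']
    · rw [mul_div_cancel₀ _ (by exact_mod_cast hn.ne')]; simpa using hx2
  choose e he hW using h1
  obtain ⟨e', he', φ, hφ, hlim⟩ := (isCompact_sphere (0:ℂ) 1).tendsto_subseq he
  have hray : ∀ t : ℝ, 0 ≤ t → W (a + t * e') = W a := by
    intro t ht
    have h2 : Tendsto (fun n => W (a + t * (e (φ n)))) atTop (𝓝 (W (a + t * e'))) :=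
      (hWc.continuousAt.tendsto).comp ((tendsto_const_nhds.mul hlim).const_add a)
    refine tendsto_nhds_unique h2 (tendsto_const_nhds.congr' ?_)
    obtain ⟨N, hN⟩ := exists_nat_gt t
    filter_upwards [eventually_ge_atTop N] with n hn
    have hφn : (N:ℝ) ≤ φ n := by exact_mod_cast hn.trans (hφ.id_le n)
    have hpos : (0:ℝ) < φ n + 1 := by positivity
    have := (S.Zconvex (W a)).add_smul_sub_mem (x := a) rfl (hW (φ n)) (t := t / (φ n + 1)) ⟨by positivity, by
      rw [div_le_one hpos]; linarith⟩
    have e1 : a + (t / (φ n + 1)) • (a + ((φ n + 1 : ℝ)) * e (φ n) - a) = a + t * e (φ n) := by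
      have : ((φ n : ℂ) + 1) ≠ 0 := by exact_mod_cast hpos.ne'
      simp only [real_smul]; push_cast; field_simp; ring
    rw [e1] at this
    exact (this : W _ = W a).symm
  have hle : ∀ y, dot2 (W y - W a) e' ≤ 0 := by
    intro y
    have : 0 ≤ -dot2 (W y - W a) e' := by
      refine nonneg_of_lin (A := dot2 (W y - W a) (y - a)) fun t ht => ?_
      have := S.mono (a + t * e') y
      rw [hray t ht, show y - (a + t * e') = (y - a) - t * e' by ring, dot2_sub_right, dot2_smul_right] at this
      linarith
    linarith
  refine ⟨e', mem_sphere_zero_iff_norm.1 he', hle, fun b hb t ht => S.minty fun y => ?_⟩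
  have := S.mono b y
  rw [hb] at this
  rw [show y - (b + t * e') = (y - b) - t * e' by ring, dot2_sub_right, dot2_smul_right]
  nlinarith [hle y]

namespace Lim2
variable {U : ℂ → ℝ} {W : ℂ → ℂ} (L : Lim2 U W)
include L

lemma smono {z w : ℂ} (hz : 0 < U z) (hne : w ≠ z) : 0 < dot2 (W w - W z) (w - z) := L.S.smono hz (L.lt z hz) hne

lemma mapO {x : ℂ} (hx : 0 < U x) : map W (𝓝 x) = 𝓝 (W x) := by
  have hcont : ContinuousAt (cg U) x := (L.S.har.hol.differentiableAt (L.S.op.mem_nhds hx)).continuousAt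
  have h1 : HasStrictFDerivAt W (om 1 (conj (cg U x ^ 2))) x := by
    refine hasStrictFDerivAt_of_hasFDerivAt_of_continuousAt (f' := fun z => om 1 (conj (cg U z ^ 2))) ?_ ?_
    · filter_upwards [L.S.op.mem_nhds hx] with z hz using L.S.wd z hz
    · have hc2 : ContinuousAt (fun z => conj (cg U z ^ 2)) x :=
        (continuous_conj.continuousAt).comp (hcont.pow 2)
      rw [Metric.continuousAt_iff] at hc2 ⊢
      intro ε hε
      obtain ⟨δ, hδ, h⟩ := hc2 ε hε
      refine ⟨δ, hδ, fun y hy => lt_of_le_of_lt ?_ (h hy)⟩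
      rw [dist_eq_norm, om_sub, dist_eq_norm]
      refine (norm_om_le _ _).trans ?_
      simp
  refine h1.map_nhds_eq_of_surj ?_
  have hinj : Function.Injective (om 1 (conj (cg U x ^ 2))).toLinearMap := by
    rw [injective_iff_map_eq_zero]
    intro v hv
    have hv' : om 1 (conj (cg U x ^ 2)) v = 0 := hv
    rw [om_apply] at hv'
    by_contra hne
    have h2 : ‖v‖ = ‖conj (cg U x ^ 2) * conj v‖ := by
      rw [← norm_neg]; congr 1; linear_combination -hv'
    rw [norm_mul, RCLike.norm_conj, RCLike.norm_conj, norm_pow] at h2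
    have h3 := L.lt x hx
    have h4 : 0 < ‖v‖ := norm_pos_iff.2 hne
    nlinarith [norm_nonneg (cg U x), mul_pos h4 (sub_pos.2 h3)]
  exact LinearMap.range_eq_top.2 (LinearMap.injective_iff_surjective.1 hinj)

lemma off1 {x : ℂ} (hx : x ∉ closure {z | 0 < U z}) (hc : ∀ᶠ w in 𝓝 x, W w = W x) :
    W x ∈ W '' frontier {z | 0 < U z} := by
  have hWc := L.S.wlip.continuous
  set E : Set ℂ := {y | y ∉ closure {z | 0 < U z} ∧ ∀ᶠ w in 𝓝 y, W w = W x} with hE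
  have hEo : IsOpen E := by
    rw [isOpen_iff_mem_nhds]
    rintro y ⟨h1, h2⟩
    filter_upwards [isClosed_closure.isOpen_compl.mem_nhds h1, eventually_eventually_nhds.2 h2] with z hz1 hz2 using ⟨hz1, hz2⟩
  have hxE : x ∈ E := ⟨hx, hc⟩
  have h0E : (0:ℂ) ∉ E := fun h => h.1 (frontier_subset_closure L.S.o0)
  have hncl : ¬ IsClosed E := fun hcl => by
    have : IsClopen E := ⟨hcl, hEo⟩
    rcases isClopen_iff.1 this with h | h
    · rw [h] at hxE; exact hxE
    · rw [h] at h0E; exact h0E (mem_univ _)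
  have : ¬ closure E ⊆ E := fun h => hncl (isClosed_of_closure_subset h)
  rw [not_subset] at this
  obtain ⟨y, hy1, hy2⟩ := this
  have hEW : E ⊆ {w | W w = W x} := fun w hw => hw.2.self_of_nhds
  have hWy : W y = W x := closure_minimal hEW (isClosed_eq hWc continuous_const) hy1
  refine ⟨y, ?_, hWy⟩
  have hyO : ¬ 0 < U y := fun h => by
    obtain ⟨w, hw1, hw2⟩ := mem_closure_iff.1 hy1 _ L.S.op h
    exact hw2.1 (subset_closure hw1)
  refine L.S.fr_iff.2 ⟨le_antisymm (not_lt.1 hyO) (L.S.nn y), ?_⟩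
  by_contra hyc
  rcases L.S.ext y hyc with h | h
  · exact hy2 ⟨hyc, by rw [hWy] at h; exact h⟩
  · obtain ⟨w, hw1, hw2⟩ := mem_closure_iff_nhds.1 hy1 _ (eventually_eventually_nhds.2 h)
    have hw1' : ∀ᶠ w' in 𝓝 w, W w' - w' = W y - y := hw1
    have := hw1'.and hw2.2
    obtain ⟨r, hr, hb⟩ := eventually_nhds_iff_ball.1 this
    have ha := hb w (mem_ball_self hr)
    have hbb := hb (w + (r/2 : ℝ)) (by simp [dist_eq_norm, abs_of_pos hr]; linarith)
    have : ((r/2:ℝ):ℂ) = 0 := by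
      have e1 := ha.1; have e2 := hbb.1
      rw [ha.2] at e1; rw [hbb.2] at e2
      linear_combination e1 - e2
    have : r/2 = 0 := by exact_mod_cast this
    linarith

/-- the set where `W` is strictly monotone -/
lemma exists_Q : ∃ Q : Set ℂ, IsOpen Q ∧ (∀ x, 0 < U x → x ∈ Q) ∧
    (∀ x ∈ Q, map W (𝓝 x) = 𝓝 (W x)) ∧ (∀ z ∈ Q, ∀ w, w ≠ z → 0 < dot2 (W w - W z) (w - z)) ∧
    (∀ x ∉ Q, W x ∈ W '' frontier {z | 0 < U z}) ∧
    (∀ x ∈ Q, 0 < U x ∨ x ∉ closure {z | 0 < U z}) ∧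
    (∀ x ∉ closure {z | 0 < U z}, x ∉ Q → ∀ᶠ w in 𝓝 x, W w = W x) := by
  refine ⟨{x | 0 < U x} ∪ {x | x ∉ closure {z | 0 < U z} ∧ ∀ᶠ w in 𝓝 x, W w - w = W x - x},
    ?_, fun x hx => Or.inl hx, ?_, ?_, ?_, ?_, ?_⟩
  · refine L.S.op.union ?_
    rw [isOpen_iff_mem_nhds]
    rintro y ⟨h1, h2⟩
    filter_upwards [isClosed_closure.isOpen_compl.mem_nhds h1, eventually_eventually_nhds.2 h2, h2] with z hz1 hz2 hz3
    refine ⟨hz1, ?_⟩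
    rw [hz3]; exact hz2
  · rintro x (hx | ⟨-, hx⟩)
    · exact L.mapO hx
    · have : W =ᶠ[𝓝 x] fun w => w + (W x - x) := by
        filter_upwards [hx] with w hw
        linear_combination hw
      rw [Filter.map_congr this]
      have := (Homeomorph.addRight (W x - x)).map_nhds_eq x
      simpa using this
  · rintro z (hz | ⟨-, hz⟩) w hne
    · exact L.smono hz hne
    · obtain ⟨r, hr, hb⟩ := eventually_nhds_iff_ball.1 hz
      obtain ⟨t, y, hn, ht0, ht1, hyz, hwy, hyz', hyb⟩ := seg_pt hr hne
      have h2 := L.S.mono y w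
      have h3 : W y - W z = t * (w - z) := by have := hb y hyb; linear_combination this + hyz
      rw [hwy, dot2_smul_right] at h2
      have h2' := nonneg_of_mul_nonneg_right h2 (by linarith)
      have h4 : W w - W z = (W w - W y) + t * (w - z) := by linear_combination h3
      rw [h4, dot2_add_left, dot2_smul_left, dot2_self]
      positivity
  · intro x hx
    simp only [mem_union, not_or] at hx
    by_cases hc : x ∈ closure {z | 0 < U z}
    · exact ⟨x, L.S.fr_iff.2 ⟨le_antisymm (not_lt.1 hx.1) (L.S.nn x), hc⟩, rfl⟩
    · rcases L.S.ext x hc with h | h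
      · exact L.off1 hc h
      · exact absurd ⟨hc, h⟩ hx.2
  · rintro x (hx | ⟨hx, -⟩)
    · exact Or.inl hx
    · exact Or.inr hx
  · intro x hx hQ
    rcases L.S.ext x hx with h | h
    · exact h
    · exact absurd (Or.inr ⟨hx, h⟩) hQ

theorem structure1 : IsPreconnected {z | 0 < U z} ∧ Convex ℝ (W '' {z | 0 < U z}) ∧
    (∀ x, ¬ 0 < U x → W x ∈ W '' frontier {z | 0 < U z}) ∧
    (∀ x ∉ closure {z | 0 < U z}, ∀ᶠ w in 𝓝 x, W w = W x) := by
  have hWc := L.S.wlip.continuous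
  obtain ⟨Q, hQo, hOQ, hQm, hQs, hQoff, hQ2, hQext⟩ := L.exists_Q
  have hopen : ∀ A : Set ℂ, IsOpen A → IsOpen (W '' (Q ∩ A)) := by
    intro A hA
    rw [isOpen_iff_mem_nhds]
    rintro _ ⟨x, ⟨hx, hxA⟩, rfl⟩
    rw [← hQm x hx]
    exact image_mem_map ((hQo.inter hA).mem_nhds ⟨hx, hxA⟩)
  have hWQ : IsOpen (W '' Q) := by simpa using hopen univ isOpen_univ
  have hinj : InjOn W Q := by
    intro x hx y hy hxy
    by_contra hne
    have := hQs x hx y (Ne.symm hne)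
    rw [hxy] at this
    simp [dot2] at this
  have hclaim : ∀ q0 ∈ W '' Q, ∀ q1 ∈ W '' Q, segment ℝ q0 q1 ⊆ W '' Q := by
    intro q0 hq0 q1 hq1
    refine (convex_segment q0 q1).isPreconnected.subset_of_closure_inter_subset hWQ ⟨q0, left_mem_segment ℝ _ _, hq0⟩ ?_
    rintro q ⟨hqc, hqs⟩
    have nocone : ∀ e : ℂ, ‖e‖ = 1 → (∀ y, dot2 (W y - q) e ≤ 0) → False := by
      intro e he hle
      obtain ⟨r0, hr0, hb0⟩ := Metric.isOpen_iff.1 hWQ q0 hq0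
      obtain ⟨r1, hr1, hb1⟩ := Metric.isOpen_iff.1 hWQ q1 hq1
      set ρ := min r0 r1 / 2 with hρ
      have hρ0 : 0 < ρ := by positivity
      have hρ1 : ρ < r0 := by have := min_le_left r0 r1; linarith
      have hρ2 : ρ < r1 := by have := min_le_right r0 r1; linarith
      obtain ⟨y0, -, hy0⟩ := hb0 (show q0 + ρ * e ∈ ball q0 r0 by simp [dist_eq_norm, he, abs_of_pos hρ0, hρ1])
      obtain ⟨y1, -, hy1⟩ := hb1 (show q1 + ρ * e ∈ ball q1 r1 by simp [dist_eq_norm, he, abs_of_pos hρ0, hρ2])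
      obtain ⟨s, t, hs, ht, hst, rfl⟩ := hqs
      have h0 := hle y0
      have h1 := hle y1
      rw [hy0] at h0
      rw [hy1] at h1
      have hst' : (s:ℂ) + t = 1 := by exact_mod_cast hst
      have e0 : s * dot2 (q0 + ρ * e - (s • q0 + t • q1)) e + t * dot2 (q1 + ρ * e - (s • q0 + t • q1)) e = ρ := by
        rw [← dot2_smul_left, ← dot2_smul_left, ← dot2_add_left]
        have : (s:ℂ) * (q0 + ρ * e - (s • q0 + t • q1)) + t * (q1 + ρ * e - (s • q0 + t • q1)) = ρ * e := by
          simp only [real_smul]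
          linear_combination (ρ * e - s * q0 - t * q1) * hst'
        rw [this, dot2_smul_left, dot2_self, he]; ring
      nlinarith
    obtain ⟨q', hq'1, hq'2⟩ := mem_closure_iff_seq_limit.1 hqc
    choose z hz hzq using hq'1
    have hlim : Tendsto (fun n => W (z n)) atTop (𝓝 q) := by simpa [hzq] using hq'2
    by_cases hbd : ∃ M : ℝ, ∃ᶠ n in atTop, ‖z n‖ ≤ M
    · obtain ⟨M, hM⟩ := hbd
      obtain ⟨x, -, φ, hφ, hx⟩ := (isCompact_closedBall (0:ℂ) M).tendsto_subseq' (x := z) (by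
        refine hM.mono fun n hn => ?_
        simpa using hn)
      have hWx : W x = q := tendsto_nhds_unique ((hWc.tendsto x).comp hx) (hlim.comp hφ.tendsto_atTop)
      by_cases hxQ : x ∈ Q
      · exact ⟨x, hxQ, hWx⟩
      · exfalso
        obtain ⟨a, ha, hWa⟩ := hQoff x hxQ
        obtain ⟨e, he, hle, -⟩ := L.S.ray ha
        rw [hWa, hWx] at hle
        exact nocone e he hle
    · exfalso
      push Not at hbd
      have htop : Tendsto (fun n => ‖z n‖) atTop atTop := by
        rw [Filter.tendsto_atTop]
        intro b
        have := hbd b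
        filter_upwards [this] with n hn using hn.le
      obtain ⟨e, he, φ, hφ, hlime⟩ := (isCompact_closedBall (0:ℂ) 1).tendsto_subseq (x := fun n => z n / ‖z n‖) (fun n => by
        simp only [mem_closedBall, dist_zero_right, norm_div, norm_real, norm_norm]
        exact div_self_le_one _)
      have hnorm : ‖e‖ = 1 := by
        refine tendsto_nhds_unique hlime.norm (tendsto_const_nhds.congr' ?_)
        filter_upwards [hφ.tendsto_atTop.eventually (htop.eventually_gt_atTop 0)] with n hn
        simp [hn.ne']
      refine nocone e hnorm fun y => ?_
      have h1 : Tendsto (fun n => dot2 (W (z (φ n)) - W y) (z (φ n) / ‖z (φ n)‖ - y * ((‖z (φ n)‖⁻¹ : ℝ) : ℂ))) atTop (𝓝 (dot2 (q - W y) (e - y * ((0:ℝ):ℂ)))) := by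
        have ha : Tendsto (fun n => W (z (φ n)) - W y) atTop (𝓝 (q - W y)) := (hlim.comp hφ.tendsto_atTop).sub_const _
        have hb : Tendsto (fun n => z (φ n) / ‖z (φ n)‖ - y * ((‖z (φ n)‖⁻¹ : ℝ) : ℂ)) atTop (𝓝 (e - y * ((0:ℝ):ℂ))) := by
          refine hlime.sub (Tendsto.const_mul _ ?_)
          exact (continuous_ofReal.tendsto 0).comp (tendsto_inv_atTop_zero.comp (htop.comp hφ.tendsto_atTop))
        exact (continuous_dot2.tendsto (q - W y, e - y * ((0:ℝ):ℂ))).comp (ha.prodMk_nhds hb)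
      have h2 : 0 ≤ dot2 (q - W y) (e - y * ((0:ℝ):ℂ)) := by
        refine ge_of_tendsto h1 ?_
        filter_upwards [hφ.tendsto_atTop.eventually (htop.eventually_gt_atTop 0)] with n hn
        have e1 : z (φ n) / ‖z (φ n)‖ - y * ((‖z (φ n)‖⁻¹ : ℝ) : ℂ) = ((‖z (φ n)‖⁻¹ : ℝ) : ℂ) * (z (φ n) - y) := by
          push_cast; rw [div_eq_mul_inv]; ring
        rw [e1, dot2_smul_right]
        exact mul_nonneg (by positivity) (L.S.mono _ _)
      simp only [ofReal_zero, mul_zero, sub_zero] at h2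
      rw [dot2_sub_left] at h2 ⊢
      linarith
  have hconv : Convex ℝ (W '' Q) := convex_iff_segment_subset.2 fun q0 h0 q1 h1 => hclaim q0 h0 q1 h1
  have hQpre : IsPreconnected Q := by
    intro A B hA hB hcov ⟨x, hxQ, hxA⟩ ⟨y, hyQ, hyB⟩
    obtain ⟨q, -, ⟨a, ha, haq⟩, ⟨b, hb, hbq⟩⟩ := hconv.isPreconnected (W '' (Q ∩ A)) (W '' (Q ∩ B)) (hopen A hA) (hopen B hB) (by
        rintro _ ⟨z, hz, rfl⟩
        rcases hcov hz with h | h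
        · exact Or.inl ⟨z, ⟨hz, h⟩, rfl⟩
        · exact Or.inr ⟨z, ⟨hz, h⟩, rfl⟩)
      ⟨W x, ⟨x, hxQ, rfl⟩, ⟨x, ⟨hxQ, hxA⟩, rfl⟩⟩ ⟨W y, ⟨y, hyQ, rfl⟩, ⟨y, ⟨hyQ, hyB⟩, rfl⟩⟩
    have : a = b := hinj ha.1 hb.1 (haq.trans hbq.symm)
    exact ⟨a, ha.1, ha.2, this ▸ hb.2⟩
  have hQO : Q = {z | 0 < U z} := by
    refine Subset.antisymm ?_ fun x hx => hOQ x hx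
    obtain ⟨z0, hz0⟩ := L.ne
    refine hQpre.subset_left_of_subset_union L.S.op isClosed_closure.isOpen_compl ?_ (fun x hx => hQ2 x hx) ⟨z0, hOQ z0 hz0, hz0⟩
    exact disjoint_left.2 fun x hx hx2 => hx2 (subset_closure hx)
  subst hQO
  exact ⟨hQpre, hconv, fun x hx => hQoff x hx, fun x hx => hQext x hx fun h => hx (subset_closure h)⟩

end Lim2
end OP

namespace OP

namespace Lim2
variable {U : ℂ → ℝ} {W : ℂ → ℂ} (L : Lim2 U W)
include L

lemma off {x : ℂ} (hx : ¬ 0 < U x) : W x ∈ W '' frontier {z | 0 < U z} := L.structure1.2.2.1 x hx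

lemma zero_of_val {x y : ℂ} (hx : ¬ 0 < U x) (h : W y = W x) : ¬ 0 < U y := by
  intro hy
  have hne : x ≠ y := by rintro rfl; exact hx hy
  have := L.smono hy hne
  rw [h] at this
  simp [dot2] at this

lemma near {x : ℂ} (hx : ¬ 0 < U x) : ∀ᶠ w in 𝓝 x, 0 < U w ∨ W w = W x := by
  have hWc := L.S.wlip.continuous
  have hfin : (W '' frontier {z | 0 < U z} \ {W x}).Finite := L.S.fin_vals.subset diff_subset
  have : W ⁻¹' (W '' frontier {z | 0 < U z} \ {W x})ᶜ ∈ 𝓝 x :=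
    (hfin.isClosed.isOpen_compl.preimage hWc).mem_nhds (by simp)
  filter_upwards [this] with w hw
  by_contra! hcon
  exact hw ⟨L.off (not_lt.2 hcon.1), hcon.2⟩

lemma locN {x : ℂ} (hx : 0 < U x) : ∃ r > 0, ∃ q < 1, ball x r ⊆ {z | 0 < U z} ∧
    ∀ y ∈ ball x r, ‖(W y - y) - (W x - x)‖ ≤ q * ‖y - x‖ := by
  have hcont : ContinuousAt (cg U) x := (L.S.har.hol.differentiableAt (L.S.op.mem_nhds hx)).continuousAt
  have hlt := L.lt x hx
  set q := (‖cg U x‖ + 1) / 2 with hq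
  have hev := (hcont.norm.eventually (gt_mem_nhds (show ‖cg U x‖ < q by linarith))).and (L.S.op.mem_nhds hx)
  obtain ⟨r, hr, hb⟩ := eventually_nhds_iff_ball.1 hev
  refine ⟨r, hr, q, by linarith, fun y hy => (hb y hy).2, fun y hy => ?_⟩
  refine (convex_ball x r).norm_image_sub_le_of_norm_hasFDerivWithin_le (f := fun z => W z - z)
    (f' := fun z => om 1 (conj (cg U z ^ 2)) - ContinuousLinearMap.id ℝ ℂ)
    (fun z hz => ((L.S.wd z (hb z hz).2).sub (hasFDerivAt_id z)).hasFDerivWithinAt) (fun z hz => ?_) (mem_ball_self hr) hy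
  have hz1 := (hb z hz).1
  have hz0 := norm_nonneg (cg U z)
  refine ContinuousLinearMap.opNorm_le_bound _ (by linarith) fun v => ?_
  simp only [_root_.sub_apply, om_apply, ContinuousLinearMap.id_apply, one_mul, add_sub_cancel_left]
  rw [norm_mul, RCLike.norm_conj, RCLike.norm_conj, norm_pow]
  gcongr
  have : q ≤ 1 := by linarith
  nlinarith

lemma N_lip (z w : ℂ) : ‖(W w - w) - (W z - z)‖ ≤ ‖w - z‖ := by
  have hWc := L.S.wlip.continuous
  have key : ∀ η : ℂ, ‖η‖ = 1 → dot2 ((W w - w) - (W z - z)) η ≤ ‖w - z‖ := by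
    intro η hη
    set Bd : Set ℝ := {t | ¬ 0 < U (z + t * (w - z)) ∧ ∀ s > t, W (z + s * (w - z)) ≠ W (z + t * (w - z))} with hBd
    have hBfin : Bd.Finite := by
      refine Set.Finite.of_injOn (f := fun t : ℝ => W (z + t * (w - z))) (fun t ht => L.off ht.1) ?_ L.S.fin_vals
      intro t ht s hs hts
      rcases lt_trichotomy t s with h | h | h
      · exact absurd hts.symm (ht.2 s h)
      · exact h
      · exact absurd hts (hs.2 t h)
    have := mono1 (h := fun t : ℝ => ‖w - z‖ * t - dot2 (W (z + t * (w - z)) - (z + t * (w - z))) η)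
      (by
        refine Continuous.sub (by fun_prop) (Continuous.dot2' (by fun_prop) (by fun_prop))) Bd (hBfin.image _) (fun t _ htB => by
        have hcont : Continuous fun s : ℝ => z + s * (w - z) := by fun_prop
        by_cases hO : 0 < U (z + t * (w - z))
        · obtain ⟨r, hr, q, hq, hb, hN⟩ := L.locN hO
          have hev := nhdsWithin_le_nhds (s := Ioi t) (hcont.continuousAt.eventually (ball_mem_nhds (z + t * (w - z)) hr))
          filter_upwards [hev, self_mem_nhdsWithin] with s hs hst
          have h1 := hN _ hs
          have e : z + s * (w - z) - (z + t * (w - z)) = ((s - t : ℝ) : ℂ) * (w - z) := by push_cast; ring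
          have hst' : 0 < s - t := sub_pos.2 hst
          rw [e, norm_mul, norm_real_pos hst'] at h1
          have h2 := le_of_abs_le (abs_dot2_le ((W (z + s * (w - z)) - (z + s * (w - z))) - (W (z + t * (w - z)) - (z + t * (w - z)))) η)
          rw [hη, dot2_sub_left] at h2
          have h3 : 0 ≤ (1 - q) * ((s - t) * ‖w - z‖) := by
            have : 0 < 1 - q := by linarith
            positivity
          linarith
        · have : ∃ s > t, W (z + s * (w - z)) = W (z + t * (w - z)) := by
            by_contra! hcon
            exact htB ⟨hO, hcon⟩
          obtain ⟨s1, hs1, hW1⟩ := this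
          filter_upwards [Ioc_mem_nhdsGT hs1] with s hs
          have hcx := (L.S.Zconvex (W (z + t * (w - z)))).add_smul_sub_mem (x := z + t * (w - z)) rfl hW1 (t := (s - t) / (s1 - t))
            ⟨div_nonneg (by linarith [hs.1]) (by linarith), by rw [div_le_one (by linarith)]; linarith [hs.2]⟩
          have e1 : z + t * (w - z) + ((s - t) / (s1 - t)) • (z + s1 * (w - z) - (z + t * (w - z))) = z + s * (w - z) := by
            have : ((s1:ℂ) - t) ≠ 0 := by
              have : s1 - t ≠ 0 := by linarith
              exact_mod_cast this
            simp only [real_smul]; push_cast; field_simp; ring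
          rw [e1] at hcx
          have hcx' : W (z + s * (w - z)) = W (z + t * (w - z)) := hcx
          rw [hcx']
          have e2 : (z + s * (w - z)) = (z + t * (w - z)) + ((s - t : ℝ) : ℂ) * (w - z) := by push_cast; ring
          have e3 : dot2 (W (z + t * (w - z)) - (z + s * (w - z))) η = dot2 (W (z + t * (w - z)) - (z + t * (w - z))) η
              - (s - t) * dot2 (w - z) η := by
            rw [e2, ← sub_sub _ (z + t * (w - z)), dot2_sub_left (W (z + t * (w - z)) - (z + t * (w - z))), dot2_smul_left]
          rw [e3]
          have h2 := neg_le_of_abs_le (abs_dot2_le (w - z) η)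
          rw [hη] at h2
          nlinarith [hs.1])
    simp only [ofReal_zero, zero_mul, add_zero, mul_zero, zero_sub, ofReal_one, one_mul, mul_one, add_sub_cancel] at this
    rw [dot2_sub_left]
    linarith
  by_cases h0 : (W w - w) - (W z - z) = 0
  · rw [h0]; simp
  · set D := (W w - w) - (W z - z) with hD
    have hn : 0 < ‖D‖ := norm_pos_iff.2 h0
    have := key (((‖D‖⁻¹ : ℝ) : ℂ) * D) (by rw [norm_mul, norm_real_pos (by positivity)]; field_simp)
    rw [dot2_smul_right, dot2_self] at this
    field_simp at this
    exact this

lemma N_lt {z w : ℂ} (hz : 0 < U z) (hne : w ≠ z) : ‖(W w - w) - (W z - z)‖ < ‖w - z‖ := by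
  obtain ⟨r, hr, q, hq, hb, hN⟩ := L.locN hz
  obtain ⟨t, y, hn, ht0, ht1, hyz, hwy, hyz', hyb⟩ := seg_pt hr hne
  have hwy' : ‖w - y‖ = (1 - t) * ‖w - z‖ := by rw [hwy, norm_mul, norm_real_pos (by linarith)]
  have h1 := hN y hyb
  have h2 := L.N_lip y w
  rw [hyz'] at h1
  rw [hwy'] at h2
  have h3 := norm_add_le ((W w - w) - (W y - y)) ((W y - y) - (W z - z))
  rw [show (W w - w) - (W y - y) + ((W y - y) - (W z - z)) = (W w - w) - (W z - z) by ring] at h3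
  have h4 : 0 < (1 - q) * (t * ‖w - z‖) := by
    have : 0 < 1 - q := by linarith
    positivity
  linarith

/-- rotation -/
lemma rot {μ : ℂ} (hμ : ‖μ‖ = 1) : Lim2 (fun z => U (μ * z)) (fun z => conj μ * W (μ * z)) := by
  have hμ0 : μ ≠ 0 := by rintro rfl; simp at hμ
  have hμc : μ * conj μ = 1 := by
    rw [mul_conj, normSq_eq_norm_sq, hμ]; simp
  have hcn : ‖conj μ‖ = 1 := by rw [RCLike.norm_conj, hμ]
  have hcinj : ∀ a b : ℂ, conj μ * a = conj μ * b → a = b := fun a b h => by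
    linear_combination μ * h + (b - a) * hμc
  have hiso : Isometry fun z : ℂ => μ * z := by
    refine Isometry.of_dist_eq fun a b => ?_
    rw [dist_eq_norm, ← mul_sub, norm_mul, hμ, one_mul, dist_eq_norm]
  set e := Homeomorph.mulLeft₀ μ hμ0 with he
  have hpre : {z | 0 < U (μ * z)} = e ⁻¹' {z | 0 < U z} := rfl
  have hfr : frontier {z | 0 < U (μ * z)} = e ⁻¹' frontier {z | 0 < U z} := by rw [hpre, e.preimage_frontier]
  have hcl : closure {z | 0 < U (μ * z)} = e ⁻¹' closure {z | 0 < U z} := by rw [hpre, e.preimage_closure]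
  have hmul : ∀ z, HasFDerivAt (fun z : ℂ => μ * z) (om μ 0) z := fun z => by
    refine ((hasDerivAt_id z).const_mul μ).hasFDerivAt.restrictScalars ℝ |>.congr_fderiv ?_
    ext v <;> simp [mul_comm]
  have hd : ∀ z, 0 < U (μ * z) → HasFDerivAt (fun z => U (μ * z)) (reL (cg U (μ * z) * μ)) z := by
    intro z hz
    have := (L.S.har.hd _ hz).comp z (hmul z)
    refine this.congr_fderiv ?_
    refine ContinuousLinearMap.ext fun v => ?_
    simp only [ContinuousLinearMap.comp_apply, reL_apply, om_apply, zero_mul, add_zero, mul_assoc]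
  have hcg : ∀ z, 0 < U (μ * z) → cg (fun z => U (μ * z)) z = cg U (μ * z) * μ := fun z hz => cg_eq (hd z hz)
  have hop : IsOpen {z | 0 < U (μ * z)} := by rw [hpre]; exact L.S.op.preimage e.continuous
  refine ⟨⟨?_, fun z => L.S.nn _, by simpa using L.S.u0, ⟨hop, fun z hz => ?_, ?_⟩, ?_, ?_, ?_, ?_, ?_, ?_, ?_⟩, ?_, ?_⟩
  · have := L.S.lip.comp hiso.lipschitz
    rw [mul_one] at this; exact this
  · rw [hcg z hz]; exact hd z hz
  · have : DifferentiableOn ℂ (fun z => cg U (μ * z) * μ) {z | 0 < U (μ * z)} := by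
      refine DifferentiableOn.mul_const (L.S.har.hol.comp (g := cg U) (f := fun z => μ * z) (s := {z | 0 < U (μ * z)}) (by fun_prop) fun z hz => hz) _
    exact this.congr fun z hz => hcg z hz
  · refine LipschitzWith.of_dist_le_mul fun a b => ?_
    have := L.S.wlip.dist_le_mul (μ * a) (μ * b)
    rw [hiso.dist_eq] at this
    rw [dist_eq_norm, ← mul_sub, norm_mul, hcn, one_mul, ← dist_eq_norm]
    exact this
  · intro z hz
    have := ((L.S.wd _ hz).comp z (hmul z)).const_mul (conj μ)
    refine this.congr_fderiv ?_
    rw [hcg z hz]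
    refine ContinuousLinearMap.ext fun v => ?_
    simp only [_root_.smul_apply, ContinuousLinearMap.comp_apply, om_apply, smul_eq_mul, map_mul, map_pow]
    simp only [zero_mul, add_zero, map_mul]
    linear_combination v * hμc
  · intro x hx ρ hρ
    rw [hfr] at hx
    obtain ⟨x', h1, h2⟩ := L.S.far (μ * x) hx ρ hρ
    have e1 : μ * (conj μ * x') = x' := by linear_combination x' * hμc
    refine ⟨conj μ * x', ?_, ?_⟩
    · rw [← hiso.dist_eq]; simp only [e1]; exact h1
    · simp only [e1]; rw [h2]
  · intro x hx
    rw [hcl] at hx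
    have hct : Tendsto (fun z => μ * z) (𝓝 x) (𝓝 (μ * x)) := (continuous_const.mul continuous_id).tendsto x
    rcases L.S.ext (μ * x) hx with h | h
    · left
      filter_upwards [hct.eventually h] with w hw
      rw [hw]
    · right
      filter_upwards [hct.eventually h] with w hw
      linear_combination conj μ * hw + (w - x) * hμc
  · obtain ⟨c, hc, h⟩ := L.S.nd
    refine ⟨c, hc, fun x hx r hr => ?_⟩
    rw [hfr] at hx
    obtain ⟨y, hy1, hy2⟩ := h (μ * x) hx r hr
    have e1 : μ * (conj μ * y) = y := by linear_combination y * hμc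
    refine ⟨conj μ * y, ?_, ?_⟩
    · rw [mem_ball, ← hiso.dist_eq]; simp only [e1]; exact hy1
    · simp only [e1]; exact hy2
  · intro N x hx hinj
    refine L.S.fin N (fun i => μ * x i) (fun i => ?_) fun i j hij => hinj ?_
    · have := hx i
      rw [hfr] at this; exact this
    · simp only at hij ⊢
      rw [hij]
  · rw [hfr]
    have : e 0 = 0 := by simp [he]
    rw [mem_preimage, this]; exact L.S.o0
  · intro z hz
    rw [hcg z hz, norm_mul, hμ, mul_one]
    exact L.lt _ hz
  · obtain ⟨z, hz⟩ := L.ne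
    refine ⟨conj μ * z, ?_⟩
    have e1 : μ * (conj μ * z) = z := by linear_combination z * hμc
    simp only [e1]; exact hz

/-- derivative of ζ -/
lemma zeta_deriv {z : ℂ} (hz : 0 < U z) :
    HasDerivAt (fun z => 2 * (z.re : ℂ) - conj (W z)) (1 - cg U z ^ 2) z := by
  have h1 := L.S.wd z hz
  have h2 : HasFDerivAt (fun z => 2 * (z.re : ℂ) - conj (W z)) (om (1 - cg U z ^ 2) 0) z := by
    have h3 := (ofRealCLM.comp reCLM).hasFDerivAt (x := z) |>.const_mul (2:ℂ)
    have h4 := (conjCLE : ℂ →L[ℝ] ℂ).hasFDerivAt.comp z h1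
    refine (h3.sub h4).congr_fderiv ?_
    refine ContinuousLinearMap.ext fun v => ?_
    simp only [_root_.sub_apply, _root_.smul_apply, ContinuousLinearMap.comp_apply, om_apply, smul_eq_mul]
    have e1 : (2:ℂ) * ((v.re : ℝ) : ℂ) = v + conj v := by
      rw [Complex.add_conj]; push_cast; ring
    have e2 : ofRealCLM (reCLM v) = (v.re : ℂ) := rfl
    rw [e2, e1]
    simp
    ring
  rw [hasDerivAt_iff_hasFDerivAt]
  refine hasFDerivAt_of_restrictScalars ℝ h2 ?_
  refine ContinuousLinearMap.ext fun v => ?_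
  simp [mul_comm]

end Lim2
end OP

namespace OP

/-- max norm on ℂ -/
noncomputable def mx (w : ℂ) : ℝ := max |w.re| |w.im|

lemma mx_I (w : ℂ) : mx (I * w) = mx w := by simp [mx, max_comm]
lemma mx_neg (w : ℂ) : mx (-w) = mx w := by simp [mx]
lemma mx_cont : Continuous mx := by unfold mx; fun_prop
lemma norm_le_mx (w : ℂ) : ‖w‖ ≤ 2 * mx w := by
  have := norm_le_abs_re_add_abs_im w
  have h1 := le_max_left |w.re| |w.im|
  have h2 := le_max_right |w.re| |w.im|
  unfold mx; linarith

/-- four rotation trick: function on a square vanishing on one side vanishes at the center -/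
lemma square_trick {g : ℂ → ℂ} {c : ℂ} {h : ℝ} (hh : 0 < h)
    (hc : ContinuousOn g {z | mx (z - c) ≤ h}) (hd : DifferentiableOn ℂ g {z | mx (z - c) < h})
    (h0 : ∀ z, mx (z - c) ≤ h → (z - c).re = -h → g z = 0) : g c = 0 := by
  set V : Set ℂ := {z | mx (z - c) < h} with hV
  have hmc : Continuous fun z => mx (z - c) := mx_cont.comp (by fun_prop)
  have hclV : closure V ⊆ {z | mx (z - c) ≤ h} := closure_lt_subset_le hmc continuous_const
  have hfrV : frontier V ⊆ {z | mx (z - c) = h} := frontier_lt_subset_eq hmc continuous_const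
  set G : ℂ → ℂ := fun z => g (c + (z - c)) * g (c + I * (z - c)) * (g (c + -(z - c)) * g (c + -(I * (z - c)))) with hG
  have hdiff : ∀ r : ℂ, (∀ w, mx (r * w) = mx w) → DiffContOnCl ℂ (fun z => g (c + r * (z - c))) V := by
    intro r hr
    constructor
    · refine hd.comp (f := fun z => c + r * (z - c)) (by fun_prop) fun z hz => ?_
      simp only [hV, mem_ofPred_eq, add_sub_cancel_left, hr] at hz ⊢; exact hz
    · refine hc.comp (f := fun z => c + r * (z - c)) (by fun_prop) fun z hz => ?_
      simp only [mem_ofPred_eq, add_sub_cancel_left, hr]; exact hclV hz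
  have e1 := hdiff 1 (by simp)
  have e2 := hdiff I mx_I
  have e3 := hdiff (-1) (fun w => by rw [neg_one_mul, mx_neg])
  have e4 := hdiff (-I) (fun w => by rw [neg_mul, mx_neg, mx_I])
  simp only [one_mul, neg_mul] at e1 e2 e3 e4
  have hGd : DiffContOnCl ℂ G V :=
    ⟨(e1.1.mul e2.1).mul (e3.1.mul e4.1), (e1.2.mul e2.2).mul (e3.2.mul e4.2)⟩
  have hbd : Bornology.IsBounded V := by
    refine (isBounded_ball (x := c) (r := 2 * h)).subset fun z hz => ?_
    rw [mem_ball, dist_eq_norm]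
    have hz' : mx (z - c) < h := hz
    linarith [norm_le_mx (z - c)]
  have hmax := norm_le_of_forall_mem_frontier_norm_le hbd hGd (C := 0) (fun z hz => by
    have hz' : mx (z - c) = h := hfrV hz
    have hcase : (z - c).re = -h ∨ (I * (z - c)).re = -h ∨ (-(z - c)).re = -h ∨ (-(I * (z - c))).re = -h := by
      simp only [mx] at hz'
      rcases max_choice |(z-c).re| |(z-c).im| with h1 | h1 <;> rw [h1] at hz'
      · rcases abs_choice (z-c).re with h2 | h2 <;> rw [h2] at hz'
        · right; right; left; rw [neg_re]; linarith
        · left; linarith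
      · rcases abs_choice (z-c).im with h2 | h2 <;> rw [h2] at hz'
        · right; left; simp only [I_mul_re]; linarith
        · right; right; right; simp only [neg_re, I_mul_re]; linarith
    have hG0 : G z = 0 := by
      simp only [hG]
      rcases hcase with h1 | h1 | h1 | h1
      · rw [h0 (c + (z - c))] <;> simp [hz'.le] ; simpa using h1
      · rw [h0 (c + I * (z - c))]
        · simp
        · rw [add_sub_cancel_left, mx_I, hz']
        · rw [add_sub_cancel_left]; exact h1
      · rw [h0 (c + -(z - c))]
        · simp
        · rw [add_sub_cancel_left, mx_neg, hz']
        · rw [add_sub_cancel_left]; exact h1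
      · rw [h0 (c + -(I * (z - c)))]
        · simp
        · rw [add_sub_cancel_left, mx_neg, mx_I, hz']
        · rw [add_sub_cancel_left]; exact h1
    rw [hG0]; simp) (z := c) (subset_closure (by simp [hV, mx, hh]))
  have hGc : G c = 0 := norm_le_zero_iff.1 hmax
  simp only [hG, sub_self, mul_zero, neg_zero, add_zero] at hGc
  simpa using hGc

namespace Lim2
variable {U : ℂ → ℝ} {W : ℂ → ℂ} (L : Lim2 U W)
include L

lemma interior_I {a : ℂ} (ha : ¬ 0 < U a) (hray : ∀ b, W b = W a → ∀ t : ℝ, 0 ≤ t → W (b + t * I) = W a) :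
    ∃ c ρ, 0 < ρ ∧ ∀ z ∈ ball c ρ, W z = W a := by
  have hWc := L.S.wlip.continuous
  by_cases hb : ∃ b, W b = W a ∧ b.re ≠ a.re
  · obtain ⟨b, hb, hne⟩ := hb
    have hd : 0 < |b.re - a.re| := abs_pos.2 (sub_ne_zero.2 hne)
    refine ⟨(a + b) / 2 + ((|b.im - a.im| + 1 : ℝ) : ℂ) * I, min (|b.re - a.re| / 4) 1, by positivity, fun z hz => ?_⟩
    rw [mem_ball, dist_eq_norm] at hz
    have h1 := (abs_re_le_norm _).trans_lt (hz.trans_le (min_le_left _ _))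
    have h2 := (Complex.abs_im_le_norm _).trans_lt (hz.trans_le (min_le_right _ _))
    have hre : (z - ((a + b) / 2 + ((|b.im - a.im| + 1 : ℝ) : ℂ) * I)).re = z.re - (a.re + b.re)/2 := by
      have : ((a + b)/2).re = (a.re + b.re)/2 := by
        rw [show (a+b)/2 = ((1/2:ℝ):ℂ) * (a+b) by push_cast; ring, re_ofReal_mul]; simp; ring
      simp [this]
    have him : (z - ((a + b) / 2 + ((|b.im - a.im| + 1 : ℝ) : ℂ) * I)).im = z.im - ((a.im + b.im)/2 + (|b.im - a.im| + 1)) := by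
      have : ((a + b)/2).im = (a.im + b.im)/2 := by
        rw [show (a+b)/2 = ((1/2:ℝ):ℂ) * (a+b) by push_cast; ring, im_ofReal_mul]; simp; ring
      simp [this]
    rw [hre] at h1
    rw [him] at h2
    set d := b.re - a.re with hdd
    have hd0 : d ≠ 0 := abs_pos.1 hd
    set s := (z.re - a.re) / d with hs
    have hsd : s * d = z.re - a.re := by rw [hs]; field_simp
    have hs2 : |s - 1/2| ≤ 1/4 := by
      have : (s - 1/2) * d = z.re - (a.re + b.re)/2 := by rw [sub_mul, hsd, hdd]; ring
      rw [← this, abs_mul] at h1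
      by_contra! hcon
      nlinarith
    rw [abs_le] at hs2
    have hq := (L.S.Zconvex (W a)).add_smul_sub_mem (x := a) rfl hb (t := s) ⟨by linarith, by linarith⟩
    have hq' : W (a + s * (b - a)) = W a := by simpa using hq
    have h3 := hray _ hq' (z.im - (a.im + s * (b.im - a.im))) (by
      rw [abs_lt] at h2
      have hk : |(s - 1/2) * (b.im - a.im)| ≤ 1/4 * |b.im - a.im| := by
        rw [abs_mul]; gcongr; exact abs_le.2 hs2
      have := (abs_le.1 hk).2
      have := abs_nonneg (b.im - a.im)
      nlinarith)
    rw [← h3]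
    congr 1
    apply Complex.ext
    · simp; rw [← hdd, hsd]; ring
    · simp
  · exfalso
    push Not at hb
    set c0 := a + I with hc0
    have hWc0 : W c0 = W a := by simpa using hray a rfl 1 zero_le_one
    have hUc0 : ¬ 0 < U c0 := L.zero_of_val ha hWc0
    obtain ⟨δ, hδ, hball⟩ := eventually_nhds_iff_ball.1 (L.near hUc0)
    rw [hWc0] at hball
    set h := min δ 1 / 4 with hh
    have hh0 : 0 < h := by positivity
    have hhδ : 4 * h ≤ δ := by have := min_le_left δ 1; linarith
    have hh1 : 4 * h ≤ 1 := by have := min_le_right δ 1; linarith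
    set g : ℂ → ℂ := fun z => (2 * (z.re : ℂ) - conj (W z)) - (2 * (a.re : ℂ) - conj (W a)) with hg
    have hgc : Continuous g := by simp only [hg]; fun_prop
    have hgd : ∀ z, 0 < U z → HasDerivAt g (1 - cg U z ^ 2) z := fun z hz => (L.zeta_deriv hz).sub_const _
    have hpos : ∀ w ∈ ball c0 δ, a.re < w.re → 0 < U w := fun w hw hre => by
      rcases hball w hw with h | h
      · exact h
      · exact absurd (hb w h) hre.ne'
    have hz0 : ∀ c : ℂ, 0 < c.re - a.re → c.re - a.re < h → |c.im - c0.im| < h → g c = 0 := by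
      intro c hc1 hc2 hc3
      have hcc : ‖c - c0‖ < 2 * h := by
        refine (norm_le_abs_re_add_abs_im _).trans_lt ?_
        have : (c - c0).re = c.re - a.re := by simp [hc0]
        rw [this, abs_of_pos hc1, sub_im]; linarith
      refine square_trick hc1 hgc.continuousOn (fun z hz => ?_) (fun z hz hzre => ?_)
      · have hz' : mx (z - c) < c.re - a.re := hz
        have hre : |(z - c).re| < c.re - a.re := (le_max_left _ _).trans_lt hz'
        refine ((hgd z (hpos z ?_ ?_)).differentiableAt).differentiableWithinAt
        · rw [mem_ball, dist_eq_norm]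
          have := norm_add_le (z - c) (c - c0)
          rw [sub_add_sub_cancel] at this
          have := norm_le_mx (z - c)
          linarith
        · have := (abs_lt.1 hre).1
          rw [sub_re] at this; linarith
      · have him : |(z - c).im| ≤ c.re - a.re := (le_max_right _ _).trans hz
        have hza : z.re = a.re := by rw [sub_re] at hzre; linarith
        have hzi : a.im ≤ z.im := by
          have h1 := (abs_le.1 him).1
          have h2 := (abs_lt.1 hc3).1
          have h3 : c0.im = a.im + 1 := by simp [hc0]
          rw [sub_im] at h1
          linarith
        have := hray a rfl (z.im - a.im) (by linarith)
        have e : a + ((z.im - a.im : ℝ) : ℂ) * I = z := by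
          apply Complex.ext <;> simp [hza]
        rw [e] at this
        simp [hg, this, hza]
    set c1 := c0 + ((h/2 : ℝ) : ℂ) with hc1
    have hre1 : c1.re = a.re + h/2 := by simp [hc1, hc0]
    have hUc1 : 0 < U c1 := by
      refine hpos c1 ?_ (by rw [hre1]; linarith)
      rw [mem_ball, dist_eq_norm, hc1, add_sub_cancel_left, norm_real_pos (by linarith)]; linarith
    have hev : g =ᶠ[𝓝 c1] fun _ => 0 := by
      have ho : IsOpen {c : ℂ | 0 < c.re - a.re ∧ c.re - a.re < h ∧ |c.im - c0.im| < h} := by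
        have o1 : IsOpen {c : ℂ | 0 < c.re - a.re} := isOpen_lt (by fun_prop) (by fun_prop)
        have o2 : IsOpen {c : ℂ | c.re - a.re < h} := isOpen_lt (by fun_prop) (by fun_prop)
        have o3 : IsOpen {c : ℂ | |c.im - c0.im| < h} := isOpen_lt (by fun_prop) (by fun_prop)
        exact o1.inter (o2.inter o3)
      filter_upwards [ho.mem_nhds (by
        refine ⟨by rw [hre1]; linarith, by rw [hre1]; linarith, ?_⟩
        simp [hc1, hh0])] with c hc using hz0 c hc.1 hc.2.1 hc.2.2
    have h1 := (hgd c1 hUc1).congr_of_eventuallyEq hev.symm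
    have h2 := h1.unique (hasDerivAt_const c1 (0:ℂ))
    have h3 : cg U c1 ^ 2 = 1 := by linear_combination -h2
    have h4 := L.lt c1 hUc1
    have h5 : ‖cg U c1‖ ^ 2 = 1 := by rw [← norm_pow, h3]; simp
    nlinarith [norm_nonneg (cg U c1)]

lemma has_interior {a e : ℂ} (he : ‖e‖ = 1) (ha : ¬ 0 < U a)
    (hray : ∀ b, W b = W a → ∀ t : ℝ, 0 ≤ t → W (b + t * e) = W a) :
    ∃ c ρ, 0 < ρ ∧ ∀ z ∈ ball c ρ, W z = W a := by
  set μ := -I * e with hμd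
  have hμ : ‖μ‖ = 1 := by simp [hμd, he]
  have hμI : μ * I = e := by rw [hμd]; linear_combination (-e) * I_sq
  have hμc : μ * conj μ = 1 := by
    rw [mul_conj, normSq_eq_norm_sq, hμ]; simp
  have e1 : ∀ x, μ * (conj μ * x) = x := fun x => by linear_combination x * hμc
  have hcinj : ∀ a b : ℂ, conj μ * a = conj μ * b → a = b := fun a b h => by
    linear_combination μ * h + (b - a) * hμc
  obtain ⟨c, ρ, hρ, h⟩ := (L.rot hμ).interior_I (a := conj μ * a) (by rw [e1]; exact ha) (by
    intro b hb t ht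
    simp only [e1] at hb ⊢
    have h1 := hcinj _ _ hb
    have h2 := hray _ h1 t ht
    rw [show μ * (b + t * I) = μ * b + t * e by rw [← hμI]; ring, h2])
  refine ⟨μ * c, ρ, hρ, fun z hz => ?_⟩
  have := h (conj μ * z) (by
    rw [mem_ball, dist_eq_norm] at hz ⊢
    have : conj μ * z - c = conj μ * (z - μ * c) := by linear_combination c * hμc
    rw [this, norm_mul, RCLike.norm_conj, hμ, one_mul]; exact hz)
  simp only [e1] at this
  exact hcinj _ _ this

end Lim2
end OP

namespace OP

lemma sector_bound {κ : ℝ} (hm : 0 < κ) : ∃ β : ℝ, 1 < β ∧ ∃ k > 0, ∀ w : ℂ, 0 < w.re → |w.im| ≤ κ * w.re →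
    k * ‖w‖ ^ β ≤ (exp (β * log w)).re := by
  set θ := Real.arctan κ with hθ
  have hθ0 : 0 < θ := by rw [hθ]; exact Real.arctan_pos.2 hm
  have hθ1 : θ < Real.pi / 2 := Real.arctan_lt_pi_div_two _
  refine ⟨(Real.pi/2 + θ) / (2 * θ), ?_, Real.cos ((Real.pi/2 + θ)/2), ?_, fun w hw hwi => ?_⟩
  · rw [lt_div_iff₀ (by positivity)]; linarith
  · exact Real.cos_pos_of_mem_Ioo ⟨by linarith, by linarith⟩
  · set β := (Real.pi/2 + θ) / (2 * θ) with hβ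
    have hβ0 : 0 < β := by positivity
    have hβθ : β * θ = (Real.pi/2 + θ)/2 := by rw [hβ]; field_simp
    have hw0 : w ≠ 0 := by rintro rfl; simp at hw
    have harg : |arg w| ≤ θ := by
      have h1 := Complex.abs_arg_lt_pi_div_two_iff.2 (Or.inl hw)
      have h2 := Real.arctan_tan (abs_lt.1 h1).1 (abs_lt.1 h1).2
      have h3 : |Real.tan (arg w)| ≤ κ := by
        rw [Complex.tan_arg, abs_div, abs_of_pos hw, div_le_iff₀ hw]; exact hwi
      rw [abs_le] at h3 ⊢
      rw [← h2, hθ, ← Real.arctan_neg]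
      exact ⟨Real.arctan_strictMono.monotone h3.1, Real.arctan_strictMono.monotone h3.2⟩
    have e1 : (exp (β * log w)).re = ‖w‖ ^ β * Real.cos (β * arg w) := by
      rw [Complex.exp_re]
      have r1 : ((β:ℂ) * log w).re = β * Real.log ‖w‖ := by rw [re_ofReal_mul, log_re]
      have r2 : ((β:ℂ) * log w).im = β * arg w := by rw [im_ofReal_mul, log_im]
      rw [r1, r2, Real.rpow_def_of_pos (norm_pos_iff.2 hw0), mul_comm β]
    rw [e1, mul_comm]
    have : Real.cos ((Real.pi/2 + θ)/2) ≤ Real.cos (β * arg w) := by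
      rw [← Real.cos_abs (β * arg w)]
      refine Real.cos_le_cos_of_nonneg_of_le_pi (abs_nonneg _) (by linarith) ?_
      rw [abs_mul, abs_of_pos hβ0, ← hβθ]
      gcongr
    gcongr

lemma PL {U : ℂ → ℝ} (hc : Continuous U) (hn : ∀ z, 0 ≤ U z) (hg : ∀ z, U z ≤ 4 * ‖z‖) (hh : Har U {z | 0 < U z})
    {m A B X0 : ℝ} (hm : 0 ≤ m)
    (hB : ∀ z : ℂ, X0 ≤ z.re → z.im = B + m * z.re → U z = 0)
    (hA : ∀ z : ℂ, X0 ≤ z.re → z.im = A - m * z.re → U z = 0) {ε : ℝ} (hε : 0 < ε) :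
    ∃ R, ∀ z : ℂ, X0 < z.re → A - m * z.re < z.im → z.im < B + m * z.re → R ≤ z.re → U z ≤ ε := by
  set x0 : ℝ := min 0 (X0 - |A| - |B| - 1) with hx0
  have hx00 : x0 ≤ 0 := min_le_left _ _
  have hx01 : x0 ≤ X0 - |A| - |B| - 1 := min_le_right _ _
  have hX : 1 ≤ X0 - x0 := by linarith [abs_nonneg A, abs_nonneg B]
  set S : Set ℂ := {z | X0 < z.re ∧ A - m * z.re < z.im ∧ z.im < B + m * z.re} with hS
  set Sc : Set ℂ := {z | X0 ≤ z.re ∧ A - m * z.re ≤ z.im ∧ z.im ≤ B + m * z.re} with hSc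
  have hSo : IsOpen S := by
    have o1 : IsOpen {z : ℂ | X0 < z.re} := isOpen_lt (by fun_prop) (by fun_prop)
    have o2 : IsOpen {z : ℂ | A - m * z.re < z.im} := isOpen_lt (by fun_prop) (by fun_prop)
    have o3 : IsOpen {z : ℂ | z.im < B + m * z.re} := isOpen_lt (by fun_prop) (by fun_prop)
    exact o1.inter (o2.inter o3)
  have hScc : IsClosed Sc := by
    have o1 : IsClosed {z : ℂ | X0 ≤ z.re} := isClosed_le (by fun_prop) (by fun_prop)
    have o2 : IsClosed {z : ℂ | A - m * z.re ≤ z.im} := isClosed_le (by fun_prop) (by fun_prop)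
    have o3 : IsClosed {z : ℂ | z.im ≤ B + m * z.re} := isClosed_le (by fun_prop) (by fun_prop)
    exact o1.inter (o2.inter o3)
  have hSSc : S ⊆ Sc := fun z hz => ⟨hz.1.le, hz.2.1.le, hz.2.2.le⟩
  have hsec : ∀ z ∈ Sc, 1 ≤ (z - x0).re ∧ |(z - x0).im| ≤ (m + 1) * (z - x0).re := by
    rintro z ⟨h1, h2, h3⟩
    have e1 : (z - x0).re = z.re - x0 := by simp
    have e2 : (z - x0).im = z.im := by simp
    rw [e1, e2, abs_le]
    have hmx : m * x0 ≤ 0 := mul_nonpos_of_nonneg_of_nonpos hm hx00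
    refine ⟨by linarith, ?_, ?_⟩
    · have := le_abs_self A; have := neg_abs_le A; have := abs_nonneg B; linarith
    · have := le_abs_self B; have := abs_nonneg A; linarith
  have hnorm : ∀ w : ℂ, |w.im| ≤ (m+1) * w.re → 1 ≤ w.re → ‖w‖ ≤ (m + 2) * w.re := by
    intro w h1 h2
    have := norm_le_abs_re_add_abs_im w
    rw [abs_of_pos (by linarith : 0 < w.re)] at this
    linarith
  obtain ⟨β, hβ, k, hk, hpow⟩ := sector_bound (κ := m + 1) (by linarith)
  set C : ℝ := 4 * ((m+2) * (X0 - x0) + |x0|) with hC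
  have hC0 : 0 ≤ C := by
    have : 0 ≤ (m+2) * (X0 - x0) := mul_nonneg (by linarith) (by linarith)
    rw [hC]; positivity
  set C' : ℝ := C * ((m+2)^2 * (X0 - x0)) with hC'
  have hC'0 : 0 ≤ C' := mul_nonneg hC0 (mul_nonneg (by positivity) (by linarith))
  set F : ℝ → ℂ → ℂ := fun η z => C' * (z - x0)⁻¹ + η * exp (β * log (z - x0)) with hF
  have hFd : ∀ η z, 0 < (z - x0 : ℂ).re → DifferentiableAt ℂ (F η) z := by
    intro η z hz
    have h0 : z - x0 ≠ 0 := by intro h; rw [h] at hz; simp at hz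
    have h1 : (z - x0) ∈ slitPlane := Or.inl hz
    simp only [hF]
    have d1 : DifferentiableAt ℂ (fun z : ℂ => z - x0) z := by fun_prop
    exact ((d1.inv h0).const_mul _).add (((d1.clog h1).const_mul _).cexp.const_mul _)
  have hFpos : ∀ η : ℝ, 0 ≤ η → ∀ z ∈ Sc, 0 ≤ (C' * (z - x0 : ℂ)⁻¹).re ∧ η * (k * ‖(z - x0 : ℂ)‖ ^ β) ≤ (η * exp (β * log (z - x0 : ℂ))).re := by
    intro η hη z hz
    obtain ⟨h1, h2⟩ := hsec z hz
    constructor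
    · rw [re_ofReal_mul, Complex.inv_re]
      exact mul_nonneg hC'0 (div_nonneg (by linarith) (normSq_nonneg _))
    · rw [re_ofReal_mul]
      exact mul_le_mul_of_nonneg_left (hpow _ (by linarith) h2) hη
  have main : ∀ η : ℝ, 0 < η → ∀ z ∈ S, U z ≤ (F η z).re := by
    intro η hη z hz
    by_cases hUz : 0 < U z
    swap
    · obtain ⟨h1, h2⟩ := hFpos η hη.le z (hSSc hz)
      have h3 : 0 ≤ η * (k * ‖(z - x0 : ℂ)‖ ^ β) := by positivity
      simp only [hF, add_re]
      linarith
    have htop : Tendsto (fun R : ℝ => R ^ (β - 1)) atTop atTop := tendsto_rpow_atTop (by linarith)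
    obtain ⟨R, hR1, hR2, hR3, hR4⟩ := ((htop.eventually_ge_atTop (8 / (η * k))).and ((eventually_gt_atTop ‖(z - x0 : ℂ)‖).and
      ((eventually_ge_atTop |x0|).and (eventually_gt_atTop 0)))).exists
    set V : Set ℂ := {z | 0 < U z} ∩ (S ∩ ball (x0:ℂ) R) with hV
    have hVo : IsOpen V := hh.op.inter (hSo.inter isOpen_ball)
    have hclV : closure V ⊆ Sc ∩ closedBall (x0:ℂ) R :=
      closure_minimal (fun q hq => ⟨hSSc hq.2.1, ball_subset_closedBall hq.2.2⟩) (hScc.inter isClosed_closedBall)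
    have hre : ∀ q ∈ Sc, 0 < (q - x0 : ℂ).re := fun q hq => by linarith [(hsec q hq).1]
    have hFh := (har_of_re (U := fun z => (F η z).re) hVo (fun q hq => (hFd η q (hre q (hSSc hq.2.1))).hasDerivAt) (fun q _ => rfl)).1
    have hUh : Har U V := hh.mono inter_subset_left hVo
    have := (hUh.sub hFh).1.max_principle (M := 0) (isBounded_ball.subset fun q hq => hq.2.2) (by
      refine hc.continuousOn.sub ?_
      intro q hq
      exact (continuous_re.continuousAt.comp (hFd η q (hre q (hclV hq).1)).continuousAt).continuousWithinAt) (by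
      intro q hq
      rw [hVo.frontier_eq] at hq
      obtain ⟨hq1, hq2⟩ := hclV hq.1
      obtain ⟨h1, h2⟩ := hFpos η hη.le q hq1
      have h3 : 0 ≤ η * (k * ‖(q - x0 : ℂ)‖ ^ β) := by positivity
      obtain ⟨hs1, hs2⟩ := hsec q hq1
      have goal2 : U q ≤ (F η q).re := by
        by_cases hUq : 0 < U q
        swap
        · simp only [hF, add_re]; linarith
        have hgq : U q ≤ 4 * (‖(q - x0 : ℂ)‖ + |x0|) := by
          refine (hg q).trans ?_
          have := norm_add_le (q - x0) (x0:ℂ)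
          rw [sub_add_cancel, norm_real, Real.norm_eq_abs] at this
          linarith
        by_cases hqR : q ∈ ball (x0:ℂ) R
        · have hqS : q ∉ S := fun h => hq.2 ⟨hUq, h, hqR⟩
          have hqX : q.re = X0 := by
            by_contra hne
            refine hqS ⟨lt_of_le_of_ne hq1.1 (Ne.symm hne), lt_of_le_of_ne hq1.2.1 ?_, lt_of_le_of_ne hq1.2.2 ?_⟩
            · intro h; exact hUq.ne' (hA q hq1.1 h.symm)
            · intro h; exact hUq.ne' (hB q hq1.1 h)
          have hw : (q - x0 : ℂ).re = X0 - x0 := by simp [hqX]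
          have hnq := hnorm _ hs2 hs1
          rw [hw] at hnq
          have h4 : U q ≤ C := by rw [hC]; linarith
          have h5 : C ≤ (C' * (q - x0 : ℂ)⁻¹).re := by
            rw [re_ofReal_mul, Complex.inv_re, hw, normSq_eq_norm_sq, hC']
            have hn0 : 0 < ‖(q - x0 : ℂ)‖ := norm_pos_iff.2 (by intro h; rw [h] at hw; simp at hw; linarith)
            rw [mul_assoc C, ← mul_div_assoc]
            refine le_mul_of_one_le_right hC0 ?_
            rw [one_le_div (by positivity)]
            nlinarith
          simp only [hF, add_re]; linarith
        · have hqR' : ‖(q - x0 : ℂ)‖ = R := by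
            rw [mem_ball, dist_eq_norm] at hqR
            rw [mem_closedBall, dist_eq_norm] at hq2
            linarith
          rw [hqR'] at hgq h2
          have h6 : R ^ β = R * R ^ (β - 1) := by
            rw [← Real.rpow_one_add' hR4.le (by linarith)]; congr 1; ring
          have h7 : 8 ≤ R ^ (β-1) * (η * k) := by rwa [div_le_iff₀ (by positivity)] at hR1
          have h8 : 8 * R ≤ η * (k * R ^ β) := by rw [h6]; nlinarith
          simp only [hF, add_re]; linarith
      simpa using goal2) z ⟨hUz, hz, by rw [mem_ball, dist_eq_norm]; exact hR2⟩
    have h9 : U z - (F η z).re ≤ 0 := this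
    linarith
  have main2 : ∀ z ∈ S, U z ≤ (C' * (z - x0 : ℂ)⁻¹).re := by
    intro z hz
    have hT : Tendsto (fun η : ℝ => (F η z).re) (𝓝[>] 0) (𝓝 ((C' * (z - x0 : ℂ)⁻¹).re)) := by
      have hcn : Continuous fun η : ℝ => (F η z).re := by simp only [hF]; fun_prop
      have := (hcn.tendsto 0).mono_left (nhdsWithin_le_nhds (s := Ioi (0:ℝ)))
      simpa [hF] using this
    refine ge_of_tendsto hT ?_
    filter_upwards [self_mem_nhdsWithin] with η hη using main η hη z hz
  refine ⟨x0 + C' / ε + 1, fun z h1 h2 h3 h4 => (main2 z ⟨h1, h2, h3⟩).trans ?_⟩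
  have hre : C' / ε + 1 ≤ (z - x0 : ℂ).re := by simp; linarith
  have hpos : 0 < C' / ε + 1 := by positivity
  have hn1 := (le_abs_self _).trans (abs_re_le_norm (z - x0 : ℂ))
  refine (Complex.re_le_norm _).trans ?_
  rw [norm_mul, norm_inv, norm_real, Real.norm_eq_abs, abs_of_nonneg hC'0, ← div_eq_mul_inv, div_le_iff₀ (by linarith)]
  have : C' / ε * ε = C' := by field_simp
  nlinarith

lemma seg_zero {g : ℂ → ℝ} (hg : Continuous g) {x y : ℂ} (hx : g x ≤ 0) (hy : 0 ≤ g y) :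
    ∃ q, g q = 0 ∧ dist q x ≤ dist y x := by
  have hc : Continuous fun t : ℝ => g (x + t * (y - x)) := by fun_prop
  obtain ⟨t, ht, h⟩ := intermediate_value_Icc (zero_le_one' ℝ) hc.continuousOn (show (0:ℝ) ∈ Icc _ _ from ⟨by simpa using hx, by simpa using hy⟩)
  refine ⟨x + t * (y - x), h, ?_⟩
  rw [dist_eq_norm, dist_eq_norm, add_sub_cancel_left, norm_mul, norm_real, Real.norm_eq_abs, abs_of_nonneg ht.1]
  exact mul_le_of_le_one_left (norm_nonneg _) ht.2

lemma Lim2.no_wedge {U : ℂ → ℝ} {W : ℂ → ℂ} (L : Lim2 U W) {m X0 A B ρ : ℝ} (hm : 0 ≤ m) (hρ : 0 < ρ) {p p' : ℂ}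
    (hne : p ≠ p') (hp : ∀ z, W z = p → ¬ 0 < U z) (hp' : ∀ z, W z = p' → ¬ 0 < U z)
    (h1 : ∀ x, X0 ≤ x → ∀ w ∈ ball (⟨x, B + m * x⟩ : ℂ) ρ, W w = p)
    (h2 : ∀ x, X0 ≤ x → ∀ w ∈ ball (⟨x, A - m * x⟩ : ℂ) ρ, W w = p')
    (hAB : ∀ x, X0 ≤ x → A - m * x < B + m * x) : False := by
  obtain ⟨c, hc, hnd⟩ := L.S.nd
  have hU0 : ∀ z, ¬ 0 < U z → U z = 0 := fun z h => le_antisymm (not_lt.1 h) (L.S.nn z)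
  obtain ⟨R, hR⟩ := PL (A := A) (B := B) (m := m) (X0 := X0) L.S.lip.continuous L.S.nn (fun z => by
      have := L.S.lip.dist_le_mul z 0
      rw [dist_eq_norm, dist_eq_norm, L.S.u0, sub_zero, sub_zero, Real.norm_eq_abs, abs_of_nonneg (L.S.nn z)] at this
      simpa using this) L.S.har hm
    (fun z hz hz2 => hU0 z (hp z (h1 z.re hz z (by rw [← hz2]; exact mem_ball_self hρ))))
    (fun z hz hz2 => hU0 z (hp' z (h2 z.re hz z (by rw [← hz2]; exact mem_ball_self hρ)))) (ε := c * ρ / 2) (by positivity)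
  set X := max R X0 + ρ + 1 with hX
  have hX1 : R + ρ + 1 ≤ X := by have := le_max_left R X0; linarith
  have hX2 : X0 + ρ + 1 ≤ X := by have := le_max_right R X0; linarith
  have hWc := L.S.wlip.continuous
  have hcv : Continuous fun y : ℝ => (⟨X, y⟩ : ℂ) := by
    have : (fun y : ℝ => (⟨X, y⟩ : ℂ)) = fun y : ℝ => (X:ℂ) + y * I := by
      funext y; apply Complex.ext <;> simp
    rw [this]; fun_prop
  have hT : IsCompact {y : ℝ | y ∈ Icc (A - m * X) (B + m * X) ∧ W ⟨X, y⟩ = p} :=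
    isCompact_Icc.inter_right (isClosed_eq (hWc.comp hcv) continuous_const)
  obtain ⟨y0, ⟨⟨hy1, hy2⟩, hy3⟩, hmin⟩ := hT.exists_isLeast ⟨B + m * X, ⟨(hAB X (by linarith)).le, le_rfl⟩,
    h1 X (by linarith) _ (mem_ball_self hρ)⟩
  have hy4 : A - m * X < y0 := by
    refine lt_of_le_of_ne hy1 ?_
    rintro rfl
    exact hne (hy3.symm.trans (h2 X (by linarith) _ (mem_ball_self hρ)))
  set xs : ℂ := ⟨X, y0⟩ with hxs
  have hcl : xs ∈ closure {z | 0 < U z} := by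
    by_contra hcl
    have h3 := L.structure1.2.2.2 xs hcl
    have h4 : ∀ᶠ y in 𝓝[<] y0, W ⟨X, y⟩ = W xs := nhdsWithin_le_nhds (hcv.continuousAt.eventually h3)
    have h5 : ∀ᶠ y in 𝓝[<] y0, y ∈ Ioo (A - m * X) y0 := Ioo_mem_nhdsLT hy4
    obtain ⟨y, h6, h7⟩ := (h4.and h5).exists
    have := hmin ⟨⟨h7.1.le, h7.2.le.trans hy2⟩, h6.trans hy3⟩
    linarith [h7.2]
  obtain ⟨y, hy, hUy⟩ := hnd xs (L.S.fr_iff.2 ⟨hU0 _ (hp _ hy3), hcl⟩) ρ hρ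
  have hball : ∀ q : ℂ, dist q xs ≤ dist y xs → X0 < q.re ∧ R ≤ q.re ∧ xs ∈ ball q ρ := by
    intro q hq
    have h3 : dist q xs < ρ := lt_of_le_of_lt hq hy
    have h4 := (abs_re_le_norm (q - xs)).trans_lt (by rwa [dist_eq_norm] at h3)
    rw [sub_re, abs_lt] at h4
    have : xs.re = X := rfl
    exact ⟨by linarith [h4.1], by linarith [h4.1], by rw [mem_ball, dist_comm]; exact h3⟩
  obtain ⟨hy5, hy6, -⟩ := hball y le_rfl
  have hyB : y.im < B + m * y.re := by
    by_contra! hcon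
    obtain ⟨q, hq, hqd⟩ := seg_zero (g := fun z => z.im - (B + m * z.re)) (by fun_prop) (x := xs) (y := y)
      (by simp [hxs]; linarith) (by simp; linarith)
    obtain ⟨hq1, -, hq2⟩ := hball q hqd
    have hqe : (⟨q.re, B + m * q.re⟩ : ℂ) = q := Complex.ext rfl (by have hq3 := hq; dsimp only at hq3 ⊢; linarith)
    obtain ⟨w, hw1, hw2⟩ := mem_closure_iff.1 hcl _ isOpen_ball hq2
    exact hp w (h1 q.re hq1.le w (by rw [hqe]; exact hw1)) hw2
  have hyA : A - m * y.re < y.im := by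
    by_contra! hcon
    obtain ⟨q, hq, hqd⟩ := seg_zero (g := fun z => -(z.im - (A - m * z.re))) (by fun_prop) (x := xs) (y := y)
      (by simp [hxs]; linarith) (by simp; linarith)
    obtain ⟨hq1, -, hq2⟩ := hball q hqd
    have hqe : (⟨q.re, A - m * q.re⟩ : ℂ) = q := Complex.ext rfl (by have hq3 := hq; dsimp only at hq3 ⊢; linarith)
    exact hne (hy3.symm.trans (h2 q.re hq1.le xs (by rw [hqe]; exact hq2)))
  have := hR y hy5 hyA hyB hy6
  nlinarith [mul_pos hc hρ]

lemma Lim2.wedge1 {U : ℂ → ℝ} {W : ℂ → ℂ} (L : Lim2 U W) {ρ c s : ℝ} (hρ : 0 < ρ) (hc : 0 < c) (hs : 0 ≤ s) {p p' a a' : ℂ}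
    (hne : p ≠ p') (hp : ∀ z, W z = p → ¬ 0 < U z) (hp' : ∀ z, W z = p' → ¬ 0 < U z)
    (h1 : ∀ z ∈ ball a ρ, ∀ t : ℝ, 0 ≤ t → W (z + t * (⟨c, s⟩ : ℂ)) = p)
    (h2 : ∀ z ∈ ball a' ρ, ∀ t : ℝ, 0 ≤ t → W (z + t * (⟨c, -s⟩ : ℂ)) = p')
    (hcase : 0 < s ∨ (s = 0 ∧ a'.im < a.im)) : False := by
  set m := s / c with hm
  have hm0 : 0 ≤ m := by positivity
  set B := a.im - m * a.re with hB
  set A := a'.im + m * a'.re with hA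
  refine L.no_wedge (m := m) (A := A) (B := B) (X0 := max (max a.re a'.re) ((A - B) / (2 * m) + 1)) hm0 hρ hne hp hp' ?_ ?_ ?_
  · intro x hx w hw
    have hx1 : a.re ≤ x := (le_max_left _ _).trans ((le_max_left _ _).trans hx)
    have e : (x - a.re) / c * c = x - a.re := by field_simp
    have e2 : (x - a.re) / c * s = m * (x - a.re) := by rw [hm]; field_simp
    have := h1 (w - ((x - a.re) / c : ℝ) * (⟨c, s⟩ : ℂ)) (by
      rw [mem_ball, dist_eq_norm] at hw ⊢
      convert hw using 2
      apply Complex.ext <;> simp [-ofReal_div, -ofReal_sub]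
      · linarith
      · linarith) ((x - a.re) / c) (div_nonneg (by linarith) hc.le)
    rwa [sub_add_cancel] at this
  · intro x hx w hw
    have hx1 : a'.re ≤ x := (le_max_right _ _).trans ((le_max_left _ _).trans hx)
    have e : (x - a'.re) / c * c = x - a'.re := by field_simp
    have e2 : (x - a'.re) / c * s = m * (x - a'.re) := by rw [hm]; field_simp
    have := h2 (w - ((x - a'.re) / c : ℝ) * (⟨c, -s⟩ : ℂ)) (by
      rw [mem_ball, dist_eq_norm] at hw ⊢
      convert hw using 2
      apply Complex.ext <;> simp [-ofReal_div, -ofReal_sub]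
      · linarith
      · linarith) ((x - a'.re) / c) (div_nonneg (by linarith) hc.le)
    rwa [sub_add_cancel] at this
  · intro x hx
    rcases hcase with h | ⟨h, h'⟩
    · have hmp : 0 < m := by positivity
      have hx2 : (A - B) / (2 * m) + 1 ≤ x := (le_max_right _ _).trans hx
      have : (A - B) / (2 * m) * (2 * m) = A - B := by field_simp
      nlinarith
    · have : m = 0 := by rw [hm, h]; simp
      rw [this] at hA hB ⊢
      linarith

lemma Lim2.wedge2 {U : ℂ → ℝ} {W : ℂ → ℂ} (L : Lim2 U W) {ρ c s : ℝ} (hρ : 0 < ρ) (hc : 0 < c) {p p' a a' : ℂ}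
    (hne : p ≠ p') (hp : ∀ z, W z = p → ¬ 0 < U z) (hp' : ∀ z, W z = p' → ¬ 0 < U z)
    (h1 : ∀ z ∈ ball a ρ, ∀ t : ℝ, 0 ≤ t → W (z + t * (⟨c, s⟩ : ℂ)) = p)
    (h2 : ∀ z ∈ ball a' ρ, ∀ t : ℝ, 0 ≤ t → W (z + t * (⟨c, -s⟩ : ℂ)) = p') : False := by
  rcases lt_trichotomy s 0 with h | h | h
  · exact L.wedge1 (s := -s) hρ hc (by linarith) hne.symm hp' hp h2 (by simpa using h1) (Or.inl (by linarith))
  · subst h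
    simp only [neg_zero] at h2
    rcases lt_trichotomy a.im a'.im with h | h | h
    · exact L.wedge1 (s := 0) hρ hc le_rfl hne.symm hp' hp h2 (by simpa using h1) (Or.inr ⟨rfl, h⟩)
    · apply hne
      rcases le_total a.re a'.re with h' | h'
      · rw [← h1 a (mem_ball_self hρ) ((a'.re - a.re) / c) (div_nonneg (by linarith) hc.le), ← h2 a' (mem_ball_self hρ) 0 le_rfl]
        congr 1
        apply Complex.ext <;> simp [h, -ofReal_div, -ofReal_sub]
        field_simp; ring
      · rw [← h2 a' (mem_ball_self hρ) ((a.re - a'.re) / c) (div_nonneg (by linarith) hc.le), ← h1 a (mem_ball_self hρ) 0 le_rfl]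
        congr 1
        apply Complex.ext <;> simp [h, -ofReal_div, -ofReal_sub]
        field_simp; ring
    · exact L.wedge1 (s := 0) hρ hc le_rfl hne hp hp' h1 (by simpa using h2) (Or.inr ⟨rfl, h⟩)
  · exact L.wedge1 hρ hc h.le hne hp hp' h1 h2 (Or.inl h)

lemma Lim2.opp {U : ℂ → ℝ} {W : ℂ → ℂ} (L : Lim2 U W) {e e' a a' : ℂ} (he : ‖e‖ = 1) (he' : ‖e'‖ = 1)
    (ha : ¬ 0 < U a) (ha' : ¬ 0 < U a') (hne : W a ≠ W a')
    (hr : ∀ b, W b = W a → ∀ t : ℝ, 0 ≤ t → W (b + t * e) = W a)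
    (hr' : ∀ b, W b = W a' → ∀ t : ℝ, 0 ≤ t → W (b + t * e') = W a') : e' = -e := by
  by_contra hcon
  have hs : e + e' ≠ 0 := fun h => hcon (by linear_combination h)
  obtain ⟨b, ρ, hρ, hb⟩ := L.has_interior he ha hr
  obtain ⟨b', ρ', hρ', hb'⟩ := L.has_interior he' ha' hr'
  set r := ‖e + e'‖ with hr0
  have hrp : 0 < r := norm_pos_iff.2 hs
  set μ : ℂ := (e + e') / r with hμ
  have hrc : (r:ℂ) ≠ 0 := by exact_mod_cast hrp.ne'
  have hμ1 : ‖μ‖ = 1 := by rw [hμ, norm_div, norm_real_pos hrp, ← hr0]; field_simp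
  have hec : e * conj e = 1 := by rw [mul_conj, normSq_eq_norm_sq, he]; simp
  have hec' : e' * conj e' = 1 := by rw [mul_conj, normSq_eq_norm_sq, he']; simp
  have hμc : conj μ = (conj e + conj e') / r := by simp [hμ]
  have hμμ : μ * conj μ = 1 := by rw [mul_conj, normSq_eq_norm_sq, hμ1]; simp
  set d := conj μ * e with hd
  have hd' : conj μ * e' = conj d := by
    rw [hd, map_mul, conj_conj, hμc, hμ]
    field_simp
    linear_combination hec' - hec
  have hdre : 0 < d.re := by
    have h1 : (r * d).re = r^2 / 2 := by
      have h2 : (r * d : ℂ) = 1 + conj e' * e := by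
        rw [hd, hμc]; field_simp; linear_combination hec
      rw [h2, hr0, ← normSq_eq_norm_sq, normSq_add, normSq_eq_norm_sq, normSq_eq_norm_sq, he, he']
      simp; ring
    rw [re_ofReal_mul] at h1
    have : d.re = r / 2 := by field_simp; nlinarith
    rw [this]; positivity
  have key : ∀ {b p e : ℂ} {ρ : ℝ}, (∀ z ∈ ball b ρ, W z = p) → (∀ b, W b = p → ∀ t : ℝ, 0 ≤ t → W (b + t * e) = p) →
      ∀ z ∈ ball (conj μ * b) ρ, ∀ t : ℝ, 0 ≤ t →
        conj μ * W (μ * (z + t * (conj μ * e))) = conj μ * p := by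
    intro b p e ρ h1 h2 z hz t ht
    have h3 : μ * (z + t * (conj μ * e)) = μ * z + t * e := by linear_combination (t * e) * hμμ
    rw [h3, h2 _ (h1 _ ?_) t ht]
    rw [mem_ball, dist_eq_norm] at hz ⊢
    have h4 : μ * z - b = μ * (z - conj μ * b) := by linear_combination b * hμμ
    rwa [h4, norm_mul, hμ1, one_mul]
  have hμ0 : conj μ ≠ 0 := by intro h; rw [h] at hμμ; simp at hμμ
  have hoff : ∀ {a : ℂ}, ¬ 0 < U a → ∀ z, conj μ * W (μ * z) = conj μ * W a → ¬ 0 < U (μ * z) :=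
    fun {a} h z hz => L.zero_of_val h (mul_left_cancel₀ hμ0 hz)
  refine (L.rot hμ1).wedge2 (ρ := min ρ ρ') (c := d.re) (s := d.im) (lt_min hρ hρ') hdre
    (p := conj μ * W a) (p' := conj μ * W a') (fun h => hne (mul_left_cancel₀ hμ0 h)) (hoff ha) (hoff ha')
    (a := conj μ * b) (a' := conj μ * b') ?_ ?_
  · intro z hz t ht
    exact key hb hr z (ball_subset_ball (min_le_left _ _) hz) t ht
  · intro z hz t ht
    have : (⟨d.re, -d.im⟩ : ℂ) = conj μ * e' := by rw [hd']; rfl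
    rw [this]
    exact key hb' hr' z (ball_subset_ball (min_le_right _ _) hz) t ht

structure Lim3 (U : ℂ → ℝ) (W : ℂ → ℂ) (p0 : ℂ) (Q : Set ℂ) : Prop where
  L : Lim2 U W
  pt0 : ∃ x ∈ frontier {z | 0 < U z}, W x = p0
  top : ∀ y, (W y).im ≤ p0.im
  ray : ∀ b, W b = p0 → ∀ t : ℝ, 0 ≤ t → W (b + t * I) = p0
  vals : ∀ x, ¬ 0 < U x → W x = p0 ∨ W x ∈ Q
  bot : ∀ q ∈ Q, ∀ y, q.im ≤ (W y).im
  rayq : ∀ q ∈ Q, ∀ b, W b = q → ∀ t : ℝ, 0 ≤ t → W (b + t * (-I)) = q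
  ptq : ∀ q ∈ Q, ∃ x ∈ frontier {z | 0 < U z}, W x = q
  sub : Q.Subsingleton

lemma Lim2.toLim3 {U : ℂ → ℝ} {W : ℂ → ℂ} (L : Lim2 U W) : ∃ μ : ℂ, ‖μ‖ = 1 ∧ ∃ p0 Q,
    Lim3 (fun z => U (μ * z)) (fun z => conj μ * W (μ * z)) p0 Q := by
  obtain ⟨e, he, htop, hray⟩ := L.S.ray L.S.o0
  set μ := -I * e with hμd
  have hμ : ‖μ‖ = 1 := by simp [hμd, he]
  have hμI : μ * I = e := by rw [hμd]; linear_combination -e * I_mul_I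
  have hμμ : μ * conj μ = 1 := by rw [mul_conj, normSq_eq_norm_sq, hμ]; simp
  have hμ0 : conj μ ≠ 0 := by intro h; rw [h] at hμμ; simp at hμμ
  have L' := L.rot hμ
  set U' : ℂ → ℝ := fun z => U (μ * z) with hU'
  set W' : ℂ → ℂ := fun z => conj μ * W (μ * z) with hW'
  have hray' : ∀ b, W' b = W' 0 → ∀ t : ℝ, 0 ≤ t → W' (b + t * I) = W' 0 := by
    intro b hb t ht
    have h1 : W (μ * b) = W 0 := by simpa [hW'] using mul_left_cancel₀ hμ0 hb
    simp only [hW', mul_zero]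
    rw [← hray _ h1 t ht, ← hμI]
    congr 2; ring
  have hU0 : ¬ 0 < U' 0 := by rw [L'.S.u0]; exact lt_irrefl _
  have hq : ∀ q ∈ W' '' frontier {z | 0 < U' z} \ {W' 0}, (∀ y, q.im ≤ (W' y).im) ∧
      (∀ b, W' b = q → ∀ t : ℝ, 0 ≤ t → W' (b + t * (-I)) = q) := by
    rintro q ⟨⟨a, ha, rfl⟩, hne⟩
    obtain ⟨e', he', h1, h2⟩ := L'.S.ray ha
    have ha0 : ¬ 0 < U' a := by rw [(L'.S.fr_iff.1 ha).1]; exact lt_irrefl _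
    have h3 : e' = -I := L'.opp (by simp) he' hU0 ha0 (fun h => hne h.symm) hray' h2
    subst h3
    refine ⟨fun y => ?_, h2⟩
    have := h1 y
    simp [dot2] at this
    linarith
  refine ⟨μ, hμ, W' 0, W' '' frontier {z | 0 < U' z} \ {W' 0}, L', ⟨0, L'.S.o0, rfl⟩, ?_, hray', ?_, fun q h => (hq q h).1,
    fun q h => (hq q h).2, fun q h => ?_, ?_⟩
  · intro y
    have h1 := htop (μ * y)
    rw [← hμI] at h1
    simp only [hW', mul_zero]
    simp [dot2] at h1 ⊢
    linarith
  · intro x hx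
    by_cases h : W' x = W' 0
    · exact Or.inl h
    · exact Or.inr ⟨L'.off hx, h⟩
  · obtain ⟨⟨x, hx, h2⟩, -⟩ := h
    exact ⟨x, hx, h2⟩
  · intro q h q' h'
    by_contra hne
    have r1 := (hq q h).2
    have r2 := (hq q' h').2
    obtain ⟨⟨a, ha, rfl⟩, -⟩ := h
    obtain ⟨⟨a', ha', rfl⟩, -⟩ := h'
    have := L'.opp (e := -I) (e' := -I) (by simp) (by simp) (by rw [(L'.S.fr_iff.1 ha).1]; exact lt_irrefl _)
      (by rw [(L'.S.fr_iff.1 ha').1]; exact lt_irrefl _) hne r1 r2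
    rw [neg_neg] at this
    have := congrArg Complex.im this
    norm_num at this

def zt (W : ℂ → ℂ) (z : ℂ) : ℂ := 2 * (z.re : ℂ) - conj (W z)

def Sg (p0 : ℂ) (Q : Set ℂ) : Set ℂ := {s | s.im < p0.im ∧ ∀ q ∈ Q, q.im < s.im}

lemma zt_im (W : ℂ → ℂ) (z : ℂ) : (zt W z).im = (W z).im := by simp [zt]
lemma zt_re (W : ℂ → ℂ) (z : ℂ) : (zt W z).re = 2 * z.re - (W z).re := by simp [zt]

namespace Lim3
variable {U : ℂ → ℝ} {W : ℂ → ℂ} {p0 : ℂ} {Q : Set ℂ}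

lemma cont (M : Lim3 U W p0 Q) : Continuous (zt W) := by
  have := M.L.S.wlip.continuous
  unfold zt
  fun_prop

lemma flip {q : ℂ} (M : Lim3 U W p0 Q) (hq : q ∈ Q) :
    Lim3 (fun z => U (-z)) (fun z => -W (-z)) (-q) {-p0} := by
  have hQ : ∀ q' ∈ Q, q' = q := fun q' h => M.sub h hq
  have L' := M.L.rot (μ := -1) (by simp)
  have hL : Lim2 (fun z => U (-z)) (fun z => -W (-z)) := by simpa using L'
  have hfr : ∀ x ∈ frontier {z | 0 < U z}, -x ∈ frontier {z | 0 < U (-z)} := by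
    intro x hx
    have : {z | 0 < U (-z)} = (Homeomorph.neg ℂ) ⁻¹' {z | 0 < U z} := rfl
    rw [this, ← Homeomorph.preimage_frontier]
    simpa using hx
  refine ⟨hL, ?_, fun y => ?_, ?_, ?_, ?_, ?_, ?_, subsingleton_singleton⟩
  · obtain ⟨x, hx, h⟩ := M.ptq q hq
    exact ⟨-x, hfr x hx, by simp [h]⟩
  · have := M.bot q hq (-y); simpa using this
  · intro b hb t ht
    have := M.rayq q hq (-b) (by simpa using hb) t ht
    simp only [neg_inj]
    rw [← this]; congr 1; ring
  · intro x hx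
    rcases M.vals _ hx with h | h
    · right; simp [h]
    · left; simp [hQ _ h]
  · rintro q' rfl y
    have := M.top (-y); simpa using this
  · rintro q' rfl b hb t ht
    have := M.ray (-b) (by simpa using hb) t ht
    simp only [neg_inj]
    rw [← this]; congr 1; ring
  · rintro q' rfl
    obtain ⟨x, hx, h⟩ := M.pt0
    exact ⟨-x, hfr x hx, by simp [h]⟩

lemma inO (M : Lim3 U W p0 Q) {z : ℂ} (hz : 0 < U z) : zt W z ∈ Sg p0 Q := by
  have key : ∀ S : Set ℂ, (∀ y, W y ∈ S) → ∀ v : ℂ, ∃ ε : ℝ, 0 < ε ∧ W z + ε * v ∈ S := by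
    intro S hS v
    have h1 : S ∈ 𝓝 (W z) := by
      rw [← M.L.mapO hz]; exact Filter.mem_map.2 (Filter.Eventually.of_forall hS)
    have hc : Continuous fun ε : ℝ => W z + ε * v := by fun_prop
    have h2 : ∀ᶠ ε : ℝ in 𝓝[>] (0:ℝ), W z + ε * v ∈ S :=
      ((hc.tendsto 0).mono_left nhdsWithin_le_nhds) (by simpa using h1)
    obtain ⟨ε, h3, h4⟩ := (h2.and self_mem_nhdsWithin).exists
    exact ⟨ε, h4, h3⟩
  refine ⟨?_, fun q hq => ?_⟩
  · rw [zt_im]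
    obtain ⟨ε, hε, h⟩ := key {w | w.im ≤ p0.im} M.top I
    simp at h; linarith
  · rw [zt_im]
    obtain ⟨ε, hε, h⟩ := key {w | q.im ≤ w.im} (M.bot q hq) (-I)
    simp at h; linarith

lemma offO (M : Lim3 U W p0 Q) {z : ℂ} (hz : ¬ 0 < U z) : zt W z ∉ Sg p0 Q := by
  rintro ⟨h1, h2⟩
  rw [zt_im] at h1
  rcases M.vals z hz with h | h
  · rw [h] at h1; exact lt_irrefl _ h1
  · have := h2 _ h
    rw [zt_im] at this; exact lt_irrefl _ this

lemma slice (M : Lim3 U W p0 Q) {z w : ℂ} (hz : 0 < U z) (hne : w ≠ z) (him : (W w).im = (W z).im) :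
    0 < ((zt W w).re - (zt W z).re) * ((W w).re - (W z).re) := by
  have h := M.L.N_lt hz hne
  have h2 : ‖(W w - w) - (W z - z)‖^2 < ‖w - z‖^2 := by gcongr
  rw [← normSq_eq_norm_sq, ← normSq_eq_norm_sq, normSq_apply, normSq_apply] at h2
  simp only [sub_re, sub_im, him] at h2
  rw [zt_re, zt_re]
  nlinarith

lemma inj (M : Lim3 U W p0 Q) {z w : ℂ} (hz : 0 < U z) (h : zt W w = zt W z) : w = z := by
  by_contra hne
  have := M.slice hz hne (by rw [← zt_im W w, ← zt_im W z, h])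
  rw [h] at this
  simp at this

lemma slice_interval (M : Lim3 U W p0 Q) {z1 z2 s : ℂ} (h1 : 0 < U z1) (h2 : 0 < U z2)
    (hs1 : s.im = (zt W z1).im) (hs2 : s.im = (zt W z2).im) (hr1 : (zt W z1).re ≤ s.re) (hr2 : s.re ≤ (zt W z2).re) :
    ∃ z, 0 < U z ∧ zt W z = s := by
  set O : Set ℂ := {z | 0 < U z} with hO
  have hseg : segment ℝ (W z1) (W z2) ⊆ W '' O := M.L.structure1.2.1.segment_subset ⟨z1, h1, rfl⟩ ⟨z2, h2, rfl⟩
  have hinj : Function.Injective (fun x : O => W x) := by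
    intro x y hxy
    by_contra hne
    have := M.L.smono x.2 (w := y) (fun h => hne (Subtype.ext h.symm))
    rw [show W y = W x from hxy.symm] at this
    simp [dot2] at this
  have hop : IsOpenMap (fun x : O => W x) := by
    rw [isOpenMap_iff_nhds_le]
    intro x
    have e1 : Filter.map (fun x : O => W x) (𝓝 x) = Filter.map W (Filter.map Subtype.val (𝓝 x)) := rfl
    rw [e1, map_nhds_subtype_coe_eq_nhds x.2 (M.L.S.op.mem_nhds x.2), M.L.mapO x.2]
  have hpre := (convex_segment (𝕜 := ℝ) (W z1) (W z2)).isPreconnected.preimage_of_isOpenMap hinj hop (by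
    intro y hy
    obtain ⟨x, hx, rfl⟩ := hseg hy
    exact ⟨⟨x, hx⟩, rfl⟩)
  have hiv := hpre.intermediate_value (f := fun x : O => (zt W x).re) (a := ⟨z1, h1⟩) (b := ⟨z2, h2⟩)
    (left_mem_segment ℝ _ _) (right_mem_segment ℝ _ _)
    ((continuous_re.comp (M.cont.comp continuous_subtype_val)).continuousOn)
  obtain ⟨⟨x, hx⟩, hx1, hx2⟩ := hiv ⟨hr1, hr2⟩
  refine ⟨x, hx, Complex.ext hx2 ?_⟩
  have hx3 : W x ∈ segment ℝ (W z1) (W z2) := hx1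
  obtain ⟨a, b, ha, hb, hab, h3⟩ := hx3
  rw [zt_im] at hs1 hs2 ⊢
  rw [← h3]
  simp
  rw [← hs1, ← hs2]
  linear_combination s.im * hab

end Lim3
end OP

namespace OP

lemma sqrt_facts {q : ℂ} (hq : q ∈ slitPlane) : 0 < (exp (log q / 2)).re ∧ exp (log q / 2) * exp (log q / 2) = q := by
  constructor
  · rw [Complex.exp_re]
    have h1 : (log q / 2).im = arg q / 2 := by
      have : log q / 2 = ((1/2 : ℝ) : ℂ) * log q := by push_cast; ring
      rw [this, im_ofReal_mul, log_im]; ring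
    rw [h1]
    have h2 := neg_pi_lt_arg q
    have h3 : arg q < Real.pi := lt_of_le_of_ne (arg_le_pi q) (mem_slitPlane_iff_arg.1 hq).1
    exact mul_pos (Real.exp_pos _) (Real.cos_pos_of_mem_Ioo ⟨by linarith, by linarith⟩)
  · rw [← Complex.exp_add, add_halves, exp_log (slitPlane_ne_zero hq)]

lemma Kfun {a b : ℂ} (hab : a ≠ b) : ∃ K : ℂ → ℂ, (∀ s ∉ segment ℝ a b, DifferentiableAt ℂ K s ∧ ‖K s‖ < 1) ∧
    (∃ R, ∀ s ∉ segment ℝ a b, R ≤ ‖s‖ → ‖K s‖ ≤ 1/2) ∧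
    (∀ k < 1, ∃ ρ > 0, ∀ s ∉ segment ℝ a b, s ∈ ball a ρ → k < ‖K s‖) := by
  set q : ℂ → ℂ := fun s => (s - a) / (s - b) with hq
  set ϖ : ℂ → ℂ := fun s => exp (log (q s) / 2) with hϖ
  have hsb : ∀ s ∉ segment ℝ a b, s - b ≠ 0 := by
    intro s hs h
    exact hs (by rw [sub_eq_zero.1 h]; exact right_mem_segment ℝ a b)
  have hsl : ∀ s ∉ segment ℝ a b, q s ∈ slitPlane := by
    intro s hs
    by_contra hcon
    rw [mem_slitPlane_iff] at hcon
    push Not at hcon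
    obtain ⟨h1, h2⟩ := hcon
    set t := -(q s).re with ht
    have ht0 : 0 ≤ t := by linarith
    have hqt : q s = -(t:ℂ) := by apply Complex.ext <;> simp [ht, h2]
    have h3 : s - a = -(t:ℂ) * (s - b) := by
      rw [← hqt, hq]; field_simp [hsb s hs]
    have h1t : (1 + t) ≠ 0 := by positivity
    have h1tc : (1 + (t:ℂ)) ≠ 0 := by exact_mod_cast h1t
    refine hs ⟨1/(1+t), t/(1+t), by positivity, by positivity, by field_simp, ?_⟩
    simp only [real_smul]
    push_cast
    field_simp
    linear_combination -h3
  have hpos : ∀ s ∉ segment ℝ a b, 0 < (ϖ s).re ∧ ϖ s * ϖ s = q s := fun s hs => sqrt_facts (hsl s hs)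
  have h1le : ∀ w : ℂ, 0 < w.re → 1 < ‖w + 1‖ := by
    intro w hw
    refine lt_of_lt_of_le ?_ ((le_abs_self _).trans (abs_re_le_norm _))
    simp [hw]
  have hne : ∀ s ∉ segment ℝ a b, ϖ s + 1 ≠ 0 := by
    intro s hs h
    have := h1le _ (hpos s hs).1
    rw [h] at this; simp at this; linarith
  refine ⟨fun s => (ϖ s - 1) / (ϖ s + 1), ?_, ?_, ?_⟩
  · intro s hs
    constructor
    · have dq : DifferentiableAt ℂ q s := by
        simp only [hq]
        exact DifferentiableAt.div (by fun_prop) (by fun_prop) (hsb s hs)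
      have dϖ : DifferentiableAt ℂ ϖ s := ((dq.clog (hsl s hs)).div_const 2).cexp
      exact (dϖ.sub_const 1).div (dϖ.add_const 1) (hne s hs)
    · rw [norm_div, div_lt_one (norm_pos_iff.2 (hne s hs))]
      have h2 : ‖ϖ s - 1‖^2 < ‖ϖ s + 1‖^2 := by
        rw [← normSq_eq_norm_sq, ← normSq_eq_norm_sq, normSq_apply, normSq_apply]
        simp
        nlinarith [(hpos s hs).1]
      exact lt_of_pow_lt_pow_left₀ 2 (norm_nonneg _) h2
  · refine ⟨‖b‖ + 2 * ‖b - a‖, fun s hs hR => ?_⟩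
    obtain ⟨h1, h2⟩ := hpos s hs
    have h3 : (ϖ s - 1) * (ϖ s + 1) * (s - b) = b - a := by
      have : (ϖ s - 1) * (ϖ s + 1) = q s - 1 := by rw [← h2]; ring
      rw [this, hq]; field_simp [hsb s hs]; ring
    have h4 := h1le _ h1
    have h5 := congrArg norm h3
    rw [norm_mul, norm_mul] at h5
    have h6 : 2 * ‖b - a‖ ≤ ‖s - b‖ := by
      have := norm_sub_norm_le s b; linarith
    have h7 : 0 < ‖b - a‖ := norm_pos_iff.2 (sub_ne_zero.2 hab.symm)
    rw [norm_div, div_le_iff₀ (by linarith)]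
    have h8 : ‖ϖ s - 1‖ * ‖ϖ s + 1‖ ≤ 1/2 := by
      by_contra! hcon
      nlinarith
    nlinarith [norm_nonneg (ϖ s - 1)]
  · intro k hk
    have hT : Tendsto (fun s => (1 - Real.sqrt ‖q s‖) / (1 + Real.sqrt ‖q s‖)) (𝓝 a) (𝓝 1) := by
      have hqc : ContinuousAt q a := by
        simp only [hq]
        exact ContinuousAt.div (by fun_prop) (by fun_prop) (sub_ne_zero.2 hab)
      have hsq : ContinuousAt (fun s => Real.sqrt ‖q s‖) a := Real.continuous_sqrt.continuousAt.comp hqc.norm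
      have := ((continuousAt_const (y := (1:ℝ))).sub hsq).div ((continuousAt_const (y := (1:ℝ))).add hsq)
        (by have h0 := Real.sqrt_nonneg ‖q a‖; exact (by linarith : (0:ℝ) < 1 + Real.sqrt ‖q a‖).ne')
      have hq0 : q a = 0 := by simp [hq]
      have h2 : Tendsto (fun s => (1 - Real.sqrt ‖q s‖) / (1 + Real.sqrt ‖q s‖)) (𝓝 a)
        (𝓝 ((1 - Real.sqrt ‖q a‖) / (1 + Real.sqrt ‖q a‖))) := this
      simpa [hq0] using h2
    obtain ⟨ρ, hρ, hb⟩ := eventually_nhds_iff_ball.1 (hT.eventually_const_lt hk)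
    refine ⟨ρ, hρ, fun s hs hsb' => (hb s hsb').trans_le ?_⟩
    obtain ⟨h1, h2⟩ := hpos s hs
    have h3 : Real.sqrt ‖q s‖ = ‖ϖ s‖ := by
      rw [← h2, norm_mul, Real.sqrt_mul_self (norm_nonneg _)]
    rw [h3, norm_div]
    have h4 : 1 - ‖ϖ s‖ ≤ ‖ϖ s - 1‖ := by
      have := norm_sub_norm_le (1:ℂ) (ϖ s); rw [norm_one, norm_sub_rev] at this; exact this
    have h5 : ‖ϖ s + 1‖ ≤ 1 + ‖ϖ s‖ := by
      have := norm_add_le (ϖ s) 1; rw [norm_one] at this; linarith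
    have h6 : 0 < ‖ϖ s + 1‖ := norm_pos_iff.2 (hne s hs)
    refine (div_le_div_of_nonneg_right h4 (by positivity)).trans ?_
    exact div_le_div_of_nonneg_left (norm_nonneg _) h6 h5

namespace Lim3
variable {U : ℂ → ℝ} {W : ℂ → ℂ} {p0 : ℂ} {Q : Set ℂ}

lemma Lprime (M : Lim3 U W p0 Q) {κ : ℂ → ℂ} {k : ℝ} (hk : 0 < k) (hc : ContinuousOn κ (closure {z | 0 < U z}))
    (hd : DifferentiableOn ℂ κ {z | 0 < U z}) (h1 : ∀ z, 0 < U z → ‖κ z‖ ≤ 1)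
    (hf : ∀ z ∈ frontier {z | 0 < U z}, ‖κ z‖ ≤ k) {z : ℂ} (hz : 0 < U z) : ‖κ z‖ ≤ k := by
  set O : Set ℂ := {z | 0 < U z} with hO
  have hOo : IsOpen O := M.L.S.op
  obtain ⟨x, hx, hxp⟩ := M.pt0
  have hx0 : ¬ 0 < U x := by rw [(M.L.S.fr_iff.1 hx).1]; exact lt_irrefl _
  obtain ⟨c, ρ, hρ, hb⟩ := M.L.has_interior (e := I) (a := x) (by simp) hx0 (by rw [hxp]; exact M.ray)
  have hcl : ∀ w ∈ closure O, ρ ≤ ‖w - c‖ := by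
    have hcs : IsClosed {w : ℂ | ρ ≤ ‖w - c‖} := isClosed_le (by fun_prop) (by fun_prop)
    refine fun w hw => (closure_minimal (fun v hv => ?_) hcs) hw
    by_contra hcon
    have : v ∈ ball c ρ := by rw [mem_ball, dist_eq_norm]; exact not_le.1 hcon
    exact M.L.zero_of_val hx0 (hb v this) hv
  have key : ∀ N : ℕ, ‖κ z‖ ^ N * (ρ / ‖z - c‖) ≤ k ^ N := by
    intro N
    set R : ℝ := ‖c‖ + ρ / k ^ N + ‖z‖ + 1 with hR
    set V : Set ℂ := O ∩ ball 0 R with hV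
    have hVo : IsOpen V := hOo.inter isOpen_ball
    have hclV : closure V ⊆ closure O ∩ closedBall 0 R := fun w hw =>
      ⟨closure_mono inter_subset_left hw, closure_ball_subset_closedBall (closure_mono inter_subset_right hw)⟩
    have hne : ∀ w ∈ closure O, w - c ≠ 0 := by
      intro w hw h
      have := hcl w hw
      rw [h, norm_zero] at this; linarith
    have hdc : DiffContOnCl ℂ (fun w => κ w ^ N * (ρ / (w - c))) V := by
      constructor
      · intro w hw
        have := (hd.differentiableAt (hOo.mem_nhds hw.1))
        exact ((this.pow N).mul (DifferentiableAt.div (by fun_prop) (by fun_prop) (hne w (subset_closure hw.1)))).differentiableWithinAt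
      · refine ((hc.mono fun w hw => (hclV hw).1).pow N).mul (ContinuousOn.div (by fun_prop) (by fun_prop) fun w hw => hne w (hclV hw).1)
    have := norm_le_of_forall_mem_frontier_norm_le (C := k ^ N) (isBounded_ball.subset inter_subset_right) hdc (by
      intro w hw
      rw [hVo.frontier_eq] at hw
      obtain ⟨hw1, hw2⟩ := hclV hw.1
      have hcw := hcl w hw1
      rw [norm_mul, norm_pow, norm_div, norm_real_pos hρ]
      by_cases hwO : 0 < U w
      · have hwR : ‖w‖ = R := by
          have h3 : w ∉ ball (0:ℂ) R := fun h => hw.2 ⟨hwO, h⟩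
          rw [mem_ball_zero_iff] at h3
          rw [mem_closedBall_zero_iff] at hw2
          linarith
        have h4 : ρ / k ^ N ≤ ‖w - c‖ := by
          have := norm_sub_norm_le w c
          have := norm_nonneg z
          linarith
        have h5 : ρ / ‖w - c‖ ≤ k ^ N := by
          rw [div_le_iff₀ (by positivity)] at h4
          rw [div_le_iff₀ (by linarith)]; linarith
        have h6 : ‖κ w‖ ^ N ≤ 1 := pow_le_one₀ (norm_nonneg _) (h1 w hwO)
        calc _ ≤ 1 * (ρ / ‖w - c‖) := by gcongr
          _ ≤ _ := by rw [one_mul]; exact h5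
      · have h7 : ‖κ w‖ ≤ k := hf w (by rw [hOo.frontier_eq]; exact ⟨hw1, hwO⟩)
        have h8 : ρ / ‖w - c‖ ≤ 1 := by rw [div_le_one (by linarith)]; exact hcw
        calc _ ≤ k ^ N * 1 := by gcongr
          _ = _ := mul_one _) (z := z) (subset_closure ⟨hz, by
            rw [mem_ball_zero_iff, hR]; have : 0 ≤ ρ / k ^ N := by positivity
            have := norm_nonneg c; linarith⟩)
    rwa [norm_mul, norm_pow, norm_div, norm_real_pos hρ] at this
  by_contra! hcon
  have hlt : 1 < ‖κ z‖ / k := by rwa [one_lt_div hk]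
  have hzc : 0 < ‖z - c‖ := lt_of_lt_of_le hρ (hcl z (subset_closure hz))
  obtain ⟨N, hN⟩ := ((tendsto_pow_atTop_atTop_of_one_lt hlt).eventually_gt_atTop (‖z - c‖ / ρ)).exists
  have h9 := key N
  rw [div_pow, lt_div_iff₀ (by positivity)] at hN
  have : ‖z - c‖ / ρ * k ^ N * (ρ / ‖z - c‖) = k ^ N := by field_simp
  have h10 : ‖z - c‖ / ρ * k ^ N * (ρ / ‖z - c‖) < ‖κ z‖ ^ N * (ρ / ‖z - c‖) := by gcongr
  linarith

lemma segm (M : Lim3 U W p0 Q) {a b : ℂ} (hab : a ≠ b) {F : Set ℂ} (hF : IsClosed F) (hFs : ∀ s ∈ F, s ∉ segment ℝ a b)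
    (hfr : ∀ z ∈ frontier {z | 0 < U z}, zt W z ∈ F) (hO : ∀ z, 0 < U z → zt W z ∉ segment ℝ a b) :
    ∃ ρ > 0, ∀ z, 0 < U z → zt W z ∉ ball a ρ := by
  obtain ⟨K, hK1, ⟨R, hK2⟩, hK3⟩ := Kfun hab
  have hk : ∃ k < 1, 1/2 ≤ k ∧ ∀ s ∈ F, ‖K s‖ ≤ k := by
    have hcomp : IsCompact (F ∩ closedBall 0 R) := (isCompact_closedBall 0 R).inter_left hF
    rcases (F ∩ closedBall (0:ℂ) R).eq_empty_or_nonempty with he | hne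
    · refine ⟨1/2, by norm_num, le_rfl, fun s hs => hK2 s (hFs s hs) ?_⟩
      by_contra hcon
      have : s ∈ F ∩ closedBall 0 R := ⟨hs, by rw [mem_closedBall_zero_iff]; exact (not_le.1 hcon).le⟩
      rw [he] at this; exact this
    · obtain ⟨x, hx, hmax⟩ := hcomp.exists_isMaxOn hne (f := fun s => ‖K s‖)
        (fun s hs => ((hK1 s (hFs s hs.1)).1.continuousAt.norm).continuousWithinAt)
      refine ⟨max (1/2) ‖K x‖, max_lt (by norm_num) (hK1 x (hFs x hx.1)).2, le_max_left _ _, fun s hs => ?_⟩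
      by_cases hsR : R ≤ ‖s‖
      · exact (hK2 s (hFs s hs) hsR).trans (le_max_left _ _)
      · exact (hmax ⟨hs, by rw [mem_closedBall_zero_iff]; exact (not_le.1 hsR).le⟩).trans (le_max_right _ _)
  obtain ⟨k, hk1, hk0, hkF⟩ := hk
  obtain ⟨ρ, hρ, hK4⟩ := hK3 k hk1
  refine ⟨ρ, hρ, fun z hz hzb => ?_⟩
  have h1 := hK4 _ (hO z hz) hzb
  have hOo : IsOpen {z | 0 < U z} := M.L.S.op
  have h2 := M.Lprime (κ := fun z => K (zt W z)) (k := k) (by linarith) (by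
      intro w hw
      have hns : zt W w ∉ segment ℝ a b := by
        by_cases hwO : 0 < U w
        · exact hO w hwO
        · exact hFs _ (hfr w (by rw [hOo.frontier_eq]; exact ⟨hw, hwO⟩))
      exact ((hK1 _ hns).1.continuousAt.comp M.cont.continuousAt).continuousWithinAt)
    (by
      intro w hw
      exact ((hK1 _ (hO w hw)).1.comp w (M.L.zeta_deriv hw).differentiableAt).differentiableWithinAt)
    (fun w hw => (hK1 _ (hO w hw)).2.le) (fun w hw => hkF _ (hfr w hw)) hz
  exact absurd h1 (not_lt.2 h2)

lemma Sg_open (M : Lim3 U W p0 Q) : IsOpen (Sg p0 Q) := by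
  have h1 : IsOpen {s : ℂ | s.im < p0.im} := isOpen_lt (by fun_prop) (by fun_prop)
  have h2 : IsOpen (⋂ q ∈ Q, {s : ℂ | q.im < s.im}) := M.sub.finite.isOpen_biInter fun q _ => isOpen_lt (by fun_prop) (by fun_prop)
  convert h1.inter h2 using 1
  ext s; simp [Sg]

lemma Sg_convex (p0 : ℂ) (Q : Set ℂ) : Convex ℝ (Sg p0 Q) := by
  intro a ha b hb s t hs ht hst
  have h0 : (s • a + t • b).im = s * a.im + t * b.im := by simp
  have hcomb : ∀ c : ℝ, c = s * c + t * c := fun c => by rw [← add_mul, hst, one_mul]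
  refine ⟨?_, fun q hq => ?_⟩
  · rw [h0, hcomb p0.im]
    rcases hs.eq_or_lt with rfl | hs
    · have : t = 1 := by linarith
      subst this; simp; exact hb.1
    · have := mul_lt_mul_of_pos_left ha.1 hs
      have := mul_le_mul_of_nonneg_left hb.1.le ht
      linarith
  · rw [h0, hcomb q.im]
    rcases hs.eq_or_lt with rfl | hs
    · have : t = 1 := by linarith
      subst this; simp; exact hb.2 q hq
    · have := mul_lt_mul_of_pos_left (ha.2 q hq) hs
      have := mul_le_mul_of_nonneg_left (hb.2 q hq).le ht
      linarith

lemma f_ne (M : Lim3 U W p0 Q) {z : ℂ} (hz : 0 < U z) : 1 - cg U z ^ 2 ≠ 0 := by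
  intro h
  have h1 : cg U z ^ 2 = 1 := by linear_combination -h
  have h2 := congrArg norm h1
  rw [norm_pow, norm_one] at h2
  have := M.L.lt z hz
  nlinarith [norm_nonneg (cg U z)]

lemma zt_strict (M : Lim3 U W p0 Q) {z : ℂ} (hz : 0 < U z) : HasStrictDerivAt (zt W) (1 - cg U z ^ 2) z := by
  have hcont : ContinuousAt (fun z => 1 - cg U z ^ 2) z := by
    have := (M.L.S.har.hol.differentiableAt (M.L.S.op.mem_nhds hz)).continuousAt
    fun_prop
  refine hasStrictDerivAt_of_hasDerivAt_of_continuousAt (f' := fun z => 1 - cg U z ^ 2) ?_ hcont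
  filter_upwards [M.L.S.op.mem_nhds hz] with w hw using M.L.zeta_deriv hw

lemma zt_open (M : Lim3 U W p0 Q) {V : Set ℂ} (hV : IsOpen V) (hVO : ∀ z ∈ V, 0 < U z) : IsOpen (zt W '' V) := by
  rw [isOpen_iff_mem_nhds]
  rintro _ ⟨z, hz, rfl⟩
  rw [← (M.zt_strict (hVO z hz)).map_nhds_eq (M.f_ne (hVO z hz))]
  exact image_mem_map (hV.mem_nhds hz)

lemma seg_im {a b s : ℂ} (h : a.im = b.im) (hs : s ∈ segment ℝ a b) : s.im = a.im ∧ min a.re b.re ≤ s.re ∧ s.re ≤ max a.re b.re := by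
  obtain ⟨x, y, hx, hy, hxy, rfl⟩ := hs
  have e1 : (x • a + y • b).re = x * a.re + y * b.re := by simp
  have e2 : (x • a + y • b).im = x * a.im + y * b.im := by simp
  rw [e1, e2, ← h]
  have hc : ∀ c : ℝ, x * c + y * c = c := fun c => by rw [← add_mul, hxy, one_mul]
  refine ⟨hc _, ?_, ?_⟩
  · have := mul_le_mul_of_nonneg_left (min_le_left a.re b.re) hx
    have := mul_le_mul_of_nonneg_left (min_le_right a.re b.re) hy
    have := hc (min a.re b.re)
    linarith
  · have := mul_le_mul_of_nonneg_left (le_max_left a.re b.re) hx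
    have := mul_le_mul_of_nonneg_left (le_max_right a.re b.re) hy
    have := hc (max a.re b.re)
    linarith

lemma surj (M : Lim3 U W p0 Q) : Sg p0 Q ⊆ zt W '' {z | 0 < U z} := by
  set O : Set ℂ := {z | 0 < U z} with hO
  obtain ⟨z0, hz0⟩ := M.L.ne
  refine (Sg_convex p0 Q).isPreconnected.subset_of_closure_inter_subset (M.zt_open M.L.S.op fun z hz => hz)
    ⟨zt W z0, M.inO hz0, z0, hz0, rfl⟩ ?_
  rintro a ⟨hacl, ha⟩
  by_contra hna
  have main : ∃ b : ℂ, a ≠ b ∧ a.im = b.im ∧ ∀ z, 0 < U z → zt W z ∉ segment ℝ a b := by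
    by_cases h1 : ∀ z, 0 < U z → zt W z ∉ segment ℝ a (a + 1)
    · exact ⟨a + 1, by simp, by simp, h1⟩
    · refine ⟨a - 1, fun h => by have h0 := congrArg re h; rw [sub_re, one_re] at h0; linarith, by simp, fun z2 hz2 hs2 => ?_⟩
      push Not at h1
      obtain ⟨z1, hz1, hs1⟩ := h1
      obtain ⟨i1, j1, k1⟩ := seg_im (by simp) hs1
      obtain ⟨i2, j2, k2⟩ := seg_im (by simp) hs2
      have e1 : min a.re (a + 1).re = a.re := min_eq_left (by simp)
      have e2 : max a.re (a - 1).re = a.re := max_eq_left (by simp)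
      rw [e1] at j1; rw [e2] at k2
      obtain ⟨z, hz, h⟩ := M.slice_interval hz2 hz1 i2.symm i1.symm k2 j1
      exact hna ⟨z, hz, h⟩
  obtain ⟨b, hab, him, hseg⟩ := main
  obtain ⟨ρ, hρ, hb⟩ := M.segm hab (F := (Sg p0 Q)ᶜ) M.Sg_open.isClosed_compl (by
    intro s hs hss
    obtain ⟨i1, -, -⟩ := seg_im him hss
    exact hs ⟨by rw [i1]; exact ha.1, fun q hq => by rw [i1]; exact ha.2 q hq⟩)
    (fun z hz => M.offO (by rw [(M.L.S.fr_iff.1 hz).1]; exact lt_irrefl _)) hseg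
  obtain ⟨_, h1, z, hz, rfl⟩ := mem_closure_iff.1 hacl _ isOpen_ball (mem_ball_self hρ)
  exact hb z hz h1

end Lim3
end OP

namespace OP
namespace Lim3
variable {U : ℂ → ℝ} {W : ℂ → ℂ} {p0 : ℂ} {Q : Set ℂ}

lemma reZ_aux (M : Lim3 U W p0 Q) {a b : ℂ} (ha : a.im = p0.im) (hb : b.im = p0.im) (hab : a ≠ b) {F : Set ℂ} (hF : IsClosed F)
    (hFs : ∀ s ∈ F, s ∉ segment ℝ a b) (hz : ∀ z, W z = p0 → zt W z ∈ F) : False := by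
  obtain ⟨z0, hz0⟩ := M.L.ne
  have h0 := M.inO hz0
  set h := (zt W z0).im with hh
  have him : ∀ s ∈ segment ℝ a b, s.im = p0.im := fun s hs => by rw [(seg_im (ha.trans hb.symm) hs).1, ha]
  have hcl : IsClosed {s : ℂ | s.im ≤ h} := isClosed_le (by fun_prop) (by fun_prop)
  obtain ⟨ρ, hρ, hball⟩ := M.segm hab (F := F ∪ {s | s.im ≤ h}) (hF.union hcl) (by
    rintro s (hs | hs) hss
    · exact hFs s hs hss
    · have h1 := him s hss
      have h2 : s.im ≤ h := hs
      linarith [h0.1]) (by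
    intro z hz1
    rcases M.vals z (by rw [(M.L.S.fr_iff.1 hz1).1]; exact lt_irrefl _) with h1 | h1
    · exact Or.inl (hz z h1)
    · right
      have := h0.2 _ h1
      change (zt W z).im ≤ h
      rw [zt_im]; exact this.le) (by
    intro z hz1 hs
    have := (M.inO hz1).1
    rw [him _ hs] at this
    exact lt_irrefl _ this)
  set ε := min (ρ / 2) ((p0.im - h) / 2) with hε
  have h00 : h < p0.im := h0.1
  have hε0 : 0 < ε := lt_min (by linarith) (by linarith)
  have e1 : ε ≤ ρ / 2 := min_le_left _ _
  have e2 : ε ≤ (p0.im - h) / 2 := min_le_right _ _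
  have e3 : (a - ε * I).im = p0.im - ε := by simp [ha]
  obtain ⟨z, hz1, hz2⟩ := M.surj (show a - ε * I ∈ Sg p0 Q from ⟨by rw [e3]; linarith, fun q hq => by
    rw [e3]; have := h0.2 q hq; linarith⟩)
  refine hball z hz1 ?_
  rw [hz2, mem_ball, dist_eq_norm, sub_sub_cancel_left, norm_neg, norm_mul, norm_I, norm_real_pos hε0]
  linarith

lemma reZ (M : Lim3 U W p0 Q) (x : ℝ) : ∃ z, z.re = x ∧ W z = p0 := by
  by_contra! hcon
  obtain ⟨c, -, hc⟩ := M.pt0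
  have hside : (∀ z, W z = p0 → z.re < x) ∨ (∀ z, W z = p0 → x < z.re) := by
    by_contra! h
    obtain ⟨⟨z1, h1, h1'⟩, z2, h2, h2'⟩ := h
    have hpre := (M.L.S.Zconvex p0).isPreconnected.intermediate_value (f := re) (a := z2) (b := z1) h2 h1
      continuous_re.continuousOn
    obtain ⟨z, hz, hzx⟩ := hpre ⟨h2', h1'⟩
    exact hcon z hzx hz
  rcases hside with hs | hs
  · refine M.reZ_aux (a := ⟨2 * (x + 1) - p0.re, p0.im⟩) (b := ⟨2 * (x + 2) - p0.re, p0.im⟩) rfl rfl ?_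
      (F := {s | s.re ≤ 2 * x - p0.re}) (isClosed_le (by fun_prop) (by fun_prop)) ?_ ?_
    · intro h; have := congrArg re h; dsimp only at this; linarith
    · intro s hs1 hs2
      have h3 := (seg_im (a := ⟨2 * (x + 1) - p0.re, p0.im⟩) (b := ⟨2 * (x + 2) - p0.re, p0.im⟩) rfl hs2).2.1
      have h4 : s.re ≤ 2 * x - p0.re := hs1
      dsimp only at h3
      rw [min_eq_left (by linarith)] at h3
      linarith
    · intro z hz
      change (zt W z).re ≤ _
      rw [zt_re, hz]; linarith [hs z hz]
  · refine M.reZ_aux (a := ⟨2 * (x - 1) - p0.re, p0.im⟩) (b := ⟨2 * (x - 2) - p0.re, p0.im⟩) rfl rfl ?_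
      (F := {s | 2 * x - p0.re ≤ s.re}) (isClosed_le (by fun_prop) (by fun_prop)) ?_ ?_
    · intro h; have := congrArg re h; dsimp only at this; linarith
    · intro s hs1 hs2
      have h3 := (seg_im (a := ⟨2 * (x - 1) - p0.re, p0.im⟩) (b := ⟨2 * (x - 2) - p0.re, p0.im⟩) rfl hs2).2.2
      have h4 : 2 * x - p0.re ≤ s.re := hs1
      dsimp only at h3
      rw [max_eq_left (by linarith)] at h3
      linarith
    · intro z hz
      change _ ≤ (zt W z).re
      rw [zt_re, hz]; linarith [hs z hz]

lemma lowest (M : Lim3 U W p0 Q) (x : ℝ) : ∃ z1, z1.re = x ∧ W z1 = p0 ∧ z1 ∈ closure {z | 0 < U z} ∧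
    ∀ z, z.re = x → W z = p0 → z1.im ≤ z.im := by
  obtain ⟨z0, hz0⟩ := M.L.ne
  obtain ⟨b, hb, hbp⟩ := M.reZ x
  have hWc := M.L.S.wlip.continuous
  have h0 := (M.inO hz0).1
  rw [zt_im] at h0
  have hcv : Continuous fun y : ℝ => (x:ℂ) + y * I := by fun_prop
  set T : Set ℝ := {y | W (x + y * I) = p0} with hT
  have hTc : IsClosed T := isClosed_eq (hWc.comp hcv) continuous_const
  have hre : ∀ z : ℂ, z.re = x → (x:ℂ) + z.im * I = z := by
    rintro z rfl; exact re_add_im z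
  have hTn : T.Nonempty := ⟨b.im, by rw [hT, mem_ofPred_eq, hre b hb, hbp]⟩
  have hTb : BddBelow T := by
    refine ⟨z0.im - |(p0 - W z0).re * (x - z0.re)| / (p0.im - (W z0).im), fun y hy => ?_⟩
    have hy' : W (x + y * I) = p0 := hy
    have hne : (x:ℂ) + y * I ≠ z0 := by
      intro h; rw [h] at hy'; rw [hy'] at h0; exact lt_irrefl _ h0
    have h1 := M.L.smono hz0 hne
    rw [hy'] at h1
    simp [dot2] at h1
    have h2 : 0 < p0.im - (W z0).im := by linarith
    rw [sub_le_iff_le_add, ← sub_le_iff_le_add', le_div_iff₀ h2]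
    have h3 := le_abs_self ((p0 - W z0).re * (x - z0.re))
    simp at h3 ⊢
    nlinarith
  have hmem := hTc.csInf_mem hTn hTb
  set y1 := sInf T with hy1
  have hW1 : W (x + y1 * I) = p0 := hmem
  have hmin : ∀ z, z.re = x → W z = p0 → y1 ≤ z.im := fun z hz hzp => csInf_le hTb (by rw [hT, mem_ofPred_eq, hre z hz, hzp])
  refine ⟨x + y1 * I, by simp, hmem, ?_, fun z hz hzp => by simpa using hmin z hz hzp⟩
  by_contra hcl
  have h3 := M.L.structure1.2.2.2 _ hcl
  have h4 : ∀ᶠ y : ℝ in 𝓝[<] y1, W (x + y * I) = W (x + y1 * I) := nhdsWithin_le_nhds (hcv.continuousAt.eventually h3)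
  obtain ⟨y, h6, h7⟩ := (h4.and self_mem_nhdsWithin).exists
  have h8 := hmin (x + y * I) (by simp) (h6.trans hW1)
  simp at h8
  exact absurd h8 (not_le.2 h7)

lemma above (M : Lim3 U W p0 Q) {z1 z2 : ℂ} (h1 : W z1 = p0) (hre : z2.re = z1.re) (him : z1.im < z2.im) :
    ∀ᶠ v in 𝓝 z2, W v = p0 := by
  obtain ⟨zl, hl, hlp⟩ := M.reZ (z1.re - 1)
  obtain ⟨zr, hr, hrp⟩ := M.reZ (z1.re + 1)
  have hup : ∀ v w : ℂ, W w = p0 → v.re = w.re → w.im ≤ v.im → W v = p0 := by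
    intro v w hw h2 h3
    have := M.ray w hw (v.im - w.im) (by linarith)
    rwa [show w + ((v.im - w.im : ℝ) : ℂ) * I = v by apply Complex.ext <;> simp [h2]] at this
  have key : ∀ w v : ℂ, W w = p0 → |w.re - z1.re| = 1 → ∀ t : ℝ, 0 ≤ t → t ≤ 1 → v.re = z1.re + t * (w.re - z1.re) →
      z1.im + t * |w.im - z1.im| ≤ v.im → W v = p0 := by
    intro w v hw hwr t ht0 ht1 hv hvi
    have h3 : W (z1 + t * (w - z1)) = p0 := by
      have := M.L.S.Zconvex p0 h1 hw (by linarith : 0 ≤ 1 - t) ht0 (by ring)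
      have h4 : (1 - t) • z1 + t • w = z1 + t * (w - z1) := by simp only [real_smul]; push_cast; ring
      rw [h4] at this; exact this
    refine hup v _ h3 (by simp [hv]) ?_
    have := mul_le_mul_of_nonneg_left (le_abs_self (w.im - z1.im)) ht0
    simp; linarith
  have c1 : Continuous fun v : ℂ => z1.im + |v.re - z1.re| * (|zl.im - z1.im| + |zr.im - z1.im|) := by fun_prop
  have o1 : IsOpen {v : ℂ | z1.im + |v.re - z1.re| * (|zl.im - z1.im| + |zr.im - z1.im|) < v.im} :=
    isOpen_lt c1 (by fun_prop)
  have o2 : IsOpen {v : ℂ | |v.re - z1.re| < 1} := isOpen_lt (by fun_prop) (by fun_prop)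
  filter_upwards [o1.mem_nhds (show z2 ∈ _ by simp [hre, him]), o2.mem_nhds (show z2 ∈ _ by simp [hre])] with v hv1 hv2
  change z1.im + |v.re - z1.re| * (|zl.im - z1.im| + |zr.im - z1.im|) < v.im at hv1
  change |v.re - z1.re| < 1 at hv2
  have hl0 := abs_nonneg (zl.im - z1.im)
  have hr0 := abs_nonneg (zr.im - z1.im)
  rcases le_total z1.re v.re with h | h
  · have e : |v.re - z1.re| = v.re - z1.re := abs_of_nonneg (by linarith)
    rw [e] at hv1 hv2
    refine key zr v hrp (by rw [hr]; simp) (v.re - z1.re) (by linarith) hv2.le (by rw [hr]; ring) ?_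
    nlinarith
  · have e : |v.re - z1.re| = z1.re - v.re := by rw [abs_sub_comm]; exact abs_of_nonneg (by linarith)
    rw [e] at hv1 hv2
    refine key zl v hlp (by rw [hl]; simp) (z1.re - v.re) (by linarith) hv2.le (by rw [hl]; ring) ?_
    nlinarith

lemma bdry (M : Lim3 U W p0 Q) (x : ℝ) : ∃ z1, z1.re = x ∧ W z1 = p0 ∧ ∀ r > 0, ∃ δ > 0, ∀ z, 0 < U z →
    dist (zt W z) (2 * (x:ℂ) - conj p0) < δ → dist z z1 < r := by
  obtain ⟨z1, hz1, hW1, hcl, hmin⟩ := M.lowest x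
  refine ⟨z1, hz1, hW1, fun r hr => ?_⟩
  set s0 : ℂ := 2 * (x:ℂ) - conj p0 with hs0
  set O : Set ℂ := {z | 0 < U z} with hO
  have hOo : IsOpen O := M.L.S.op
  have hs0z : zt W z1 = s0 := by rw [zt, hW1, hz1]
  have hs0im : s0.im = p0.im := by simp [hs0]
  have hs0S : s0 ∉ Sg p0 Q := fun h => by have := h.1; rw [hs0im] at this; exact lt_irrefl _ this
  obtain ⟨z0, hz0⟩ := M.L.ne
  have h0 := M.inO hz0
  have hpu : ∀ w, W w = p0 → ¬ 0 < U w := by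
    intro w hw hU
    have := (M.inO hU).1
    rw [zt_im, hw] at this; exact lt_irrefl _ this
  set K : Set ℂ := closure O ∩ sphere z1 r with hK
  have hKc : IsCompact K := (isCompact_sphere z1 r).inter_left isClosed_closure
  have hKne : ∀ w ∈ K, zt W w ≠ s0 := by
    rintro w ⟨hw1, hw2⟩ hws
    have hwU : ¬ 0 < U w := fun h => hs0S (by rw [← hws]; exact M.inO h)
    have hwim : (W w).im = p0.im := by rw [← zt_im, hws, hs0im]
    have hwp : W w = p0 := by
      rcases M.vals w hwU with h | h
      · exact h
      · have h1 := h0.2 _ h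
        have h2 := h0.1
        rw [hwim] at h1; linarith
    have hwre : w.re = x := by
      have := congrArg re hws
      rw [zt_re, hwp, hs0] at this
      simp at this; linarith
    have h3 := hmin w hwre hwp
    have h4 : z1.im < w.im := by
      refine lt_of_le_of_ne h3 fun h => ?_
      have : w = z1 := Complex.ext (hwre.trans hz1.symm) h.symm
      rw [this, mem_sphere, dist_self] at hw2
      linarith
    have h5 := M.above hW1 (hwre.trans hz1.symm) h4
    obtain ⟨v, hv1, hv2⟩ := mem_closure_iff_nhds.1 hw1 _ h5
    exact hpu v hv1 hv2
  obtain ⟨δ, hδ, hKδ⟩ : ∃ δ > 0, ∀ w ∈ K, δ ≤ dist (zt W w) s0 := by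
    rcases K.eq_empty_or_nonempty with h | h
    · exact ⟨1, one_pos, by rw [h]; simp⟩
    · obtain ⟨w, hw, hmin⟩ := hKc.exists_isMinOn h (f := fun w => dist (zt W w) s0) (M.cont.dist continuous_const).continuousOn
      exact ⟨dist (zt W w) s0, dist_pos.2 (hKne w hw), fun v hv => hmin hv⟩
  refine ⟨δ, hδ, fun z hz hzd => ?_⟩
  have hsub : Sg p0 Q ∩ ball s0 δ ⊆ zt W '' (O ∩ ball z1 r) := by
    refine ((Sg_convex p0 Q).inter (convex_ball s0 δ)).isPreconnected.subset_of_closure_inter_subset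
      (M.zt_open (hOo.inter isOpen_ball) fun z hz => hz.1) ?_ ?_
    · have h1 : zt W ⁻¹' ball s0 δ ∩ ball z1 r ∈ 𝓝 z1 :=
        inter_mem (M.cont.continuousAt (by rw [hs0z]; exact ball_mem_nhds _ hδ)) (ball_mem_nhds _ hr)
      obtain ⟨v, hv1, hv2⟩ := mem_closure_iff_nhds.1 hcl _ h1
      exact ⟨zt W v, ⟨M.inO hv2, hv1.1⟩, v, ⟨hv2, hv1.2⟩, rfl⟩
    · rintro s ⟨hs1, hs2, hs3⟩
      have hcomp : IsCompact (closure (O ∩ ball z1 r)) := (isBounded_ball.subset inter_subset_right).isCompact_closure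
      have h1 : closure (zt W '' (O ∩ ball z1 r)) ⊆ zt W '' closure (O ∩ ball z1 r) :=
        closure_minimal (image_mono subset_closure) (hcomp.image M.cont).isClosed
      obtain ⟨w, hw, rfl⟩ := h1 hs1
      have hwO : 0 < U w := by by_contra h; exact M.offO h hs2
      have hw2 : w ∈ closedBall z1 r := closure_ball_subset_closedBall (closure_mono inter_subset_right hw)
      refine ⟨w, ⟨hwO, ?_⟩, rfl⟩
      refine mem_ball.2 (lt_of_le_of_ne (mem_closedBall.1 hw2) fun h => ?_)
      have := hKδ w ⟨subset_closure hwO, h⟩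
      rw [mem_ball] at hs3
      linarith
  obtain ⟨z', hz', he⟩ := hsub ⟨M.inO hz, hzd⟩
  rw [← M.inj hz he]
  exact hz'.2

end Lim3
end OP

namespace OP

lemma Har.comp {U : ℂ → ℝ} {O O' : Set ℂ} {φ φ' : ℂ → ℂ} (h : Har U O) (ho : IsOpen O')
    (hφ : ∀ z ∈ O', HasDerivAt φ (φ' z) z) (hm : MapsTo φ O' O) :
    Har (fun z => U (φ z)) O' ∧ ∀ z ∈ O', cg (fun z => U (φ z)) z = cg U (φ z) * φ' z := by
  have key : ∀ z ∈ O', HasFDerivAt (fun z => U (φ z)) (reL (cg U (φ z) * φ' z)) z := by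
    intro z hz
    refine ((h.hd _ (hm hz)).comp z ((hφ z hz).hasFDerivAt.restrictScalars ℝ)).congr_fderiv ?_
    ext v; simp; ring
  have e : ∀ z ∈ O', cg (fun z => U (φ z)) z = cg U (φ z) * φ' z := fun z hz => cg_eq (key z hz)
  refine ⟨⟨ho, fun z hz => by rw [e z hz]; exact key z hz, ?_⟩, e⟩
  have hd : DifferentiableOn ℂ φ O' := fun z hz => (hφ z hz).differentiableAt.differentiableWithinAt
  have hd' : DifferentiableOn ℂ φ' O' :=
    (hd.deriv ho).congr fun z hz => ((hφ z hz).deriv).symm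
  exact ((h.hol.comp hd hm).mul hd').congr fun z hz => e z hz

section disc
variable {V : ℂ → ℝ}

lemma cont_dil (h : Har V (ball 0 1)) {r : ℝ} (h0 : 0 < r) (h1 : r < 1) :
    ContinuousOn (fun ζ : ℂ => V (r * ζ)) (closedBall 0 1) := by
  refine h.cont.comp (by fun_prop) fun ζ hζ => ?_
  have := mem_closedBall_zero_iff.1 hζ
  rw [mem_ball_zero_iff, norm_mul, norm_real, Real.norm_of_nonneg h0.le]
  nlinarith [norm_nonneg ζ]

lemma poi (h : Har V (ball 0 1)) {r : ℝ} (h0 : 0 < r) (h1 : r < 1) {w : ℂ} (hw : w ∈ ball (0:ℂ) 1) :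
    Real.circleAverage (fun ζ => poissonKernel 0 w ζ * V (r * ζ)) 0 1 = V (r * w) := by
  obtain ⟨F, hF, hV⟩ := h.primitive (subset_refl _)
  have hmem : ∀ ζ : ℂ, ζ ∈ closedBall (0:ℂ) 1 → (r:ℂ) * ζ ∈ ball (0:ℂ) 1 := by
    intro ζ hζ
    have := mem_closedBall_zero_iff.1 hζ
    rw [mem_ball_zero_iff, norm_mul, norm_real, Real.norm_of_nonneg h0.le]
    nlinarith [norm_nonneg ζ]
  have hd : DifferentiableOn ℂ (fun ζ : ℂ => F (r * ζ)) (closure (ball (0:ℂ) 1)) := by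
    rw [closure_ball _ one_ne_zero]
    intro ζ hζ
    exact ((hF _ (hmem ζ hζ)).differentiableAt.comp ζ (by fun_prop)).differentiableWithinAt
  have key := hd.diffContOnCl.circleAverage_poissonKernel_smul hw
  have hci : CircleIntegrable (poissonKernel 0 w • fun ζ : ℂ => F (r * ζ)) 0 1 := by
    refine ContinuousOn.circleIntegrable zero_le_one ?_
    have hF' : ContinuousOn (fun ζ : ℂ => F (r * ζ)) (sphere 0 1) := by
      refine (hd.mono ?_).continuousOn
      rw [closure_ball _ one_ne_zero]; exact sphere_subset_closedBall
    refine ContinuousOn.smul ?_ hF'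
    unfold poissonKernel
    refine ContinuousOn.div (by fun_prop) (by fun_prop) fun ζ hζ => ?_
    have : ‖ζ - 0 - (w - 0)‖ ≠ 0 := by
      rw [norm_ne_zero_iff]; intro h
      have : ζ = w := by linear_combination h
      subst this
      rw [mem_sphere_zero_iff_norm] at hζ; rw [mem_ball_zero_iff] at hw; linarith
    positivity
  have h2 := reCLM.circleAverage_comp_comm hci
  rw [key] at h2
  rw [hV _ (hmem w (ball_subset_closedBall hw))]
  have h3 : (F (r * w)).re = reCLM (F (r * w)) := rfl
  rw [h3, ← h2]
  refine Real.circleAverage_congr_sphere fun ζ hζ => ?_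
  rw [abs_one] at hζ
  simp [hV _ (hmem ζ (sphere_subset_closedBall hζ))]

lemma small (h : Har V (ball 0 1)) (hnn : ∀ z ∈ ball (0:ℂ) 1, 0 ≤ V z)
    (hb : ∀ z : ℂ, ‖z‖ = 1 → z ≠ 1 → z ≠ -1 → Tendsto V (𝓝[ball 0 1] z) (𝓝 0))
    {g : ℂ → ℝ} (hg : ContinuousOn g (sphere 0 1)) (g1 : g 1 = 0) (g2 : g (-1) = 0) :
    Tendsto (fun r : ℝ => Real.circleAverage (fun ζ => g ζ * V (r * ζ)) 0 1) (𝓝[<] (1:ℝ)) (𝓝 0) := by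
  obtain ⟨G, hG⟩ := (isCompact_sphere (0:ℂ) 1).exists_bound_of_continuousOn hg
  have hG0 : 0 ≤ G := (norm_nonneg _).trans (hG 1 (by simp))
  rw [Metric.tendsto_nhds]
  intro ε hε
  have h00 : 0 ≤ V 0 := hnn 0 (by simp)
  set δ := ε / (2 * (V 0 + G + 1)) with hδ
  have hδ0 : 0 < δ := by positivity
  set K := {ζ ∈ sphere (0:ℂ) 1 | δ ≤ |g ζ|} with hK
  have hKc : IsCompact K := by
    have : IsClosed (sphere (0:ℂ) 1 ∩ (fun ζ => |g ζ|) ⁻¹' Ici δ) :=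
      hg.abs.preimage_isClosed_of_isClosed isClosed_sphere isClosed_Ici
    exact (isCompact_sphere (0:ℂ) 1).of_isClosed_subset this inter_subset_left
  have hev : ∀ᶠ r : ℝ in 𝓝 1, ∀ ζ ∈ K, ((0 < r ∧ r < 1 ∧ ‖ζ‖ = 1) → V (r * ζ) < δ) := by
    refine hKc.eventually_forall_of_forall_eventually fun ζ hζ => ?_
    have hζ1 : ‖ζ‖ = 1 := mem_sphere_zero_iff_norm.1 hζ.1
    have hne1 : ζ ≠ 1 := by rintro rfl; have := hζ.2; rw [g1] at this; simp at this; linarith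
    have hne2 : ζ ≠ -1 := by rintro rfl; have := hζ.2; rw [g2] at this; simp at this; linarith
    have h3 := (hb ζ hζ1 hne1 hne2).eventually (gt_mem_nhds hδ0)
    rw [eventually_nhdsWithin_iff] at h3
    have hc : Tendsto (fun p : ℝ × ℂ => (p.1:ℂ) * p.2) (𝓝 (1, ζ)) (𝓝 ζ) := by
      have : Continuous (fun p : ℝ × ℂ => (p.1:ℂ) * p.2) := by fun_prop
      have := this.tendsto (1, ζ)
      simpa using this
    filter_upwards [hc.eventually h3] with p hp hp2
    refine hp ?_
    rw [mem_ball_zero_iff, norm_mul, norm_real, Real.norm_of_nonneg hp2.1.le, hp2.2.2]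
    linarith [hp2.2.1]
  have hev2 : ∀ᶠ r : ℝ in 𝓝[<] 1, 0 < r := by
    exact (lt_mem_nhds (zero_lt_one)).filter_mono nhdsWithin_le_nhds
  filter_upwards [hev.filter_mono nhdsWithin_le_nhds, hev2, self_mem_nhdsWithin] with r hr hr0 hr1
  have hr1 : r < 1 := hr1
  have hVc : ContinuousOn (fun ζ : ℂ => V (r * ζ)) (sphere 0 1) :=
    (cont_dil h hr0 hr1).mono sphere_subset_closedBall
  have hmem : ∀ ζ ∈ sphere (0:ℂ) 1, (r:ℂ) * ζ ∈ ball (0:ℂ) 1 := by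
    intro ζ hζ
    rw [mem_ball_zero_iff, norm_mul, norm_real, Real.norm_of_nonneg hr0.le, mem_sphere_zero_iff_norm.1 hζ]
    linarith
  have i1 : CircleIntegrable (fun ζ : ℂ => |g ζ * V (r * ζ)|) 0 1 :=
    (hg.mul hVc).abs.circleIntegrable zero_le_one
  have i2 : CircleIntegrable (fun ζ : ℂ => δ * V (r * ζ)) 0 1 :=
    (continuousOn_const.mul hVc).circleIntegrable zero_le_one
  have i3 : CircleIntegrable (fun _ : ℂ => δ * G) 0 1 := continuousOn_const.circleIntegrable zero_le_one
  have hle : Real.circleAverage (fun ζ => |g ζ * V (r * ζ)|) 0 1 ≤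
      Real.circleAverage (fun ζ => δ * V (r * ζ) + δ * G) 0 1 := by
    refine Real.circleAverage_mono i1 (i2.add i3) fun ζ hζ => ?_
    rw [abs_one] at hζ
    have hv := hnn _ (hmem ζ hζ)
    have hgz := hG ζ hζ
    rw [Real.norm_eq_abs] at hgz
    change _ ≤ δ * V (r * ζ) + δ * G
    rw [abs_mul, abs_of_nonneg hv]
    by_cases hk : ζ ∈ K
    · have := hr ζ hk ⟨hr0, hr1, mem_sphere_zero_iff_norm.1 hζ⟩
      nlinarith
    · have : |g ζ| < δ := by by_contra hcon; exact hk ⟨hζ, not_lt.1 hcon⟩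
      have := mul_le_mul_of_nonneg_right this.le hv
      nlinarith
  have hV0 : Real.circleAverage (fun ζ : ℂ => V (r * ζ)) 0 1 = V 0 := by
    have := poi h hr0 hr1 (w := 0) (by simp)
    rw [mul_zero] at this
    rw [← this]
    refine Real.circleAverage_congr_sphere fun ζ hζ => ?_
    rw [abs_one, mem_sphere_zero_iff_norm] at hζ
    simp [poissonKernel, hζ]
  rw [Real.circleAverage_fun_add i2 i3, Real.circleAverage_const] at hle
  have h7 : Real.circleAverage (fun ζ : ℂ => δ * V (r * ζ)) 0 1 = δ * V 0 := by
    rw [← hV0]; exact Real.circleAverage_fun_smul (a := δ)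
  rw [h7] at hle
  rw [Real.dist_eq, sub_zero]
  have h8 : |Real.circleAverage (fun ζ : ℂ => g ζ * V (r * ζ)) 0 1| ≤ Real.circleAverage (fun ζ => |g ζ * V (r * ζ)|) 0 1 :=
    Real.abs_circleAverage_le_circleAverage_abs
  have h9 : δ * V 0 + δ * G < ε := by
    have : δ * (V 0 + G + 1) = ε / 2 := by rw [hδ]; field_simp
    nlinarith
  linarith

lemma disc (h : Har V (ball 0 1)) (hnn : ∀ z ∈ ball (0:ℂ) 1, 0 ≤ V z)
    (hb : ∀ z : ℂ, ‖z‖ = 1 → z ≠ 1 → z ≠ -1 → Tendsto V (𝓝[ball 0 1] z) (𝓝 0)) :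
    ∃ A B : ℝ, ∀ z ∈ ball (0:ℂ) 1, V z = A * poissonKernel 0 z 1 + B * poissonKernel 0 z (-1) := by
  set m : ℝ → ℝ := fun r => Real.circleAverage (fun ζ => (1 + ζ.re) / 2 * V (r * ζ)) 0 1 with hm
  set n : ℝ → ℝ := fun r => Real.circleAverage (fun ζ => (1 - ζ.re) / 2 * V (r * ζ)) 0 1 with hn
  have key : ∀ w ∈ ball (0:ℂ) 1, Tendsto (fun r : ℝ => m r * poissonKernel 0 w 1 + n r * poissonKernel 0 w (-1))
      (𝓝[<] (1:ℝ)) (𝓝 (V w)) := by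
    intro w hw
    have hPc : ContinuousOn (poissonKernel 0 w) (sphere 0 1) := by
      unfold poissonKernel
      refine ContinuousOn.div (by fun_prop) (by fun_prop) fun ζ hζ => ?_
      have : ‖ζ - 0 - (w - 0)‖ ≠ 0 := by
        rw [norm_ne_zero_iff]; intro h
        have : ζ = w := by linear_combination h
        subst this
        rw [mem_sphere_zero_iff_norm] at hζ; rw [mem_ball_zero_iff] at hw; linarith
      positivity
    have h1 := small h hnn hb (g := fun ζ => poissonKernel 0 w ζ - (poissonKernel 0 w 1 * ((1 + ζ.re) / 2) +
      poissonKernel 0 w (-1) * ((1 - ζ.re) / 2))) (hPc.sub (by fun_prop)) (by simp) (by simp)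
    have h2 : Tendsto (fun r : ℝ => V (r * w)) (𝓝[<] (1:ℝ)) (𝓝 (V w)) := by
      have hc : ContinuousAt V w := h.cont.continuousAt (isOpen_ball.mem_nhds hw)
      have h3 : Tendsto (fun r : ℝ => (r:ℂ) * w) (𝓝[<] (1:ℝ)) (𝓝 w) := by
        have : Continuous (fun r : ℝ => (r:ℂ) * w) := by fun_prop
        have := this.tendsto 1
        rw [ofReal_one, one_mul] at this
        exact this.mono_left nhdsWithin_le_nhds
      exact hc.tendsto.comp h3
    have h4 := h2.sub h1
    rw [sub_zero] at h4
    refine h4.congr' ?_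
    have hev2 : ∀ᶠ r : ℝ in 𝓝[<] 1, 0 < r :=
      (lt_mem_nhds (zero_lt_one)).filter_mono nhdsWithin_le_nhds
    filter_upwards [hev2, self_mem_nhdsWithin] with r hr0 hr1
    have hr1 : r < 1 := hr1
    have hVc : ContinuousOn (fun ζ : ℂ => V (r * ζ)) (sphere 0 1) :=
      (cont_dil h hr0 hr1).mono sphere_subset_closedBall
    have i0 : CircleIntegrable (fun ζ : ℂ => poissonKernel 0 w ζ * V (r * ζ)) 0 1 :=
      (hPc.mul hVc).circleIntegrable zero_le_one
    have j1 : ContinuousOn (fun ζ : ℂ => (1 + ζ.re) / 2 * V (r * ζ)) (sphere 0 1) :=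
      ContinuousOn.mul (by fun_prop) hVc
    have j2 : ContinuousOn (fun ζ : ℂ => (1 - ζ.re) / 2 * V (r * ζ)) (sphere 0 1) :=
      ContinuousOn.mul (by fun_prop) hVc
    have i1 : CircleIntegrable (fun ζ : ℂ => poissonKernel 0 w 1 * ((1 + ζ.re) / 2 * V (r * ζ))) 0 1 :=
      (continuousOn_const.mul j1).circleIntegrable zero_le_one
    have i2 : CircleIntegrable (fun ζ : ℂ => poissonKernel 0 w (-1) * ((1 - ζ.re) / 2 * V (r * ζ))) 0 1 :=
      (continuousOn_const.mul j2).circleIntegrable zero_le_one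
    have e1 : Real.circleAverage (fun ζ : ℂ => poissonKernel 0 w 1 * ((1 + ζ.re) / 2 * V (r * ζ))) 0 1 =
      poissonKernel 0 w 1 * m r := Real.circleAverage_fun_smul (a := poissonKernel 0 w 1)
    have e2 : Real.circleAverage (fun ζ : ℂ => poissonKernel 0 w (-1) * ((1 - ζ.re) / 2 * V (r * ζ))) 0 1 =
      poissonKernel 0 w (-1) * n r := Real.circleAverage_fun_smul (a := poissonKernel 0 w (-1))
    have e3 : Real.circleAverage (fun ζ : ℂ => (poissonKernel 0 w ζ - (poissonKernel 0 w 1 * ((1 + ζ.re) / 2) +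
      poissonKernel 0 w (-1) * ((1 - ζ.re) / 2))) * V (r * ζ)) 0 1 =
        V (r * w) - (poissonKernel 0 w 1 * m r + poissonKernel 0 w (-1) * n r) := by
      rw [← poi h hr0 hr1 hw, ← e1, ← e2, ← Real.circleAverage_add i1 i2,
        ← Real.circleAverage_fun_sub i0 (i1.add i2)]
      congr 1; funext ζ; simp only [Pi.add_apply]; ring
    rw [e3]; ring
  have k0 := key 0 (by simp)
  have k1 := key (1/2) (by rw [mem_ball_zero_iff]; norm_num)
  have p1 : poissonKernel 0 0 1 = 1 := by norm_num [poissonKernel]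
  have p2 : poissonKernel 0 0 (-1) = 1 := by norm_num [poissonKernel]
  have p3 : poissonKernel 0 (1/2) 1 = 3 := by norm_num [poissonKernel]
  have p4 : poissonKernel 0 (1/2) (-1) = 1/3 := by norm_num [poissonKernel]
  rw [p1, p2] at k0; rw [p3, p4] at k1
  have hmt : Tendsto m (𝓝[<] (1:ℝ)) (𝓝 ((3 * V (1/2) - V 0) / 8)) := by
    refine (((k1.const_mul 3).sub k0).div_const 8).congr fun r => ?_
    ring
  have hnt : Tendsto n (𝓝[<] (1:ℝ)) (𝓝 (V 0 - (3 * V (1/2) - V 0) / 8)) := by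
    refine (k0.sub hmt).congr fun r => ?_
    ring
  exact ⟨_, _, fun z hz => tendsto_nhds_unique (key z hz) ((hmt.mul_const _).add (hnt.mul_const _))⟩

lemma halfpl (h : Har V {q : ℂ | 0 < q.re}) (hnn : ∀ q : ℂ, 0 < q.re → 0 ≤ V q)
    (hb : ∀ q : ℂ, q.re = 0 → q ≠ 0 → Tendsto V (𝓝[{q : ℂ | 0 < q.re}] q) (𝓝 0)) :
    ∃ A B : ℝ, ∀ q : ℂ, 0 < q.re → V q = A * q.re + B * (1 / q).re := by
  have hre : ∀ a b : ℂ, ((a + b) / (a - b)).re = (‖a‖^2 - ‖b‖^2) / ‖a - b‖^2 := by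
    intro a b
    have := congrFun (poissonKernel_eq_re_herglotzRieszKernel (c := 0) (w := b)) a
    simpa [poissonKernel, herglotzRieszKernel] using this.symm
  have hne : ∀ z : ℂ, z ≠ 1 → (1:ℂ) - z ≠ 0 := fun z hz h => hz (by linear_combination -h)
  have hb1 : ∀ z ∈ ball (0:ℂ) 1, z ≠ 1 := by rintro z hz rfl; simp at hz
  have hmaps : MapsTo (fun z : ℂ => (1 + z) / (1 - z)) (ball 0 1) {q : ℂ | 0 < q.re} := by
    intro z hz
    change 0 < ((1 + z) / (1 - z)).re
    rw [hre]
    have h1 := norm_pos_iff.2 (hne z (hb1 z hz))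
    rw [mem_ball_zero_iff] at hz
    have : ‖z‖^2 < 1 := by nlinarith [norm_nonneg z]
    rw [norm_one]
    have : 0 < (1:ℝ)^2 - ‖z‖^2 := by linarith
    positivity
  have hder : ∀ z : ℂ, z ≠ 1 → HasDerivAt (fun z : ℂ => (1 + z) / (1 - z)) (2 / (1 - z)^2) z := by
    intro z hz
    have := ((hasDerivAt_id z).const_add 1).div ((hasDerivAt_id z).const_sub 1) (hne z hz)
    refine this.congr_deriv ?_
    simp; ring
  obtain ⟨A, B, hAB⟩ := disc (h.comp isOpen_ball (fun z hz => hder z (hb1 z hz)) hmaps).1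
    (fun z hz => hnn _ (hmaps hz)) (by
      intro z hz h1 h2
      refine (hb ((1 + z) / (1 - z)) ?_ ?_).comp ?_
      · rw [hre, hz]; simp
      · exact div_ne_zero (fun h => h2 (by linear_combination h)) (hne z h1)
      · refine tendsto_nhdsWithin_iff.2 ⟨(hder z h1).continuousAt.tendsto.mono_left nhdsWithin_le_nhds, ?_⟩
        filter_upwards [self_mem_nhdsWithin] with x hx using hmaps hx)
  refine ⟨A, B, fun q hq => ?_⟩
  have hq1 : q + 1 ≠ 0 := by
    intro h; have := congrArg re h; simp at this; linarith
  have hz : (q - 1) / (q + 1) ∈ ball (0:ℂ) 1 := by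
    rw [mem_ball_zero_iff, norm_div, div_lt_one (norm_pos_iff.2 hq1)]
    have : ‖q - 1‖^2 < ‖q + 1‖^2 := by
      rw [← normSq_eq_norm_sq, ← normSq_eq_norm_sq, normSq_apply, normSq_apply]; simp; nlinarith
    exact lt_of_pow_lt_pow_left₀ 2 (norm_nonneg _) this
  have e1 : (1 + (q - 1) / (q + 1)) / (1 - (q - 1) / (q + 1)) = q := by field_simp; ring
  have e2 : (-1 + (q - 1) / (q + 1)) / (-1 - (q - 1) / (q + 1)) = 1 / q := by
    have h3 : -1 - (q - 1) / (q + 1) = -2 * q / (q + 1) := by field_simp; ring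
    rw [h3]; field_simp; ring
  have := hAB _ hz
  rw [e1] at this
  rw [this]
  have f : ∀ b : ℂ, poissonKernel 0 ((q - 1) / (q + 1)) b =
      ((b + (q - 1) / (q + 1)) / (b - (q - 1) / (q + 1))).re := by
    intro b; rw [hre]; simp [poissonKernel]
  rw [f, f, e1, e2]

lemma strip (h : Har V {w : ℂ | |w.im| < Real.pi / 2}) (hnn : ∀ w : ℂ, |w.im| < Real.pi / 2 → 0 ≤ V w)
    (hb : ∀ w : ℂ, |w.im| = Real.pi / 2 → Tendsto V (𝓝[{w : ℂ | |w.im| < Real.pi / 2}] w) (𝓝 0)) :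
    ∃ A B : ℝ, ∀ w : ℂ, |w.im| < Real.pi / 2 → V w = A * (exp w).re + B * (exp (-w)).re := by
  have hsl : ∀ q : ℂ, 0 < q.re → q ∈ slitPlane := fun q hq => Or.inl hq
  have hmaps : MapsTo Complex.log {q : ℂ | 0 < q.re} {w : ℂ | |w.im| < Real.pi / 2} := by
    intro q hq
    change |(Complex.log q).im| < _
    rw [log_im, abs_arg_lt_pi_div_two_iff]
    exact Or.inl hq
  obtain ⟨A, B, hAB⟩ := halfpl (h.comp (O' := {q : ℂ | 0 < q.re}) (isOpen_lt (by fun_prop) (by fun_prop))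
    (fun q hq => hasDerivAt_log (hsl q hq)) hmaps).1 (fun q hq => hnn _ (hmaps hq)) (by
      intro q hq hq0
      have him : q.im ≠ 0 := fun h => hq0 (Complex.ext hq h)
      refine (hb (Complex.log q) ?_).comp ?_
      · rw [log_im]
        refine le_antisymm (abs_arg_le_pi_div_two_iff.2 hq.ge) (not_lt.1 fun hc => ?_)
        rcases abs_arg_lt_pi_div_two_iff.1 hc with h | h
        · linarith
        · exact hq0 h
      · refine tendsto_nhdsWithin_iff.2 ⟨(hasDerivAt_log (Or.inr him)).continuousAt.tendsto.mono_left
          nhdsWithin_le_nhds, ?_⟩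
        filter_upwards [self_mem_nhdsWithin] with x hx using hmaps hx)
  refine ⟨A, B, fun w hw => ?_⟩
  have hw' := abs_lt.1 hw
  have h1 : 0 < (exp w).re := by
    rw [exp_re]
    exact mul_pos (Real.exp_pos _) (Real.cos_pos_of_mem_Ioo ⟨hw'.1, hw'.2⟩)
  have h2 := hAB _ h1
  rw [Complex.log_exp (by linarith [Real.pi_pos]) (by linarith [Real.pi_pos])] at h2
  rw [h2, exp_neg, one_div]
end disc
end OP

namespace OP

lemma strip_convex : Convex ℝ {w : ℂ | |w.im| < Real.pi / 2} := by
  intro x hx y hy a b ha hb hab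
  have hx' := abs_lt.1 (show |x.im| < Real.pi / 2 from hx)
  have hy' := abs_lt.1 (show |y.im| < Real.pi / 2 from hy)
  have e : (a • x + b • y).im = a * x.im + b * y.im := by simp
  change |(a • x + b • y).im| < _
  have h1 : b = 1 - a := by linarith
  rw [e, abs_lt, h1]
  rcases ha.eq_or_lt with h | h
  · rw [← h]; constructor <;> nlinarith
  · constructor <;> nlinarith

lemma const_of_zero_derivC {Y : ℂ → ℂ} {C : Set ℂ} (hC : Convex ℝ C)
    (h : ∀ z ∈ C, HasDerivAt Y 0 z) {x y : ℂ} (hx : x ∈ C) (hy : y ∈ C) : Y x = Y y := by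
  refine const_of_zero_deriv hC (fun z hz => ?_) hx hy
  refine ((h z hz).hasFDerivAt.restrictScalars ℝ).congr_fderiv ?_
  ext v <;> simp

section endA
variable {a A B κ : ℝ} {Z g : ℂ → ℂ}

lemma endA1 (ha : 0 < a) (hZ : ∀ w : ℂ, |w.im| < Real.pi / 2 → HasDerivAt Z (g w) w)
    (hsq : ∀ w : ℂ, |w.im| < Real.pi / 2 → (g w - a) ^ 2 = a ^ 2 + (A * exp w - B * exp (-w)) ^ 2)
    (hpos : ∀ x : ℝ, 0 < A * Real.exp x + B * Real.exp (-x))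
    (hbd : ∀ x : ℝ, Tendsto (fun w : ℂ => (Z w).re - a * w.re) (𝓝[{w : ℂ | |w.im| < Real.pi / 2}] (x + (Real.pi / 2 : ℝ) * I)) (𝓝 κ))
    (x0 : ℝ) : a ≤ A * Real.exp x0 + B * Real.exp (-x0) := by
  by_contra! hlt
  set E := A * Real.exp x0 + B * Real.exp (-x0) with hE
  have hE0 : 0 < E := hpos x0
  set D0 := a ^ 2 - E ^ 2 with hD0
  have hD0p : 0 < D0 := by rw [hD0]; nlinarith
  set D : ℂ → ℂ := fun w => (a:ℂ) ^ 2 + (A * exp w - B * exp (-w)) ^ 2 with hD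
  set b : ℂ := x0 + (Real.pi / 2 : ℝ) * I with hb
  have hDb : (D b).re = D0 := by
    have h1 : exp b = Real.exp x0 * I := by
      rw [hb, exp_add]; push_cast; rw [exp_pi_div_two_mul_I]
    have h2 : exp (-b) = -(Real.exp (-x0) * I) := by
      rw [hb, neg_add, exp_add, ← neg_mul]; push_cast
      rw [show -((Real.pi:ℂ) / 2) * I = -(Real.pi / 2 * I) by ring, exp_neg (Real.pi / 2 * I), exp_pi_div_two_mul_I, inv_I]; ring
    have h3 : D b = ((a ^ 2 - E ^ 2 : ℝ) : ℂ) := by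
      simp only [hD]; rw [h1, h2]
      have : (A * (Real.exp x0 * I) - B * -(Real.exp (-x0) * I)) = (E:ℂ) * I := by rw [hE]; push_cast; ring
      rw [this, mul_pow, I_sq]; push_cast; ring
    rw [h3, ofReal_re]
  have hev : ∀ᶠ w in 𝓝 b, D0 / 2 < (D w).re := by
    have : ContinuousAt (fun w => (D w).re) b := by fun_prop
    exact this.eventually (lt_mem_nhds (by change D0 / 2 < (D b).re; rw [hDb]; linarith))
  obtain ⟨ρ, hρ, hball⟩ := Metric.eventually_nhds_iff.1 hev
  have hline : ∀ x : ℝ, Tendsto (fun y : ℝ => (Z (x + y * I)).re - a * ((x:ℂ) + y * I).re) (𝓝[<] (Real.pi / 2)) (𝓝 κ) := by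
    intro x
    refine (hbd x).comp (tendsto_nhdsWithin_iff.2 ⟨?_, ?_⟩)
    · have : Continuous (fun y : ℝ => (x:ℂ) + y * I) := by fun_prop
      exact (this.tendsto (Real.pi / 2)).mono_left nhdsWithin_le_nhds
    · have h1 : ∀ᶠ y : ℝ in 𝓝[<] (Real.pi / 2), -(Real.pi / 2) < y :=
        (lt_mem_nhds (by linarith [Real.pi_pos])).filter_mono nhdsWithin_le_nhds
      filter_upwards [h1, self_mem_nhdsWithin] with y hy1 hy2
      change |((x:ℂ) + y * I).im| < _
      have : ((x:ℂ) + y * I).im = y := by simp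
      rw [this, abs_lt]; exact ⟨hy1, hy2⟩
  have hlim := ((hline (x0 + ρ / 2)).sub (hline x0)).pow 2
  rw [sub_self] at hlim
  have hge : D0 / 2 * (ρ / 2) ^ 2 ≤ (0:ℝ) ^ 2 := by
    refine ge_of_tendsto hlim ?_
    have h1 : ∀ᶠ y : ℝ in 𝓝[<] (Real.pi / 2), -(Real.pi / 2) < y :=
      (lt_mem_nhds (by linarith [Real.pi_pos])).filter_mono nhdsWithin_le_nhds
    have h2 : ∀ᶠ y : ℝ in 𝓝[<] (Real.pi / 2), Real.pi / 2 - ρ / 2 < y :=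
      (lt_mem_nhds (by linarith)).filter_mono nhdsWithin_le_nhds
    filter_upwards [h1, h2, self_mem_nhdsWithin] with y hy1 hy2 hy3
    have hy3 : y < Real.pi / 2 := hy3
    have him : ∀ x : ℝ, |((x:ℂ) + y * I).im| < Real.pi / 2 := by
      intro x
      have : ((x:ℂ) + y * I).im = y := by simp
      rw [this, abs_lt]; exact ⟨hy1, hy3⟩
    have hder : ∀ x : ℝ, HasDerivAt (fun x : ℝ => (Z (x + y * I)).re - a * ((x:ℂ) + y * I).re)
        ((g (x + y * I) - a).re) x := by
      intro x
      have h3 : HasDerivAt (fun w : ℂ => Z (w + y * I) - a * (w + y * I)) (g (x + y * I) - a) (x:ℂ) := by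
        have h5 : HasDerivAt (fun w : ℂ => w + y * I) 1 (x:ℂ) := (hasDerivAt_id _).add_const _
        have h4 := (hZ _ (him x)).comp (x:ℂ) h5
        exact (h4.sub (h5.const_mul (a:ℂ))).congr_deriv (by ring)
      refine h3.real_of_complex.congr_of_eventuallyEq (Eventually.of_forall fun s => ?_)
      simp
    obtain ⟨c, hc, hsl⟩ := exists_hasDerivAt_eq_slope (fun x : ℝ => (Z (x + y * I)).re - a * ((x:ℂ) + y * I).re)
      (fun x => (g (x + y * I) - a).re) (show x0 < x0 + ρ / 2 by linarith)
      (fun x _ => (hder x).continuousAt.continuousWithinAt) (fun x _ => hder x)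
    have hcb : dist ((c:ℂ) + y * I) b < ρ := by
      rw [dist_eq_norm]
      refine (norm_le_abs_re_add_abs_im _).trans_lt ?_
      have e1 : ((c:ℂ) + y * I - b).re = c - x0 := by simp [hb]
      have e2 : ((c:ℂ) + y * I - b).im = y - Real.pi / 2 := by simp [hb]
      rw [e1, e2, abs_of_pos (by linarith [hc.1]), abs_of_neg (by linarith)]
      linarith [hc.2]
    have h6 := hball hcb
    have h7 := congrArg re (hsq _ (him c))
    change _ = (D (c + y * I)).re at h7
    rw [← h7, sq, mul_re] at h6
    have hρ2 : x0 + ρ / 2 - x0 = ρ / 2 := by ring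
    rw [hρ2, eq_div_iff (by positivity)] at hsl
    have hsl' : ((Z ((x0 + ρ / 2 : ℝ) + y * I)).re - a * (((x0 + ρ / 2 : ℝ):ℂ) + y * I).re -
      ((Z (x0 + y * I)).re - a * ((x0:ℂ) + y * I).re)) = (g (c + y * I) - a).re * (ρ / 2) := hsl.symm
    rw [hsl', mul_pow]
    refine mul_le_mul_of_nonneg_right ?_ (by positivity)
    nlinarith [mul_self_nonneg (g (c + y * I) - a).im]
  have : 0 < D0 / 2 * (ρ / 2) ^ 2 := by positivity
  norm_num at hge
  linarith

lemma endA (ha : 0 < a) (hZ : ∀ w : ℂ, |w.im| < Real.pi / 2 → HasDerivAt Z (g w) w)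
    (hg0 : ∀ w : ℂ, |w.im| < Real.pi / 2 → g w ≠ 0)
    (hsq : ∀ w : ℂ, |w.im| < Real.pi / 2 → (g w - a) ^ 2 = a ^ 2 + (A * exp w - B * exp (-w)) ^ 2)
    (hpos : ∀ x : ℝ, 0 < A * Real.exp x + B * Real.exp (-x))
    (hbd : ∀ x : ℝ, Tendsto (fun w : ℂ => (Z w).re - a * w.re) (𝓝[{w : ℂ | |w.im| < Real.pi / 2}] (x + (Real.pi / 2 : ℝ) * I)) (𝓝 κ)) :
    ∃ (t : ℝ) (c : ℂ), A * Real.exp t = a / 2 ∧ B * Real.exp (-t) = a / 2 ∧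
      ∀ w : ℂ, |w.im| < Real.pi / 2 → Z w = a * ((w - t) + sinh (w - t)) + c := by
  have hEa := endA1 ha hZ hsq hpos hbd
  have hpa : ∀ b : ℝ, b * (a / (|b| + a)) < a := by
    intro b
    rw [← mul_div_assoc, div_lt_iff₀ (by positivity)]
    nlinarith [le_abs_self b, abs_nonneg b]
  have hA : 0 < A := by
    by_contra! h
    have h1 := hEa (Real.log ((|B| + a) / a))
    have hp : 0 < (|B| + a) / a := by positivity
    rw [Real.exp_neg, Real.exp_log hp, inv_div] at h1
    have := hpa B
    nlinarith
  have hB : 0 < B := by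
    by_contra! h
    have h1 := hEa (-Real.log ((|A| + a) / a))
    have hp : 0 < (|A| + a) / a := by positivity
    rw [neg_neg, Real.exp_neg, Real.exp_log hp, inv_div] at h1
    have := hpa A
    nlinarith
  set t := Real.log (B / A) / 2 with ht
  set C := A * Real.exp t with hC
  have hC0 : 0 < C := by positivity
  have hBC : B * Real.exp (-t) = C := by
    have h1 : Real.exp t * Real.exp t = B / A := by
      rw [← Real.exp_add, show t + t = Real.log (B / A) by rw [ht]; ring, Real.exp_log (by positivity)]
    rw [hC, Real.exp_neg]
    have := Real.exp_pos t
    field_simp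
    field_simp at h1
    linarith
  have hAe : ∀ w : ℂ, A * exp w = C * exp (w - t) := by
    intro w; rw [hC]; push_cast
    rw [mul_assoc, ← exp_add]; congr 2; ring
  have hBe : ∀ w : ℂ, B * exp (-w) = C * exp (-(w - t)) := by
    intro w; rw [← hBC]; push_cast
    rw [mul_assoc, ← exp_add]; congr 2; ring
  have hsq' : ∀ w : ℂ, |w.im| < Real.pi / 2 → (g w - a) ^ 2 = a ^ 2 + 4 * C ^ 2 * sinh (w - t) ^ 2 := by
    intro w hw
    rw [hsq w hw, hAe, hBe, sinh]; ring
  have hSo : IsOpen {w : ℂ | |w.im| < Real.pi / 2} := isOpen_lt (by fun_prop) (by fun_prop)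
  have hgd : DifferentiableOn ℂ g {w : ℂ | |w.im| < Real.pi / 2} := by
    have : DifferentiableOn ℂ Z {w : ℂ | |w.im| < Real.pi / 2} :=
      fun w hw => (hZ w hw).differentiableAt.differentiableWithinAt
    exact (this.deriv hSo).congr fun w hw => ((hZ w hw).deriv).symm
  have h2C : a ≤ 2 * C := by have := hEa t; rw [hBC] at this; linarith
  have h2C' : 2 * C = a := by
    by_contra hne
    have hlt : a < 2 * C := lt_of_le_of_ne h2C (Ne.symm hne)
    set θ := Real.arcsin (a / (2 * C)) with hθ
    have hq1 : a / (2 * C) < 1 := (div_lt_one (by positivity)).2 hlt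
    have hq0 : 0 < a / (2 * C) := by positivity
    have hθ1 : θ < Real.pi / 2 := Real.arcsin_lt_pi_div_two.2 hq1
    have hθ0 : 0 < θ := Real.arcsin_pos.2 hq0
    have hsin : Real.sin θ = a / (2 * C) := Real.sin_arcsin (by linarith) hq1.le
    have hcos : 0 < Real.cos θ := Real.cos_pos_of_mem_Ioo ⟨by linarith, hθ1⟩
    set w1 : ℂ := t + θ * I with hw1
    have him : w1.im = θ := by simp [hw1]
    have hwS : |w1.im| < Real.pi / 2 := by rw [him, abs_of_pos hθ0]; exact hθ1
    have hsub : w1 - t = θ * I := by rw [hw1]; ring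
    have hsh : sinh (w1 - t) = ((a / (2 * C) : ℝ) : ℂ) * I := by
      rw [hsub, sinh_mul_I, ← ofReal_sin, hsin]
    have hch : cosh (w1 - t) = (Real.cos θ : ℂ) := by
      rw [hsub, cosh_mul_I, ← ofReal_cos]
    have hCc : (C:ℂ) ≠ 0 := by exact_mod_cast hC0.ne'
    have hr0 : g w1 - a = 0 := by
      have := hsq' w1 hwS
      rw [hsh, mul_pow, I_sq] at this
      have e : (a:ℂ) ^ 2 + 4 * C ^ 2 * (((a / (2 * C) : ℝ) : ℂ) ^ 2 * -1) = 0 := by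
        push_cast; field_simp; ring
      rw [e] at this
      exact pow_eq_zero_iff (two_ne_zero) |>.1 this
    have hgd1 : HasDerivAt g (deriv g w1) w1 := (hgd.differentiableAt (hSo.mem_nhds hwS)).hasDerivAt
    have d1 : HasDerivAt (fun w => (g w - a) ^ 2) 0 w1 := by
      refine ((hgd1.sub_const (a:ℂ)).pow 2).congr_deriv ?_
      simp [hr0]
    have d2 : HasDerivAt (fun w : ℂ => (a:ℂ) ^ 2 + 4 * C ^ 2 * sinh (w - t) ^ 2)
        (4 * C ^ 2 * (2 * sinh (w1 - t) * cosh (w1 - t))) w1 := by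
      have h5 : HasDerivAt (fun w : ℂ => w - t) 1 w1 := (hasDerivAt_id _).sub_const _
      refine (((h5.csinh.pow 2).const_mul (4 * (C:ℂ) ^ 2)).const_add _).congr_deriv ?_
      simp
    have d3 := d1.congr_of_eventuallyEq (f₁ := fun w : ℂ => (a:ℂ) ^ 2 + 4 * C ^ 2 * sinh (w - t) ^ 2) (by
      filter_upwards [hSo.mem_nhds hwS] with w hw using (hsq' w hw).symm)
    have h6 := d2.unique d3
    rw [hsh, hch] at h6
    have hcc : (Real.cos θ : ℂ) ≠ 0 := by exact_mod_cast hcos.ne'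
    have hqc : ((a / (2 * C) : ℝ) : ℂ) ≠ 0 := by exact_mod_cast hq0.ne'
    have : (4:ℂ) * C ^ 2 * (2 * (((a / (2 * C) : ℝ) : ℂ) * I) * (Real.cos θ : ℂ)) ≠ 0 := by
      simp only [ne_eq, mul_eq_zero, not_or, pow_eq_zero_iff two_ne_zero, I_ne_zero, hcc, hqc, hCc]
      norm_num
    exact this h6
  have hcoshne : ∀ w : ℂ, |w.im| < Real.pi / 2 → cosh (w - t) ≠ 0 := by
    intro w hw h
    have h1 := congrArg re h
    have e : w - t = ((w.re - t : ℝ):ℂ) + (w.im : ℝ) * I := by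
      apply Complex.ext <;> simp
    have e2 : cosh (w - t) = ((Real.cosh (w.re - t) * Real.cos w.im : ℝ):ℂ) + ((Real.sinh (w.re - t) * Real.sin w.im : ℝ):ℂ) * I := by
      rw [e, cosh_add, cosh_mul_I, sinh_mul_I]; push_cast; ring
    rw [e2] at h1
    simp only [add_re, ofReal_re, mul_I_re, ofReal_im, zero_re, neg_zero, add_zero] at h1
    have := abs_lt.1 hw
    rcases mul_eq_zero.1 h1 with h1 | h1
    · exact (Real.cosh_pos (w.re - t)).ne' h1
    · exact (Real.cos_pos_of_mem_Ioo this).ne' h1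
  have hac : (a:ℂ) ≠ 0 := by exact_mod_cast ha.ne'
  have hgeq : ∀ w : ℂ, |w.im| < Real.pi / 2 → g w = a + a * cosh (w - t) := by
    have h1 := strip_convex.isPreconnected.eq_or_eq_neg_of_sq_eq (f := fun w => g w - a) (g := fun w => (a:ℂ) * cosh (w - t))
      (hgd.continuousOn.sub continuousOn_const) (by fun_prop) (fun w hw => by
        have := hsq' w hw
        simp only [Pi.pow_apply]
        rw [this, mul_pow, cosh_sq]
        have e : (a:ℂ) = 2 * C := by exact_mod_cast h2C'.symm
        rw [e]; ring) (fun {w} hw => mul_ne_zero hac (hcoshne w hw))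
    rcases h1 with h1 | h1
    · intro w hw
      have := h1 hw
      simp only at this
      linear_combination this
    · exfalso
      have htS : |((t:ℂ)).im| < Real.pi / 2 := by simp; exact Real.pi_pos
      have := h1 htS
      simp at this
      exact hg0 t htS this
  have hYd : ∀ w ∈ {w : ℂ | |w.im| < Real.pi / 2}, HasDerivAt (fun w => Z w - a * ((w - t) + sinh (w - t))) 0 w := by
    intro w hw
    have h5 : HasDerivAt (fun w : ℂ => w - t) 1 w := (hasDerivAt_id _).sub_const _
    refine ((hZ w hw).sub ((h5.add h5.csinh).const_mul (a:ℂ))).congr_deriv ?_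
    rw [hgeq w hw]; ring
  refine ⟨t, Z 0 - a * ((0 - t) + sinh (0 - t)), by rw [← hC]; linarith, by rw [hBC]; linarith, fun w hw => ?_⟩
  have := const_of_zero_derivC strip_convex hYd (x := w) (y := 0) hw (by simp; exact Real.pi_pos)
  beta_reduce at this
  rw [← this]; ring

end endA
end OP

namespace OP
namespace Lim3
variable {U : ℂ → ℝ} {W : ℂ → ℂ} {p0 : ℂ} {Q : Set ℂ}

lemma psi (M : Lim3 U W p0 Q) : ∃ ψ : ℂ → ℂ, (∀ s ∈ Sg p0 Q, 0 < U (ψ s)) ∧ (∀ s ∈ Sg p0 Q, zt W (ψ s) = s) ∧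
    ∀ s ∈ Sg p0 Q, HasDerivAt ψ (1 - cg U (ψ s) ^ 2)⁻¹ s := by
  have h : ∀ s, ∃ z, s ∈ Sg p0 Q → 0 < U z ∧ zt W z = s := by
    intro s
    by_cases hs : s ∈ Sg p0 Q
    · obtain ⟨z, hz, he⟩ := M.surj hs
      exact ⟨z, fun _ => ⟨hz, he⟩⟩
    · exact ⟨0, fun h => absurd h hs⟩
  choose ψ hψ using h
  refine ⟨ψ, fun s hs => (hψ s hs).1, fun s hs => (hψ s hs).2, fun s hs => ?_⟩
  have hc : ContinuousAt ψ s := by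
    rw [ContinuousAt, tendsto_def]
    intro N hN
    have h1 : N ∩ {z | 0 < U z} ∈ 𝓝 (ψ s) := inter_mem hN (M.L.S.op.mem_nhds (hψ s hs).1)
    obtain ⟨N', hN', ho, hm⟩ := _root_.mem_nhds_iff.1 h1
    have h2 := M.zt_open ho fun z hz => (hN' hz).2
    filter_upwards [h2.mem_nhds ⟨ψ s, hm, (hψ s hs).2⟩]
    rintro _ ⟨z, hz, rfl⟩
    have hz0 : 0 < U z := (hN' hz).2
    have := M.inj hz0 (hψ _ (M.inO hz0)).2
    change ψ (zt W z) ∈ N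
    rw [this]; exact (hN' hz).1
  refine HasDerivAt.of_local_left_inverse hc (M.zt_strict (hψ s hs).1).hasDerivAt (M.f_ne (hψ s hs).1) ?_
  filter_upwards [M.Sg_open.mem_nhds hs] with y hy using (hψ y hy).2

lemma vb (M : Lim3 U W p0 Q) {ψ : ℂ → ℂ} (h1 : ∀ s ∈ Sg p0 Q, 0 < U (ψ s)) (h2 : ∀ s ∈ Sg p0 Q, zt W (ψ s) = s)
    {p s0 : ℂ} (hp : p = p0 ∨ p ∈ Q) (hs0 : s0.im = p.im) :
    ∃ z1 : ℂ, z1.re = (s0.re + p.re) / 2 ∧ U z1 = 0 ∧ Tendsto ψ (𝓝[Sg p0 Q] s0) (𝓝 z1) := by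
  have hU : ∀ z1 : ℂ, z1.re = (s0.re + p.re) / 2 → W z1 = p → U z1 = 0 := by
    intro z1 hz hW
    by_contra hne
    have hpos : 0 < U z1 := lt_of_le_of_ne (M.L.S.nn z1) (Ne.symm hne)
    have h3 := M.inO hpos
    have h4 : (zt W z1).im = p.im := by rw [zt_im, hW]
    rcases hp with rfl | hq
    · have := h3.1; linarith
    · have := h3.2 p hq; linarith
  rcases hp with rfl | hq
  · obtain ⟨z1, hz1, hW, hd⟩ := M.bdry ((s0.re + p.re) / 2)
    refine ⟨z1, hz1, hU z1 hz1 hW, ?_⟩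
    have e : 2 * (((s0.re + p.re) / 2 : ℝ):ℂ) - conj p = s0 := by
      apply Complex.ext
      · simp; ring
      · simp [hs0]
    rw [e] at hd
    rw [Metric.tendsto_nhdsWithin_nhds]
    intro r hr
    obtain ⟨δ, hδ, h⟩ := hd r hr
    refine ⟨δ, hδ, fun {s} hs hsd => h _ (h1 s hs) ?_⟩
    rw [h2 s hs]; exact hsd
  · obtain ⟨z1, hz1, hW, hd⟩ := (M.flip hq).bdry (-((s0.re + p.re) / 2))
    have hz1' : (-z1).re = (s0.re + p.re) / 2 := by rw [neg_re, hz1, neg_neg]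
    refine ⟨-z1, hz1', hU _ hz1' (neg_injective hW), ?_⟩
    have e : 2 * ((-((s0.re + p.re) / 2) : ℝ):ℂ) - conj (-p) = -s0 := by
      apply Complex.ext
      · simp; ring
      · simp [hs0]
    rw [e] at hd
    rw [Metric.tendsto_nhdsWithin_nhds]
    intro r hr
    obtain ⟨δ, hδ, h⟩ := hd r hr
    refine ⟨δ, hδ, fun {s} hs hsd => ?_⟩
    have h5 := h (-ψ s) (by rw [neg_neg]; exact h1 s hs) (by
      have : zt (fun z => -W (-z)) (-ψ s) = -s := by
        have h6 := h2 s hs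
        simp only [zt] at h6 ⊢
        rw [neg_neg, neg_re, map_neg]
        push_cast
        linear_combination -h6
      rw [this, dist_neg_neg]
      exact hsd)
    rw [← dist_neg_neg, neg_neg]; exact h5

lemma no_one (M : Lim3 U W p0 ∅) : False := by
  obtain ⟨ψ, h1, h2, h3⟩ := M.psi
  set H : Set ℂ := {q : ℂ | 0 < q.re} with hH
  have hHo : IsOpen H := isOpen_lt (by fun_prop) (by fun_prop)
  have hHc : Convex ℝ H := convex_halfSpace_re_gt 0
  set φ : ℂ → ℂ := fun q => (p0.im:ℂ) * I - I * q with hφ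
  have hφm : MapsTo φ H (Sg p0 ∅) := by
    intro q hq
    have hq : 0 < q.re := hq
    refine ⟨?_, fun q hq => hq.elim⟩
    simp [hφ]; exact hq
  have hφc : Continuous φ := by fun_prop
  have hφd : ∀ q, HasDerivAt φ (-I) q := by
    intro q
    refine (((hasDerivAt_id q).const_mul I).const_sub _).congr_deriv (by simp)
  set Z : ℂ → ℂ := fun q => ψ (φ q) with hZ
  set g : ℂ → ℂ := fun q => (1 - cg U (Z q) ^ 2)⁻¹ * (-I) with hg
  have hZd : ∀ q ∈ H, HasDerivAt Z (g q) q := fun q hq => (h3 _ (hφm hq)).comp q (hφd q)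
  have hZO : MapsTo Z H {z | 0 < U z} := fun q hq => h1 _ (hφm hq)
  obtain ⟨hV, hVc⟩ := M.L.S.har.comp hHo hZd hZO
  have hUc := M.L.S.lip.continuous
  have hbd : ∀ q : ℂ, q.re = 0 → ∃ z1 : ℂ, z1.re = (q.im + p0.re) / 2 ∧ U z1 = 0 ∧ Tendsto Z (𝓝[H] q) (𝓝 z1) := by
    intro q hq
    obtain ⟨z1, ha, hb, hc⟩ := M.vb h1 h2 (p := p0) (s0 := φ q) (Or.inl rfl) (by simp [hφ, hq])
    refine ⟨z1, by rw [ha]; simp [hφ], hb, hc.comp ?_⟩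
    refine tendsto_nhdsWithin_iff.2 ⟨(hφc.tendsto q).mono_left nhdsWithin_le_nhds, ?_⟩
    filter_upwards [self_mem_nhdsWithin] with x hx using hφm hx
  have hVb : ∀ q : ℂ, q.re = 0 → Tendsto (fun q => U (Z q)) (𝓝[H] q) (𝓝 0) := by
    intro q hq
    obtain ⟨z1, _, hb, hc⟩ := hbd q hq
    rw [← hb]; exact (hUc.tendsto z1).comp hc
  obtain ⟨A, B, hAB⟩ := halfpl hV (fun q hq => (hZO hq).le) (fun q hq _ => hVb q hq)
  have hB : B = 0 := by
    have ht : Tendsto (fun t : ℝ => (t:ℂ)) (𝓝[>] (0:ℝ)) (𝓝[H] (0:ℂ)) := by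
      refine tendsto_nhdsWithin_iff.2 ⟨?_, ?_⟩
      · have := (continuous_ofReal.tendsto (0:ℝ)).mono_left (nhdsWithin_le_nhds (s := Ioi 0))
        simpa using this
      · filter_upwards [self_mem_nhdsWithin] with t ht
        change 0 < ((t:ℂ)).re
        simpa using ht
    have hid : Tendsto (fun t : ℝ => t) (𝓝[>] (0:ℝ)) (𝓝 0) := tendsto_id.mono_left nhdsWithin_le_nhds
    have l1 := (((hVb 0 rfl).comp ht).mul hid).sub ((hid.mul hid).const_mul A)
    have l2 : Tendsto (fun _ : ℝ => B) (𝓝[>] (0:ℝ)) (𝓝 (0 * 0 - A * (0 * 0))) := by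
      refine l1.congr' ?_
      filter_upwards [self_mem_nhdsWithin] with t ht
      have ht : 0 < t := ht
      simp only [Function.comp]
      rw [hAB t (by simpa using ht)]
      rw [show (1:ℂ) / (t:ℂ) = ((1 / t : ℝ) : ℂ) by push_cast; rfl, ofReal_re, ofReal_re]
      field_simp; ring
    have := tendsto_nhds_unique l2 tendsto_const_nhds
    simpa using this.symm
  have hfg : ∀ q ∈ H, cg U (Z q) * g q = A := by
    intro q hq
    have h5 := har_of_re (U := fun q => U (Z q)) (F := fun q => (A:ℂ) * q) (f := fun _ => (A:ℂ)) hHo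
      (fun q _ => ((hasDerivAt_id q).const_mul (A:ℂ)).congr_deriv (by simp)) (fun q hq => by
        rw [hAB q hq, hB]; simp)
    rw [← hVc q hq, h5.2 q hq]
  have hgf : ∀ q ∈ H, g q * (1 - cg U (Z q) ^ 2) = -I := by
    intro q hq
    have := M.f_ne (hZO hq)
    simp only [hg]; field_simp
  have hr : ∀ q ∈ H, (g q + I / 2) ^ 2 = (A:ℂ) ^ 2 - 1 / 4 := by
    intro q hq
    have e1 := hfg q hq
    have e2 := hgf q hq
    have : (g q + I / 2) ^ 2 = (cg U (Z q) * g q) ^ 2 + g q * (g q * (1 - cg U (Z q) ^ 2)) + I * g q + I ^ 2 / 4 := by ring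
    rw [this, e1, e2, I_sq]; ring
  have hgd : DifferentiableOn ℂ g H := by
    have : DifferentiableOn ℂ Z H := fun w hw => (hZd w hw).differentiableAt.differentiableWithinAt
    exact (this.deriv hHo).congr fun w hw => ((hZd w hw).deriv).symm
  have hconst : ∃ c : ℂ, ∀ q ∈ H, g q = c := by
    obtain ⟨c0, hc0⟩ := IsAlgClosed.exists_pow_nat_eq ((A:ℂ) ^ 2 - 1 / 4) (n := 2) (by norm_num)
    by_cases hz : c0 = 0
    · refine ⟨-I / 2, fun q hq => ?_⟩
      have := hr q hq
      rw [← hc0, hz] at this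
      have h7 : g q + I / 2 = 0 := pow_eq_zero_iff two_ne_zero |>.1 (by rw [this]; ring)
      linear_combination h7
    · have h1 := hHc.isPreconnected.eq_or_eq_neg_of_sq_eq (f := fun w => g w + I / 2) (g := fun _ => c0)
        (hgd.continuousOn.add continuousOn_const) continuousOn_const (fun q hq => by
          simp only [Pi.pow_apply]; rw [hr q hq, hc0]) (fun {w} hw => hz)
      rcases h1 with h1 | h1
      · exact ⟨c0 - I / 2, fun q hq => by have h8 : g q + I / 2 = c0 := h1 hq; linear_combination h8⟩
      · exact ⟨-c0 - I / 2, fun q hq => by have h8 : g q + I / 2 = -c0 := h1 hq; linear_combination h8⟩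
  obtain ⟨c, hc⟩ := hconst
  have h1H : (1:ℂ) ∈ H := by simp [hH]
  have hlin : ∀ q ∈ H, Z q = c * q + (Z 1 - c) := by
    intro q hq
    have := const_of_zero_derivC (Y := fun q => Z q - c * q) hHc (fun q hq => by
      refine ((hZd q hq).sub ((hasDerivAt_id q).const_mul c)).congr_deriv ?_
      rw [hc q hq]; simp) hq h1H
    beta_reduce at this
    linear_combination this
  have hcl : ∀ q : ℂ, q.re = 0 → (c * q + (Z 1 - c)).re = (q.im + p0.re) / 2 := by
    intro q hq
    obtain ⟨z1, ha, _, hcz⟩ := hbd q hq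
    have h6 : Tendsto Z (𝓝[H] q) (𝓝 (c * q + (Z 1 - c))) := by
      have hcont : Continuous fun q : ℂ => c * q + (Z 1 - c) := by fun_prop
      refine ((hcont.tendsto q).mono_left nhdsWithin_le_nhds).congr' ?_
      filter_upwards [self_mem_nhdsWithin] with x hx using (hlin x hx).symm
    have : (𝓝[H] q).NeBot := by
      rw [← mem_closure_iff_nhdsWithin_neBot, hH, closure_setOfPred_lt_re]
      exact hq.ge
    rw [tendsto_nhds_unique h6 hcz, ha]
  have k0 := hcl 0 rfl
  have k1 := hcl I (by simp)
  simp at k0 k1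
  have hcim : c.im = -1 / 2 := by linarith
  have e2 := hgf 1 h1H
  rw [hc 1 h1H] at e2
  have hlt := M.L.lt _ (hZO h1H)
  set f := cg U (Z 1) with hf
  have e3 : c * f ^ 2 = c + I := by linear_combination -e2
  have e4 := congrArg norm e3
  have e5 : c + I = conj c := by
    apply Complex.ext
    · simp
    · simp; rw [hcim]; norm_num
  rw [e5, Complex.norm_conj, norm_mul, norm_pow] at e4
  have hcn : 0 < ‖c‖ := norm_pos_iff.2 (by intro h; rw [h, zero_im] at hcim; norm_num at hcim)
  have : ‖f‖ ^ 2 = 1 := by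
    have : ‖c‖ * (‖f‖ ^ 2 - 1) = 0 := by linarith
    rcases mul_eq_zero.1 this with h | h <;> linarith
  nlinarith [norm_nonneg f]

lemma two (M : Lim3 U W p0 Q) {q : ℂ} (hq : q ∈ Q) : ∃ a : ℝ, 0 < a ∧ ∃ c : ℂ, ∀ z, U (z + c) = hairpin a z := by
  obtain ⟨ψ, h1, h2, h3⟩ := M.psi
  have hpq : q.im < p0.im := by
    obtain ⟨z, hz⟩ := M.L.ne
    have := M.inO hz
    exact (this.2 q hq).trans this.1
  have hSg : ∀ s : ℂ, s ∈ Sg p0 Q ↔ q.im < s.im ∧ s.im < p0.im := by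
    intro s
    constructor
    · rintro ⟨h, h'⟩; exact ⟨h' q hq, h⟩
    · rintro ⟨h, h'⟩; exact ⟨h', fun q' hq' => by rw [M.sub hq' hq]; exact h⟩
  set S : Set ℂ := {w : ℂ | |w.im| < Real.pi / 2} with hS
  have hSo : IsOpen S := isOpen_lt (by fun_prop) (by fun_prop)
  set a := (p0.im - q.im) / (2 * Real.pi) with ha
  have ha0 : 0 < a := by have : 0 < p0.im - q.im := by linarith
                         positivity
  have hapi : a * Real.pi = (p0.im - q.im) / 2 := by rw [ha]; field_simp
  have hac : (a:ℂ) ≠ 0 := by exact_mod_cast ha0.ne'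
  set m := (p0.im + q.im) / 2 with hm
  set φ : ℂ → ℂ := fun w => 2 * (a:ℂ) * w + m * I with hφ
  have hφim : ∀ w, (φ w).im = 2 * a * w.im + m := by intro w; simp [hφ]
  have hφre : ∀ w, (φ w).re = 2 * a * w.re := by intro w; simp [hφ]
  have hφS : ∀ w, φ w ∈ Sg p0 Q ↔ |w.im| < Real.pi / 2 := by
    intro w
    rw [hSg, hφim, abs_lt]
    constructor
    · rintro ⟨k1, k2⟩
      constructor
      · by_contra hcon; push Not at hcon
        have := mul_le_mul_of_nonneg_left hcon ha0.le
        nlinarith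
      · by_contra hcon; push Not at hcon
        have := mul_le_mul_of_nonneg_left hcon ha0.le
        nlinarith
    · rintro ⟨k1, k2⟩
      have := mul_lt_mul_of_pos_left k1 ha0
      have := mul_lt_mul_of_pos_left k2 ha0
      constructor <;> nlinarith
  have hφm : MapsTo φ S (Sg p0 Q) := fun w hw => (hφS w).2 hw
  have hφc : Continuous φ := by fun_prop
  have hφd : ∀ w, HasDerivAt φ (2 * a) w := by
    intro w
    refine (((hasDerivAt_id w).const_mul (2 * (a:ℂ))).add_const _).congr_deriv (by simp)
  set Z : ℂ → ℂ := fun w => ψ (φ w) with hZ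
  set g : ℂ → ℂ := fun w => (1 - cg U (Z w) ^ 2)⁻¹ * (2 * a) with hg
  have hZd : ∀ w ∈ S, HasDerivAt Z (g w) w := fun w hw => (h3 _ (hφm hw)).comp w (hφd w)
  have hZO : MapsTo Z S {z | 0 < U z} := fun w hw => h1 _ (hφm hw)
  obtain ⟨hV, hVc⟩ := M.L.S.har.comp hSo hZd hZO
  have hUc := M.L.S.lip.continuous
  have hφt : ∀ w, Tendsto φ (𝓝[S] w) (𝓝[Sg p0 Q] (φ w)) := by
    intro w
    refine tendsto_nhdsWithin_iff.2 ⟨(hφc.tendsto w).mono_left nhdsWithin_le_nhds, ?_⟩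
    filter_upwards [self_mem_nhdsWithin] with x hx using hφm hx
  have hVb : ∀ w : ℂ, |w.im| = Real.pi / 2 → Tendsto (fun w => U (Z w)) (𝓝[S] w) (𝓝 0) := by
    intro w hw
    have : ∃ p : ℂ, (p = p0 ∨ p ∈ Q) ∧ (φ w).im = p.im := by
      rcases eq_or_eq_neg_of_abs_eq hw with h | h
      · refine ⟨p0, Or.inl rfl, ?_⟩
        rw [hφim, h]; linarith
      · refine ⟨q, Or.inr hq, ?_⟩
        rw [hφim, h]; linarith
    obtain ⟨p, hp, hpim⟩ := this
    obtain ⟨z1, _, hb, hc⟩ := M.vb h1 h2 hp hpim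
    rw [← hb]; exact (hUc.tendsto z1).comp (hc.comp (hφt w))
  obtain ⟨A, B, hAB⟩ := strip hV (fun w hw => (hZO hw).le) hVb
  have hfg : ∀ w ∈ S, cg U (Z w) * g w = A * exp w - B * exp (-w) := by
    intro w hw
    have h5 := har_of_re (U := fun w => U (Z w)) (F := fun w => (A:ℂ) * exp w + B * exp (-w))
      (f := fun w => (A:ℂ) * exp w - B * exp (-w)) hSo
      (fun w _ => (((Complex.hasDerivAt_exp w).const_mul (A:ℂ)).add
        (((hasDerivAt_id w).neg.cexp).const_mul (B:ℂ))).congr_deriv (by simp; ring)) (fun w hw => by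
        rw [hAB w hw]; simp)
    rw [← hVc w hw, h5.2 w hw]
  have hgf : ∀ w ∈ S, g w * (1 - cg U (Z w) ^ 2) = 2 * a := by
    intro w hw
    have := M.f_ne (hZO hw)
    simp only [hg]; field_simp
  have hsq : ∀ w : ℂ, |w.im| < Real.pi / 2 → (g w - a) ^ 2 = a ^ 2 + (A * exp w - B * exp (-w)) ^ 2 := by
    intro w hw
    rw [← hfg w hw]
    linear_combination g w * hgf w hw
  have hpos : ∀ x : ℝ, 0 < A * Real.exp x + B * Real.exp (-x) := by
    intro x
    have hx : |((x:ℂ)).im| < Real.pi / 2 := by rw [ofReal_im, abs_zero]; positivity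
    have h5 := hAB x hx
    have h6 : 0 < U (Z x) := hZO hx
    rw [h5] at h6
    rw [← ofReal_neg, ← ofReal_exp, ← ofReal_exp, ofReal_re, ofReal_re] at h6
    exact h6
  obtain ⟨t, c, hA, hB, hform⟩ := endA (κ := p0.re / 2) ha0 hZd (fun w hw =>
    mul_ne_zero (inv_ne_zero (M.f_ne (hZO hw))) (mul_ne_zero two_ne_zero hac)) hsq hpos (by
      intro x
      have him : ((x:ℂ) + (Real.pi / 2 : ℝ) * I).im = Real.pi / 2 := by simp
      have hre : ((x:ℂ) + (Real.pi / 2 : ℝ) * I).re = x := by simp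
      obtain ⟨z1, hz1, _, hc⟩ := M.vb h1 h2 (p := p0) (s0 := φ ((x:ℂ) + (Real.pi / 2 : ℝ) * I)) (Or.inl rfl)
        (by rw [hφim, him]; linarith)
      rw [hφre, hre] at hz1
      have l1 := (continuous_re.tendsto z1).comp (hc.comp (hφt _))
      have l2 : Tendsto (fun w : ℂ => a * w.re) (𝓝[S] ((x:ℂ) + (Real.pi / 2 : ℝ) * I)) (𝓝 (a * x)) := by
        have hcc : Continuous fun w : ℂ => a * w.re := by fun_prop
        have := (hcc.tendsto ((x:ℂ) + (Real.pi / 2 : ℝ) * I)).mono_left (nhdsWithin_le_nhds (s := S))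
        rwa [hre] at this
      have l3 := l1.sub l2
      rw [hz1, show (2 * a * x + p0.re) / 2 - a * x = p0.re / 2 by ring] at l3
      exact l3)
  refine ⟨a, ha0, c, fun z => ?_⟩
  have hval : ∀ w : ℂ, |w.im| < Real.pi / 2 → U (a * (w + sinh w) + c) = a * (cosh w).re := by
    intro w hw
    have hw' : |(w + t).im| < Real.pi / 2 := by simpa using hw
    have e := hform (w + t) hw'
    rw [add_sub_cancel_right] at e
    rw [← e]
    have h5 : U (Z (w + t)) = _ := hAB (w + t) hw'
    rw [h5, neg_add, exp_add, exp_add, ← ofReal_neg, ← ofReal_exp, ← ofReal_exp, re_mul_ofReal, re_mul_ofReal]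
    have e6 : (cosh w).re = ((exp w).re + (exp (-w)).re) / 2 := by
      rw [cosh, ← add_re, div_ofNat_re]
    rw [e6]
    linear_combination (exp w).re * hA + (exp (-w)).re * hB
  unfold hairpin hairpinH
  split_ifs with h
  · have hw := h.choose_spec
    have hw1 : |h.choose.im| < Real.pi / 2 := hw.1
    rw [← hval _ hw1, hw.2]
    congr 1; field_simp
  · rw [mul_zero]
    by_contra hne
    have hzp : 0 < U (z + c) := lt_of_le_of_ne (M.L.S.nn _) (Ne.symm hne)
    have hs := M.inO hzp
    have hinv := M.inj hzp (h2 _ hs)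
    set s := zt W (z + c) with hsd
    have hφw : φ ((s - m * I) / (2 * a)) = s := by simp only [hφ]; field_simp; ring
    have hwS : |((s - m * I) / (2 * a)).im| < Real.pi / 2 := (hφS _).1 (by rw [hφw]; exact hs)
    have h7 := hform _ hwS
    have h8 : Z ((s - m * I) / (2 * a)) = z + c := by simp only [hZ]; rw [hφw, hinv]
    rw [h8] at h7
    refine h ⟨(s - m * I) / (2 * a) - t, ?_, ?_⟩
    · change |((s - m * I) / (2 * a) - t).im| < Real.pi / 2
      rw [sub_im, ofReal_im, sub_zero]; exact hwS
    · rw [eq_div_iff hac]; linear_combination -h7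

end Lim3

lemma Lim.final {U : ℂ → ℝ} {W : ℂ → ℂ} (S : Lim U W) : ∃ T : ℂ → ℂ, Isometry T ∧
          (U ∘ T = Pfun ∨
           (∃ a : ℝ, 0 < a ∧ U ∘ T = TPfun a) ∨
           (∃ a : ℝ, 0 < a ∧ U ∘ T = hairpin a) ∨
           U ∘ T = Wfun 1) := by
  by_cases h1 : ∀ z, 0 < U z → ‖cg U z‖ = 1
  · obtain ⟨T, hT, h⟩ := S.type1 h1
    exact ⟨T, hT, h.imp_right (Or.imp_right Or.inr)⟩
  · push Not at h1
    obtain ⟨z, hz, hne⟩ := h1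
    have L := S.toLim2 hz (lt_of_le_of_ne (S.grad_le_one hz) hne)
    obtain ⟨μ, hμ, p0, Q, M⟩ := L.toLim3
    rcases Q.eq_empty_or_nonempty with rfl | ⟨q, hq⟩
    · exact M.no_one.elim
    · obtain ⟨a, ha, c, hc⟩ := M.two hq
      refine ⟨fun z => μ * (z + c), ?_, Or.inr (Or.inr (Or.inl ⟨a, ha, funext fun z => hc z⟩))⟩
      refine Isometry.of_dist_eq fun x y => ?_
      rw [dist_eq_norm, dist_eq_norm, ← mul_sub, norm_mul, hμ, one_mul, add_sub_add_right_eq_sub]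

end OP

/-- global limits of classical solutions: up to rigid motion, the limit
is a one-plane solution, a two-plane solution, a double hairpin, or the wedge `W₁`. -/
theorem global_limits_classical_solutions (R : ℕ → ℝ) (hRpos : ∀ k, 0 < R k)
    (hR : Filter.Tendsto R atTop atTop)
    (u : ℕ → ℂ → ℝ)
    (hsol : ∀ k, IsClassicalSolution (ball 0 (R k)) (u k))
    (h0 : ∀ k, (0 : ℂ) ∈ FB (ball 0 (R k)) (u k)) :
    ∃ (φ : ℕ → ℕ) (U : ℂ → ℝ), StrictMono φ ∧
      TendstoLocallyUniformly (fun k => u (φ k)) U atTop ∧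
      ((∀ k, ∀ z ∈ FB (ball 0 (R k)) (u k),
          ¬ IsCompact (connectedComponentIn (FB (ball 0 (R k)) (u k)) z)) →
        ∃ T : ℂ → ℂ, Isometry T ∧
          (U ∘ T = Pfun ∨
           (∃ a : ℝ, 0 < a ∧ U ∘ T = TPfun a) ∨
           (∃ a : ℝ, 0 < a ∧ U ∘ T = hairpin a) ∨
           U ∘ T = Wfun 1)) := by
  obtain ⟨φ, U, hφ, hUl, hc⟩ := OP.first_conv R hRpos hR u hsol h0
  refine ⟨φ, U, hφ, hc, fun hnc => ?_⟩
  obtain ⟨W, S⟩ := OP.main_lim R hRpos hR u hsol h0 hnc hφ hUl hc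
  exact S.final
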